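/- Suppose ρ satisfies condition (3) with S = 0. Then the maps F, G of Theorem 1 (initialized with f(z) = (R,0,…,0), g(z) = (1/R,0,…,0)) extend C¹-smoothly to the annulus {w ∈ ℂⁿ : 0 < |w| ≤ R}, with F(w)(z) = w constantly and G(w)(z) = w̄/|w|² when |w| = R; and P(w) = ρ(z,F(w)(z)) extends continuously to the closed ball {|w| ≤ R} with P(0) = 0. Moreover, if wʲ → 0 then F(wʲ) converges uniformly to the zero function. -/

import Mathlib

open Complex Metric MeasureTheory Filter Set

noncomputable section

/-- The unit circle `Γ` in `ℂ`. -/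
def Circ : Set ℂ := Metric.sphere (0 : ℂ) 1

/-- The closed unit disk `Δ` in `ℂ`. -/
def Disk : Set ℂ := Metric.closedBall (0 : ℂ) 1

/-- The Euclidean norm on `ℂⁿ`. -/
def euclNorm {n : ℕ} (w : Fin n → ℂ) : ℝ := Real.sqrt (∑ j, Complex.normSq (w j))

/-- The complex partial derivative `∂g/∂wⱼ` of a real-valued function `g` on `ℂⁿ`. -/
def wderiv {n : ℕ} (g : (Fin n → ℂ) → ℝ) (w : Fin n → ℂ) (j : Fin n) : ℂ :=
  (((fderiv ℝ g w) (Pi.single j 1) : ℝ) - Complex.I * ((fderiv ℝ g w) (Pi.single j Complex.I) : ℝ)) / 2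

/-- The affine complex tangent plane at `p` to the level set of `g` through `p`. -/
def TangentPlane {n : ℕ} (g : (Fin n → ℂ) → ℝ) (p : Fin n → ℂ) : Set (Fin n → ℂ) :=
  {w | ∑ j, (w j - p j) * wderiv g p j = 0}

/-- `ρ` is strictly hypoconvex on a subset `U` of `Γ × ℂⁿ`: on every compact subset
there is `𝒦 > 0` such that the real Hessian in `w` is `≥ 𝒦‖u‖²` on complex tangent
vectors `u` of the fibers. -/
def StrictHypoconvexOn {n : ℕ} (ρ : ℂ → (Fin n → ℂ) → ℝ) (U : Set (ℂ × (Fin n → ℂ))) : Prop :=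
  ∀ C : Set (ℂ × (Fin n → ℂ)), C ⊆ U → IsCompact C →
    ∃ K0 > (0:ℝ), ∀ p ∈ C, ∀ u : Fin n → ℂ,
      (∑ j, u j * wderiv (ρ p.1) p.2 j) = 0 →
      K0 * (euclNorm u)^2 ≤ iteratedFDeriv ℝ 2 (ρ p.1) p.2 ![u, u]

/-- Two subsets of real normed spaces are (C⁶-)diffeomorphic: there are C⁶ maps on
open neighborhoods carrying one onto the other, inverse to each other on the sets. -/
def DiffeomorphicSets {E F : Type*} [NormedAddCommGroup E] [NormedSpace ℝ E]
    [NormedAddCommGroup F] [NormedSpace ℝ F] (A : Set E) (B : Set F) : Prop :=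
  ∃ (U : Set E) (V : Set F) (f : E → F) (g : F → E),
    IsOpen U ∧ IsOpen V ∧ A ⊆ U ∧ B ⊆ V ∧
    ContDiffOn ℝ 6 f U ∧ ContDiffOn ℝ 6 g V ∧
    Set.MapsTo f A B ∧ Set.MapsTo g B A ∧
    (∀ x ∈ A, g (f x) = x) ∧ (∀ y ∈ B, f (g y) = y)

/-- Condition (3) of the paper, for `ρ` with respect to `R` and `S`. -/
structure Cond3 (n : ℕ) (ρ : ℂ → (Fin n → ℂ) → ℝ) (R : ℝ) (S : ℂ → Fin n → ℂ) : Prop where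
  hn : 2 ≤ n
  nonneg : ∀ z ∈ Circ, ∀ w, 0 ≤ ρ z w
  cont : ContinuousOn (fun p : ℂ × (Fin n → ℂ) => ρ p.1 p.2) {p | p.1 ∈ Circ}
  smooth : ContDiffOn ℝ 6 (fun p : ℂ × (Fin n → ℂ) => ρ p.1 p.2)
      {p | p.1 ∈ Circ ∧ ρ p.1 p.2 ≠ 0}
  hR : 1 < R
  grad_ne : ∀ z ∈ Circ, ∀ w, 0 < ρ z w → ρ z w ≤ R → fderiv ℝ (ρ z) w ≠ 0
  hypo : StrictHypoconvexOn ρ {p | p.1 ∈ Circ ∧ ρ p.1 p.2 ≠ 0}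
  levelCompact : ∀ t : ℝ, 0 < t → t ≤ R →
      IsCompact {p : ℂ × (Fin n → ℂ) | p.1 ∈ Circ ∧ ρ p.1 p.2 = t}
  fiberSphere : ∀ t : ℝ, 0 < t → t ≤ R → ∀ z ∈ Circ,
      DiffeomorphicSets {w | ρ z w = t} (Metric.sphere (0 : EuclideanSpace ℂ (Fin n)) 1)
  levelR : ∀ z ∈ Circ, ∀ w, ρ z w = R ↔ euclNorm w = R
  aboveR : ∀ z ∈ Circ, ∀ w, R < euclNorm w → R < ρ z w
  Scont : ContinuousOn S Circ
  Ssmall : ∀ z ∈ Circ, euclNorm (S z) < R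
  Szero : ∀ z ∈ Circ, ∀ w, ρ z w = 0 ↔ w = S z

/-- The `j`-th Fourier coefficient of the boundary values of `f` on the circle. -/
def bCoeff (f : ℂ → ℂ) (j : ℤ) : ℂ :=
  (1 / (2 * Real.pi) : ℂ) * ∫ θ in (0:ℝ)..(2 * Real.pi),
    f (Complex.exp (↑θ * Complex.I)) * Complex.exp (-(j : ℂ) * ↑θ * Complex.I)

/-- The Hilbert space `ℓ²(ℤ)` used to represent `W^{1,2}(Γ)`. -/
abbrev Seq2 : Type := lp (fun _ : ℤ => ℂ) 2

/-- `a ∈ ℓ²(ℤ)` is the (weighted) Fourier coefficient representation of `f` in the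
Sobolev space `W^{1,2}(Γ)`; the weight `√(1+j²)` makes the `ℓ²` norm of `a`
equivalent to the `W^{1,2}` norm of `f`. -/
def RepOf (a : Seq2) (f : ℂ → ℂ) : Prop :=
  ∀ j : ℤ, (a : ∀ _ : ℤ, ℂ) j = (Real.sqrt (1 + (j:ℝ)^2) : ℂ) * bCoeff f j

/-- Membership in `H^{1,2}(Δ) = H²(Δ) ∩ W^{1,2}(Γ)` (whose elements extend
continuously to the closed disk). -/
def MemH12 (f : ℂ → ℂ) : Prop :=
  ContinuousOn f Disk ∧ DifferentiableOn ℂ f (Metric.ball (0:ℂ) 1) ∧ ∃ a : Seq2, RepOf a f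

/-- Membership in the disk algebra `A(Δ)`. -/
def MemA (f : ℂ → ℂ) : Prop :=
  ContinuousOn f Disk ∧ DifferentiableOn ℂ f (Metric.ball (0:ℂ) 1)

/-- Membership in `H^∞(Δ)`. -/
def MemHinf (f : ℂ → ℂ) : Prop :=
  DifferentiableOn ℂ f (Metric.ball (0:ℂ) 1) ∧ ∃ M : ℝ, ∀ z ∈ Metric.ball (0:ℂ) 1, ‖f z‖ ≤ M

/-- `f` is `C^k`-smooth on the circle `Γ`. -/
def CkCirc (k : ℕ) (f : ℂ → ℂ) : Prop :=
  ContDiff ℝ k (fun θ : ℝ => f (Complex.exp (↑θ * Complex.I)))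

/-- `f` is `C⁴`-smooth on the circle `Γ`. -/
def C4Circ (f : ℂ → ℂ) : Prop := CkCirc 4 f

/-- Vector-valued versions. -/
def MemH12V {n : ℕ} (f : ℂ → Fin n → ℂ) : Prop := ∀ j, MemH12 fun z => f z j
def MemAV {n : ℕ} (f : ℂ → Fin n → ℂ) : Prop := ∀ j, MemA fun z => f z j
def MemHinfV {n : ℕ} (f : ℂ → Fin n → ℂ) : Prop := ∀ j, MemHinf fun z => f z j
def C4CircV {n : ℕ} (f : ℂ → Fin n → ℂ) : Prop := ∀ j, C4Circ fun z => f z j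

/-- The coordinates of a point of `ℂ × ℂⁿ` as a point of `ℂ^{n+1}`. -/
def pcoords {n : ℕ} (p : ℂ × (Fin n → ℂ)) : Fin (n+1) → ℂ := Fin.cons p.1 p.2

/-- The polynomial hull of a subset of `ℂ × ℂⁿ ≅ ℂ^{n+1}`. -/
def polyHull {n : ℕ} (Y : Set (ℂ × (Fin n → ℂ))) : Set (ℂ × (Fin n → ℂ)) :=
  {p | ∀ P : MvPolynomial (Fin (n+1)) ℂ, ∀ M : ℝ,
    (∀ q ∈ Y, ‖MvPolynomial.eval (pcoords q) P‖ ≤ M) → ‖MvPolynomial.eval (pcoords p) P‖ ≤ M}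

/-- The polynomial hull of a subset of `ℂⁿ`. -/
def polyHulln {n : ℕ} (Y : Set (Fin n → ℂ)) : Set (Fin n → ℂ) :=
  {w | ∀ P : MvPolynomial (Fin n) ℂ, ∀ M : ℝ,
    (∀ v ∈ Y, ‖MvPolynomial.eval v P‖ ≤ M) → ‖MvPolynomial.eval w P‖ ≤ M}

/-- The coordinates of a point of `ℂ × ℂⁿ × ℂⁿ` as a point of `ℂ^{2n+1}`. -/
def pcoords2 {n : ℕ} (p : ℂ × ((Fin n → ℂ) × (Fin n → ℂ))) : Fin (n + n + 1) → ℂ :=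
  Fin.cons p.1 (Fin.append p.2.1 p.2.2)

/-- The polynomial hull of a subset of `ℂ × ℂⁿ × ℂⁿ ≅ ℂ^{2n+1}`. -/
def polyHull2 {n : ℕ} (Y : Set (ℂ × ((Fin n → ℂ) × (Fin n → ℂ)))) :
    Set (ℂ × ((Fin n → ℂ) × (Fin n → ℂ))) :=
  {p | ∀ P : MvPolynomial (Fin (n + n + 1)) ℂ, ∀ M : ℝ,
    (∀ q ∈ Y, ‖MvPolynomial.eval (pcoords2 q) P‖ ≤ M) → ‖MvPolynomial.eval (pcoords2 p) P‖ ≤ M}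

/-- A subset of `ℂⁿ` is hypoconvex if its complement is a union of complex affine
hyperplanes. -/
def HypoconvexSet {n : ℕ} (A : Set (Fin n → ℂ)) : Prop :=
  ∀ v : Fin n → ℂ, v ∉ A → ∃ (c : Fin n → ℂ) (d : ℂ), c ≠ 0 ∧
    (∑ j, c j * v j) = d ∧ ∀ w ∈ A, (∑ j, c j * w j) ≠ d

/-- `A` has `C^k` boundary: near each boundary point the boundary is the zero set of a
`C^k` function with nonvanishing gradient. -/
def CkBoundary {E : Type*} [NormedAddCommGroup E] [NormedSpace ℝ E] (k : ℕ) (A : Set E) : Prop :=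
  ∀ p ∈ frontier A, ∃ U : Set E, IsOpen U ∧ p ∈ U ∧
    ∃ φ : E → ℝ, ContDiffOn ℝ k φ U ∧ (∀ x ∈ U, fderiv ℝ φ x ≠ 0) ∧
      frontier A ∩ U = {x | φ x = 0} ∩ U

/-- `fb` gives the a.e. radial boundary values on `Γ` of the function `f` on the open disk. -/
def IsBdryVal {n : ℕ} (f fb : ℂ → Fin n → ℂ) : Prop :=
  ∀ᵐ (θ : ℝ) ∂(volume.restrict (Set.Ioc (0:ℝ) (2 * Real.pi))),
    Filter.Tendsto (fun r : ℝ => f ((r : ℂ) * Complex.exp (↑θ * Complex.I)))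
      (nhdsWithin 1 (Set.Iio 1)) (nhds (fb (Complex.exp (↑θ * Complex.I))))

/-- The optimal control `γ_ρ = inf_{f ∈ H^∞(Δ)ⁿ} ess sup_{z ∈ Γ} ρ(z,f(z))`. -/
def gammaRho {n : ℕ} (ρ : ℂ → (Fin n → ℂ) → ℝ) : ℝ :=
  sInf {c : ℝ | ∃ f fb : ℂ → Fin n → ℂ, MemHinfV f ∧ IsBdryVal f fb ∧
    ∀ᵐ (θ : ℝ) ∂(volume.restrict (Set.Ioc (0:ℝ) (2 * Real.pi))),
      ρ (Complex.exp (↑θ * Complex.I)) (fb (Complex.exp (↑θ * Complex.I))) ≤ c}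

/-- `δ_ρ = inf_{f ∈ A(Δ)ⁿ} sup_{z ∈ Γ} ρ(z,f(z))`. -/
def deltaRho {n : ℕ} (ρ : ℂ → (Fin n → ℂ) → ℝ) : ℝ :=
  sInf {c : ℝ | ∃ f : ℂ → Fin n → ℂ, MemAV f ∧ ∀ z ∈ Circ, ρ z (f z) ≤ c}

/-- `ρ_m(z,w) = ρ(z, w/zᵐ)`. -/
def rhoShift {n : ℕ} (ρ : ℂ → (Fin n → ℂ) → ℝ) (m : ℕ) : ℂ → (Fin n → ℂ) → ℝ :=
  fun z w => ρ z (fun j => w j / z ^ m)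

/-- `q` is an `n`-tuple of harmonic polynomials. -/
def HarmPolyTuple {n : ℕ} (q : ℂ → Fin n → ℂ) : Prop :=
  ∃ (d : ℕ) (a b : ℕ → Fin n → ℂ), ∀ z : ℂ, ∀ j,
    q z j = ∑ i ∈ Finset.range (d+1), (a i j * z ^ i + b i j * (starRingEnd ℂ z) ^ i)

/-- `zᵐ q(z)` has analytic polynomial coordinates (as boundary values on `Γ`). -/
def ZmAnalytic {n : ℕ} (m : ℕ) (q : ℂ → Fin n → ℂ) : Prop :=
  ∀ j, ∃ p : Polynomial ℂ, ∀ z ∈ Circ, z ^ m * q z j = Polynomial.eval z p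

/-- The boundary function `q` on `Γ` is analytic, i.e. agrees on `Γ` with an element
of `A(Δ)ⁿ`. -/
def BoundaryAnalytic {n : ℕ} (q : ℂ → Fin n → ℂ) : Prop :=
  ∃ h : ℂ → Fin n → ℂ, MemAV h ∧ ∀ z ∈ Circ, h z = q z


namespace S17

/-- gradient vector `∂Ψ_θ/∂w`. -/
def gr {n : ℕ} (Ψ : ℝ → (Fin n → ℂ) → ℝ) (θ : ℝ) (w : Fin n → ℂ) : Fin n → ℂ :=
  fun j => wderiv (Ψ θ) w j

/-- The geometric data on the circle, in the angle variable. -/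
structure Data (n : ℕ) (Ψ : ℝ → (Fin n → ℂ) → ℝ) (R : ℝ) : Prop where
  hR : 1 < R
  per : ∀ θ w, Ψ (θ + 2 * Real.pi) w = Ψ θ w
  cont : Continuous (fun p : ℝ × (Fin n → ℂ) => Ψ p.1 p.2)
  smooth : ContDiffOn ℝ 6 (fun p : ℝ × (Fin n → ℂ) => Ψ p.1 p.2) {p | p.2 ≠ 0}
  nonneg : ∀ θ w, 0 ≤ Ψ θ w
  zero : ∀ θ w, Ψ θ w = 0 ↔ w = 0
  grad : ∀ θ w, 0 < Ψ θ w → Ψ θ w ≤ R → gr Ψ θ w ≠ 0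
  hypo : ∀ C : Set (ℝ × (Fin n → ℂ)), C ⊆ {p | p.2 ≠ 0} → IsCompact C →
    ∃ K0 > (0:ℝ), ∀ p ∈ C, ∀ u : Fin n → ℂ, u ⬝ᵥ gr Ψ p.1 p.2 = 0 →
      K0 * ‖u‖ ^ 2 ≤ 2 * (u ⬝ᵥ fderiv ℝ (gr Ψ p.1) p.2 u).re
  levelR : ∀ θ w, Ψ θ w = R ↔ euclNorm w = R
  aboveR : ∀ θ w, R < euclNorm w → R < Ψ θ w

variable {n : ℕ} {Ψ : ℝ → (Fin n → ℂ) → ℝ} {R : ℝ}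

lemma dot_norm_le (u v : Fin n → ℂ) : ‖u ⬝ᵥ v‖ ≤ n * ‖u‖ * ‖v‖ := by
  unfold dotProduct
  calc ‖∑ j, u j * v j‖ ≤ ∑ j : Fin n, ‖u‖ * ‖v‖ := by
        refine (norm_sum_le _ _).trans (Finset.sum_le_sum fun j _ => ?_)
        rw [norm_mul]
        exact mul_le_mul (norm_le_pi_norm u j) (norm_le_pi_norm v j) (norm_nonneg _) (norm_nonneg _)
    _ = n * ‖u‖ * ‖v‖ := by simp [mul_assoc]

lemma norm_le_eucl (w : Fin n → ℂ) : ‖w‖ ≤ euclNorm w := by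
  unfold euclNorm
  refine (pi_norm_le_iff_of_nonneg (Real.sqrt_nonneg _)).2 fun j => ?_
  apply Real.le_sqrt_of_sq_le
  rw [← Complex.normSq_eq_norm_sq]
  exact Finset.single_le_sum (f := fun j => Complex.normSq (w j)) (fun i _ => Complex.normSq_nonneg _) (Finset.mem_univ j)

lemma eucl_sq (w : Fin n → ℂ) : euclNorm w ^ 2 = ∑ j, Complex.normSq (w j) :=
  Real.sq_sqrt (Finset.sum_nonneg fun _ _ => Complex.normSq_nonneg _)

lemma eucl_nonneg (w : Fin n → ℂ) : 0 ≤ euclNorm w := Real.sqrt_nonneg _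

lemma eucl_cont : Continuous (euclNorm : (Fin n → ℂ) → ℝ) := by
  unfold euclNorm
  refine Real.continuous_sqrt.comp (continuous_finsetSum _ fun j _ => ?_)
  exact Complex.continuous_normSq.comp (continuous_apply j)

lemma eucl_le (w : Fin n → ℂ) : euclNorm w ≤ n * ‖w‖ := by
  unfold euclNorm
  apply Real.sqrt_le_iff.2 ⟨by positivity, ?_⟩
  have h : ∑ j : Fin n, Complex.normSq (w j) ≤ ∑ j : Fin n, ‖w‖ ^ 2 :=
    Finset.sum_le_sum fun j _ => by
      rw [Complex.normSq_eq_norm_sq]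
      exact pow_le_pow_left₀ (norm_nonneg _) (norm_le_pi_norm w j) 2
  refine h.trans ?_
  simp only [Finset.sum_const, Finset.card_univ, Fintype.card_fin, nsmul_eq_mul, mul_pow]
  rcases Nat.eq_zero_or_pos n with h0 | h0
  · simp [h0]
  · have : (1:ℝ) ≤ n := by exact_mod_cast h0
    have h2 : (0:ℝ) ≤ ‖w‖^2 := by positivity
    have h3 : (n:ℝ) ≤ n ^ 2 := by nlinarith
    exact mul_le_mul_of_nonneg_right h3 h2

lemma eucl_eq_zero {w : Fin n → ℂ} : euclNorm w = 0 ↔ w = 0 := by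
  constructor
  · intro h
    have := norm_le_eucl w
    rw [h] at this
    exact norm_le_zero_iff.1 this
  · rintro rfl; simp [euclNorm]

lemma dot_star_self (w : Fin n → ℂ) : w ⬝ᵥ star w = ((euclNorm w ^ 2 : ℝ) : ℂ) := by
  rw [eucl_sq]
  simp [dotProduct, Complex.mul_conj]

lemma real_clm_eq (L : (Fin n → ℂ) →L[ℝ] ℝ) (d : Fin n → ℂ) :
    L d = 2 * (d ⬝ᵥ fun j => ((L (Pi.single j 1) : ℝ) - Complex.I * (L (Pi.single j Complex.I) : ℝ)) / 2).re := by
  have hd : d = ∑ j, ((d j).re • (Pi.single j (1:ℂ) : Fin n → ℂ) + (d j).im • (Pi.single j Complex.I : Fin n → ℂ)) := by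
    ext i
    rw [Finset.sum_apply, Finset.sum_eq_single i]
    · simp
    · intro b _ hb
      simp [hb.symm]
    · simp
  conv_lhs => rw [hd]
  rw [map_sum, dotProduct, Complex.re_sum, Finset.mul_sum]
  refine Finset.sum_congr rfl fun j _ => ?_
  rw [map_add, map_smul, map_smul]
  rw [← Complex.re_add_im (d j)]
  simp
  ring

lemma fderiv_eq (Ψ : ℝ → (Fin n → ℂ) → ℝ) (θ : ℝ) (w d : Fin n → ℂ) :
    fderiv ℝ (Ψ θ) w d = 2 * (d ⬝ᵥ gr Ψ θ w).re := real_clm_eq _ d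

lemma isOpen_ne : IsOpen {p : ℝ × (Fin n → ℂ) | p.2 ≠ 0} :=
  isOpen_compl_singleton.preimage continuous_snd

/-- smoothness of a slice derivative -/
lemma slice_fderiv {F : Type*} [NormedAddCommGroup F] [NormedSpace ℝ F] {φ : ℝ × (Fin n → ℂ) → F}
    {p : ℝ × (Fin n → ℂ)} (h : DifferentiableAt ℝ φ p) :
    fderiv ℝ (fun w => φ (p.1, w)) p.2 = (fderiv ℝ φ p).comp (ContinuousLinearMap.inr ℝ ℝ (Fin n → ℂ)) := by
  have h1 : HasFDerivAt (fun w : Fin n → ℂ => (p.1, w)) (ContinuousLinearMap.inr ℝ ℝ (Fin n → ℂ)) p.2 := by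
    exact hasFDerivAt_prodMk_right p.1 p.2
  exact (HasFDerivAt.comp (g := φ) p.2 (f := fun w => (p.1, w)) h.hasFDerivAt h1).fderiv

lemma gr_contDiff (h : ContDiffOn ℝ 6 (fun p : ℝ × (Fin n → ℂ) => Ψ p.1 p.2) {p | p.2 ≠ 0}) :
    ContDiffOn ℝ 5 (fun p : ℝ × (Fin n → ℂ) => gr Ψ p.1 p.2) {p | p.2 ≠ 0} := by
  have h1 : ContDiffOn ℝ 5 (fderiv ℝ (fun p : ℝ × (Fin n → ℂ) => Ψ p.1 p.2)) {p | p.2 ≠ 0} :=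
    h.fderiv_of_isOpen isOpen_ne (by norm_num)
  have key : ∀ v : Fin n → ℂ, ContDiffOn ℝ 5 (fun p : ℝ × (Fin n → ℂ) => ((fderiv ℝ (Ψ p.1) p.2 v : ℝ) : ℂ)) {p | p.2 ≠ 0} := by
    intro v
    have h2 : ContDiffOn ℝ 5 (fun p : ℝ × (Fin n → ℂ) => fderiv ℝ (fun p : ℝ × (Fin n → ℂ) => Ψ p.1 p.2) p (0, v)) {p | p.2 ≠ 0} :=
      h1.clm_apply contDiffOn_const
    have h3 := (Complex.ofRealCLM.contDiff (n := 5)).comp_contDiffOn h2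
    refine h3.congr fun p hp => ?_
    have hd : DifferentiableAt ℝ (fun p : ℝ × (Fin n → ℂ) => Ψ p.1 p.2) p :=
      (h.contDiffAt (isOpen_ne.mem_nhds hp)).differentiableAt (by norm_num)
    have := slice_fderiv hd
    simp only at this
    show ((fderiv ℝ (Ψ p.1) p.2 v : ℝ) : ℂ) = _
    change fderiv ℝ (Ψ p.1) p.2 = _ at this
    rw [this]
    simp
  rw [contDiffOn_pi]
  intro j
  show ContDiffOn ℝ 5 (fun p : ℝ × (Fin n → ℂ) => (((fderiv ℝ (Ψ p.1) p.2) (Pi.single j 1) : ℝ) - Complex.I * ((fderiv ℝ (Ψ p.1) p.2) (Pi.single j Complex.I) : ℝ)) / 2) _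
  exact ((key _).sub (contDiffOn_const.mul (key _))).div_const 2

lemma Data.ofCond {ρ : ℂ → (Fin n → ℂ) → ℝ} (h : Cond3 n ρ R (fun _ => 0)) :
    Data n (fun θ w => ρ (Complex.exp (θ * Complex.I)) w) R := by
  have hc : ∀ θ : ℝ, Complex.exp (θ * Complex.I) ∈ Circ := fun θ => by
    simp [Circ, Complex.norm_exp_ofReal_mul_I]
  have hexp : ContDiff ℝ 6 (fun p : ℝ × (Fin n → ℂ) => (Complex.exp (p.1 * Complex.I), p.2)) := by
    refine ContDiff.prodMk ?_ contDiff_snd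
    exact ContDiff.cexp ((Complex.ofRealCLM.contDiff.comp contDiff_fst).mul contDiff_const)
  have hz : ∀ θ : ℝ, ∀ w, ρ (Complex.exp (θ * Complex.I)) w = 0 ↔ w = 0 := fun θ w => h.Szero _ (hc θ) w
  have hsm : ContDiffOn ℝ 6 (fun p : ℝ × (Fin n → ℂ) => ρ (Complex.exp (p.1 * Complex.I)) p.2) {p | p.2 ≠ 0} := by
    refine h.smooth.comp (f := fun p : ℝ × (Fin n → ℂ) => (Complex.exp (p.1 * Complex.I), p.2)) hexp.contDiffOn ?_
    intro p hp
    exact ⟨hc _, fun h0 => hp ((hz _ _).1 h0)⟩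
  refine ⟨h.hR, ?_, ?_, hsm, fun θ w => h.nonneg _ (hc θ) w, hz, ?_, ?_, fun θ w => h.levelR _ (hc θ) w,
    fun θ w => h.aboveR _ (hc θ) w⟩
  · intro θ w
    have : Complex.exp (((θ + 2 * Real.pi : ℝ) : ℂ) * Complex.I) = Complex.exp (θ * Complex.I) := by
      push_cast
      rw [add_mul, Complex.exp_add, Complex.exp_two_pi_mul_I, mul_one]
    simp only [this]
  · exact h.cont.comp_continuous (f := fun p : ℝ × (Fin n → ℂ) => (Complex.exp (p.1 * Complex.I), p.2)) hexp.continuous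
      (fun p => hc p.1)
  · intro θ w h1 h2 h3
    refine h.grad_ne _ (hc θ) w h1 h2 ?_
    ext d
    have := fderiv_eq (fun θ : ℝ => fun w => ρ (Complex.exp (θ * Complex.I)) w) θ w d
    rw [h3] at this
    simpa using this
  · intro C hC hcomp
    have him : IsCompact ((fun p : ℝ × (Fin n → ℂ) => (Complex.exp (p.1 * Complex.I), p.2)) '' C) :=
      hcomp.image hexp.continuous
    obtain ⟨K, hK, hK2⟩ := h.hypo _ (by
      rintro _ ⟨p, hp, rfl⟩
      exact ⟨hc _, fun h0 => hC hp ((hz _ _).1 h0)⟩) him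
    refine ⟨K, hK, fun p hp u hu => ?_⟩
    have h4 := hK2 _ ⟨p, hp, rfl⟩ u hu
    have h5 : K * ‖u‖ ^ 2 ≤ K * euclNorm u ^ 2 := by
      have := norm_le_eucl u
      have h0 := norm_nonneg u
      gcongr
    refine h5.trans (h4.trans (le_of_eq ?_))
    simp only
    rw [iteratedFDeriv_two_apply]
    simp only [Matrix.cons_val_zero, Matrix.cons_val_one]
    set Φ : ℝ → (Fin n → ℂ) → ℝ := fun θ w => ρ (Complex.exp (θ * Complex.I)) w with hΦ
    have hw : p.2 ≠ 0 := hC hp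
    have hgd : DifferentiableAt ℝ (gr Φ p.1) p.2 := by
      have h6 := (gr_contDiff (Ψ := Φ) hsm).contDiffAt (isOpen_ne.mem_nhds (x := p) hw)
      have h7 : DifferentiableAt ℝ (fun p : ℝ × (Fin n → ℂ) => gr Φ p.1 p.2) (p.1, p.2) := h6.differentiableAt (by norm_num)
      exact h7.comp p.2 (f := fun w => (p.1, w)) (by fun_prop)
    have hfd : DifferentiableAt ℝ (fderiv ℝ (Φ p.1)) p.2 := by
      have h6 : ContDiffAt ℝ 6 (Φ p.1) p.2 := by
        have := hsm.contDiffAt (isOpen_ne.mem_nhds (x := (p.1, p.2)) hw)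
        exact this.comp p.2 (f := fun w => (p.1, w)) (by fun_prop)
      exact (h6.fderiv_right (m := 1) (by norm_num)).differentiableAt (by norm_num)
    change fderiv ℝ (fderiv ℝ (Φ p.1)) p.2 u u = _
    have e1 : fderiv ℝ (fun w => fderiv ℝ (Φ p.1) w u) p.2 u = fderiv ℝ (fderiv ℝ (Φ p.1)) p.2 u u := by
      have := (hfd.hasFDerivAt.clm_apply (hasFDerivAt_const u p.2)).fderiv
      rw [this]; simp
    rw [← e1]
    have e2 : (fun w => fderiv ℝ (Φ p.1) w u) = fun w => 2 * (u ⬝ᵥ gr Φ p.1 w).re := by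
      funext w; exact fderiv_eq Φ p.1 w u
    rw [e2]
    have e3 : HasFDerivAt (fun w => u ⬝ᵥ gr Φ p.1 w)
        (∑ j, (u j) • ((ContinuousLinearMap.proj j).comp (fderiv ℝ (gr Φ p.1) p.2))) p.2 := by
      unfold dotProduct
      refine HasFDerivAt.fun_sum fun j _ => ?_
      exact ((hasFDerivAt_pi'.1 hgd.hasFDerivAt) j).const_mul (u j)
    have e4 := ((Complex.reCLM.hasFDerivAt.comp p.2 e3).const_mul 2).fderiv
    change fderiv ℝ (fun w => 2 * (u ⬝ᵥ gr Φ p.1 w).re) p.2 = _ at e4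
    rw [e4]
    simp [dotProduct]

end S17

namespace S17

variable {n : ℕ} {Ψ : ℝ → (Fin n → ℂ) → ℝ} {R : ℝ}

/-- the compactness trick -/
lemma compact_trick {X : Type*} [TopologicalSpace X] [T2Space X] {Z : Set X} (hZ : IsCompact Z)
    {q p : X → ℝ} (hq : ContinuousOn q Z) (hp : ContinuousOn p Z) (h0 : ∀ z ∈ Z, 0 ≤ p z)
    (hpos : ∀ z ∈ Z, p z = 0 → 0 < q z) :
    ∃ k > (0:ℝ), ∃ C ≥ (0:ℝ), ∀ z ∈ Z, k - C * p z ≤ q z := by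
  have hA : IsCompact (Z ∩ p ⁻¹' {0}) :=
    hZ.of_isClosed_subset (hp.preimage_isClosed_of_isClosed hZ.isClosed isClosed_singleton) inter_subset_left
  obtain ⟨k, hk, hkA⟩ : ∃ k > (0:ℝ), ∀ z ∈ Z ∩ p ⁻¹' {0}, k < q z := by
    rcases (Z ∩ p ⁻¹' {0}).eq_empty_or_nonempty with h | h
    · exact ⟨1, one_pos, by simp [h]⟩
    · obtain ⟨z, hz, hm⟩ := hA.exists_isMinOn h (hq.mono inter_subset_left)
      have := hpos z hz.1 hz.2
      exact ⟨q z / 2, by linarith, fun y hy => by have := hm hy; simp only [mem_ofPred_eq] at this; linarith⟩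
  have hB : IsCompact (Z ∩ q ⁻¹' Iic k) :=
    hZ.of_isClosed_subset (hq.preimage_isClosed_of_isClosed hZ.isClosed isClosed_Iic) inter_subset_left
  rcases (Z ∩ q ⁻¹' Iic k).eq_empty_or_nonempty with h | h
  · refine ⟨k, hk, 0, le_rfl, fun z hz => ?_⟩
    by_contra hcon
    have : z ∈ Z ∩ q ⁻¹' Iic k := ⟨hz, by simp only [mem_preimage, mem_Iic]; linarith⟩
    rw [h] at this; exact this
  · obtain ⟨z, hz, hm⟩ := hB.exists_isMinOn h (hp.mono inter_subset_left)
    obtain ⟨y, hy, hmy⟩ := hB.exists_isMinOn h (hq.mono inter_subset_left)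
    have hpz : 0 < p z := lt_of_le_of_ne (h0 z hz.1) fun he => by
      have := hkA z ⟨hz.1, he.symm⟩
      have h2 : q z ≤ k := hz.2
      linarith
    have hyk : q y ≤ k := hy.2
    refine ⟨k, hk, (k - q y) / p z, div_nonneg (by linarith) hpz.le, fun x hx => ?_⟩
    by_cases hxk : q x ≤ k
    · have h1 : p z ≤ p x := hm ⟨hx, hxk⟩
      have h2 : q y ≤ q x := hmy ⟨hx, hxk⟩
      have h3 : (k - q y) ≤ (k - q y) / p z * p x := by
        rw [div_mul_eq_mul_div, le_div_iff₀ hpz]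
        exact mul_le_mul_of_nonneg_left h1 (by linarith)
      linarith
    · have : 0 ≤ (k - q y) / p z * p x := mul_nonneg (div_nonneg (by linarith) hpz.le) (h0 x hx)
      push Not at hxk
      linarith

lemma compact_bound {X : Type*} [TopologicalSpace X] {Z : Set X} (hZ : IsCompact Z)
    {F : Type*} [NormedAddCommGroup F] {q : X → F} (hq : ContinuousOn q Z) :
    ∃ C > (0:ℝ), ∀ z ∈ Z, ‖q z‖ ≤ C := by
  obtain ⟨C, hC⟩ := hZ.exists_bound_of_continuousOn hq
  exact ⟨max C 1, by positivity, fun z hz => (hC z hz).trans (le_max_left _ _)⟩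

lemma compact_lower {X : Type*} [TopologicalSpace X] {Z : Set X} (hZ : IsCompact Z)
    {q : X → ℝ} (hq : ContinuousOn q Z) (hpos : ∀ z ∈ Z, 0 < q z) :
    ∃ c > (0:ℝ), ∀ z ∈ Z, c ≤ q z := by
  rcases Z.eq_empty_or_nonempty with h | h
  · exact ⟨1, one_pos, by simp [h]⟩
  · obtain ⟨z, hz, hm⟩ := hZ.exists_isMinOn h hq
    exact ⟨q z, hpos z hz, fun y hy => hm hy⟩

lemma taylor1 {f f1 f2 : ℝ → ℝ} {m : ℝ} (h1 : ∀ s ∈ Icc (0:ℝ) 1, HasDerivAt f (f1 s) s)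
    (h2 : ∀ s ∈ Icc (0:ℝ) 1, HasDerivAt f1 (f2 s) s) (hm : ∀ s ∈ Icc (0:ℝ) 1, m ≤ f2 s) :
    f 0 + f1 0 + m / 2 ≤ f 1 := by
  have m1 : MonotoneOn (fun s => f1 s - m * s) (Icc (0:ℝ) 1) := by
    have hd : ∀ s ∈ Icc (0:ℝ) 1, HasDerivAt (fun s => f1 s - m * s) (f2 s - m) s := fun s hs => by
      have := (h2 s hs).sub ((hasDerivAt_id s).const_mul m)
      refine this.congr_deriv ?_
      simp
    apply monotoneOn_of_deriv_nonneg (convex_Icc _ _)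
    · exact fun s hs => (hd s hs).continuousAt.continuousWithinAt
    · exact fun s hs => (hd s (interior_subset hs)).differentiableAt.differentiableWithinAt
    · intro s hs
      rw [(hd s (interior_subset hs)).deriv]
      linarith [hm s (interior_subset hs)]
  have m2 : MonotoneOn (fun s => f s - f1 0 * s - m * s ^ 2 / 2) (Icc (0:ℝ) 1) := by
    have hd : ∀ s ∈ Icc (0:ℝ) 1, HasDerivAt (fun s => f s - f1 0 * s - m * s ^ 2 / 2) (f1 s - f1 0 - m * s) s := fun s hs => by
      have := ((h1 s hs).sub ((hasDerivAt_id s).const_mul (f1 0))).sub ((((hasDerivAt_id s).pow 2).const_mul m).div_const 2)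
      refine this.congr_deriv ?_
      simp; ring
    apply monotoneOn_of_deriv_nonneg (convex_Icc _ _)
    · exact fun s hs => (hd s hs).continuousAt.continuousWithinAt
    · exact fun s hs => (hd s (interior_subset hs)).differentiableAt.differentiableWithinAt
    · intro s hs
      have hs' := interior_subset hs
      rw [(hd s hs').deriv]
      have := m1 (left_mem_Icc.2 zero_le_one) hs' hs'.1
      simp only at this
      linarith
  have := m2 (left_mem_Icc.2 zero_le_one) (right_mem_Icc.2 zero_le_one) zero_le_one
  simp only at this
  linarith

namespace Data

lemma diffAt (D : Data n Ψ R) {θ : ℝ} {w : Fin n → ℂ} (hw : w ≠ 0) :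
    DifferentiableAt ℝ (fun p : ℝ × (Fin n → ℂ) => Ψ p.1 p.2) (θ, w) :=
  (D.smooth.contDiffAt (isOpen_ne.mem_nhds (x := (θ, w)) hw)).differentiableAt (by norm_num)

lemma diffAt_w (D : Data n Ψ R) {θ : ℝ} {w : Fin n → ℂ} (hw : w ≠ 0) : DifferentiableAt ℝ (Ψ θ) w :=
  DifferentiableAt.comp w (f := fun w => (θ, w)) (g := fun p : ℝ × (Fin n → ℂ) => Ψ p.1 p.2)
    (D.diffAt hw) (by fun_prop)

lemma grC (D : Data n Ψ R) : ContDiffOn ℝ 5 (fun p : ℝ × (Fin n → ℂ) => gr Ψ p.1 p.2) {p | p.2 ≠ 0} :=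
  gr_contDiff D.smooth

lemma gr_cont (D : Data n Ψ R) : ContinuousOn (fun p : ℝ × (Fin n → ℂ) => gr Ψ p.1 p.2) {p | p.2 ≠ 0} :=
  D.grC.continuousOn

lemma gr_diffAt (D : Data n Ψ R) {θ : ℝ} {w : Fin n → ℂ} (hw : w ≠ 0) :
    DifferentiableAt ℝ (fun p : ℝ × (Fin n → ℂ) => gr Ψ p.1 p.2) (θ, w) :=
  (D.grC.contDiffAt (isOpen_ne.mem_nhds (x := (θ, w)) hw)).differentiableAt (by norm_num)

lemma gr_diffAt_w (D : Data n Ψ R) {θ : ℝ} {w : Fin n → ℂ} (hw : w ≠ 0) : DifferentiableAt ℝ (gr Ψ θ) w :=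
  DifferentiableAt.comp w (f := fun w => (θ, w)) (g := fun p : ℝ × (Fin n → ℂ) => gr Ψ p.1 p.2)
    (D.gr_diffAt hw) (by fun_prop)

lemma dgr_cont (D : Data n Ψ R) : ContinuousOn (fun p : ℝ × (Fin n → ℂ) => fderiv ℝ (gr Ψ p.1) p.2) {p | p.2 ≠ 0} := by
  have h1 : ContinuousOn (fderiv ℝ (fun p : ℝ × (Fin n → ℂ) => gr Ψ p.1 p.2)) {p | p.2 ≠ 0} :=
    (D.grC.continuousOn_fderiv_of_isOpen isOpen_ne (by norm_num))
  have h2 : ContinuousOn (fun p : ℝ × (Fin n → ℂ) => (fderiv ℝ (fun p : ℝ × (Fin n → ℂ) => gr Ψ p.1 p.2) p).comp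
      (ContinuousLinearMap.inr ℝ ℝ (Fin n → ℂ))) {p | p.2 ≠ 0} := by
    exact h1.clm_comp continuousOn_const
  refine h2.congr fun p hp => ?_
  exact slice_fderiv (D.gr_diffAt (θ := p.1) (w := p.2) hp)

lemma hess_coercive (D : Data n Ψ R) {Z : Set (ℝ × (Fin n → ℂ))} (hZ : IsCompact Z) (hZ0 : Z ⊆ {p | p.2 ≠ 0}) :
    ∃ k > (0:ℝ), ∃ C ≥ (0:ℝ), ∀ p ∈ Z, ∀ u : Fin n → ℂ,
      k * ‖u‖ ^ 2 - C * ‖u ⬝ᵥ gr Ψ p.1 p.2‖ ^ 2 ≤ 2 * (u ⬝ᵥ fderiv ℝ (gr Ψ p.1) p.2 u).re := by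
  obtain ⟨K, hK, hK2⟩ := D.hypo Z hZ0 hZ
  have hc : IsCompact (Z ×ˢ sphere (0 : Fin n → ℂ) 1) := hZ.prod (isCompact_sphere _ _)
  have hg : ContinuousOn (fun x : (ℝ × (Fin n → ℂ)) × (Fin n → ℂ) => gr Ψ x.1.1 x.1.2) (Z ×ˢ sphere (0 : Fin n → ℂ) 1) :=
    (D.gr_cont.mono hZ0).comp continuousOn_fst fun x hx => hx.1
  have hdg : ContinuousOn (fun x : (ℝ × (Fin n → ℂ)) × (Fin n → ℂ) => fderiv ℝ (gr Ψ x.1.1) x.1.2) (Z ×ˢ sphere (0 : Fin n → ℂ) 1) :=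
    (D.dgr_cont.mono hZ0).comp continuousOn_fst fun x hx => hx.1
  obtain ⟨k, hk, C, hC, h⟩ := compact_trick hc
    (q := fun x => 2 * (x.2 ⬝ᵥ fderiv ℝ (gr Ψ x.1.1) x.1.2 x.2).re)
    (p := fun x => ‖x.2 ⬝ᵥ gr Ψ x.1.1 x.1.2‖ ^ 2)
    (by
      have h1 : ContinuousOn (fun x : (ℝ × (Fin n → ℂ)) × (Fin n → ℂ) => fderiv ℝ (gr Ψ x.1.1) x.1.2 x.2) (Z ×ˢ sphere (0 : Fin n → ℂ) 1) :=
        hdg.clm_apply continuousOn_snd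
      have h2 : ContinuousOn (fun x : (ℝ × (Fin n → ℂ)) × (Fin n → ℂ) => x.2 ⬝ᵥ fderiv ℝ (gr Ψ x.1.1) x.1.2 x.2) (Z ×ˢ sphere (0 : Fin n → ℂ) 1) := by
        unfold dotProduct
        fun_prop
      exact (Complex.continuous_re.comp_continuousOn h2).const_smul (2:ℝ))
    (by
      have h2 : ContinuousOn (fun x : (ℝ × (Fin n → ℂ)) × (Fin n → ℂ) => x.2 ⬝ᵥ gr Ψ x.1.1 x.1.2) (Z ×ˢ sphere (0 : Fin n → ℂ) 1) := by
        unfold dotProduct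
        fun_prop
      exact h2.norm.pow 2)
    (fun _ _ => by positivity)
    (fun x hx h0 => by
      have h1 : x.2 ⬝ᵥ gr Ψ x.1.1 x.1.2 = 0 := by simpa using h0
      have h2 := hK2 x.1 hx.1 x.2 h1
      have h3 : ‖x.2‖ = 1 := by simpa using hx.2
      rw [h3] at h2
      linarith)
  refine ⟨k, hk, C, hC, fun p hp u => ?_⟩
  by_cases hu : u = 0
  · simp [hu]
  have hun : 0 < ‖u‖ := norm_pos_iff.2 hu
  have h1 := h (p, (‖u‖⁻¹ : ℝ) • u) ⟨hp, by simp [norm_smul, hun.ne']⟩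
  simp only [smul_dotProduct, map_smul, dotProduct_smul, norm_smul, Complex.smul_re, smul_eq_mul] at h1
  rw [norm_inv, norm_norm] at h1
  have h4 := mul_le_mul_of_nonneg_right h1 (sq_nonneg ‖u‖)
  have e1 : (k - C * (‖u‖⁻¹ * ‖u ⬝ᵥ gr Ψ p.1 p.2‖) ^ 2) * ‖u‖ ^ 2 = k * ‖u‖ ^ 2 - C * ‖u ⬝ᵥ gr Ψ p.1 p.2‖ ^ 2 := by
    field_simp
  have e2 : 2 * (‖u‖⁻¹ * (‖u‖⁻¹ * (u ⬝ᵥ fderiv ℝ (gr Ψ p.1) p.2 u).re)) * ‖u‖ ^ 2 = 2 * (u ⬝ᵥ fderiv ℝ (gr Ψ p.1) p.2 u).re := by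
    field_simp
  rw [e1, e2] at h4
  exact h4

/-- enlarging a compact set in the `w` direction -/
lemma thicken (_ : Data n Ψ R) {Z : Set (ℝ × (Fin n → ℂ))} (hZ : IsCompact Z) (hZ0 : Z ⊆ {p | p.2 ≠ 0}) :
    ∃ Z' : Set (ℝ × (Fin n → ℂ)), IsCompact Z' ∧ Z' ⊆ {p | p.2 ≠ 0} ∧ Z ⊆ Z' ∧ ∃ δ > (0:ℝ),
      ∀ p ∈ Z, ∀ θ : ℝ, ∀ w : Fin n → ℂ, |θ - p.1| ≤ δ → ‖w - p.2‖ ≤ δ → (θ, w) ∈ Z' := by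
  obtain ⟨δ, hδ, h⟩ := hZ.exists_cthickening_subset_open isOpen_ne hZ0
  refine ⟨cthickening δ Z, hZ.cthickening, h, self_subset_cthickening Z, δ, hδ, fun p hp θ w h1 h2 => ?_⟩
  refine mem_cthickening_of_dist_le _ p δ Z hp ?_
  rw [Prod.dist_eq, Real.dist_eq, dist_eq_norm]
  exact max_le h1 h2

set_option maxHeartbeats 400000 in
/-- Local Taylor estimates, and Lipschitz bound for the gradient. -/
lemma LT (D : Data n Ψ R) {Z : Set (ℝ × (Fin n → ℂ))} (hZ : IsCompact Z) (hZ0 : Z ⊆ {p | p.2 ≠ 0}) :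
    ∃ δ > (0:ℝ), ∃ k > (0:ℝ), ∃ C > (0:ℝ), ∀ p ∈ Z, ∀ d : Fin n → ℂ, ‖d‖ < δ →
      Ψ p.1 p.2 + 2 * (d ⬝ᵥ gr Ψ p.1 p.2).re + k * ‖d‖ ^ 2 - C * ‖d ⬝ᵥ gr Ψ p.1 p.2‖ ^ 2 ≤ Ψ p.1 (p.2 + d) ∧
      Ψ p.1 (p.2 + d) ≤ Ψ p.1 p.2 + 2 * (d ⬝ᵥ gr Ψ p.1 p.2).re + C * ‖d‖ ^ 2 ∧
      ‖gr Ψ p.1 (p.2 + d) - gr Ψ p.1 p.2‖ ≤ C * ‖d‖ ∧ p.2 + d ≠ 0 := by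
  obtain ⟨Z', hZ', hZ'0, -, δ1, hδ1, hin⟩ := D.thicken hZ hZ0
  obtain ⟨k, hk, C, hC, hco⟩ := D.hess_coercive hZ' hZ'0
  obtain ⟨M, hM, hMb⟩ := compact_bound hZ' (D.dgr_cont.mono hZ'0)
  obtain ⟨δ2, hδ2, hsm⟩ : ∃ δ2 > (0:ℝ), ∀ x, 0 ≤ x → x < δ2 → C * (2 * (n * M) ^ 2 * x ^ 2) ≤ k / 2 := by
    have : Tendsto (fun x : ℝ => C * (2 * (n * M) ^ 2 * x ^ 2)) (nhds 0) (nhds 0) := by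
      have : Continuous (fun x : ℝ => C * (2 * (n * M) ^ 2 * x ^ 2)) := by fun_prop
      simpa using this.tendsto 0
    obtain ⟨δ2, hδ2, h⟩ := Metric.eventually_nhds_iff.1 (this.eventually (gt_mem_nhds (half_pos hk)))
    exact ⟨δ2, hδ2, fun x hx hx2 => (h (by simpa [abs_of_nonneg hx] using hx2)).le⟩
  refine ⟨min δ1 δ2, lt_min hδ1 hδ2, k / 4, by linarith, (C + M + n * M), by positivity, ?_⟩
  rintro ⟨θ, w⟩ hp d hd
  have hd1 := hd.trans_le (min_le_left _ _)
  have hd2 := hd.trans_le (min_le_right _ _)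
  have hmem : ∀ x ∈ closedBall w ‖d‖, (θ, x) ∈ Z' := fun x hx => by
    refine hin _ hp θ x (by simpa using hδ1.le) ?_
    rw [mem_closedBall, dist_eq_norm] at hx
    exact hx.trans hd1.le
  have hne : ∀ x ∈ closedBall w ‖d‖, x ≠ 0 := fun x hx => hZ'0 (hmem x hx)
  have hbd : ∀ x ∈ closedBall w ‖d‖, ‖fderiv ℝ (gr Ψ θ) x‖ ≤ M := fun x hx => hMb (θ, x) (hmem x hx)
  have hlip : ∀ x ∈ closedBall w ‖d‖, ‖gr Ψ θ x - gr Ψ θ w‖ ≤ M * ‖x - w‖ := fun x hx => by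
    refine (convex_closedBall w ‖d‖).norm_image_sub_le_of_norm_fderiv_le (𝕜 := ℝ)
      (fun y hy => D.gr_diffAt_w (hne y hy)) hbd
      (mem_closedBall_self (norm_nonneg _)) hx
  have hseg : ∀ s ∈ Icc (0:ℝ) 1, w + s • d ∈ closedBall w ‖d‖ := fun s hs => by
    rw [mem_closedBall, dist_eq_norm, add_sub_cancel_left, norm_smul, Real.norm_eq_abs, abs_of_nonneg hs.1]
    exact mul_le_of_le_one_left (norm_nonneg _) hs.2
  have h1 : ∀ s ∈ Icc (0:ℝ) 1, HasDerivAt (fun s : ℝ => Ψ θ (w + s • d)) (2 * (d ⬝ᵥ gr Ψ θ (w + s • d)).re) s := fun s hs => by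
    have hl : HasDerivAt (fun s : ℝ => w + s • d) d s := by
      simpa using ((hasDerivAt_id s).smul_const d).const_add w
    have := (D.diffAt_w (θ := θ) (hne _ (hseg s hs))).hasFDerivAt.comp_hasDerivAt s hl
    rw [fderiv_eq] at this
    exact this
  have h2 : ∀ s ∈ Icc (0:ℝ) 1, HasDerivAt (fun s : ℝ => 2 * (d ⬝ᵥ gr Ψ θ (w + s • d)).re)
      (2 * (d ⬝ᵥ fderiv ℝ (gr Ψ θ) (w + s • d) d).re) s := fun s hs => by
    have hl : HasDerivAt (fun s : ℝ => w + s • d) d s := by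
      simpa using ((hasDerivAt_id s).smul_const d).const_add w
    have h3 := (D.gr_diffAt_w (θ := θ) (hne _ (hseg s hs))).hasFDerivAt.comp_hasDerivAt s hl
    have h4 : HasDerivAt (fun s : ℝ => d ⬝ᵥ gr Ψ θ (w + s • d)) (d ⬝ᵥ fderiv ℝ (gr Ψ θ) (w + s • d) d) s := by
      unfold dotProduct
      exact HasDerivAt.fun_sum fun j _ => ((hasDerivAt_pi.1 h3) j).const_mul (d j)
    exact (Complex.reCLM.hasFDerivAt.comp_hasDerivAt s h4).const_mul 2
  refine ⟨?_, ?_, ?_, ?_⟩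
  · have hlow : ∀ s ∈ Icc (0:ℝ) 1, k / 2 * ‖d‖ ^ 2 - 2 * C * ‖d ⬝ᵥ gr Ψ θ w‖ ^ 2 ≤
        2 * (d ⬝ᵥ fderiv ℝ (gr Ψ θ) (w + s • d) d).re := fun s hs => by
      have hb := hco (θ, w + s • d) (hmem _ (hseg s hs)) d
      have e1 : d ⬝ᵥ gr Ψ θ (w + s • d) = d ⬝ᵥ gr Ψ θ w + d ⬝ᵥ (gr Ψ θ (w + s • d) - gr Ψ θ w) := by
        rw [← dotProduct_add]; congr 1; abel
      have e2 : ‖d ⬝ᵥ (gr Ψ θ (w + s • d) - gr Ψ θ w)‖ ≤ n * M * ‖d‖ ^ 2 := by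
        refine (dot_norm_le _ _).trans ?_
        have h5 := hlip _ (hseg s hs)
        have h6 : ‖w + s • d - w‖ ≤ ‖d‖ := by simpa [dist_eq_norm] using hseg s hs
        have h7 : ‖gr Ψ θ (w + s • d) - gr Ψ θ w‖ ≤ M * ‖d‖ := h5.trans (mul_le_mul_of_nonneg_left h6 hM.le)
        calc n * ‖d‖ * ‖gr Ψ θ (w + s • d) - gr Ψ θ w‖ ≤ n * ‖d‖ * (M * ‖d‖) := by gcongr
          _ = n * M * ‖d‖ ^ 2 := by ring
      have e3 : ‖d ⬝ᵥ gr Ψ θ (w + s • d)‖ ^ 2 ≤ 2 * ‖d ⬝ᵥ gr Ψ θ w‖ ^ 2 + 2 * (n * M) ^ 2 * ‖d‖ ^ 2 * ‖d‖ ^ 2 := by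
        rw [e1]
        have h8 := norm_add_le (d ⬝ᵥ gr Ψ θ w) (d ⬝ᵥ (gr Ψ θ (w + s • d) - gr Ψ θ w))
        have h9 : ‖d ⬝ᵥ gr Ψ θ w + d ⬝ᵥ (gr Ψ θ (w + s • d) - gr Ψ θ w)‖ ≤ ‖d ⬝ᵥ gr Ψ θ w‖ + n * M * ‖d‖ ^ 2 := by linarith
        calc _ ≤ (‖d ⬝ᵥ gr Ψ θ w‖ + n * M * ‖d‖ ^ 2) ^ 2 := by gcongr
          _ ≤ _ := by nlinarith [sq_nonneg (‖d ⬝ᵥ gr Ψ θ w‖ - n * M * ‖d‖ ^ 2)]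
      have e4 := hsm ‖d‖ (norm_nonneg _) hd2
      have e5 := mul_le_mul_of_nonneg_right e4 (sq_nonneg ‖d‖)
      have e6 := mul_le_mul_of_nonneg_left e3 hC
      simp only at hb
      nlinarith
    have := taylor1 h1 h2 hlow
    simp only [one_smul, zero_smul, add_zero] at this
    have h10 : 0 ≤ (M + n * M) * ‖d ⬝ᵥ gr Ψ θ w‖ ^ 2 := by positivity
    simp only
    nlinarith
  · have hup : ∀ s ∈ Icc (0:ℝ) 1, - (2 * n * M * ‖d‖ ^ 2) ≤ - (2 * (d ⬝ᵥ fderiv ℝ (gr Ψ θ) (w + s • d) d).re) := fun s hs => by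
      have h5 := (Complex.re_le_norm (d ⬝ᵥ fderiv ℝ (gr Ψ θ) (w + s • d) d)).trans (dot_norm_le _ _)
      have h6 : ‖fderiv ℝ (gr Ψ θ) (w + s • d) d‖ ≤ M * ‖d‖ := (ContinuousLinearMap.le_opNorm _ _).trans
        (mul_le_mul_of_nonneg_right (hbd _ (hseg s hs)) (norm_nonneg _))
      have h7 : n * ‖d‖ * ‖fderiv ℝ (gr Ψ θ) (w + s • d) d‖ ≤ n * ‖d‖ * (M * ‖d‖) := by gcongr
      nlinarith
    have := taylor1 (fun s hs => (h1 s hs).neg) (fun s hs => (h2 s hs).neg) hup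
    simp only [one_smul, zero_smul, add_zero, Pi.neg_apply] at this
    have h10 : 0 ≤ (C + M) * ‖d‖ ^ 2 := by positivity
    simp only
    nlinarith
  · have := hlip (w + d) (by simp [dist_eq_norm])
    rw [add_sub_cancel_left] at this
    have h10 : 0 ≤ (C + n * M) * ‖d‖ := by positivity
    simp only
    nlinarith
  · exact hZ'0 (hmem _ (by simp [dist_eq_norm]))

end Data
end S17

namespace S17

variable {n : ℕ} {Ψ : ℝ → (Fin n → ℂ) → ℝ} {R : ℝ}

lemma star_dot_self_ne {g : Fin n → ℂ} (hg : g ≠ 0) : star g ⬝ᵥ g ≠ 0 := by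
  rw [dotProduct_comm, dot_star_self]
  have : euclNorm g ≠ 0 := fun h => hg (eucl_eq_zero.1 h)
  exact_mod_cast pow_ne_zero 2 this

lemma cont_dot {X : Type*} [TopologicalSpace X] {f g : X → Fin n → ℂ} {s : Set X}
    (hf : ContinuousOn f s) (hg : ContinuousOn g s) : ContinuousOn (fun x => f x ⬝ᵥ g x) s := by
  unfold dotProduct
  fun_prop

lemma tendsto_dot {X : Type*} {l : Filter X} {f g : X → Fin n → ℂ} {a b : Fin n → ℂ}
    (hf : Tendsto f l (nhds a)) (hg : Tendsto g l (nhds b)) : Tendsto (fun x => f x ⬝ᵥ g x) l (nhds (a ⬝ᵥ b)) := by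
  unfold dotProduct
  exact tendsto_finsetSum _ fun j _ => ((tendsto_pi_nhds.1 hf) j).mul ((tendsto_pi_nhds.1 hg) j)

namespace Data

lemma contw (D : Data n Ψ R) (θ : ℝ) : Continuous (Ψ θ) :=
  D.cont.comp (Continuous.prodMk_right θ)

lemma gr_contAt (D : Data n Ψ R) {θ : ℝ} {w : Fin n → ℂ} (hw : w ≠ 0) : ContinuousAt (gr Ψ θ) w :=
  (D.gr_diffAt_w hw).continuousAt

lemma ne_of_pos (D : Data n Ψ R) {θ : ℝ} {w : Fin n → ℂ} (h : 0 < Ψ θ w) : w ≠ 0 :=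
  fun h0 => h.ne' ((D.zero θ w).2 h0)

lemma pos_of_ne (D : Data n Ψ R) {θ : ℝ} {w : Fin n → ℂ} (h : w ≠ 0) : 0 < Ψ θ w :=
  lt_of_le_of_ne (D.nonneg θ w) fun h0 => h ((D.zero θ w).1 h0.symm)

lemma eucl_le_R (D : Data n Ψ R) {θ : ℝ} {w : Fin n → ℂ} (h : Ψ θ w ≤ R) : euclNorm w ≤ R :=
  not_lt.1 fun h1 => absurd (D.aboveR θ w h1) (not_lt.2 h)

lemma norm_le_R (D : Data n Ψ R) {θ : ℝ} {w : Fin n → ℂ} (h : Ψ θ w ≤ R) : ‖w‖ ≤ R :=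
  (norm_le_eucl w).trans (D.eucl_le_R h)

lemma lt_R (D : Data n Ψ R) {θ : ℝ} {w : Fin n → ℂ} (h : euclNorm w < R) : Ψ θ w < R := by
  by_contra hcon
  push Not at hcon
  have hc : Continuous (fun s : ℝ => Ψ θ (s • w)) := (D.contw θ).comp (by fun_prop)
  have h0 : Ψ θ ((0:ℝ) • w) ≤ R := by
    rw [zero_smul, (D.zero θ 0).2 rfl]; linarith [D.hR]
  have h1 : R ≤ Ψ θ ((1:ℝ) • w) := by rwa [one_smul]
  obtain ⟨s, hs, hs2⟩ := intermediate_value_Icc (zero_le_one (α := ℝ)) hc.continuousOn ⟨h0, h1⟩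
  have h2 := (D.levelR θ _).1 hs2
  have h3 : euclNorm (s • w) = s * euclNorm w := by
    unfold euclNorm
    have : ∑ j, Complex.normSq ((s • w) j) = s ^ 2 * ∑ j, Complex.normSq (w j) := by
      rw [Finset.mul_sum]
      refine Finset.sum_congr rfl fun j _ => ?_
      simp [Complex.normSq_mul, sq]
    rw [this, Real.sqrt_mul (sq_nonneg s), Real.sqrt_sq hs.1]
  rw [h3] at h2
  nlinarith [eucl_nonneg w, hs.1, hs.2]

lemma le_R (D : Data n Ψ R) {θ : ℝ} {w : Fin n → ℂ} (h : euclNorm w ≤ R) : Ψ θ w ≤ R := by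
  rcases h.lt_or_eq with h | h
  · exact (D.lt_R h).le
  · exact ((D.levelR θ w).2 h).le

/-- compact level regions -/
def KS (Ψ : ℝ → (Fin n → ℂ) → ℝ) (R s : ℝ) : Set (ℝ × (Fin n → ℂ)) :=
  {p | p.1 ∈ Icc (-10:ℝ) 10 ∧ s ≤ Ψ p.1 p.2 ∧ Ψ p.1 p.2 ≤ R}

lemma KS_compact (D : Data n Ψ R) (s : ℝ) : IsCompact (KS Ψ R s) := by
  refine (isCompact_Icc.prod (isCompact_closedBall (0 : Fin n → ℂ) R)).of_isClosed_subset (s := Icc (-10:ℝ) 10 ×ˢ closedBall (0 : Fin n → ℂ) R) ?_ ?_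
  · refine (isClosed_Icc.preimage continuous_fst).inter ((isClosed_Ici.preimage D.cont).inter (isClosed_Iic.preimage D.cont))
  · rintro p ⟨h1, h2, h3⟩
    exact ⟨h1, by simpa using D.norm_le_R h3⟩

lemma KS_ne (D : Data n Ψ R) {s : ℝ} (hs : 0 < s) : KS Ψ R s ⊆ {p | p.2 ≠ 0} :=
  fun _ hp => D.ne_of_pos (hs.trans_le hp.2.1)

lemma hasDerivAt_line (D : Data n Ψ R) {θ : ℝ} {x : Fin n → ℂ} (hx : x ≠ 0) (d : Fin n → ℂ) :
    HasDerivAt (fun s : ℝ => Ψ θ (x + s • d)) (2 * (d ⬝ᵥ gr Ψ θ x).re) 0 := by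
  have hl : HasDerivAt (fun s : ℝ => x + s • d) d 0 := by
    simpa using ((hasDerivAt_id (0:ℝ)).smul_const d).const_add x
  have h1 : DifferentiableAt ℝ (Ψ θ) (x + (0:ℝ) • d) := D.diffAt_w (by simpa using hx)
  have := h1.hasFDerivAt.comp_hasDerivAt (0:ℝ) hl
  rw [fderiv_eq] at this
  simp only [zero_smul, add_zero] at this
  exact this

lemma crit (D : Data n Ψ R) {θ : ℝ} {x g : Fin n → ℂ} (hx : x ≠ 0)
    (h : ∀ d : Fin n → ℂ, d ⬝ᵥ g = 0 → ∀ᶠ s in nhds (0:ℝ), Ψ θ x ≤ Ψ θ (x + s • d))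
    (d : Fin n → ℂ) (hd : d ⬝ᵥ g = 0) : d ⬝ᵥ gr Ψ θ x = 0 := by
  have key : ∀ d : Fin n → ℂ, d ⬝ᵥ g = 0 → (d ⬝ᵥ gr Ψ θ x).re = 0 := by
    intro d hd
    have hm : IsLocalMin (fun s : ℝ => Ψ θ (x + s • d)) 0 := by
      filter_upwards [h d hd] with s hs
      simpa using hs
    have := hm.hasDerivAt_eq_zero (D.hasDerivAt_line hx d)
    linarith
  have h1 := key d hd
  have h2 := key (Complex.I • d) (by rw [smul_dotProduct, hd, smul_zero])
  rw [smul_dotProduct, smul_eq_mul, Complex.I_mul_re] at h2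
  exact Complex.ext h1 (by simpa using h2)

lemma top_par (D : Data n Ψ R) {θ : ℝ} {w : Fin n → ℂ} (hw : Ψ θ w = R) (d : Fin n → ℂ)
    (hd : d ⬝ᵥ star w = 0) : d ⬝ᵥ gr Ψ θ w = 0 := by
  have hRpos : 0 < R := by linarith [D.hR]
  have hw0 : w ≠ 0 := D.ne_of_pos (by rw [hw]; exact hRpos)
  have hwR := (D.levelR θ w).1 hw
  have neg : ∀ e : Fin n → ℂ, (e ⬝ᵥ star w).re < 0 → (e ⬝ᵥ gr Ψ θ w).re ≤ 0 := by
    intro e he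
    by_contra hcon
    push Not at hcon
    have hd1 := D.hasDerivAt_line (θ := θ) hw0 e
    -- Ψ (w + s e) > R for small s > 0, and |w + s e| < R
    have hpos : 0 < 2 * (e ⬝ᵥ gr Ψ θ w).re := by linarith
    have h1 : ∀ᶠ s in nhdsWithin (0:ℝ) (Ioi 0), R < Ψ θ (w + s • e) := by
      have hs := hd1.tendsto_slope
      have h2 := (hs.eventually (lt_mem_nhds hpos)).filter_mono (nhdsWithin_mono (0:ℝ) (s := Ioi 0) (fun x hx => ne_of_gt hx))
      filter_upwards [h2, self_mem_nhdsWithin] with s h3 h4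
      rw [slope_def_field] at h3
      have h4' : (0:ℝ) < s := h4
      simp only [zero_smul, add_zero, sub_zero] at h3
      have := (lt_div_iff₀ h4').1 h3
      linarith
    have h5 : ∀ᶠ s in nhdsWithin (0:ℝ) (Ioi 0), euclNorm (w + s • e) < R := by
      have hc : Tendsto (fun s : ℝ => 2 * (e ⬝ᵥ star w).re + s * euclNorm e ^ 2) (nhdsWithin (0:ℝ) (Ioi 0)) (nhds (2 * (e ⬝ᵥ star w).re)) := by
        have : Continuous (fun s : ℝ => 2 * (e ⬝ᵥ star w).re + s * euclNorm e ^ 2) := by fun_prop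
        simpa using (this.tendsto 0).mono_left nhdsWithin_le_nhds
      filter_upwards [hc.eventually (gt_mem_nhds (show 2 * (e ⬝ᵥ star w).re < 0 by linarith)), self_mem_nhdsWithin] with s h6 h7
      have h7' : (0:ℝ) < s := h7
      have h8 : euclNorm (w + s • e) ^ 2 = R ^ 2 + s * (2 * (e ⬝ᵥ star w).re + s * euclNorm e ^ 2) := by
        rw [← hwR, eucl_sq, eucl_sq, eucl_sq, dotProduct, Complex.re_sum]
        simp only [mul_add, Finset.mul_sum]
        rw [← Finset.sum_add_distrib, ← Finset.sum_add_distrib]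
        refine Finset.sum_congr rfl fun j _ => ?_
        simp [Complex.normSq_apply]
        ring
      have h9 : euclNorm (w + s • e) ^ 2 < R ^ 2 := by nlinarith
      exact lt_of_pow_lt_pow_left₀ 2 hRpos.le h9
    obtain ⟨s, hs1, hs2⟩ := (h1.and h5).exists
    exact absurd (D.lt_R hs2 (θ := θ)) (not_lt.2 hs1.le)
  have re0 : ∀ d : Fin n → ℂ, d ⬝ᵥ star w = 0 → (d ⬝ᵥ gr Ψ θ w).re ≤ 0 := by
    intro d hd
    have h1 : ∀ τ ∈ Ioi (0:ℝ), (d ⬝ᵥ gr Ψ θ w).re - τ * (w ⬝ᵥ gr Ψ θ w).re ≤ 0 := by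
      intro τ hτ
      have := neg (d - τ • w) (by
        rw [sub_dotProduct, hd, smul_dotProduct, dot_star_self, hwR]
        simp only [zero_sub, Complex.neg_re, Complex.smul_re, Complex.ofReal_re, smul_eq_mul]
        have : 0 < τ * R ^ 2 := mul_pos hτ (by positivity)
        linarith)
      rw [sub_dotProduct, smul_dotProduct] at this
      simpa using this
    have h2 : Tendsto (fun τ : ℝ => (d ⬝ᵥ gr Ψ θ w).re - τ * (w ⬝ᵥ gr Ψ θ w).re) (nhdsWithin 0 (Ioi 0)) (nhds (d ⬝ᵥ gr Ψ θ w).re) := by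
      have : Continuous (fun τ : ℝ => (d ⬝ᵥ gr Ψ θ w).re - τ * (w ⬝ᵥ gr Ψ θ w).re) := by fun_prop
      simpa using (this.tendsto 0).mono_left nhdsWithin_le_nhds
    exact le_of_tendsto h2 (eventually_mem_nhdsWithin.mono h1)
  have h1 := re0 d hd
  have h2 := re0 (-d) (by rw [neg_dotProduct, hd, neg_zero])
  have h3 := re0 (Complex.I • d) (by rw [smul_dotProduct, hd, smul_zero])
  have h4 := re0 (-(Complex.I • d)) (by rw [neg_dotProduct, smul_dotProduct, hd, smul_zero, neg_zero])
  simp only [neg_dotProduct, smul_dotProduct, smul_eq_mul, Complex.neg_re, Complex.I_mul_re] at h2 h3 h4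
  exact Complex.ext (by simp; linarith) (by simp; linarith)

lemma LC_top (D : Data n Ψ R) {θ : ℝ} {w w' : Fin n → ℂ} (hw : Ψ θ w = R) (hw' : Ψ θ w' ≤ R)
    (hne : w' ≠ w) : (w' - w) ⬝ᵥ gr Ψ θ w ≠ 0 := by
  intro h0
  have hRpos : 0 < R := by linarith [D.hR]
  have hwR := (D.levelR θ w).1 hw
  have hG := D.grad θ w (by rw [hw]; exact hRpos) hw.le
  have hwne : w ⬝ᵥ star w ≠ 0 := by
    rw [dot_star_self, hwR]; exact_mod_cast (pow_pos hRpos 2).ne'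
  have dec : ∀ d : Fin n → ℂ, d ⬝ᵥ gr Ψ θ w = (d ⬝ᵥ star w) / (w ⬝ᵥ star w) * (w ⬝ᵥ gr Ψ θ w) := by
    intro d
    have := D.top_par hw (d - ((d ⬝ᵥ star w) / (w ⬝ᵥ star w)) • w) (by
      rw [sub_dotProduct, smul_dotProduct, smul_eq_mul]; field_simp; simp)
    rw [sub_dotProduct, smul_dotProduct, smul_eq_mul, sub_eq_zero] at this
    exact this
  have hwG : w ⬝ᵥ gr Ψ θ w ≠ 0 := by
    intro h
    apply star_dot_self_ne hG
    rw [dec, h, mul_zero]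
  rw [dec] at h0
  have h1 : (w' - w) ⬝ᵥ star w = 0 := by
    rcases mul_eq_zero.1 h0 with h | h
    · rcases div_eq_zero_iff.1 h with h | h
      · exact h
      · exact absurd h hwne
    · exact absurd h hwG
  have h2 := D.eucl_le_R hw'
  have h3 : euclNorm w' ^ 2 = R ^ 2 + (2 * ((w' - w) ⬝ᵥ star w).re + euclNorm (w' - w) ^ 2) := by
    rw [← hwR, eucl_sq, eucl_sq, eucl_sq, dotProduct, Complex.re_sum, Finset.mul_sum]
    rw [← Finset.sum_add_distrib, ← Finset.sum_add_distrib]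
    refine Finset.sum_congr rfl fun j _ => ?_
    simp [Complex.normSq_apply]
    ring
  rw [h1] at h3
  have h4 : 0 < euclNorm (w' - w) := lt_of_le_of_ne (eucl_nonneg _) fun h => hne (sub_eq_zero.1 (eucl_eq_zero.1 h.symm))
  simp at h3
  nlinarith [eucl_nonneg w']

end Data
end S17

namespace S17

variable {n : ℕ} {Ψ : ℝ → (Fin n → ℂ) → ℝ} {R : ℝ}

/-- the correction moving `v` onto the hyperplane through `x` orthogonal to `h` in direction `star g`. -/
def corr (g v x h : Fin n → ℂ) : Fin n → ℂ := v + (-((v - x) ⬝ᵥ h) / (star g ⬝ᵥ h)) • star g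

lemma corr_mem {g v x h : Fin n → ℂ} (hh : star g ⬝ᵥ h ≠ 0) : (corr g v x h - x) ⬝ᵥ h = 0 := by
  unfold corr
  rw [show v + (-((v - x) ⬝ᵥ h) / (star g ⬝ᵥ h)) • star g - x = (v - x) + (-((v - x) ⬝ᵥ h) / (star g ⬝ᵥ h)) • star g by abel,
    add_dotProduct, smul_dotProduct, smul_eq_mul]
  field_simp
  ring

namespace Data

/-- the main step of linear convexity -/
lemma LC_step (D : Data n Ψ R) {θ : ℝ} {w w' : Fin n → ℂ} (hw0 : 0 < Ψ θ w) (hwR : Ψ θ w < R)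
    (hw' : Ψ θ w' ≤ Ψ θ w) (hne : w' ≠ w) (ht : (w' - w) ⬝ᵥ gr Ψ θ w = 0)
    (hmax : ∀ x y, Ψ θ w < Ψ θ x → Ψ θ x ≤ R → Ψ θ y ≤ Ψ θ x → y ≠ x → (y - x) ⬝ᵥ gr Ψ θ x ≠ 0) : False := by
  set G := gr Ψ θ w with hGdef
  set s := Ψ θ w with hs
  have hwne : w ≠ 0 := D.ne_of_pos hw0
  have hG : G ≠ 0 := D.grad θ w hw0 hwR.le
  have hGG := star_dot_self_ne hG
  set l := nhdsWithin (0:ℝ) (Ioi 0) with hl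
  have hlt : l ≤ nhds 0 := nhdsWithin_le_nhds
  set δ := ‖w' - w‖ / 3 with hδ
  have hδpos : 0 < δ := div_pos (norm_pos_iff.2 (sub_ne_zero.2 hne)) (by norm_num)
  let W : ℝ → Fin n → ℂ := fun ε => w + ε • star G
  have hWt : Tendsto W l (nhds w) := by
    have : Continuous W := by fun_prop
    simpa [W] using (this.tendsto 0).mono_left hlt
  have hgW : Tendsto (fun ε => gr Ψ θ (W ε)) l (nhds G) := (D.gr_contAt hwne).tendsto.comp hWt
  have hΨW : Tendsto (fun ε => Ψ θ (W ε)) l (nhds s) := ((D.contw θ).tendsto w).comp hWt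
  have hup : ∀ᶠ ε in l, s < Ψ θ (W ε) := by
    have hd1 := D.hasDerivAt_line (θ := θ) hwne (star G)
    have hpos : 0 < 2 * (star G ⬝ᵥ G).re := by
      rw [dotProduct_comm, dot_star_self, Complex.ofReal_re]
      have : euclNorm G ≠ 0 := fun h => hG (eucl_eq_zero.1 h)
      positivity
    have h2 := (hd1.tendsto_slope.eventually (lt_mem_nhds hpos)).filter_mono (nhdsWithin_mono (0:ℝ) (s := Ioi 0) (fun x hx => ne_of_gt hx))
    filter_upwards [h2, self_mem_nhdsWithin] with ε h3 h4
    rw [slope_def_field] at h3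
    have h4' : (0:ℝ) < ε := h4
    simp only [zero_smul, add_zero, sub_zero] at h3
    have := (lt_div_iff₀ h4').1 h3
    simp only [W]
    linarith
  have hWR : ∀ᶠ ε in l, Ψ θ (W ε) < R := hΨW.eventually (gt_mem_nhds hwR)
  have hWclose : ∀ᶠ ε in l, ‖W ε - w‖ < δ := by
    have := (tendsto_iff_norm_sub_tendsto_zero.1 hWt)
    exact this.eventually (gt_mem_nhds hδpos)
  have hden : ∀ᶠ ε in l, star G ⬝ᵥ gr Ψ θ (W ε) ≠ 0 := by
    have : Tendsto (fun ε => star G ⬝ᵥ gr Ψ θ (W ε)) l (nhds (star G ⬝ᵥ G)) := tendsto_dot tendsto_const_nhds hgW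
    exact this.eventually_ne hGG
  -- Claim A
  have hA : ∀ᶠ ε in l, ∀ v, ‖v - w'‖ ≤ δ → (v - W ε) ⬝ᵥ gr Ψ θ (W ε) = 0 → Ψ θ (W ε) < Ψ θ v := by
    filter_upwards [hup, hWR, hWclose] with ε h1 h2 h3 v hv hv2
    by_contra hcon
    push Not at hcon
    refine hmax (W ε) v h1 h2.le hcon ?_ hv2
    rintro rfl
    have h4 : ‖w' - w‖ ≤ ‖W ε - w‖ + ‖W ε - w'‖ := by
      have := norm_sub_le (W ε - w) (W ε - w')
      rwa [show W ε - w - (W ε - w') = w' - w by abel] at this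
    have : ‖w' - w‖ = 3 * δ := by rw [hδ]; ring
    linarith
  -- correction converges
  have hcorr : ∀ v, (v - w) ⬝ᵥ G = 0 → Tendsto (fun ε => corr G v (W ε) (gr Ψ θ (W ε))) l (nhds v) := by
    intro v hv
    have h1 : Tendsto (fun ε => (v - W ε) ⬝ᵥ gr Ψ θ (W ε)) l (nhds 0) := by
      rw [← hv]; exact tendsto_dot (tendsto_const_nhds.sub hWt) hgW
    have h2 : Tendsto (fun ε => star G ⬝ᵥ gr Ψ θ (W ε)) l (nhds (star G ⬝ᵥ G)) := tendsto_dot tendsto_const_nhds hgW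
    have h3 := ((h1.neg.div h2 hGG).smul_const (star G)).const_add v
    simpa [corr] using h3
  -- Claim B
  have hB : ∀ v, ‖v - w'‖ < δ → (v - w) ⬝ᵥ G = 0 → s ≤ Ψ θ v := by
    intro v hv hv2
    have h1 := hcorr v hv2
    have h2 : Tendsto (fun ε => Ψ θ (corr G v (W ε) (gr Ψ θ (W ε)))) l (nhds (Ψ θ v)) := ((D.contw θ).tendsto v).comp h1
    refine ge_of_tendsto h2 ?_
    have h3 : ∀ᶠ ε in l, ‖corr G v (W ε) (gr Ψ θ (W ε)) - w'‖ < δ :=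
      (h1.sub_const w').norm.eventually (gt_mem_nhds hv)
    filter_upwards [hA, h3, hup, hden] with ε h4 h5 h6 h7
    exact (h6.trans (h4 _ h5.le (corr_mem h7))).le
  have hw's : Ψ θ w' = s := le_antisymm hw' (hB w' (by simpa using hδpos) ht)
  have hw'ne : w' ≠ 0 := D.ne_of_pos (by rw [hw's]; exact hw0)
  -- Claim C
  have hC : ∀ d : Fin n → ℂ, d ⬝ᵥ G = 0 → d ⬝ᵥ gr Ψ θ w' = 0 := by
    refine D.crit hw'ne fun d hd => ?_
    have hc : Tendsto (fun s : ℝ => ‖w' + s • d - w'‖) (nhds 0) (nhds 0) := by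
      have : Continuous (fun s : ℝ => ‖w' + s • d - w'‖) := by fun_prop
      simpa using this.tendsto 0
    filter_upwards [hc.eventually (gt_mem_nhds hδpos)] with t ht2
    rw [hw's]
    refine hB _ ht2 ?_
    rw [show w' + t • d - w = (w' - w) + t • d by abel, add_dotProduct, ht, smul_dotProduct, hd]; simp
  obtain ⟨m, hm⟩ : ∃ m : ℂ, ∀ d : Fin n → ℂ, d ⬝ᵥ gr Ψ θ w' = (d ⬝ᵥ G) * m := by
    refine ⟨(star G ⬝ᵥ gr Ψ θ w') / (star G ⬝ᵥ G), fun d => ?_⟩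
    have := hC (d - ((d ⬝ᵥ G) / (star G ⬝ᵥ G)) • star G) (by
      rw [sub_dotProduct, smul_dotProduct, smul_eq_mul]; field_simp; simp)
    rw [sub_dotProduct, smul_dotProduct, smul_eq_mul, sub_eq_zero] at this
    rw [this]; ring
  -- Claim D
  obtain ⟨δ', hδ', k, hk, C, hCpos, hLT⟩ := D.LT (Z := {(θ, w')}) isCompact_singleton (by simpa using hw'ne)
  obtain ⟨r, hr, hrδ, hrδ'⟩ : ∃ r > (0:ℝ), r < δ ∧ r < δ' :=
    ⟨min δ δ' / 2, by positivity, by linarith [min_le_left δ δ', lt_min hδpos hδ'], by linarith [min_le_right δ δ', lt_min hδpos hδ']⟩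
  have hbd : ∀ᶠ ε in l, ∀ v, ‖v - w'‖ = r → (v - W ε) ⬝ᵥ gr Ψ θ (W ε) = 0 → s + k * r ^ 2 / 2 < Ψ θ v := by
    let η : ℝ → ℝ := fun ε => n * (r + ‖w' - W ε‖) * ‖G - gr Ψ θ (W ε)‖ + n * ‖W ε - w‖ * ‖G‖
    have hη : Tendsto η l (nhds 0) := by
      have h1 : Tendsto (fun ε => ‖w' - W ε‖) l (nhds ‖w' - w‖) := (tendsto_const_nhds.sub hWt).norm
      have h2 : Tendsto (fun ε => ‖G - gr Ψ θ (W ε)‖) l (nhds 0) := by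
        simpa using (tendsto_const_nhds.sub hgW : Tendsto (fun ε => G - gr Ψ θ (W ε)) l (nhds (G - G))).norm
      have h3 : Tendsto (fun ε => ‖W ε - w‖) l (nhds 0) := tendsto_iff_norm_sub_tendsto_zero.1 hWt
      have h4 := (((h1.const_add r).const_mul (n:ℝ)).mul h2).add ((h3.const_mul (n:ℝ)).mul_const ‖G‖)
      simpa [η] using h4
    have h5 : Tendsto (fun ε => 2 * (η ε * ‖m‖) + C * (η ε * ‖m‖) ^ 2) l (nhds 0) := by
      have h6 := hη.mul_const ‖m‖
      have := (h6.const_mul 2).add ((h6.pow 2).const_mul C)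
      simpa using this
    filter_upwards [h5.eventually (gt_mem_nhds (show 0 < k * r ^ 2 / 2 by positivity))] with ε h6 v hv hv2
    have h7 : ‖(v - w') ⬝ᵥ G‖ ≤ η ε := by
      have e1 : (v - w') ⬝ᵥ G = (v - W ε) ⬝ᵥ (G - gr Ψ θ (W ε)) + (W ε - w) ⬝ᵥ G := by
        have e2 : (v - w') ⬝ᵥ G = (v - w') ⬝ᵥ G + (w' - w) ⬝ᵥ G := by rw [ht, add_zero]
        rw [e2, dotProduct_sub, hv2, sub_zero, ← add_dotProduct, ← add_dotProduct]
        congr 1; abel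
      rw [e1]
      refine (norm_add_le _ _).trans (add_le_add ((dot_norm_le _ _).trans ?_) (dot_norm_le _ _))
      have h8 : ‖v - W ε‖ ≤ r + ‖w' - W ε‖ := by
        have := norm_add_le (v - w') (w' - W ε)
        rw [show v - w' + (w' - W ε) = v - W ε by abel, hv] at this
        exact this
      gcongr
    have h9 := (hLT _ rfl (v - w') (by rw [hv]; exact hrδ')).1
    simp only [add_sub_cancel] at h9
    rw [hw's, hv, hm] at h9
    have h10 : ‖((v - w') ⬝ᵥ G) * m‖ ≤ η ε * ‖m‖ := by rw [norm_mul]; gcongr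
    have h11 := (Complex.abs_re_le_norm (((v - w') ⬝ᵥ G) * m)).trans h10
    have h12 := (abs_le.1 h11).1
    have h13 : ‖((v - w') ⬝ᵥ G) * m‖ ^ 2 ≤ (η ε * ‖m‖) ^ 2 := by gcongr
    have h14 := mul_le_mul_of_nonneg_left h13 hCpos.le
    linarith
  have hE := hcorr w' ht
  have hE1 : ∀ᶠ ε in l, ‖corr G w' (W ε) (gr Ψ θ (W ε)) - w'‖ < r := by
    have := tendsto_iff_norm_sub_tendsto_zero.1 hE
    exact this.eventually (gt_mem_nhds hr)
  have hE2 : ∀ᶠ ε in l, Ψ θ (corr G w' (W ε) (gr Ψ θ (W ε))) < min (s + k * r ^ 2 / 2) R := by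
    have h2 : Tendsto (fun ε => Ψ θ (corr G w' (W ε) (gr Ψ θ (W ε)))) l (nhds (Ψ θ w')) := ((D.contw θ).tendsto w').comp hE
    refine h2.eventually (gt_mem_nhds ?_)
    rw [hw's]
    exact lt_min (by have : 0 < k * r ^ 2 / 2 := by positivity
                     linarith) hwR
  obtain ⟨ε, hA, hup, hbd, hE1, hE2, hden⟩ := (hA.and (hup.and (hbd.and (hE1.and (hE2.and hden))))).exists
  set v0 := corr G w' (W ε) (gr Ψ θ (W ε))
  let T : Set (Fin n → ℂ) := closedBall w' r ∩ {v | (v - W ε) ⬝ᵥ gr Ψ θ (W ε) = 0}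
  have hTc : IsCompact T := by
    refine (isCompact_closedBall w' r).inter_right ?_
    have : Continuous fun v : Fin n → ℂ => (v - W ε) ⬝ᵥ gr Ψ θ (W ε) := by unfold dotProduct; fun_prop
    exact isClosed_singleton.preimage this
  obtain ⟨w2, hw2, hmin⟩ := hTc.exists_isMinOn ⟨v0, by simpa [dist_eq_norm] using hE1.le, corr_mem hden⟩ (D.contw θ).continuousOn
  have hw2v : Ψ θ w2 ≤ Ψ θ v0 := hmin ⟨by simpa [dist_eq_norm] using hE1.le, corr_mem hden⟩
  have hw2r : ‖w2 - w'‖ < r := by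
    refine lt_of_le_of_ne (by simpa [dist_eq_norm] using hw2.1) fun h => ?_
    have := hbd w2 h hw2.2
    have := lt_min_iff.1 hE2
    linarith [this.1]
  have hW2 := hA w2 (hw2r.le.trans hrδ.le) hw2.2
  have hw2ne : w2 ≠ 0 := D.ne_of_pos (hw0.trans (hup.trans hW2))
  have hcr := D.crit (θ := θ) (g := gr Ψ θ (W ε)) hw2ne (fun d hd => by
    have hc : Tendsto (fun s : ℝ => ‖w2 + s • d - w'‖) (nhds 0) (nhds ‖w2 - w'‖) := by
      have : Continuous (fun s : ℝ => ‖w2 + s • d - w'‖) := by fun_prop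
      simpa using this.tendsto 0
    filter_upwards [hc.eventually (gt_mem_nhds hw2r)] with t ht2
    refine hmin ⟨by simpa [dist_eq_norm] using ht2.le, ?_⟩
    have h3 : (w2 - W ε) ⬝ᵥ gr Ψ θ (W ε) = 0 := hw2.2
    show (w2 + t • d - W ε) ⬝ᵥ gr Ψ θ (W ε) = 0
    rw [show w2 + t • d - W ε = (w2 - W ε) + t • d by abel, add_dotProduct, h3, smul_dotProduct, hd]; simp)
  refine hmax w2 (W ε) (hup.trans hW2) (hw2v.trans (lt_min_iff.1 hE2).2.le) hW2.le ?_ (hcr _ ?_)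
  · intro h; rw [h] at hW2; exact lt_irrefl _ hW2
  · have h3 : (w2 - W ε) ⬝ᵥ gr Ψ θ (W ε) = 0 := hw2.2
    rw [← neg_sub, neg_dotProduct, h3, neg_zero]

/-- Linear convexity of the sublevel sets. -/
lemma LC (D : Data n Ψ R) {θ : ℝ} {w w' : Fin n → ℂ} (hw0 : 0 < Ψ θ w) (hwR : Ψ θ w ≤ R)
    (hw' : Ψ θ w' ≤ Ψ θ w) (hne : w' ≠ w) : (w' - w) ⬝ᵥ gr Ψ θ w ≠ 0 := by
  intro ht
  set s0 := Ψ θ w with hs0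
  have hZc : IsCompact {x : Fin n → ℂ | s0 ≤ Ψ θ x ∧ Ψ θ x ≤ R} :=
    (isCompact_closedBall (0 : Fin n → ℂ) R).of_isClosed_subset
      ((isClosed_Ici.preimage (D.contw θ)).inter (isClosed_Iic.preimage (D.contw θ)))
      (fun x hx => by simpa using D.norm_le_R hx.2)
  obtain ⟨δ, hδ, k, hk, C, hC, hLT⟩ := D.LT (Z := {θ} ×ˢ {x : Fin n → ℂ | s0 ≤ Ψ θ x ∧ Ψ θ x ≤ R})
    (isCompact_singleton.prod hZc) (by
      rintro ⟨a, x⟩ ⟨h1, h2⟩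
      exact D.ne_of_pos (hw0.trans_le h2.1))
  have far : ∀ x y, s0 ≤ Ψ θ x → Ψ θ x ≤ R → Ψ θ y ≤ Ψ θ x → y ≠ x → (y - x) ⬝ᵥ gr Ψ θ x = 0 → δ ≤ ‖y - x‖ := by
    intro x y h1 h2 h3 h4 h5
    by_contra hcon
    push Not at hcon
    have := (hLT (θ, x) ⟨rfl, h1, h2⟩ (y - x) hcon).1
    simp only [h5, add_sub_cancel] at this
    have h6 : 0 < ‖y - x‖ := norm_pos_iff.2 (sub_ne_zero.2 h4)
    have h7 : 0 < k * ‖y - x‖ ^ 2 := by positivity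
    simp at this
    linarith
  let A : Set ((Fin n → ℂ) × (Fin n → ℂ)) := {p | (s0 ≤ Ψ θ p.1 ∧ Ψ θ p.1 ≤ R) ∧ Ψ θ p.2 ≤ Ψ θ p.1 ∧ δ ≤ ‖p.2 - p.1‖}
  have c1 : Continuous fun p : (Fin n → ℂ) × (Fin n → ℂ) => Ψ θ p.1 := (D.contw θ).comp continuous_fst
  have c2 : Continuous fun p : (Fin n → ℂ) × (Fin n → ℂ) => Ψ θ p.2 := (D.contw θ).comp continuous_snd
  have hAc : IsCompact A := by
    refine ((isCompact_closedBall (0 : Fin n → ℂ) R).prod (isCompact_closedBall (0 : Fin n → ℂ) R)).of_isClosed_subset ?_ ?_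
    · refine ((isClosed_le continuous_const c1).inter (isClosed_le c1 continuous_const)).inter
        ((isClosed_le c2 c1).inter (isClosed_le continuous_const (continuous_snd.sub continuous_fst).norm))
    · rintro p ⟨⟨h1, h2⟩, h3, h4⟩
      exact ⟨by simpa using D.norm_le_R h2, by simpa using D.norm_le_R (h3.trans h2)⟩
  have hgA : ContinuousOn (fun p : (Fin n → ℂ) × (Fin n → ℂ) => (p.2 - p.1) ⬝ᵥ gr Ψ θ p.1) A := by
    refine cont_dot (by fun_prop) ?_
    intro p hp
    have hp1 : p.1 ≠ 0 := D.ne_of_pos (hw0.trans_le hp.1.1)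
    exact ((D.gr_contAt (θ := θ) hp1).comp (f := Prod.fst) continuous_fst.continuousAt).continuousWithinAt
  have hBc : IsCompact (A ∩ (fun p : (Fin n → ℂ) × (Fin n → ℂ) => (p.2 - p.1) ⬝ᵥ gr Ψ θ p.1) ⁻¹' {0}) :=
    hAc.of_isClosed_subset (hgA.preimage_isClosed_of_isClosed hAc.isClosed isClosed_singleton) inter_subset_left
  obtain ⟨⟨x, x'⟩, ⟨⟨⟨h1, h2⟩, h3, h4⟩, h5⟩, hmax⟩ := hBc.exists_isMaxOn
    ⟨(w, w'), ⟨⟨le_rfl, hwR⟩, hw', far w w' le_rfl hwR hw' hne ht⟩, ht⟩ c1.continuousOn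
  simp only at h1 h2 h3 h4
  have h5' : (x' - x) ⬝ᵥ gr Ψ θ x = 0 := h5
  have hxne : x' ≠ x := by
    rintro rfl
    simp at h4; linarith
  rcases h2.lt_or_eq with h6 | h6
  · refine D.LC_step (hw0.trans_le h1) h6 h3 hxne h5' ?_
    intro a b ha haR hb hba hab
    have ha1 : s0 ≤ Ψ θ a := h1.trans ha.le
    have := hmax (a := (a, b)) ⟨⟨⟨ha1, haR⟩, hb, far a b ha1 haR hb hba hab⟩, hab⟩
    simp only [mem_ofPred_eq] at this
    linarith
  · exact D.LC_top h6 (h3.trans h2) hxne h5'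

end Data
end S17

namespace S17

variable {n : ℕ} {Ψ : ℝ → (Fin n → ℂ) → ℝ} {R : ℝ}

/-- `w · ∂Ψ` -/
def cc (Ψ : ℝ → (Fin n → ℂ) → ℝ) (θ : ℝ) (w : Fin n → ℂ) : ℂ := w ⬝ᵥ gr Ψ θ w

/-- normalized gradient -/
def nu (Ψ : ℝ → (Fin n → ℂ) → ℝ) (θ : ℝ) (w : Fin n → ℂ) : Fin n → ℂ := (cc Ψ θ w)⁻¹ • gr Ψ θ w

/-- the domain of smoothness of `nu` -/
def OK (Ψ : ℝ → (Fin n → ℂ) → ℝ) : Set (ℝ × (Fin n → ℂ)) := {p | p.2 ≠ 0 ∧ cc Ψ p.1 p.2 ≠ 0}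

lemma dot_cs (u v : Fin n → ℂ) : ‖u ⬝ᵥ v‖ ≤ euclNorm u * euclNorm v := by
  unfold dotProduct euclNorm
  refine (norm_sum_le _ _).trans ?_
  simp only [norm_mul, Complex.normSq_eq_norm_sq]
  exact Real.sum_mul_le_sqrt_mul_sqrt _ _ _

namespace Data

lemma cc_ne (D : Data n Ψ R) {θ : ℝ} {w : Fin n → ℂ} (h : 0 < Ψ θ w) (hR : Ψ θ w ≤ R) : cc Ψ θ w ≠ 0 := by
  have := D.LC (w' := 0) h hR (by rw [(D.zero θ 0).2 rfl]; exact h.le) (D.ne_of_pos h).symm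
  unfold cc
  simpa using this

lemma cc_contDiff (D : Data n Ψ R) : ContDiffOn ℝ 5 (fun p : ℝ × (Fin n → ℂ) => cc Ψ p.1 p.2) {p | p.2 ≠ 0} := by
  unfold cc dotProduct
  have h := D.grC
  rw [contDiffOn_pi] at h
  refine ContDiffOn.sum fun j _ => ContDiffOn.mul ?_ (h j)
  exact ((contDiff_apply ℝ ℂ j).comp contDiff_snd).contDiffOn

lemma OK_open (D : Data n Ψ R) : IsOpen (OK Ψ) := by
  have := D.cc_contDiff.continuousOn.isOpen_inter_preimage isOpen_ne (isOpen_compl_singleton (x := (0:ℂ)))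
  exact this

lemma nu_contDiff (D : Data n Ψ R) : ContDiffOn ℝ 5 (fun p : ℝ × (Fin n → ℂ) => nu Ψ p.1 p.2) (OK Ψ) := by
  have h1 : OK Ψ ⊆ {p | p.2 ≠ 0} := fun p hp => hp.1
  exact ((D.cc_contDiff.mono h1).inv fun p hp => hp.2).smul (D.grC.mono h1)

lemma mem_OK (D : Data n Ψ R) {θ : ℝ} {w : Fin n → ℂ} (h : 0 < Ψ θ w) (hR : Ψ θ w ≤ R) : (θ, w) ∈ OK Ψ :=
  ⟨D.ne_of_pos h, D.cc_ne h hR⟩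

lemma KS_OK (D : Data n Ψ R) {s : ℝ} (hs : 0 < s) : KS Ψ R s ⊆ OK Ψ :=
  fun p hp => D.mem_OK (θ := p.1) (w := p.2) (hs.trans_le hp.2.1) hp.2.2

lemma nu_cont (D : Data n Ψ R) : ContinuousOn (fun p : ℝ × (Fin n → ℂ) => nu Ψ p.1 p.2) (OK Ψ) :=
  D.nu_contDiff.continuousOn

end Data

lemma nu_dot_self {θ : ℝ} {w : Fin n → ℂ} (h : cc Ψ θ w ≠ 0) : nu Ψ θ w ⬝ᵥ w = 1 := by
  unfold nu
  rw [smul_dotProduct, dotProduct_comm]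
  exact inv_mul_cancel₀ h

lemma one_sub_nu {θ : ℝ} {w : Fin n → ℂ} (h : cc Ψ θ w ≠ 0) (w' : Fin n → ℂ) :
    1 - nu Ψ θ w ⬝ᵥ w' = - ((cc Ψ θ w)⁻¹ * ((w' - w) ⬝ᵥ gr Ψ θ w)) := by
  rw [← nu_dot_self h, ← dotProduct_sub]
  unfold nu
  rw [smul_dotProduct, dotProduct_comm, ← neg_sub w' w, neg_dotProduct, smul_eq_mul]
  ring

namespace Data

set_option maxHeartbeats 400000 in
/-- quantitative linear convexity -/
lemma Q1 (D : Data n Ψ R) {s : ℝ} (hs : 0 < s) : ∃ k > (0:ℝ), ∀ p ∈ KS Ψ R s, ∀ w' : Fin n → ℂ,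
    Ψ p.1 w' ≤ Ψ p.1 p.2 → k * (Ψ p.1 p.2 - Ψ p.1 w') ≤ ‖1 - nu Ψ p.1 p.2 ⬝ᵥ w'‖ := by
  have hRpos : 0 < R := by linarith [D.hR]
  obtain ⟨δ, hδ, k, hk, C, hC, hLT⟩ := D.LT (D.KS_compact s) (D.KS_ne hs)
  obtain ⟨M, hM, hMb⟩ := compact_bound (D.KS_compact s) (D.cc_contDiff.continuousOn.mono (D.KS_ne hs))
  obtain ⟨N, hN, hNb⟩ := compact_bound (D.KS_compact s) (D.gr_cont.mono (D.KS_ne hs))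
  let A : Set ((ℝ × (Fin n → ℂ)) × (Fin n → ℂ)) := (KS Ψ R s ×ˢ closedBall (0 : Fin n → ℂ) R) ∩
    {q | Ψ q.1.1 q.2 ≤ Ψ q.1.1 q.1.2 ∧ δ ≤ ‖q.2 - q.1.2‖}
  have hA : IsCompact A := by
    refine ((D.KS_compact s).prod (isCompact_closedBall _ _)).inter_right ?_
    have hcl : IsClosed {q : (ℝ × (Fin n → ℂ)) × (Fin n → ℂ) | δ ≤ ‖q.2 - q.1.2‖} :=
      isClosed_le continuous_const (by fun_prop)
    have e1 : Continuous fun q : (ℝ × (Fin n → ℂ)) × (Fin n → ℂ) => Ψ q.1.1 q.2 :=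
      D.cont.comp (f := fun q : (ℝ × (Fin n → ℂ)) × (Fin n → ℂ) => (q.1.1, q.2)) (by fun_prop)
    have e2 : Continuous fun q : (ℝ × (Fin n → ℂ)) × (Fin n → ℂ) => Ψ q.1.1 q.1.2 :=
      D.cont.comp (f := fun q : (ℝ × (Fin n → ℂ)) × (Fin n → ℂ) => q.1) (by fun_prop)
    exact (isClosed_le e1 e2).inter hcl
  obtain ⟨c, hc, hcb⟩ := compact_lower hA (q := fun q => ‖(q.2 - q.1.2) ⬝ᵥ gr Ψ q.1.1 q.1.2‖)
    (by
      refine (cont_dot (by fun_prop) ?_).norm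
      exact (D.gr_cont.mono (D.KS_ne hs)).comp continuousOn_fst fun q hq => hq.1.1)
    (by
      rintro ⟨⟨θ, w⟩, w'⟩ ⟨⟨h1, h2⟩, h3, h4⟩
      simp only at h3 h4
      refine norm_pos_iff.2 (D.LC (hs.trans_le h1.2.1) h1.2.2 h3 ?_)
      intro h5
      simp only [] at h5
      rw [h5] at h4
      simp at h4; linarith)
  -- main estimate
  have main : ∃ K > (0:ℝ), ∀ p ∈ KS Ψ R s, ∀ w' : Fin n → ℂ,
    Ψ p.1 w' ≤ Ψ p.1 p.2 → Ψ p.1 p.2 - Ψ p.1 w' ≤ K * ‖(w' - p.2) ⬝ᵥ gr Ψ p.1 p.2‖ := by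
    refine ⟨(2 + C * (n * δ * N)) + R / c, by positivity, ?_⟩
    rintro ⟨θ, w⟩ hp w' hw'
    have hx0 := norm_nonneg ((w' - w) ⬝ᵥ gr Ψ θ w)
    simp only at hw' ⊢
    by_cases hd : ‖w' - w‖ < δ
    · have h1 := (hLT (θ, w) hp (w' - w) hd).1
      simp only [add_sub_cancel] at h1
      have h2 : ‖(w' - w) ⬝ᵥ gr Ψ θ w‖ ≤ n * δ * N := by
        refine (dot_norm_le _ _).trans ?_
        have := hNb (θ, w) hp
        gcongr
      have h3 := (abs_le.1 (Complex.abs_re_le_norm ((w' - w) ⬝ᵥ gr Ψ θ w))).1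
      have h4 : 0 ≤ k * ‖w' - w‖ ^ 2 := by positivity
      have h5 : C * ‖(w' - w) ⬝ᵥ gr Ψ θ w‖ ^ 2 ≤ C * (n * δ * N) * ‖(w' - w) ⬝ᵥ gr Ψ θ w‖ := by
        rw [pow_two, mul_assoc]
        gcongr
      have h6 : 0 ≤ R / c * ‖(w' - w) ⬝ᵥ gr Ψ θ w‖ := by positivity
      nlinarith
    · push Not at hd
      have h1 := hcb ((θ, w), w') ⟨⟨hp, by simpa using D.norm_le_R (hw'.trans hp.2.2)⟩, hw', hd⟩
      simp only at h1
      have h2 : R ≤ R / c * ‖(w' - w) ⬝ᵥ gr Ψ θ w‖ := by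
        rw [div_mul_eq_mul_div, le_div_iff₀ hc]
        gcongr
      have h3 : Ψ θ w ≤ R := hp.2.2
      have h4 := D.nonneg θ w'
      have h5 : 0 ≤ (2 + C * (n * δ * N)) * ‖(w' - w) ⬝ᵥ gr Ψ θ w‖ := by positivity
      nlinarith
  obtain ⟨K, hK, hmain⟩ := main
  refine ⟨(K * M)⁻¹, by positivity, ?_⟩
  rintro ⟨θ, w⟩ hp w' hw'
  have h1 := hmain (θ, w) hp w' hw'
  have hcc := D.cc_ne (hs.trans_le hp.2.1) hp.2.2
  have h2 : ‖cc Ψ θ w‖ ≤ M := hMb (θ, w) hp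
  simp only at h1 hcc ⊢
  rw [one_sub_nu hcc, norm_neg, norm_mul, norm_inv, inv_mul_le_iff₀ (by positivity)]
  have h3 : 0 < ‖cc Ψ θ w‖ := norm_pos_iff.2 hcc
  calc _ ≤ K * ‖(w' - w) ⬝ᵥ gr Ψ θ w‖ := h1
    _ = K * ‖cc Ψ θ w‖ * (‖cc Ψ θ w‖⁻¹ * ‖(w' - w) ⬝ᵥ gr Ψ θ w‖) := by field_simp
    _ ≤ _ := by gcongr

lemma nu_top (D : Data n Ψ R) {θ : ℝ} {w : Fin n → ℂ} (h : Ψ θ w = R) :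
    nu Ψ θ w = ((R : ℂ) ^ 2)⁻¹ • star w := by
  have hRpos : 0 < R := by linarith [D.hR]
  have hwR := (D.levelR θ w).1 h
  have hcc := D.cc_ne (θ := θ) (w := w) (by linarith) h.le
  have hw2 : w ⬝ᵥ star w = (R : ℂ) ^ 2 := by rw [dot_star_self, hwR]; push_cast; rfl
  have hR2 : (R : ℂ) ^ 2 ≠ 0 := by exact_mod_cast (pow_pos hRpos 2).ne'
  have key : ∀ d : Fin n → ℂ, d ⬝ᵥ nu Ψ θ w = d ⬝ᵥ (((R : ℂ) ^ 2)⁻¹ • star w) := by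
    intro d
    have h1 : (d - ((d ⬝ᵥ star w) * ((R : ℂ) ^ 2)⁻¹) • w) ⬝ᵥ star w = 0 := by
      rw [sub_dotProduct, smul_dotProduct, hw2, smul_eq_mul]
      rw [mul_assoc, inv_mul_cancel₀ hR2]; ring
    have h2 := D.top_par h _ h1
    rw [sub_dotProduct, smul_dotProduct, smul_eq_mul] at h2
    have h3 : d ⬝ᵥ gr Ψ θ w = d ⬝ᵥ star w * ((R : ℂ) ^ 2)⁻¹ * cc Ψ θ w := by
      unfold cc; linear_combination h2
    unfold nu
    rw [dotProduct_smul, h3, dotProduct_smul, smul_eq_mul, smul_eq_mul]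
    field_simp
  funext j
  have := key (Pi.single j 1)
  simpa using this

lemma Ltheta (D : Data n Ψ R) {a : ℝ} (ha : 0 < a) : ∃ C > (0:ℝ), ∀ θ ∈ Icc (-10:ℝ) 10, ∀ θ' ∈ Icc (-10:ℝ) 10,
    ∀ w : Fin n → ℂ, euclNorm w ≤ R → Ψ θ' w ≤ max (Ψ θ w) a + C * |θ' - θ| := by
  obtain ⟨r, hr, hrb⟩ := compact_lower (D.KS_compact a) (q := fun p => ‖p.2‖) (by fun_prop)
    (fun p hp => norm_pos_iff.2 (D.KS_ne ha hp))
  let Z : Set (ℝ × (Fin n → ℂ)) := (Icc (-10:ℝ) 10 ×ˢ closedBall (0 : Fin n → ℂ) R) ∩ {p | r ≤ ‖p.2‖}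
  have hZ : IsCompact Z := (isCompact_Icc.prod (isCompact_closedBall _ _)).inter_right
    (isClosed_le continuous_const (by fun_prop))
  have hZ0 : Z ⊆ {p | p.2 ≠ 0} := fun p hp => norm_pos_iff.1 (hr.trans_le hp.2)
  obtain ⟨C, hC, hCb⟩ := compact_bound hZ ((D.smooth.continuousOn_fderiv_of_isOpen isOpen_ne (by norm_num)).mono hZ0)
  refine ⟨C, hC, fun θ hθ θ' hθ' w hw => ?_⟩
  have hpos : 0 ≤ C * |θ' - θ| := by positivity
  by_cases h : Ψ θ' w ≤ a
  · linarith [le_max_right (Ψ θ w) a]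
  · push Not at h
    have hwr : r ≤ ‖w‖ := hrb (θ', w) ⟨hθ', h.le, D.le_R hw⟩
    have hw0 : w ≠ 0 := norm_pos_iff.1 (hr.trans_le hwr)
    have hd : ∀ x ∈ Icc (-10:ℝ) 10, HasDerivWithinAt (fun x => Ψ x w)
        (fderiv ℝ (fun p : ℝ × (Fin n → ℂ) => Ψ p.1 p.2) (x, w) (1, 0)) (Icc (-10:ℝ) 10) x := by
      intro x hx
      have h1 : HasDerivAt (fun x : ℝ => (x, w)) ((1:ℝ), (0 : Fin n → ℂ)) x := by
        exact (hasDerivAt_id x).prodMk (hasDerivAt_const x w)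
      exact (HasFDerivAt.comp_hasDerivAt x (D.diffAt (θ := x) hw0).hasFDerivAt h1).hasDerivWithinAt
    have hb : ∀ x ∈ Icc (-10:ℝ) 10, ‖fderiv ℝ (fun p : ℝ × (Fin n → ℂ) => Ψ p.1 p.2) (x, w) (1, 0)‖ ≤ C := by
      intro x hx
      refine (ContinuousLinearMap.le_opNorm _ _).trans ?_
      have h1 : ‖((1:ℝ), (0 : Fin n → ℂ))‖ = 1 := by simp [Prod.norm_def]
      rw [h1, mul_one]
      exact hCb (x, w) ⟨⟨hx, by simpa using (norm_le_eucl w).trans hw⟩, hwr⟩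
    have := (convex_Icc (-10:ℝ) 10).norm_image_sub_le_of_norm_hasDerivWithin_le hd hb hθ hθ'
    rw [Real.norm_eq_abs, Real.norm_eq_abs] at this
    have h2 := le_abs_self (Ψ θ' w - Ψ θ w)
    linarith [le_max_left (Ψ θ w) a]

/-- bounds of the gradient on `KS` -/
lemma gr_bounds (D : Data n Ψ R) {s : ℝ} (hs : 0 < s) : ∃ m > (0:ℝ), ∃ M > (0:ℝ), ∀ p ∈ KS Ψ R s,
    m ≤ euclNorm (gr Ψ p.1 p.2) ^ 2 ∧ euclNorm (gr Ψ p.1 p.2) ≤ M := by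
  have hc := eucl_cont.comp_continuousOn (D.gr_cont.mono (D.KS_ne hs))
  obtain ⟨m, hm, hmb⟩ := compact_lower (D.KS_compact s) (hc.pow 2) (fun p hp => by
    have h0 := D.grad p.1 p.2 (hs.trans_le hp.2.1) hp.2.2
    have : euclNorm (gr Ψ p.1 p.2) ≠ 0 := fun h => h0 (eucl_eq_zero.1 h)
    have := eucl_nonneg (gr Ψ p.1 p.2)
    change 0 < euclNorm (gr Ψ p.1 p.2) ^ 2
    positivity)
  obtain ⟨M, hM, hMb⟩ := compact_bound (D.KS_compact s) hc
  exact ⟨m, hm, M, hM, fun p hp => ⟨hmb p hp, (le_abs_self _).trans (hMb p hp)⟩⟩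

lemma eucl_star (g : Fin n → ℂ) : euclNorm (star g) = euclNorm g := by simp [euclNorm]

/-- descent and ascent -/
lemma DeAs (D : Data n Ψ R) {s : ℝ} (hs : 0 < s) : ∃ C > (0:ℝ), ∃ η0 > (0:ℝ), ∀ p ∈ KS Ψ R s, ∀ η, 0 ≤ η → η ≤ η0 →
    (∃ w', ‖w' - p.2‖ ≤ C * η ∧ Ψ p.1 w' ≤ Ψ p.1 p.2 - η) ∧
    (∃ w', ‖w' - p.2‖ ≤ C * η ∧ Ψ p.1 w' = Ψ p.1 p.2 + η) := by
  obtain ⟨δ, hδ, k, hk, C, hC, hLT⟩ := D.LT (D.KS_compact s) (D.KS_ne hs)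
  obtain ⟨m, hm, M, hM, hb⟩ := D.gr_bounds hs
  refine ⟨M / m, by positivity, min (m * (δ / (2 * M))) (m * min (1 / C) (1 / (C * M ^ 2))), by positivity, ?_⟩
  rintro ⟨θ, w⟩ hp η h0 hη
  obtain ⟨hb1, hb2⟩ := hb (θ, w) hp
  simp only at hb1 hb2 ⊢
  set g := gr Ψ θ w with hg
  set e := euclNorm g with he
  have he0 : 0 ≤ e := eucl_nonneg g
  have hstar : star g ⬝ᵥ g = ((e ^ 2 : ℝ) : ℂ) := by rw [dotProduct_comm, dot_star_self]
  have hτ : ∀ τ : ℝ, 0 ≤ τ → τ ≤ η / m → τ ≤ δ / (2 * M) ∧ τ * C ≤ 1 ∧ τ * (C * M ^ 2) ≤ 1 := by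
    intro τ h1 h2
    have h3 : τ * m ≤ η := (le_div_iff₀ hm).1 h2
    have h4 := h3.trans hη
    have h5 := h4.trans (min_le_left _ _)
    have h6 := h4.trans (min_le_right _ _)
    rw [mul_comm] at h5 h6
    have h7 := le_of_mul_le_mul_left h5 hm
    have h8 := le_of_mul_le_mul_left h6 hm
    exact ⟨h7, (le_div_iff₀ (by positivity)).1 (h8.trans (min_le_left _ _)),
      (le_div_iff₀ (by positivity)).1 (h8.trans (min_le_right _ _))⟩
  have hn : ∀ τ : ℝ, ‖τ • star g‖ ≤ |τ| * e := by
    intro τ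
    rw [norm_smul, Real.norm_eq_abs]
    have := norm_le_eucl (star g)
    rw [eucl_star] at this
    gcongr
  have hsm : ∀ τ : ℝ, |τ| ≤ η / m → ‖τ • star g‖ < δ := by
    intro τ h1
    have h2 := (hτ |τ| (abs_nonneg _) h1).1
    calc ‖τ • star g‖ ≤ |τ| * e := hn τ
      _ ≤ δ / (2 * M) * M := by gcongr
      _ = δ / 2 := by field_simp
      _ < δ := by linarith
  have hnorm : ∀ τ : ℝ, |τ| ≤ η / m → ‖(w + τ • star g) - w‖ ≤ M / m * η := by
    intro τ h1
    rw [add_sub_cancel_left]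
    calc ‖τ • star g‖ ≤ |τ| * e := hn τ
      _ ≤ η / m * M := by gcongr
      _ = _ := by ring
  have hdot : ∀ τ : ℝ, (τ • star g) ⬝ᵥ g = ((τ * e ^ 2 : ℝ) : ℂ) := by
    intro τ
    rw [smul_dotProduct, hstar]; push_cast; simp
  have hmη : η / m * m = η := div_mul_cancel₀ _ hm.ne'
  have hq0 : 0 ≤ η / m := by positivity
  have habs : |η / m| = η / m := abs_of_nonneg hq0
  obtain ⟨-, t2, t3⟩ := hτ (η / m) hq0 le_rfl
  constructor
  · refine ⟨w + (-(η / m)) • star g, hnorm _ (by rw [abs_neg, habs]), ?_⟩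
    have h1 := (hLT (θ, w) hp ((-(η / m)) • star g) (hsm _ (by rw [abs_neg, habs]))).2.1
    simp only at h1
    rw [← hg, hdot, Complex.ofReal_re] at h1
    have h2 : ‖(-(η / m)) • star g‖ ^ 2 ≤ (η / m * e) ^ 2 := by
      have := hn (-(η / m))
      rw [abs_neg, habs] at this
      exact pow_le_pow_left₀ (norm_nonneg _) this 2
    have h3 : C * ‖(-(η / m)) • star g‖ ^ 2 ≤ C * (η / m * e) ^ 2 := by gcongr
    have h4 : C * (η / m * e) ^ 2 ≤ η / m * e ^ 2 := by
      have : (η / m * C) * (η / m * e ^ 2) ≤ 1 * (η / m * e ^ 2) := by gcongr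
      linarith
    have h5 : η / m * m ≤ η / m * e ^ 2 := by gcongr
    linarith
  · have h1 := (hLT (θ, w) hp ((η / m) • star g) (hsm _ (by rw [habs]))).1
    simp only at h1
    rw [← hg, hdot, Complex.ofReal_re, Complex.norm_real, Real.norm_eq_abs, sq_abs] at h1
    have h2 : C * (η / m * e ^ 2) ^ 2 ≤ η / m * e ^ 2 := by
      have : (η / m * (C * e ^ 2)) * (η / m * e ^ 2) ≤ 1 * (η / m * e ^ 2) := by
        gcongr
        refine le_trans ?_ t3
        gcongr
      linarith
    have h5 : η / m * m ≤ η / m * e ^ 2 := by gcongr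
    have h6 : 0 ≤ k * ‖(η / m) • star g‖ ^ 2 := by positivity
    have hc : Continuous (fun τ : ℝ => Ψ θ (w + τ • star g)) := (D.contw θ).comp (by fun_prop)
    obtain ⟨τ, ht, hτ2⟩ := intermediate_value_Icc (f := fun τ : ℝ => Ψ θ (w + τ • star g)) hq0 hc.continuousOn
      (show Ψ θ w + η ∈ _ from ⟨by simp [h0], by linarith⟩)
    exact ⟨w + τ • star g, hnorm τ (by rw [abs_of_nonneg ht.1]; exact ht.2), hτ2⟩

lemma nu_lip (D : Data n Ψ R) {s : ℝ} (hs : 0 < s) : ∃ C > (0:ℝ), ∀ p ∈ KS Ψ R s, ∀ q ∈ KS Ψ R s,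
    ‖nu Ψ p.1 p.2 - nu Ψ q.1 q.2‖ ≤ C * ‖p - q‖ := by
  have h1 : LocallyLipschitzOn (KS Ψ R s) (fun p : ℝ × (Fin n → ℂ) => nu Ψ p.1 p.2) := by
    intro p hp
    have hc : ContDiffAt ℝ 1 (fun p : ℝ × (Fin n → ℂ) => nu Ψ p.1 p.2) p :=
      (D.nu_contDiff.contDiffAt (D.OK_open.mem_nhds (D.KS_OK hs hp))).of_le (by norm_num)
    obtain ⟨K, t, ht, hl⟩ := hc.exists_lipschitzOnWith
    exact ⟨K, t, mem_nhdsWithin_of_mem_nhds ht, hl⟩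
  obtain ⟨K, hK⟩ := h1.exists_lipschitzOnWith_of_compact (D.KS_compact s)
  refine ⟨K + 1, by positivity, fun p hp q hq => ?_⟩
  have := hK.dist_le_mul p hp q hq
  rw [dist_eq_norm, dist_eq_norm] at this
  nlinarith [norm_nonneg (p - q)]

end Data
end S17

namespace S17

variable {n : ℕ} {Ψ : ℝ → (Fin n → ℂ) → ℝ} {R : ℝ}

/-- the parameter interval of the circle -/
def TI : Set ℝ := Icc (0:ℝ) (2 * Real.pi)

lemma TI_sub : TI ⊆ Icc (-10:ℝ) 10 := by
  intro x hx
  have := Real.pi_lt_four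
  have h3 := Real.pi_lt_d2
  exact ⟨by linarith [hx.1], by linarith [hx.2]⟩

lemma TI_compact : IsCompact TI := isCompact_Icc

lemma zero_mem_TI : (0:ℝ) ∈ TI := ⟨le_rfl, by positivity⟩
lemma twopi_mem_TI : (2 * Real.pi) ∈ TI := ⟨by positivity, le_rfl⟩

/-- continuous loops -/
structure Loop {F : Type*} [TopologicalSpace F] (u : ℝ → F) : Prop where
  cont : ContinuousOn u TI
  ends : u 0 = u (2 * Real.pi)

/-- existence of a continuous logarithm -/
def HasLog (u : ℝ → ℂ) : Prop := ∃ L : ℝ → ℂ, Loop L ∧ ∀ θ ∈ TI, u θ = Complex.exp (L θ)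

lemma HasLog.mul {u v : ℝ → ℂ} (hu : HasLog u) (hv : HasLog v) : HasLog (fun θ => u θ * v θ) := by
  obtain ⟨L, hL, h1⟩ := hu
  obtain ⟨L', hL', h2⟩ := hv
  refine ⟨fun θ => L θ + L' θ, ⟨hL.cont.add hL'.cont, ?_⟩, fun θ hθ => ?_⟩
  · simp only [hL.ends, hL'.ends]
  · rw [Complex.exp_add, ← h1 θ hθ, ← h2 θ hθ]

lemma HasLog.inv {u : ℝ → ℂ} (hu : HasLog u) : HasLog (fun θ => (u θ)⁻¹) := by
  obtain ⟨L, hL, h1⟩ := hu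
  refine ⟨fun θ => - L θ, ⟨hL.cont.neg, ?_⟩, fun θ hθ => ?_⟩
  · simp only [hL.ends]
  · rw [Complex.exp_neg, ← h1 θ hθ]

lemma HasLog.congr {u v : ℝ → ℂ} (hu : HasLog u) (h : ∀ θ ∈ TI, v θ = u θ) : HasLog v := by
  obtain ⟨L, hL, h1⟩ := hu
  exact ⟨L, hL, fun θ hθ => (h θ hθ).trans (h1 θ hθ)⟩

lemma HasLog.of_slit {u : ℝ → ℂ} (hu : Loop u) (h : ∀ θ ∈ TI, u θ ∈ Complex.slitPlane) : HasLog u := by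
  refine ⟨fun θ => Complex.log (u θ), ⟨hu.cont.clog h, by simp only [hu.ends]⟩, fun θ hθ => ?_⟩
  rw [Complex.exp_log (Complex.slitPlane_ne_zero (h θ hθ))]

lemma HasLog.of_near {u v : ℝ → ℂ} (hu : Loop u) (hv : Loop v) (hv0 : ∀ θ ∈ TI, v θ ≠ 0) (hl : HasLog v)
    (h : ∀ θ ∈ TI, ‖u θ - v θ‖ < ‖v θ‖) : HasLog u := by
  have h1 : HasLog (fun θ => u θ / v θ) := by
    refine HasLog.of_slit ⟨hu.cont.div hv.cont hv0, by simp only [hu.ends, hv.ends]⟩ fun θ hθ => ?_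
    refine Complex.ball_one_subset_slitPlane ?_
    rw [mem_ball, dist_eq_norm]
    have h0 := hv0 θ hθ
    rw [show u θ / v θ - 1 = (u θ - v θ) / v θ by field_simp, norm_div, div_lt_one (norm_pos_iff.2 h0)]
    exact h θ hθ
  refine (h1.mul hl).congr fun θ hθ => ?_
  rw [div_mul_cancel₀ _ (hv0 θ hθ)]

namespace Data

lemma per0 (D : Data n Ψ R) : Ψ (2 * Real.pi) = Ψ 0 := by
  funext w
  have := D.per 0 w
  rwa [zero_add] at this

lemma gr_per0 (D : Data n Ψ R) : gr Ψ (2 * Real.pi) = gr Ψ 0 := by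
  unfold gr; rw [D.per0]

lemma nu_per0 (D : Data n Ψ R) : nu Ψ (2 * Real.pi) = nu Ψ 0 := by
  unfold nu cc; rw [D.gr_per0]

lemma cc_per0 (D : Data n Ψ R) : cc Ψ (2 * Real.pi) = cc Ψ 0 := by
  unfold cc; rw [D.gr_per0]

lemma comp_contOn {F : Type*} [TopologicalSpace F] {φ : ℝ → (Fin n → ℂ) → F} {U : Set (ℝ × (Fin n → ℂ))}
    (h : ContinuousOn (fun p : ℝ × (Fin n → ℂ) => φ p.1 p.2) U) {f : ℝ → Fin n → ℂ} {s : Set ℝ} (hf : ContinuousOn f s)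
    (hU : ∀ θ ∈ s, (θ, f θ) ∈ U) : ContinuousOn (fun θ => φ θ (f θ)) s :=
  h.comp (f := fun θ => (θ, f θ)) (continuousOn_id.prodMk hf) hU

lemma Psi_contOn (D : Data n Ψ R) {f : ℝ → Fin n → ℂ} {s : Set ℝ} (hf : ContinuousOn f s) :
    ContinuousOn (fun θ => Ψ θ (f θ)) s :=
  comp_contOn D.cont.continuousOn hf (U := univ) fun _ _ => mem_univ _

lemma nu_loop (D : Data n Ψ R) {f : ℝ → Fin n → ℂ} (hf : Loop f) (h0 : ∀ θ ∈ TI, 0 < Ψ θ (f θ))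
    (hR : ∀ θ ∈ TI, Ψ θ (f θ) ≤ R) : Loop (fun θ => nu Ψ θ (f θ)) :=
  ⟨comp_contOn D.nu_cont hf.cont fun θ hθ => D.mem_OK (h0 θ hθ) (hR θ hθ), by
    simp only [← hf.ends, D.nu_per0]⟩

end Data

lemma Loop.dot {f g : ℝ → Fin n → ℂ} (hf : Loop f) (hg : Loop g) : Loop (fun θ => f θ ⬝ᵥ g θ) :=
  ⟨cont_dot hf.cont hg.cont, by simp only [hf.ends, hg.ends]⟩

lemma Loop.one_sub {u : ℝ → ℂ} (hu : Loop u) : Loop (fun θ => 1 - u θ) :=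
  ⟨continuousOn_const.sub hu.cont, by simp only [hu.ends]⟩

namespace Data

/-- Euler descent step -/
def step (Ψ : ℝ → (Fin n → ℂ) → ℝ) (s ε : ℝ) (θ : ℝ) (w : Fin n → ℂ) : Fin n → ℂ :=
  w - (ε * max (Ψ θ w - s) 0) • star (gr Ψ θ w)

lemma step_loop (D : Data n Ψ R) {s ε : ℝ} (hs : 0 < s) {h : ℝ → Fin n → ℂ} (hh : Loop h) :
    Loop (fun θ => step Ψ s ε θ (h θ)) := by
  refine ⟨?_, by simp only [step, ← hh.ends, D.gr_per0, D.per0]⟩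
  have hΨ : ContinuousOn (fun θ => Ψ θ (h θ)) TI := D.Psi_contOn hh.cont
  intro θ hθ
  by_cases h0 : h θ = 0
  · have h1 : Ψ θ (h θ) < s := by rw [(D.zero θ (h θ)).2 h0]; exact hs
    have h2 : ∀ᶠ x in nhdsWithin θ TI, Ψ x (h x) < s := (hΨ θ hθ).eventually_lt_const h1
    have key : ∀ x, Ψ x (h x) < s → step Ψ s ε x (h x) = h x := by
      intro x hx
      unfold step
      rw [max_eq_right (by linarith)]; simp
    refine (hh.cont θ hθ).congr_of_eventuallyEq ?_ (key θ h1)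
    filter_upwards [h2] with x hx using key x hx
  · have h1 : ContinuousWithinAt (fun x => gr Ψ x (h x)) TI θ := by
      have := (D.grC.contDiffAt (isOpen_ne.mem_nhds (x := (θ, h θ)) h0)).continuousAt
      exact ContinuousAt.comp_continuousWithinAt (f := fun x => (x, h x)) (g := fun p : ℝ × (Fin n → ℂ) => gr Ψ p.1 p.2) this
        (continuousWithinAt_id.prodMk (hh.cont θ hθ))
    have h2 : ContinuousWithinAt (fun x => ε * max (Ψ x (h x) - s) 0) TI θ :=
      continuousWithinAt_const.mul (((hΨ θ hθ).sub continuousWithinAt_const).max continuousWithinAt_const)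
    have h3 : ContinuousWithinAt (fun x => (ε * max (Ψ x (h x) - s) 0) • star (gr Ψ x (h x))) TI θ := h2.smul h1.star
    exact (hh.cont θ hθ).sub h3

/-- The effect of one step. -/
lemma step_est (D : Data n Ψ R) {s : ℝ} (hs : 0 < s) : ∃ ε0 > (0:ℝ), ∃ m > (0:ℝ), ∃ M > (0:ℝ), ε0 * m ≤ 1 ∧
    ∀ ε, 0 < ε → ε ≤ ε0 → ∀ θ ∈ TI, ∀ w : Fin n → ℂ, Ψ θ w ≤ R →
      Ψ θ (step Ψ s ε θ w) ≤ Ψ θ w ∧ max (Ψ θ (step Ψ s ε θ w) - s) 0 ≤ (1 - ε * m) * max (Ψ θ w - s) 0 ∧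
      ‖step Ψ s ε θ w - w‖ ≤ ε * M := by
  have hRpos : 0 < R := by linarith [D.hR]
  obtain ⟨δ, hδ, k, hk, C, hC, hLT⟩ := D.LT (D.KS_compact s) (D.KS_ne hs)
  obtain ⟨m, hm, M, hM, hb⟩ := D.gr_bounds hs
  refine ⟨min (1 / m) (min (δ / (2 * R * M)) (1 / (C * R))), by positivity, m, hm, R * M, by positivity, ?_, ?_⟩
  · rw [← le_div_iff₀ hm]; exact min_le_left _ _
  intro ε hε hε0 θ hθ w hw
  have e1 : ε * m ≤ 1 := by rw [← le_div_iff₀ hm]; exact hε0.trans (min_le_left _ _)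
  have e2 : ε ≤ δ / (2 * R * M) := hε0.trans ((min_le_right _ _).trans (min_le_left _ _))
  have e3 : ε * (C * R) ≤ 1 := by
    rw [← le_div_iff₀ (by positivity)]; exact hε0.trans ((min_le_right _ _).trans (min_le_right _ _))
  by_cases h : Ψ θ w ≤ s
  · have : step Ψ s ε θ w = w := by unfold step; rw [max_eq_right (by linarith)]; simp
    rw [this]
    refine ⟨le_rfl, ?_, by simp; positivity⟩
    rw [max_eq_right (by linarith)]; simp
  · push Not at h
    have hp : (θ, w) ∈ KS Ψ R s := ⟨TI_sub hθ, h.le, hw⟩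
    obtain ⟨hb1, hb2⟩ := hb (θ, w) hp
    simp only at hb1 hb2
    set g := gr Ψ θ w with hg
    set e := euclNorm g with he
    set a := Ψ θ w - s with ha
    have ha0 : 0 < a := by linarith
    have haR : a ≤ R := by linarith
    have he0 : 0 ≤ e := eucl_nonneg g
    have hmax : max (Ψ θ w - s) 0 = a := max_eq_left ha0.le
    have hst : step Ψ s ε θ w = w + (-(ε * a)) • star g := by
      unfold step; rw [hmax, neg_smul, sub_eq_add_neg]
    have hn : ‖(-(ε * a)) • star g‖ ≤ ε * a * e := by
      rw [norm_smul, norm_neg, Real.norm_of_nonneg (by positivity)]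
      have := norm_le_eucl (star g)
      rw [eucl_star] at this
      gcongr
    have hn2 : ‖(-(ε * a)) • star g‖ ≤ ε * (R * M) := by
      refine hn.trans ?_
      rw [mul_assoc]; gcongr
    have hnd : ‖(-(ε * a)) • star g‖ < δ := by
      calc _ ≤ ε * (R * M) := hn2
        _ ≤ δ / (2 * R * M) * (R * M) := by gcongr
        _ = δ / 2 := by field_simp
        _ < δ := by linarith
    have h1 := (hLT (θ, w) hp _ hnd).2.1
    simp only at h1
    have hdot : ((-(ε * a)) • star g) ⬝ᵥ g = ((-(ε * a) * e ^ 2 : ℝ) : ℂ) := by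
      rw [smul_dotProduct, dotProduct_comm, dot_star_self]; push_cast; simp [← he]
    rw [← hst, ← hg, hdot, Complex.ofReal_re] at h1
    have h2 : C * ‖(-(ε * a)) • star g‖ ^ 2 ≤ ε * a * e ^ 2 := by
      calc C * ‖(-(ε * a)) • star g‖ ^ 2 ≤ C * (ε * a * e) ^ 2 := by gcongr
        _ = (ε * (C * a)) * (ε * a * e ^ 2) := by ring
        _ ≤ 1 * (ε * a * e ^ 2) := by
          gcongr
          exact le_trans (by gcongr) e3
        _ = _ := one_mul _
    have h3 : ε * a * m ≤ ε * a * e ^ 2 := by gcongr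
    have h4 : 0 ≤ ε * a * m := by positivity
    refine ⟨by linarith, ?_, by rw [hst, add_sub_cancel_left]; exact hn2⟩
    rw [hmax]
    refine max_le (by linarith) ?_
    exact mul_nonneg (by linarith) ha0.le

/-- Existence of logarithms of `1 - g·h`. -/
lemma HL (D : Data n Ψ R) {t : ℝ} (ht : 0 < t) (htR : t ≤ R) {f h : ℝ → Fin n → ℂ} (hf : Loop f) (hh : Loop h)
    (hft : ∀ θ ∈ TI, Ψ θ (f θ) = t) (hht : ∀ θ ∈ TI, Ψ θ (h θ) < t) :
    HasLog (fun θ => 1 - nu Ψ θ (f θ) ⬝ᵥ h θ) := by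
  have hRpos : 0 < R := by linarith [D.hR]
  have hgl := D.nu_loop hf (fun θ hθ => by rw [hft θ hθ]; exact ht) (fun θ hθ => by rw [hft θ hθ]; exact htR)
  obtain ⟨N, hN, hNb⟩ := compact_bound TI_compact hgl.cont
  obtain ⟨kq, hkq, hQ⟩ := D.Q1 ht
  obtain ⟨γ, hγ, hγb⟩ := compact_lower TI_compact (continuousOn_const.sub (D.Psi_contOn hh.cont))
    (fun θ hθ => sub_pos.2 (hht θ hθ))
  -- small level
  obtain ⟨s, hs, hsb⟩ : ∃ s > (0:ℝ), ∀ θ ∈ TI, ∀ w : Fin n → ℂ, Ψ θ w ≤ R → Ψ θ w ≤ 2 * s → n * N * ‖w‖ ≤ 1 / 2 := by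
    have hZ : IsCompact ((TI ×ˢ closedBall (0 : Fin n → ℂ) R) ∩ {p | 1 / 2 ≤ n * N * ‖p.2‖}) :=
      (TI_compact.prod (isCompact_closedBall _ _)).inter_right (isClosed_le continuous_const (by fun_prop))
    obtain ⟨c, hc, hcb⟩ := compact_lower hZ D.cont.continuousOn (fun p hp => by
      refine D.pos_of_ne ?_
      intro h0
      have := hp.2
      simp only [mem_ofPred_eq, h0] at this
      norm_num at this)
    refine ⟨c / 4, by positivity, fun θ hθ w hw hw2 => ?_⟩
    by_contra hcon
    push Not at hcon
    have := hcb (θ, w) ⟨⟨hθ, by simpa using D.norm_le_R hw⟩, hcon.le⟩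
    simp only at this
    linarith
  obtain ⟨ε0, hε0, m, hm, M, hM, hεm, hstep⟩ := D.step_est hs
  obtain ⟨ε, hε, hεε0, hεs⟩ : ∃ ε > 0, ε ≤ ε0 ∧ n * N * (ε * M) < kq * γ := by
    refine ⟨min ε0 (kq * γ / (2 * (n * N * M + 1))), by positivity, min_le_left _ _, ?_⟩
    calc n * N * (min ε0 (kq * γ / (2 * (n * N * M + 1))) * M)
        ≤ n * N * ((kq * γ / (2 * (n * N * M + 1))) * M) := by gcongr; exact min_le_right _ _
      _ = (kq * γ / 2) * ((n * N * M) / (n * N * M + 1)) := by field_simp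
      _ ≤ (kq * γ / 2) * 1 := by
        gcongr
        rw [div_le_one (by positivity)]; linarith
      _ < kq * γ := by nlinarith [mul_pos hkq hγ]
  have hεm1 : 0 ≤ 1 - ε * m := by nlinarith
  -- the iteration
  have base : ∀ h : ℝ → Fin n → ℂ, Loop h → (∀ θ ∈ TI, Ψ θ (h θ) ≤ R) → (∀ θ ∈ TI, Ψ θ (h θ) ≤ 2 * s) →
      HasLog (fun θ => 1 - nu Ψ θ (f θ) ⬝ᵥ h θ) := by
    intro h hh hhR hhs
    refine HasLog.of_slit ((hgl.dot hh).one_sub) fun θ hθ => ?_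
    refine Complex.ball_one_subset_slitPlane ?_
    rw [mem_ball, dist_eq_norm, sub_sub_cancel_left, norm_neg]
    have h1 := hsb θ hθ (h θ) (hhR θ hθ) (hhs θ hθ)
    calc _ ≤ n * ‖nu Ψ θ (f θ)‖ * ‖h θ‖ := dot_norm_le _ _
      _ ≤ n * N * ‖h θ‖ := by have := hNb θ hθ; gcongr
      _ < 1 := by linarith
  have ind : ∀ k : ℕ, ∀ h : ℝ → Fin n → ℂ, Loop h → (∀ θ ∈ TI, Ψ θ (h θ) ≤ t - γ) →
      (∀ θ ∈ TI, (1 - ε * m) ^ k * max (Ψ θ (h θ) - s) 0 ≤ s) → HasLog (fun θ => 1 - nu Ψ θ (f θ) ⬝ᵥ h θ) := by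
    intro k
    induction k with
    | zero =>
      intro h hh h1 h2
      refine base h hh (fun θ hθ => by linarith [h1 θ hθ]) (fun θ hθ => ?_)
      have := h2 θ hθ
      rw [pow_zero, one_mul] at this
      linarith [le_max_left (Ψ θ (h θ) - s) 0]
    | succ k ih =>
      intro h hh h1 h2
      have hhR : ∀ θ ∈ TI, Ψ θ (h θ) ≤ R := fun θ hθ => by linarith [h1 θ hθ]
      have hl := ih (fun θ => step Ψ s ε θ (h θ)) (D.step_loop hs hh)
        (fun θ hθ => (hstep ε hε hεε0 θ hθ (h θ) (hhR θ hθ)).1.trans (h1 θ hθ))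
        (fun θ hθ => by
          refine le_trans ?_ (h2 θ hθ)
          rw [pow_succ, mul_assoc]
          have := (hstep ε hε hεε0 θ hθ (h θ) (hhR θ hθ)).2.1
          gcongr)
      have hlow : ∀ θ ∈ TI, kq * γ ≤ ‖1 - nu Ψ θ (f θ) ⬝ᵥ step Ψ s ε θ (h θ)‖ := by
        intro θ hθ
        have h3 := (hstep ε hε hεε0 θ hθ (h θ) (hhR θ hθ)).1.trans (h1 θ hθ)
        have h4 := hQ (θ, f θ) ⟨TI_sub hθ, (hft θ hθ).ge, (hft θ hθ).le.trans htR⟩ (step Ψ s ε θ (h θ))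
          (by simp only; rw [hft θ hθ]; linarith)
        simp only [hft θ hθ] at h4
        refine le_trans ?_ h4
        gcongr; linarith
      refine HasLog.of_near ((hgl.dot hh).one_sub) ((hgl.dot (D.step_loop hs hh)).one_sub) ?_ hl ?_
      · intro θ hθ h0
        have := hlow θ hθ
        rw [h0, norm_zero] at this
        nlinarith [mul_pos hkq hγ]
      · intro θ hθ
        refine lt_of_lt_of_le ?_ (hlow θ hθ)
        rw [sub_sub_sub_cancel_left, ← dotProduct_sub]
        have h5 := (hstep ε hε hεε0 θ hθ (h θ) (hhR θ hθ)).2.2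
        calc _ ≤ n * ‖nu Ψ θ (f θ)‖ * ‖step Ψ s ε θ (h θ) - h θ‖ := dot_norm_le _ _
          _ ≤ n * N * (ε * M) := by have := hNb θ hθ; gcongr
          _ < kq * γ := hεs
  obtain ⟨k, hk⟩ : ∃ k : ℕ, (1 - ε * m) ^ k * R ≤ s := by
    have h1 : Tendsto (fun k : ℕ => (1 - ε * m) ^ k * R) atTop (nhds (0 * R)) :=
      (tendsto_pow_atTop_nhds_zero_of_lt_one hεm1 (by nlinarith)).mul_const R
    rw [zero_mul] at h1
    obtain ⟨k, hk⟩ := (h1.eventually_lt_const hs).exists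
    exact ⟨k, hk.le⟩
  refine ind k h hh (fun θ hθ => ?_) (fun θ hθ => ?_)
  · have : γ ≤ t - Ψ θ (h θ) := hγb θ hθ
    linarith
  · refine le_trans ?_ hk
    gcongr
    exact max_le (by linarith [hht θ hθ]) hRpos.le

lemma HasLog_pos {u : ℝ → ℝ} (hu : Loop u) (h : ∀ θ ∈ TI, 0 < u θ) : HasLog (fun θ => (u θ : ℂ)) :=
  HasLog.of_slit ⟨Complex.continuous_ofReal.comp_continuousOn hu.cont, by simp only [hu.ends]⟩
    fun θ hθ => Or.inl (by simpa using h θ hθ)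

/-- `c` has a continuous logarithm. -/
lemma cc_log (D : Data n Ψ R) {t : ℝ} (ht : 0 < t) (htR : t ≤ R) {f : ℝ → Fin n → ℂ} (hf : Loop f)
    (hft : ∀ θ ∈ TI, Ψ θ (f θ) = t) : HasLog (fun θ => cc Ψ θ (f θ)) := by
  obtain ⟨δ, hδ, k, hk, C, hC, hLT⟩ := D.LT (D.KS_compact t) (D.KS_ne ht)
  obtain ⟨m, hm, M, hM, hb⟩ := D.gr_bounds ht
  have hp : ∀ θ ∈ TI, (θ, f θ) ∈ KS Ψ R t := fun θ hθ => ⟨TI_sub hθ, (hft θ hθ).ge, (hft θ hθ).le.trans htR⟩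
  have hgrl : Loop (fun θ => gr Ψ θ (f θ)) :=
    ⟨comp_contOn D.gr_cont hf.cont fun θ hθ => D.KS_ne ht (hp θ hθ), by simp only [← hf.ends, D.gr_per0]⟩
  obtain ⟨ε, hε, e1, e2⟩ : ∃ ε > 0, ε * M < δ ∧ ε * C ≤ 1 := by
    refine ⟨min (δ / (2 * M)) (1 / C), by positivity, ?_, ?_⟩
    · calc _ ≤ δ / (2 * M) * M := by gcongr; exact min_le_left _ _
        _ = δ / 2 := by field_simp
        _ < δ := by linarith
    · rw [← le_div_iff₀ hC]; exact min_le_right _ _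
  have hsm : ContinuousOn (fun θ => (-ε) • star (gr Ψ θ (f θ))) TI := hgrl.cont.star.const_smul (-ε)
  have key := D.HL ht htR hf (h := fun θ => f θ + (-ε) • star (gr Ψ θ (f θ)))
    ⟨hf.cont.add hsm, by simp only [← hf.ends, D.gr_per0]⟩ hft ?_
  · have hl := key.inv.mul (HasLog_pos (u := fun θ => ε * euclNorm (gr Ψ θ (f θ)) ^ 2)
      ⟨continuousOn_const.mul ((eucl_cont.comp_continuousOn hgrl.cont).pow 2), by simp only [← hf.ends, D.gr_per0]⟩
      (fun θ hθ => by have := (hb (θ, f θ) (hp θ hθ)).1; simp only at this; have := hm.trans_le this; positivity))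
    refine hl.congr fun θ hθ => ?_
    have hcc := D.cc_ne (θ := θ) (w := f θ) (by rw [hft θ hθ]; exact ht) (by rw [hft θ hθ]; exact htR)
    have hb1 := (hb (θ, f θ) (hp θ hθ)).1
    simp only at hb1
    have hne : ((euclNorm (gr Ψ θ (f θ)) ^ 2 : ℝ) : ℂ) ≠ 0 := by exact_mod_cast (hm.trans_le hb1).ne'
    have hεc : (ε : ℂ) ≠ 0 := by exact_mod_cast hε.ne'
    rw [one_sub_nu hcc, add_sub_cancel_left, smul_dotProduct, dotProduct_comm, dot_star_self, Complex.real_smul,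
      Complex.ofReal_mul]
    push_cast at hne ⊢
    have hne1 : (euclNorm (gr Ψ θ (f θ)) : ℂ) ≠ 0 := fun h => hne (by rw [h]; simp)
    field_simp
  · intro θ hθ
    obtain ⟨hb1, hb2⟩ := hb (θ, f θ) (hp θ hθ)
    simp only at hb1 hb2
    set g := gr Ψ θ (f θ) with hg
    set e := euclNorm g with he
    have he0 : 0 ≤ e := eucl_nonneg g
    have hn : ‖(-ε) • star g‖ ≤ ε * e := by
      rw [norm_smul, norm_neg, Real.norm_of_nonneg hε.le]
      have := norm_le_eucl (star g)
      rw [eucl_star] at this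
      gcongr
    have h1 := (hLT (θ, f θ) (hp θ hθ) ((-ε) • star g) (hn.trans_lt (lt_of_le_of_lt (by gcongr) e1))).2.1
    simp only at h1
    have hdot : ((-ε) • star g) ⬝ᵥ g = ((-ε * e ^ 2 : ℝ) : ℂ) := by
      rw [smul_dotProduct, dotProduct_comm, dot_star_self]; push_cast; simp [← he]
    rw [← hg, hdot, Complex.ofReal_re, hft θ hθ] at h1
    have h2 : C * ‖(-ε) • star g‖ ^ 2 ≤ ε * e ^ 2 := by
      calc C * ‖(-ε) • star g‖ ^ 2 ≤ C * (ε * e) ^ 2 := by gcongr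
        _ = (ε * C) * (ε * e ^ 2) := by ring
        _ ≤ 1 * (ε * e ^ 2) := by gcongr
        _ = _ := one_mul _
    have h3 : 0 < ε * m := by positivity
    have h4 : ε * m ≤ ε * e ^ 2 := by gcongr
    linarith

end Data
end S17

namespace S17

variable {n : ℕ} {Ψ : ℝ → (Fin n → ℂ) → ℝ} {R : ℝ}

instance factTwoPi : Fact (0 < 2 * Real.pi) := ⟨by positivity⟩

/-- the point of the circle with angle `θ` -/
def ex (θ : ℝ) : ℂ := Complex.exp (θ * Complex.I)

lemma ex_norm (θ : ℝ) : ‖ex θ‖ = 1 := Complex.norm_exp_ofReal_mul_I θ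

lemma ex_zero : ex 0 = 1 := by simp [ex]
lemma ex_twopi : ex (2 * Real.pi) = 1 := by
  unfold ex; push_cast; exact Complex.exp_two_pi_mul_I

lemma ex_cont : Continuous ex := by unfold ex; fun_prop

lemma ex_add_twopi (θ : ℝ) : ex (θ + 2 * Real.pi) = ex θ := by
  have h := ex_twopi
  unfold ex at h ⊢
  push_cast at h ⊢
  rw [add_mul, Complex.exp_add, h, mul_one]

lemma ex_add (a b : ℝ) : ex (a + b) = ex a * ex b := by
  unfold ex; push_cast; rw [add_mul, Complex.exp_add]

lemma exists_ex {z : ℂ} (h : ‖z‖ = 1) : ∃ θ ∈ TI, ex θ = z := by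
  obtain ⟨θ, hθ⟩ := (Complex.norm_eq_one_iff z).1 h
  have hp : Function.Periodic ex (2 * Real.pi) := ex_add_twopi
  obtain ⟨y, hy, hy2⟩ := hp.exists_mem_Ico₀ (by positivity) θ
  exact ⟨y, ⟨hy.1, hy.2.le⟩, hy2.symm.trans hθ⟩

lemma ex_loop {F : Type*} [TopologicalSpace F] {f : ℂ → F} (hf : ContinuousOn f (closedBall 0 1)) :
    Loop (fun θ => f (ex θ)) :=
  ⟨hf.comp ex_cont.continuousOn fun θ _ => by simp [ex_norm], by simp only [ex_zero, ex_twopi]⟩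

lemma DiffContOnCl.cl {F : Type*} [NormedAddCommGroup F] [NormedSpace ℂ F] {f : ℂ → F}
    (hf : DiffContOnCl ℂ f (ball 0 1)) : ContinuousOn f (closedBall 0 1) := by
  have := hf.continuousOn
  rwa [closure_ball _ one_ne_zero] at this

lemma max_bd {F : Type*} [NormedAddCommGroup F] [NormedSpace ℂ F] {f : ℂ → F}
    (hf : DiffContOnCl ℂ f (ball 0 1)) {C : ℝ} (h : ∀ θ ∈ TI, ‖f (ex θ)‖ ≤ C) {z : ℂ} (hz : ‖z‖ ≤ 1) : ‖f z‖ ≤ C := by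
  refine Complex.norm_le_of_forall_mem_frontier_norm_le isBounded_ball hf (fun z hz => ?_) ?_
  · rw [frontier_ball _ one_ne_zero, mem_sphere_zero_iff_norm] at hz
    obtain ⟨θ, hθ, rfl⟩ := exists_ex hz
    exact h θ hθ
  · rw [closure_ball _ one_ne_zero]; simpa using hz

/-- trigonometric approximation -/
lemma trig_approx {L : ℝ → ℂ} (hL : Loop L) {ε : ℝ} (hε : 0 < ε) : ∃ A B : Polynomial ℂ, ∀ θ ∈ TI,
    ‖L θ - (A.eval (ex θ) + (starRingEnd ℂ) (B.eval (ex θ)))‖ ≤ ε := by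
  let F : C(AddCircle (2 * Real.pi), ℂ) := ⟨AddCircle.liftIco (2 * Real.pi) 0 L, AddCircle.liftIco_zero_continuous hL.ends hL.cont⟩
  have h1 : F ∈ (Submodule.span ℂ (Set.range (fourier (T := 2 * Real.pi)))).topologicalClosure := by
    rw [span_fourier_closure_eq_top]; trivial
  have h2 : F ∈ closure ((Submodule.span ℂ (Set.range (fourier (T := 2 * Real.pi))) : Set C(AddCircle (2 * Real.pi), ℂ))) := h1
  obtain ⟨p, hp, hd⟩ := Metric.mem_closure_iff.1 h2 ε hε
  have key : ∃ A B : Polynomial ℂ, ∀ θ : ℝ, p (θ : AddCircle (2 * Real.pi)) = A.eval (ex θ) + (starRingEnd ℂ) (B.eval (ex θ)) := by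
    have four : ∀ (m : ℤ) (θ : ℝ), fourier m (θ : AddCircle (2 * Real.pi)) = ex θ ^ m := by
      intro m θ
      rw [fourier_coe_apply]
      unfold ex
      rw [← Complex.exp_int_mul]
      congr 1
      push_cast
      field_simp
    refine Submodule.span_induction (p := fun p _ => ∃ A B : Polynomial ℂ, ∀ θ : ℝ, p (θ : AddCircle (2 * Real.pi)) =
      A.eval (ex θ) + (starRingEnd ℂ) (B.eval (ex θ))) ?_ ?_ ?_ ?_ hp
    · rintro _ ⟨m, rfl⟩
      rcases le_total 0 m with hm | hm
      · obtain ⟨k, rfl⟩ := Int.eq_ofNat_of_zero_le hm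
        refine ⟨Polynomial.X ^ k, 0, fun θ => ?_⟩
        rw [four]; simp
      · obtain ⟨k, hk⟩ := Int.eq_ofNat_of_zero_le (neg_nonneg.2 hm)
        refine ⟨0, Polynomial.X ^ k, fun θ => ?_⟩
        have : m = -(k : ℤ) := by omega
        rw [four, this, zpow_neg, zpow_natCast]
        simp only [Polynomial.eval_zero, zero_add, Polynomial.eval_pow, Polynomial.eval_X, map_pow]
        rw [← inv_pow, Complex.inv_def]
        have : Complex.normSq (ex θ) = 1 := by rw [Complex.normSq_eq_norm_sq, ex_norm]; norm_num
        rw [this]; simp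
    · exact ⟨0, 0, fun θ => by simp⟩
    · rintro x y - - ⟨A, B, h⟩ ⟨A', B', h'⟩
      refine ⟨A + A', B + B', fun θ => ?_⟩
      rw [ContinuousMap.add_apply, h, h']; simp; ring
    · rintro a x - ⟨A, B, h⟩
      refine ⟨a • A, (starRingEnd ℂ a) • B, fun θ => ?_⟩
      rw [ContinuousMap.smul_apply, h]; simp; ring
  obtain ⟨A, B, hAB⟩ := key
  refine ⟨A, B, ?_⟩
  have hI : ∀ θ ∈ Ico 0 (2 * Real.pi), ‖L θ - (A.eval (ex θ) + (starRingEnd ℂ) (B.eval (ex θ)))‖ ≤ ε := by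
    intro θ hθ
    have h3 := ContinuousMap.dist_apply_le_dist (f := F) (g := p) (θ : AddCircle (2 * Real.pi))
    have h4 : F (θ : AddCircle (2 * Real.pi)) = L θ := AddCircle.liftIco_zero_coe_apply hθ
    rw [h4, hAB, dist_eq_norm] at h3
    exact h3.trans hd.le
  intro θ hθ
  rcases hθ.2.lt_or_eq with h | h
  · exact hI θ ⟨hθ.1, h⟩
  · have := hI 0 ⟨le_rfl, by positivity⟩
    rwa [h, ex_twopi, ← hL.ends, ← ex_zero]

/-- A multiplier `Y = exp(poly)` making `u Y` nearly positive. -/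
lemma exists_Y {u : ℝ → ℂ} (hu : HasLog u) {ε : ℝ} (hε : 0 < ε) :
    ∃ (A : Polynomial ℂ) (m : ℝ → ℝ), (∀ θ, 0 < m θ) ∧ Continuous m ∧ ∀ θ ∈ TI, ‖u θ * Complex.exp (A.eval (ex θ)) - m θ‖ ≤ ε * m θ := by
  obtain ⟨L, hL, h⟩ := hu
  obtain ⟨δ, hδ, hδ2⟩ : ∃ δ > 0, ∀ z : ℂ, ‖z‖ ≤ δ → ‖Complex.exp z - 1‖ ≤ ε := by
    have : ContinuousAt Complex.exp 0 := Complex.continuous_exp.continuousAt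
    rw [Metric.continuousAt_iff] at this
    obtain ⟨δ, hδ, h2⟩ := this ε hε
    refine ⟨δ / 2, by positivity, fun z hz => ?_⟩
    have := h2 (x := z) (by rw [dist_zero_right]; linarith)
    rw [Complex.exp_zero, dist_eq_norm] at this
    exact this.le
  obtain ⟨A, B, hAB⟩ := trig_approx hL hδ
  refine ⟨B - A, fun θ => Real.exp (2 * (B.eval (ex θ)).re), fun θ => Real.exp_pos _, ?_, fun θ hθ => ?_⟩
  · have : Continuous fun θ => B.eval (ex θ) := B.continuous.comp ex_cont
    fun_prop
  · set E := L θ - (A.eval (ex θ) + (starRingEnd ℂ) (B.eval (ex θ))) with hE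
    have h1 : u θ * Complex.exp ((B - A).eval (ex θ)) = (Real.exp (2 * (B.eval (ex θ)).re) : ℂ) * Complex.exp E := by
      rw [h θ hθ, ← Complex.exp_add, Complex.ofReal_exp, ← Complex.exp_add]
      congr 1
      have h2 : ((2 * (B.eval (ex θ)).re : ℝ) : ℂ) = B.eval (ex θ) + (starRingEnd ℂ) (B.eval (ex θ)) := by
        rw [Complex.add_conj]
      rw [h2, hE]
      simp only [Polynomial.eval_sub]; ring
    rw [h1, show (Real.exp (2 * (B.eval (ex θ)).re) : ℂ) * Complex.exp E - (Real.exp (2 * (B.eval (ex θ)).re) : ℂ)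
      = (Real.exp (2 * (B.eval (ex θ)).re) : ℂ) * (Complex.exp E - 1) by ring, norm_mul, Complex.norm_real,
      Real.norm_of_nonneg (Real.exp_pos _).le, mul_comm]
    gcongr
    exact hδ2 E (hAB θ hθ)

lemma poly_dcc (A : Polynomial ℂ) : DiffContOnCl ℂ (fun z => Complex.exp (A.eval z)) (ball 0 1) :=
  (A.differentiable.cexp).diffContOnCl

/-- nonvanishing from a continuous logarithm on the boundary -/
lemma NV {u : ℂ → ℂ} (hu : DiffContOnCl ℂ u (ball 0 1)) (hl : HasLog (fun θ => u (ex θ))) {z : ℂ} (hz : ‖z‖ ≤ 1) :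
    u z ≠ 0 := by
  obtain ⟨A, m, hm, hmc, hA⟩ := exists_Y hl (ε := 1 / 2) (by norm_num)
  obtain ⟨c, hc, hcb⟩ := compact_lower TI_compact hmc.continuousOn (fun θ _ => hm θ)
  set v : ℂ → ℂ := fun z => u z * Complex.exp (A.eval z) with hv
  have hvd : DiffContOnCl ℂ v (ball 0 1) := hu.smul (poly_dcc A)
  have hw : DiffContOnCl ℂ (fun z => Complex.exp (- v z)) (ball 0 1) :=
    ⟨hvd.neg.differentiableOn.cexp, Complex.continuous_exp.comp_continuousOn hvd.neg.continuousOn⟩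
  have hb : ‖Complex.exp (- v z)‖ ≤ Real.exp (-(c / 2)) := by
    refine max_bd hw (fun θ hθ => ?_) hz
    rw [Complex.norm_exp, Real.exp_le_exp, Complex.neg_re, neg_le_neg_iff]
    have h1 := hA θ hθ
    have h2 := (abs_le.1 (Complex.abs_re_le_norm (u (ex θ) * Complex.exp (A.eval (ex θ)) - m θ))).1
    rw [Complex.sub_re, Complex.ofReal_re] at h2
    have h3 := hcb θ hθ
    change c / 2 ≤ (u (ex θ) * Complex.exp (A.eval (ex θ))).re
    linarith
  intro h0
  have : v z = 0 := by rw [hv]; simp [h0]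
  rw [this, neg_zero, Complex.exp_zero, norm_one] at hb
  have : Real.exp (-(c / 2)) < 1 := by rw [Real.exp_lt_one_iff]; linarith
  linarith

/-- Solutions (analytic discs in a level set, with analytic normals). -/
structure Sol (Ψ : ℝ → (Fin n → ℂ) → ℝ) (R t : ℝ) (f g : ℂ → Fin n → ℂ) : Prop where
  ht : 0 < t
  htR : t ≤ R
  hf : DiffContOnCl ℂ f (ball 0 1)
  hg : DiffContOnCl ℂ g (ball 0 1)
  lev : ∀ θ ∈ TI, Ψ θ (f (ex θ)) = t
  nug : ∀ θ ∈ TI, g (ex θ) = nu Ψ θ (f (ex θ))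

lemma dcc_dot {f g : ℂ → Fin n → ℂ} (hf : DiffContOnCl ℂ f (ball 0 1)) (hg : DiffContOnCl ℂ g (ball 0 1)) :
    DiffContOnCl ℂ (fun z => f z ⬝ᵥ g z) (ball 0 1) := by
  unfold dotProduct
  constructor
  · have h1 := differentiableOn_pi.1 hf.differentiableOn
    have h2 := differentiableOn_pi.1 hg.differentiableOn
    exact DifferentiableOn.fun_sum fun j _ => (h1 j).mul (h2 j)
  · exact cont_dot hf.continuousOn hg.continuousOn

lemma eq_of_bdry {F : Type*} [NormedAddCommGroup F] [NormedSpace ℂ F] {f g : ℂ → F}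
    (hf : DiffContOnCl ℂ f (ball 0 1)) (hg : DiffContOnCl ℂ g (ball 0 1)) (h : ∀ θ ∈ TI, f (ex θ) = g (ex θ)) {z : ℂ} (hz : ‖z‖ ≤ 1) :
    f z = g z := by
  have := max_bd (hf.sub hg) (C := 0) (fun θ hθ => by simp [h θ hθ]) hz
  exact sub_eq_zero.1 (norm_le_zero_iff.1 this)

namespace Sol

variable {t : ℝ} {f g : ℂ → Fin n → ℂ}

lemma cc_ne (S : Sol Ψ R t f g) (D : Data n Ψ R) {θ : ℝ} (hθ : θ ∈ TI) : cc Ψ θ (f (ex θ)) ≠ 0 :=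
  D.cc_ne (by rw [S.lev θ hθ]; exact S.ht) (by rw [S.lev θ hθ]; exact S.htR)

lemma dot_one (S : Sol Ψ R t f g) (D : Data n Ψ R) {z : ℂ} (hz : ‖z‖ ≤ 1) : g z ⬝ᵥ f z = 1 :=
  eq_of_bdry (dcc_dot S.hg S.hf) diffContOnCl_const (fun θ hθ => by
    rw [S.nug θ hθ, nu_dot_self (S.cc_ne D hθ)]) hz

lemma f_loop (S : Sol Ψ R t f g) : Loop (fun θ => f (ex θ)) := ex_loop (DiffContOnCl.cl S.hf)
lemma g_loop (S : Sol Ψ R t f g) : Loop (fun θ => g (ex θ)) := ex_loop (DiffContOnCl.cl S.hg)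

lemma nv (S : Sol Ψ R t f g) (D : Data n Ψ R) {h : ℂ → Fin n → ℂ} (hh : DiffContOnCl ℂ h (ball 0 1))
    (hlt : ∀ θ ∈ TI, Ψ θ (h (ex θ)) < t) {z : ℂ} (hz : ‖z‖ ≤ 1) : 1 - g z ⬝ᵥ h z ≠ 0 := by
  refine NV (u := fun z => 1 - g z ⬝ᵥ h z) (diffContOnCl_const.sub (dcc_dot S.hg hh)) ?_ hz
  refine (D.HL S.ht S.htR S.f_loop (ex_loop (DiffContOnCl.cl hh)) S.lev hlt).congr fun θ hθ => ?_
  rw [S.nug θ hθ]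

/-- comparison with the constant disc -/
lemma le_max (S : Sol Ψ R t f g) (D : Data n Ψ R) : ∃ θ ∈ TI, t ≤ Ψ θ (f 0) := by
  by_contra hcon
  push Not at hcon
  refine S.nv D (h := fun _ => f 0) diffContOnCl_const hcon (z := 0) (by simp) ?_
  rw [S.dot_one D (by simp), sub_self]

lemma cc_log (S : Sol Ψ R t f g) (D : Data n Ψ R) : HasLog (fun θ => cc Ψ θ (f (ex θ))) :=
  D.cc_log S.ht S.htR S.f_loop S.lev

lemma mem_KS (S : Sol Ψ R t f g) {θ : ℝ} (hθ : θ ∈ TI) : (θ, f (ex θ)) ∈ Data.KS Ψ R t :=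
  ⟨TI_sub hθ, (S.lev θ hθ).ge, (S.lev θ hθ).le.trans S.htR⟩

/-- interior perturbation -/
lemma push (S : Sol Ψ R t f g) (D : Data n Ψ R) : ∃ A : Polynomial ℂ, ∃ ε0 > (0:ℝ), ∀ ε, 0 < ε → ε < ε0 → ∀ θ ∈ TI,
    Ψ θ (f (ex θ) + (-(ε * Complex.exp (A.eval (ex θ)))) • f (ex θ)) < t := by
  obtain ⟨A, m, hm, hmc, hA⟩ := exists_Y (S.cc_log D) (ε := 1 / 2) (by norm_num)
  obtain ⟨c, hc, hcb⟩ := compact_lower TI_compact hmc.continuousOn (fun θ _ => hm θ)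
  obtain ⟨δ, hδ, k, hk, C, hC, hLT⟩ := D.LT (D.KS_compact t) (D.KS_ne S.ht)
  have hYf : ContinuousOn (fun θ => Complex.exp (A.eval (ex θ)) • f (ex θ)) TI :=
    ((Complex.continuous_exp.comp (A.continuous.comp ex_cont)).continuousOn).smul S.f_loop.cont
  obtain ⟨N, hN, hNb⟩ := compact_bound TI_compact hYf
  refine ⟨A, min (δ / N) (c / (C * N ^ 2)), by positivity, fun ε hε hε0 θ hθ => ?_⟩
  have e1 : ε * N < δ := by
    rw [← lt_div_iff₀ hN]; exact hε0.trans_le (min_le_left _ _)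
  have e2 : ε * (C * N ^ 2) < c := by
    rw [← lt_div_iff₀ (by positivity)]; exact hε0.trans_le (min_le_right _ _)
  set Y := Complex.exp (A.eval (ex θ)) with hY
  have hN1 : ‖Y • f (ex θ)‖ ≤ N := hNb θ hθ
  have hd : ‖(-((ε:ℂ) * Y)) • f (ex θ)‖ ≤ ε * N := by
    rw [neg_smul, norm_neg, mul_smul, norm_smul, Complex.norm_real, Real.norm_of_nonneg hε.le]
    gcongr
  have h1 := (hLT (θ, f (ex θ)) (S.mem_KS hθ) _ (hd.trans_lt e1)).2.1
  simp only [S.lev θ hθ] at h1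
  have h2 : ((-((ε:ℂ) * Y)) • f (ex θ)) ⬝ᵥ gr Ψ θ (f (ex θ)) = -(ε * (cc Ψ θ (f (ex θ)) * Y)) := by
    rw [smul_dotProduct, smul_eq_mul]; unfold cc; ring
  rw [h2, Complex.neg_re, Complex.re_ofReal_mul] at h1
  have h3 := hA θ hθ
  have h4 := (abs_le.1 (Complex.abs_re_le_norm (cc Ψ θ (f (ex θ)) * Y - m θ))).1
  rw [Complex.sub_re, Complex.ofReal_re] at h4
  have h5 := hcb θ hθ
  have h6 : c / 2 ≤ (cc Ψ θ (f (ex θ)) * Y).re := by linarith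
  have h7 : C * ‖(-((ε:ℂ) * Y)) • f (ex θ)‖ ^ 2 ≤ C * (ε * N) ^ 2 := by gcongr
  have h8 : C * (ε * N) ^ 2 < ε * c := by nlinarith
  have h9 : ε * (c / 2) ≤ ε * (cc Ψ θ (f (ex θ)) * Y).re := by gcongr
  linarith

/-- Uniqueness. -/
lemma unique_aux {t' : ℝ} {f' g' : ℂ → Fin n → ℂ} (S : Sol Ψ R t f g) (S' : Sol Ψ R t' f' g') (D : Data n Ψ R)
    (h0 : f 0 = f' 0) (htt : t' ≤ t) : ∀ z, ‖z‖ ≤ 1 → f z = f' z := by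
  obtain ⟨A, ε0, hε0, hA⟩ := S'.push D
  set p : ℂ → ℂ := fun z => g z ⬝ᵥ f' z with hp
  have hpd : DiffContOnCl ℂ p (ball 0 1) := dcc_dot S.hg S'.hf
  have hp0 : p 0 = 1 := by rw [hp]; simp only []; rw [← h0]; exact S.dot_one D (by simp)
  have hne : ∀ ε : ℝ, 0 < ε → ε < ε0 → ∀ z : ℂ, ‖z‖ ≤ 1 → 1 - p z + ε * Complex.exp (A.eval z) * p z ≠ 0 := by
    intro ε hε hε1 z hz
    have hd : DiffContOnCl ℂ (fun z => f' z + (-((ε:ℂ) * Complex.exp (A.eval z))) • f' z) (ball 0 1) := by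
      have h1 : DiffContOnCl ℂ (fun z => (-((ε:ℂ) * Complex.exp (A.eval z)))) (ball 0 1) :=
        ((poly_dcc A).const_smul (ε:ℂ)).neg
      exact S'.hf.add (h1.smul S'.hf)
    have := S.nv D hd (fun θ hθ => (hA ε hε hε1 θ hθ).trans_le htt) hz
    rw [dotProduct_add, dotProduct_smul, smul_eq_mul] at this
    intro h
    apply this
    rw [hp] at h
    linear_combination h
  have hpz : ∀ᶠ z in nhds (0:ℂ), p z = 1 := by
    have hpan : AnalyticAt ℂ p 0 := hpd.differentiableOn.analyticAt (ball_mem_nhds 0 one_pos)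
    have hYan : AnalyticAt ℂ (fun z => Complex.exp (A.eval z)) 0 :=
      (A.differentiable.cexp).analyticAt 0
    set q : ℂ → ℂ := fun z => (1 - p z) / (Complex.exp (A.eval z) * p z) with hq
    have hqan : AnalyticAt ℂ q 0 := (analyticAt_const.sub hpan).div (hYan.mul hpan) (by rw [hp0]; simp)
    have hq0 : q 0 = 0 := by rw [hq]; simp [hp0]
    have hpne : ∀ᶠ z in nhds (0:ℂ), p z ≠ 0 := hpan.continuousAt.eventually_ne (by rw [hp0]; exact one_ne_zero)
    have hball : ∀ᶠ z in nhds (0:ℂ), ‖z‖ ≤ 1 := by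
      filter_upwards [ball_mem_nhds (0:ℂ) one_pos] with z hz
      simpa using (mem_ball_zero_iff.1 hz).le
    rcases hqan.eventually_constant_or_nhds_le_map_nhds with hc | hc
    · filter_upwards [hc, hpne] with z hz hz2
      rw [hq0] at hz
      simp only [hq] at hz
      have : Complex.exp (A.eval z) * p z ≠ 0 := mul_ne_zero (Complex.exp_ne_zero _) hz2
      rw [div_eq_zero_iff] at hz
      rcases hz with hz | hz
      · exact (sub_eq_zero.1 hz).symm
      · exact absurd hz this
    · exfalso
      have hS : {z : ℂ | ‖z‖ ≤ 1 ∧ p z ≠ 0} ∈ nhds (0:ℂ) := hball.and hpne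
      have h1 : q '' {z : ℂ | ‖z‖ ≤ 1 ∧ p z ≠ 0} ∈ nhds (q 0) := hc (image_mem_map hS)
      rw [hq0, Metric.mem_nhds_iff] at h1
      obtain ⟨r, hr, hrb⟩ := h1
      obtain ⟨ε, hε, hε1⟩ := exists_between (lt_min hr hε0)
      have h2 : (-(ε:ℂ)) ∈ ball (0:ℂ) r := by
        rw [mem_ball_zero_iff, norm_neg, Complex.norm_real, Real.norm_of_nonneg hε.le]
        exact hε1.trans_le (min_le_left _ _)
      obtain ⟨z, ⟨hz1, hz2⟩, hz3⟩ := hrb h2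
      apply hne ε hε (hε1.trans_le (min_le_right _ _)) z hz1
      simp only [hq] at hz3
      have : Complex.exp (A.eval z) * p z ≠ 0 := mul_ne_zero (Complex.exp_ne_zero _) hz2
      rw [div_eq_iff this] at hz3
      linear_combination hz3
  have hpall : ∀ z : ℂ, ‖z‖ ≤ 1 → p z = 1 := by
    have han : AnalyticOnNhd ℂ p (ball 0 1) := hpd.differentiableOn.analyticOnNhd isOpen_ball
    have h1 := han.eqOn_of_preconnected_of_eventuallyEq (g := fun _ => (1:ℂ)) analyticOnNhd_const
      (convex_ball (0:ℂ) 1).isPreconnected (mem_ball_self one_pos) hpz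
    have h2 : EqOn p (fun _ => 1) (closure (ball 0 1)) := by
      refine EqOn.of_subset_closure h1 hpd.continuousOn continuousOn_const subset_closure le_rfl
    intro z hz
    exact h2 (by rw [closure_ball _ one_ne_zero]; simpa using hz)
  intro z hz
  refine eq_of_bdry S.hf S'.hf (fun θ hθ => ?_) hz
  by_contra hcon
  have h1 := hpall (ex θ) (ex_norm θ).le
  have h2 := one_sub_nu (S.cc_ne D hθ) (f' (ex θ))
  rw [← S.nug θ hθ] at h2
  have h3 : g (ex θ) ⬝ᵥ f' (ex θ) = 1 := h1
  rw [h3, sub_self] at h2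
  have h4 := D.LC (θ := θ) (w := f (ex θ)) (w' := f' (ex θ)) (by rw [S.lev θ hθ]; exact S.ht) (by rw [S.lev θ hθ]; exact S.htR)
    (by rw [S.lev θ hθ, S'.lev θ hθ]; exact htt) (fun h => hcon h.symm)
  have h5 := mul_ne_zero (inv_ne_zero (S.cc_ne D hθ)) h4
  exact h5 (neg_eq_zero.1 h2.symm)

lemma unique {t' : ℝ} {f' g' : ℂ → Fin n → ℂ} (S : Sol Ψ R t f g) (S' : Sol Ψ R t' f' g') (D : Data n Ψ R)
    (h0 : f 0 = f' 0) : t = t' ∧ (∀ z, ‖z‖ ≤ 1 → f z = f' z) ∧ (∀ z, ‖z‖ ≤ 1 → g z = g' z) := by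
  have h1 : ∀ z, ‖z‖ ≤ 1 → f z = f' z := by
    rcases le_total t' t with h | h
    · exact S.unique_aux S' D h0 h
    · exact fun z hz => (S'.unique_aux S D h0.symm h z hz).symm
  refine ⟨?_, h1, fun z hz => ?_⟩
  · rw [← S.lev 0 zero_mem_TI, ← S'.lev 0 zero_mem_TI, h1 _ (ex_norm 0).le]
  · refine eq_of_bdry S.hg S'.hg (fun θ hθ => ?_) hz
    rw [S.nug θ hθ, S'.nug θ hθ, h1 _ (ex_norm θ).le]

end Sol
end S17

namespace S17

variable {n : ℕ} {Ψ : ℝ → (Fin n → ℂ) → ℝ} {R : ℝ}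

/-- circular cap near `ex θ0` -/
def cap (θ0 δ : ℝ) : Set ℂ := {ζ | ‖ζ‖ < 1 ∧ 1 - δ < (ζ * (starRingEnd ℂ) (ex θ0)).re}

lemma cap_open (θ0 δ : ℝ) : IsOpen (cap θ0 δ) := by
  refine (isOpen_lt (f := fun ζ : ℂ => ‖ζ‖) continuous_norm continuous_const).inter
    (isOpen_lt (f := fun _ : ℂ => 1 - δ) (g := fun ζ : ℂ => (ζ * (starRingEnd ℂ) (ex θ0)).re) continuous_const (by fun_prop))

lemma cap_closure (θ0 δ : ℝ) : closure (cap θ0 δ) ⊆ {ζ | ‖ζ‖ ≤ 1 ∧ 1 - δ ≤ (ζ * (starRingEnd ℂ) (ex θ0)).re} := by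
  have h : IsClosed {ζ : ℂ | ‖ζ‖ ≤ 1 ∧ 1 - δ ≤ (ζ * (starRingEnd ℂ) (ex θ0)).re} :=
    (isClosed_le (f := fun ζ : ℂ => ‖ζ‖) continuous_norm continuous_const).inter
    (isClosed_le (f := fun _ : ℂ => 1 - δ) (g := fun ζ : ℂ => (ζ * (starRingEnd ℂ) (ex θ0)).re) continuous_const (by fun_prop))
  exact closure_minimal (fun ζ hζ => ⟨hζ.1.le, hζ.2.le⟩) h

lemma cap_max {u : ℂ → ℂ} (hu : DiffContOnCl ℂ u (ball 0 1)) {θ0 δ A : ℝ} (hδ : 0 < δ) (hA : 0 < A)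
    (h1 : ∀ ζ ∈ cap θ0 δ, A / 2 ≤ ‖u ζ‖)
    (h2 : ∀ ζ : ℂ, ‖ζ‖ = 1 → 1 - δ ≤ (ζ * (starRingEnd ℂ) (ex θ0)).re → 2 * A ≤ ‖u ζ‖) :
    ∀ ζ ∈ cap θ0 (δ / 2), A ≤ ‖u ζ‖ := by
  have hcl : ∀ ζ ∈ closure (cap θ0 δ), A / 2 ≤ ‖u ζ‖ := by
    intro ζ hζ
    have hc : ContinuousWithinAt (fun ζ => ‖u ζ‖) (cap θ0 δ) ζ := by
      have := (DiffContOnCl.cl hu).norm ζ (by simpa using (cap_closure θ0 δ hζ).1)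
      exact this.mono fun x hx => by simpa using hx.1.le
    have hne := mem_closure_iff_nhdsWithin_neBot.1 hζ
    exact ge_of_tendsto hc (eventually_mem_nhdsWithin.mono fun x hx => h1 x hx)
  set l := Real.log 4 with hl
  have hl4 : Real.exp l = 4 := Real.exp_log (by norm_num)
  set e : ℂ → ℂ := fun ζ => Complex.exp (-((l / δ : ℝ) : ℂ) * (1 - ζ * (starRingEnd ℂ) (ex θ0))) with he
  have hen : ∀ ζ, ‖e ζ‖ = Real.exp (-(l / δ) * (1 - (ζ * (starRingEnd ℂ) (ex θ0)).re)) := by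
    intro ζ
    rw [he, Complex.norm_exp, ← Complex.ofReal_neg, Complex.re_ofReal_mul]
    simp
  have hsub : cap θ0 δ ⊆ ball 0 1 := fun ζ hζ => by simpa using hζ.1
  have hv : DiffContOnCl ℂ (fun ζ => e ζ / u ζ) (cap θ0 δ) := by
    constructor
    · refine DifferentiableOn.div ?_ (hu.differentiableOn.mono hsub) fun ζ hζ h0 => ?_
      · rw [he]; fun_prop
      · have := h1 ζ hζ; rw [h0, norm_zero] at this; linarith
    · refine ContinuousOn.div ?_ ((DiffContOnCl.cl hu).mono fun ζ hζ => by simpa using (cap_closure θ0 δ hζ).1) fun ζ hζ h0 => ?_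
      · rw [he]; fun_prop
      · have := hcl ζ hζ; rw [h0, norm_zero] at this; linarith
  have hl0 : 0 < l := Real.log_pos (by norm_num)
  intro ζ hζ
  have hζ' : ζ ∈ cap θ0 δ := ⟨hζ.1, by have := hζ.2; linarith⟩
  have hb : ‖e ζ / u ζ‖ ≤ 1 / (2 * A) := by
    refine Complex.norm_le_of_forall_mem_frontier_norm_le (isBounded_ball.subset hsub) hv (fun x hx => ?_) (subset_closure hζ')
    have hx1 := cap_closure θ0 δ hx.1
    have hx2 : x ∉ cap θ0 δ := by have := hx.2; rwa [(cap_open θ0 δ).interior_eq] at this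
    have hux := hcl x hx.1
    have hux0 : 0 < ‖u x‖ := by linarith
    rw [norm_div, hen, div_le_div_iff₀ hux0 (by positivity), one_mul]
    rcases hx1.1.lt_or_eq with hlt | heq
    · have hre : (x * (starRingEnd ℂ) (ex θ0)).re = 1 - δ := by
        by_contra hne
        exact hx2 ⟨hlt, lt_of_le_of_ne hx1.2 (Ne.symm hne)⟩
      rw [hre, show -(l / δ) * (1 - (1 - δ)) = -l by field_simp; ring, Real.exp_neg, hl4]
      linarith
    · have h3 := h2 x heq hx1.2
      have h4 : Real.exp (-(l / δ) * (1 - (x * (starRingEnd ℂ) (ex θ0)).re)) ≤ 1 := by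
        rw [Real.exp_le_one_iff]
        have h5 : (x * (starRingEnd ℂ) (ex θ0)).re ≤ 1 := by
          refine (Complex.re_le_norm _).trans ?_
          rw [norm_mul, heq, RCLike.norm_conj, ex_norm]; norm_num
        have : 0 < l / δ := by positivity
        nlinarith
      nlinarith
  have hu0 : 0 < ‖u ζ‖ := by have := h1 ζ hζ'; linarith
  rw [norm_div, hen, div_le_div_iff₀ hu0 (by positivity), one_mul] at hb
  have h6 : (1:ℝ) / 2 ≤ Real.exp (-(l / δ) * (1 - (ζ * (starRingEnd ℂ) (ex θ0)).re)) := by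
    have h7 : Real.exp (-(l / 2)) = 1 / 2 := by
      have h8 : Real.exp (-(l / 2)) * Real.exp (-(l / 2)) = 1 / 4 := by
        rw [← Real.exp_add, show -(l / 2) + -(l / 2) = -l by ring, Real.exp_neg, hl4]; norm_num
      have h9 := Real.exp_pos (-(l / 2))
      nlinarith
    rw [← h7, Real.exp_le_exp]
    have h10 : 1 - (ζ * (starRingEnd ℂ) (ex θ0)).re ≤ δ / 2 := by have := hζ.2; linarith
    have h11 : (l / δ) * (1 - (ζ * (starRingEnd ℂ) (ex θ0)).re) ≤ (l / δ) * (δ / 2) := by gcongr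
    have h12 : (l / δ) * (δ / 2) = l / 2 := by field_simp
    linarith
  nlinarith

lemma arc_angle {θ0 δ : ℝ} (hθ : θ0 ∈ TI) (hδ : 0 ≤ δ) {ζ : ℂ} (h : ‖ζ‖ = 1)
    (hre : 1 - δ ≤ (ζ * (starRingEnd ℂ) (ex θ0)).re) :
    ∃ θ ∈ Icc (-10:ℝ) 10, ex θ = ζ ∧ |θ - θ0| ≤ Real.pi * Real.sqrt δ := by
  set w := ζ * (starRingEnd ℂ) (ex θ0) with hw
  have hwn : ‖w‖ = 1 := by rw [hw, norm_mul, h, RCLike.norm_conj, ex_norm]; norm_num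
  set φ := Complex.arg w with hφ
  have hexφ : ex φ = w := by
    have := Complex.norm_mul_exp_arg_mul_I w
    rw [hwn] at this; simpa [ex] using this
  have h1 := Complex.abs_arg_le_pi w
  have hpi := Real.pi_lt_d2
  have hpi0 := Real.pi_pos
  refine ⟨θ0 + φ, ?_, ?_, ?_⟩
  · have := hθ.1; have := hθ.2
    have := abs_le.1 h1
    constructor <;> linarith
  · rw [ex_add, hexφ, hw]
    have : ex θ0 * (starRingEnd ℂ) (ex θ0) = 1 := by
      rw [Complex.mul_conj, Complex.normSq_eq_norm_sq, ex_norm]; norm_num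
    linear_combination ζ * this
  · rw [add_sub_cancel_left]
    have h2 := Real.cos_le_one_sub_mul_cos_sq h1
    have h3 : w.re = Real.cos φ := by
      rw [← hexφ, ex, Complex.exp_ofReal_mul_I_re]
    have h4 : 2 / Real.pi ^ 2 * φ ^ 2 ≤ δ := by rw [h3] at hre; linarith
    have h5 : φ ^ 2 ≤ Real.pi ^ 2 * δ := by
      rw [div_mul_eq_mul_div, div_le_iff₀ (by positivity)] at h4
      nlinarith [sq_nonneg φ]
    rw [← Real.sqrt_sq hpi0.le, ← Real.sqrt_mul (by positivity), ← Real.sqrt_sq_eq_abs]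
    exact Real.sqrt_le_sqrt h5

namespace Sol
variable {t : ℝ} {f g : ℂ → Fin n → ℂ}

lemma per_pick (D : Data n Ψ R) (θ : ℝ) : ∃ y ∈ TI, Ψ θ = Ψ y ∧ ex θ = ex y := by
  have hp : Function.Periodic (fun θ => (Ψ θ, ex θ)) (2 * Real.pi) := fun θ => by
    simp only [ex_add_twopi]
    rw [show Ψ (θ + 2 * Real.pi) = Ψ θ from funext (D.per θ)]
  obtain ⟨y, hy, hy2⟩ := hp.exists_mem_Ico₀ (by positivity) θ
  exact ⟨y, ⟨hy.1, hy.2.le⟩, congrArg Prod.fst hy2, congrArg Prod.snd hy2⟩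

lemma lev' (S : Sol Ψ R t f g) (D : Data n Ψ R) (θ : ℝ) : Ψ θ (f (ex θ)) = t := by
  obtain ⟨y, hy, h1, h2⟩ := per_pick D θ
  rw [h1, h2, S.lev y hy]

lemma nug' (S : Sol Ψ R t f g) (D : Data n Ψ R) (θ : ℝ) : g (ex θ) = nu Ψ θ (f (ex θ)) := by
  obtain ⟨y, hy, h1, h2⟩ := per_pick D θ
  rw [h2, S.nug y hy]
  unfold nu cc gr
  rw [h1]

lemma f_le (S : Sol Ψ R t f g) (D : Data n Ψ R) {z : ℂ} (hz : ‖z‖ ≤ 1) : ‖f z‖ ≤ R :=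
  max_bd S.hf (fun θ hθ => D.norm_le_R (by rw [S.lev θ hθ]; exact S.htR)) hz

end Sol

lemma Data.small_level (D : Data n Ψ R) {r : ℝ} (hr : 0 < r) : ∃ s > (0:ℝ), ∀ θ ∈ Icc (-10:ℝ) 10, ∀ w : Fin n → ℂ,
    Ψ θ w ≤ s → ‖w‖ ≤ r := by
  have hc : IsCompact (Icc (-10:ℝ) 10 ×ˢ (closedBall (0 : Fin n → ℂ) R ∩ {w | r ≤ ‖w‖})) :=
    isCompact_Icc.prod ((isCompact_closedBall _ _).inter_right (isClosed_le continuous_const continuous_norm))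
  obtain ⟨c, hc0, hcb⟩ := compact_lower hc (q := fun p => Ψ p.1 p.2) D.cont.continuousOn (fun p hp => D.pos_of_ne (by
    intro h; have := hp.2.2; rw [mem_ofPred_eq, h, norm_zero] at this; linarith))
  refine ⟨min R (c / 2), lt_min (by linarith [D.hR]) (by positivity), fun θ hθ w hw => ?_⟩
  by_contra hcon
  push Not at hcon
  have h1 := D.norm_le_R (hw.trans (min_le_left _ _))
  have h2 := hcb (θ, w) ⟨hθ, by simpa using h1, hcon.le⟩
  have h3 := hw.trans (min_le_right _ _)
  simp only at h2
  linarith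

end S17

namespace S17

variable {n : ℕ} {Ψ : ℝ → (Fin n → ℂ) → ℝ} {R : ℝ}

lemma dot_lower {u v v' : Fin n → ℂ} {M A B : ℝ} (hu : ‖u‖ ≤ M) (hv : ‖v' - v‖ ≤ B) (h : A ≤ ‖1 - u ⬝ᵥ v'‖) :
    A - n * M * B ≤ ‖1 - u ⬝ᵥ v‖ := by
  have h1 : (1 - u ⬝ᵥ v') = (1 - u ⬝ᵥ v) - u ⬝ᵥ (v' - v) := by rw [dotProduct_sub]; ring
  have h2 := norm_sub_le (1 - u ⬝ᵥ v) (u ⬝ᵥ (v' - v))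
  rw [← h1] at h2
  have h3 := dot_norm_le u (v' - v)
  have h4 : n * ‖u‖ * ‖v' - v‖ ≤ n * M * B := by
    have := (norm_nonneg u).trans hu
    gcongr
  linarith

lemma Data.KS_mono {s s' : ℝ} (h : s ≤ s') : Data.KS Ψ R s' ⊆ Data.KS Ψ R s :=
  fun _ hp => ⟨hp.1, h.trans hp.2.1, hp.2.2⟩

set_option maxHeartbeats 1000000 in
theorem claims (D : Data n Ψ R) {s0 : ℝ} (hs0 : 0 < s0) : ∃ q δ0 κ : ℝ, 1 / 2 < q ∧ q < 1 ∧ 0 < δ0 ∧ 0 < κ ∧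
    ∀ (t : ℝ) (f g : ℂ → Fin n → ℂ), Sol Ψ R t f g → s0 ≤ t → ∀ θ0 ∈ TI, ∀ j : ℕ, ∀ ζ ∈ cap θ0 (δ0 / 2 ^ j),
      (∀ w, Ψ θ0 w ≤ t - R * q ^ j → κ * (R * q ^ j) ≤ ‖1 - g ζ ⬝ᵥ w‖) ∧
      (∀ w, t + R * q ^ j ≤ Ψ θ0 w → Ψ θ0 w ≤ R → κ * (R * q ^ j) ≤ ‖1 - nu Ψ θ0 w ⬝ᵥ f ζ‖) := by
  have hR1 := D.hR
  have hR : 0 < R := by linarith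
  obtain ⟨M, hM, hMb⟩ := compact_bound (D.KS_compact s0) ((D.nu_cont).mono (D.KS_OK hs0))
  obtain ⟨s1', hs1', hsm⟩ := D.small_level (r := 1 / (2 * (n * M + 1))) (by positivity)
  set s1 := min s1' s0 with hs1d
  have hs1 : 0 < s1 := lt_min hs1' hs0
  have hs10 : s1 ≤ s0 := min_le_right _ _
  obtain ⟨k, hk, hQ⟩ := D.Q1 hs1
  obtain ⟨Cθ, hCθ, hLth⟩ := D.Ltheta hs1
  obtain ⟨Cd, hCd, η0, hη0, hDA⟩ := D.DeAs hs1
  obtain ⟨CL, hCL, hlip⟩ := D.nu_lip hs1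
  set κ := min (k / 4) (1 / (2 * R)) with hκ
  have hκ0 : 0 < κ := by positivity
  have hκk : κ ≤ k / 4 := min_le_left _ _
  have hκR : κ * R ≤ 1 / 2 := by
    have : κ ≤ 1 / (2 * R) := min_le_right _ _
    rw [le_div_iff₀ (by positivity)] at this; linarith
  set p := min (min (1 / 4) (η0 / R)) (min (κ / (4 * (n * M * Cd + 1))) (κ / (4 * (n * R * (CL * Cd) + 1)))) with hp
  have hp0 : 0 < p := by positivity
  have hp1 : p ≤ 1 / 4 := (min_le_left _ _).trans (min_le_left _ _)
  have hp2 : p * R ≤ η0 := by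
    have : p ≤ η0 / R := (min_le_left _ _).trans (min_le_right _ _)
    rwa [le_div_iff₀ hR] at this
  have hp3 : n * M * (Cd * p) ≤ κ / 4 := by
    have : p ≤ κ / (4 * (n * M * Cd + 1)) := (min_le_right _ _).trans (min_le_left _ _)
    rw [le_div_iff₀ (by positivity)] at this; nlinarith
  have hp4 : n * R * (CL * (Cd * p)) ≤ κ / 4 := by
    have : p ≤ κ / (4 * (n * R * (CL * Cd) + 1)) := (min_le_right _ _).trans (min_le_right _ _)
    rw [le_div_iff₀ (by positivity)] at this; nlinarith
  have hpi := Real.pi_pos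
  set b := R / (4 * Cθ * Real.pi) with hb
  have hb0 : 0 < b := by positivity
  refine ⟨1 - p, b ^ 2, κ, by linarith, by linarith, by positivity, hκ0, ?_⟩
  intro t f g S hst θ0 hθ0 j
  have hθ10 := TI_sub hθ0
  set q := 1 - p with hq
  have hq0 : 0 < q := by rw [hq]; linarith
  have hq1 : q ≤ 1 := by rw [hq]; linarith
  have hgM : ∀ {z : ℂ}, ‖z‖ ≤ 1 → ‖g z‖ ≤ M := fun hz => max_bd S.hg (fun θ hθ => by
    rw [S.nug θ hθ]
    exact hMb (θ, f (ex θ)) (Data.KS_mono hst (S.mem_KS hθ))) hz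
  have hbase : ∀ w, Ψ θ0 w ≤ s1 → ∀ ζ : ℂ, ‖ζ‖ ≤ 1 → 1 / 2 ≤ ‖1 - g ζ ⬝ᵥ w‖ := by
    intro w hw ζ hζ
    have h1 := hsm θ0 hθ10 w (hw.trans (min_le_left _ _))
    have h2 := dot_norm_le (g ζ) w
    have h3 : n * ‖g ζ‖ * ‖w‖ ≤ n * M * (1 / (2 * (n * M + 1))) := by
      have := hgM hζ
      gcongr
    have h4 : n * M * (1 / (2 * (n * M + 1))) ≤ 1 / 2 := by
      rw [mul_one_div, div_le_iff₀ (by positivity)]; linarith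
    have h5 := norm_sub_norm_le (1:ℂ) (g ζ ⬝ᵥ w)
    rw [norm_one] at h5
    linarith
  have hKt : ∀ θ ∈ Icc (-10:ℝ) 10, (θ, f (ex θ)) ∈ Data.KS Ψ R s1 := fun θ hθ =>
    ⟨hθ, by simp only [S.lev' D θ]; linarith, by simp only [S.lev' D θ]; exact S.htR⟩
  induction j with
  | zero =>
    intro ζ hζ
    refine ⟨fun w hw => ?_, fun w hw hw' => ?_⟩
    · rw [pow_zero, mul_one] at hw ⊢
      exact hκR.trans (hbase w (by have := S.htR; linarith) ζ hζ.1.le)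
    · exfalso; rw [pow_zero] at hw; have := S.ht; linarith
  | succ j ih =>
    set σ := R * q ^ j with hσ
    have hσ0 : 0 < σ := by positivity
    have hσR : σ ≤ R := by rw [hσ]; have := pow_le_one₀ hq0.le hq1 (n := j); nlinarith
    have hσ' : R * q ^ (j + 1) = σ - p * σ := by rw [hσ, pow_succ, hq]; ring
    rw [hσ']
    have hpσ : p * σ ≤ η0 := (by nlinarith : p * σ ≤ p * R).trans hp2
    have hpσ0 : 0 ≤ p * σ := by positivity
    have hpσ4 : p * σ ≤ σ / 4 := by nlinarith
    have hδe : b ^ 2 / 2 ^ (j + 1) = b ^ 2 / 2 ^ j / 2 := by rw [pow_succ 2 j, div_div]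
    rw [hδe]
    set δ := b ^ 2 / 2 ^ j with hδ
    have hδ0 : 0 < δ := by positivity
    have hδs : Cθ * (Real.pi * Real.sqrt δ) ≤ σ / 4 := by
      have h1 : Real.sqrt δ ≤ b * q ^ j := by
        rw [Real.sqrt_le_left (by positivity), hδ, mul_pow, div_eq_mul_inv, ← inv_pow, ← pow_mul, mul_comm j 2, pow_mul]
        gcongr
        rw [hq]; nlinarith
      calc Cθ * (Real.pi * Real.sqrt δ) ≤ Cθ * (Real.pi * (b * q ^ j)) := by gcongr
        _ = σ / 4 := by rw [hσ, hb]; field_simp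
    have harc : ∀ ζ : ℂ, ‖ζ‖ = 1 → 1 - δ ≤ (ζ * (starRingEnd ℂ) (ex θ0)).re →
        ∃ θ ∈ Icc (-10:ℝ) 10, ex θ = ζ ∧ Cθ * |θ - θ0| ≤ σ / 4 := by
      intro ζ h1 h2
      obtain ⟨θ, h3, h4, h5⟩ := arc_angle hθ0 hδ0.le h1 h2
      exact ⟨θ, h3, h4, le_trans (by gcongr) hδs⟩
    set A := κ * (σ - p * σ) with hA
    have hA0 : 0 < A := by rw [hA]; have : 0 < σ - p * σ := by linarith
                           positivity
    have hAk : 2 * A ≤ k * (σ / 2) := by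
      rw [hA]
      calc 2 * (κ * (σ - p * σ)) ≤ 2 * (k / 4 * σ) := by
            have : σ - p * σ ≤ σ := by linarith
            gcongr
            linarith
        _ = k * (σ / 2) := by ring
    have hAh : A / 2 ≤ κ * σ - κ / 4 * σ := by rw [hA]; have := mul_nonneg hκ0.le hpσ0; have := mul_pos hκ0 hσ0; linarith
    intro ζ hζ
    refine ⟨fun w hw => ?_, fun w hw hw' => ?_⟩
    · rcases le_or_gt (Ψ θ0 w) s1 with hs | hs
      · refine le_trans ?_ (hbase w hs ζ hζ.1.le)
        have : A ≤ κ * R := by rw [hA]; gcongr; linarith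
        linarith
      have hwR : Ψ θ0 w ≤ R := by have := S.htR; linarith
      refine cap_max (u := fun ζ => 1 - g ζ ⬝ᵥ w) (diffContOnCl_const.sub (dcc_dot S.hg diffContOnCl_const)) hδ0 hA0 ?_ ?_ ζ hζ
      · intro ζ hζ
        obtain ⟨w', hw'1, hw'2⟩ := (hDA (θ0, w) ⟨hθ10, hs.le, hwR⟩ (p * σ) hpσ0 hpσ).1
        simp only at hw'1 hw'2
        have h1 := (ih ζ hζ).1 w' (by linarith)
        have h2 := dot_lower (hgM hζ.1.le) hw'1 h1
        refine hAh.trans (le_trans ?_ h2)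
        have : n * M * (Cd * (p * σ)) = n * M * (Cd * p) * σ := by ring
        rw [this]
        have : n * M * (Cd * p) * σ ≤ κ / 4 * σ := by gcongr
        linarith
      · intro ζ h1 h2
        obtain ⟨θ, h3, rfl, h5⟩ := harc ζ h1 h2
        have h6 := hLth θ0 hθ10 θ h3 w (D.eucl_le_R hwR)
        rw [max_eq_left hs.le] at h6
        have h7 := hQ _ (hKt θ h3) w (by simp only [S.lev' D θ]; linarith)
        simp only [S.lev' D θ] at h7
        rw [← S.nug' D θ] at h7
        refine hAk.trans (le_trans ?_ h7)
        gcongr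
        linarith
    · have hws : s1 ≤ Ψ θ0 w := by linarith
      refine cap_max (u := fun ζ => 1 - nu Ψ θ0 w ⬝ᵥ f ζ) (diffContOnCl_const.sub (dcc_dot diffContOnCl_const S.hf)) hδ0 hA0 ?_ ?_ ζ hζ
      · intro ζ hζ
        set η := min (p * σ) (R - Ψ θ0 w) with hη
        have hη00 : 0 ≤ η := le_min hpσ0 (by linarith)
        have hηp : η ≤ p * σ := min_le_left _ _
        obtain ⟨w', hw'1, hw'2⟩ := (hDA (θ0, w) ⟨hθ10, hws, hw'⟩ η hη00 (hηp.trans hpσ)).2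
        simp only at hw'1 hw'2
        have hw'R : Ψ θ0 w' ≤ R := by
          have : η ≤ R - Ψ θ0 w := min_le_right _ _
          linarith
        have h1 : κ * σ ≤ ‖1 - nu Ψ θ0 w' ⬝ᵥ f ζ‖ := by
          rcases le_total (p * σ) (R - Ψ θ0 w) with hc | hc
          · have : η = p * σ := min_eq_left hc
            exact (ih ζ hζ).2 w' (by linarith) hw'R
          · have hηe : η = R - Ψ θ0 w := min_eq_right hc
            have hwe : Ψ θ0 w' = R := by linarith
            have hRt : σ / 2 ≤ R - t := by linarith
            have hcirc : ∀ θ ∈ TI, ‖nu Ψ θ0 w' ⬝ᵥ f (ex θ)‖ ≤ 1 - k * (R - t) := by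
              intro θ hθ
              have hf0 : f (ex θ) ≠ 0 := D.ne_of_pos (θ := θ) (by rw [S.lev θ hθ]; exact S.ht)
              set a := euclNorm (f (ex θ)) with ha
              have ha0 : 0 < a := lt_of_le_of_ne (eucl_nonneg _) (fun h => hf0 (eucl_eq_zero.1 h.symm))
              set v : Fin n → ℂ := ((R / a : ℝ) : ℂ) • f (ex θ) with hv
              have hve : euclNorm v = R := by
                rw [← Real.sqrt_sq hR.le, ← Real.sqrt_sq (eucl_nonneg v), eucl_sq, hv]
                congr 1
                simp only [Pi.smul_apply, smul_eq_mul, Complex.normSq_mul, Complex.normSq_ofReal, ← Finset.mul_sum]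
                rw [← eucl_sq, ← ha]; field_simp
              have hvR : Ψ θ v = R := (D.levelR θ v).2 hve
              have h2 := hQ (θ, v) ⟨TI_sub hθ, by simp only [hvR]; linarith [S.htR], hvR.le⟩ (f (ex θ)) (by
                simp only [hvR, S.lev θ hθ]; exact S.htR)
              simp only [hvR, S.lev θ hθ] at h2
              have h3 : nu Ψ θ v ⬝ᵥ f (ex θ) = ((a / R : ℝ) : ℂ) := by
                rw [D.nu_top hvR, hv, star_smul, smul_dotProduct, smul_dotProduct, dotProduct_comm, dot_star_self, ← ha]
                simp only [smul_eq_mul, Complex.star_def, Complex.conj_ofReal]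
                push_cast
                have : (a:ℂ) ≠ 0 := by exact_mod_cast ha0.ne'
                have : (R:ℂ) ≠ 0 := by exact_mod_cast hR.ne'
                field_simp
              rw [h3, ← Complex.ofReal_one, ← Complex.ofReal_sub, Complex.norm_real, Real.norm_of_nonneg (by
                have : a / R ≤ 1 := by
                  rw [div_le_one hR]; exact D.eucl_le_R (θ := θ) (by rw [S.lev θ hθ]; exact S.htR)
                linarith)] at h2
              have h4 : ‖nu Ψ θ0 w' ⬝ᵥ f (ex θ)‖ ≤ a / R := by
                rw [D.nu_top hwe, smul_dotProduct, norm_smul, norm_inv, norm_pow, Complex.norm_real, Real.norm_of_nonneg hR.le]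
                have h5 := dot_cs (star w') (f (ex θ))
                rw [Data.eucl_star, (D.levelR θ0 w').1 hwe] at h5
                calc (R ^ 2)⁻¹ * ‖star w' ⬝ᵥ f (ex θ)‖ ≤ (R ^ 2)⁻¹ * (R * a) := by gcongr
                  _ = a / R := by field_simp
              linarith
            have h6 := max_bd (dcc_dot (diffContOnCl_const (c := nu Ψ θ0 w')) S.hf) hcirc hζ.1.le
            have h7 := norm_sub_norm_le (1:ℂ) (nu Ψ θ0 w' ⬝ᵥ f ζ)
            rw [norm_one] at h7
            have h8 : k * (σ / 2) ≤ k * (R - t) := by gcongr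
            have h9 : κ * σ ≤ k / 4 * σ := by gcongr
            have h10 : k / 4 * σ ≤ k * (σ / 2) := by nlinarith [mul_pos hk hσ0]
            linarith
        have hl := hlip (θ0, w') ⟨hθ10, by simp only; linarith, hw'R⟩ (θ0, w) ⟨hθ10, hws, hw'⟩
        simp only [Prod.mk_sub_mk, sub_self, Prod.norm_mk, norm_zero] at hl
        rw [max_eq_right (norm_nonneg _)] at hl
        have hl2 : ‖nu Ψ θ0 w' - nu Ψ θ0 w‖ ≤ CL * (Cd * (p * σ)) := by
          refine hl.trans ?_
          gcongr
          exact hw'1.trans (by gcongr)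
        rw [dotProduct_comm] at h1
        have h2 := dot_lower (S.f_le D hζ.1.le) hl2 h1
        rw [dotProduct_comm] at h2
        refine hAh.trans (le_trans ?_ h2)
        have : n * R * (CL * (Cd * (p * σ))) = n * R * (CL * (Cd * p)) * σ := by ring
        rw [this]
        have : n * R * (CL * (Cd * p)) * σ ≤ κ / 4 * σ := by gcongr
        linarith
      · intro ζ h1 h2
        obtain ⟨θ, h3, rfl, h5⟩ := harc ζ h1 h2
        have h6 := hLth θ h3 θ0 hθ10 (f (ex θ)) (D.eucl_le_R (θ := θ) (by rw [S.lev' D θ]; exact S.htR))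
        rw [S.lev' D θ, max_eq_left (by linarith), abs_sub_comm] at h6
        have h7 := hQ (θ0, w) ⟨hθ10, hws, hw'⟩ (f (ex θ)) (by simp only; linarith)
        simp only at h7
        refine hAk.trans (le_trans ?_ h7)
        gcongr
        linarith

end S17

namespace S17

variable {n : ℕ} {Ψ : ℝ → (Fin n → ℂ) → ℝ} {R : ℝ}

namespace Sol
variable {t : ℝ} {f g : ℂ → Fin n → ℂ}

lemma eucl_le (S : Sol Ψ R t f g) (D : Data n Ψ R) {z : ℂ} (hz : ‖z‖ ≤ 1) : euclNorm (f z) ≤ R := by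
  have h1 : ‖star (f z) ⬝ᵥ f z‖ ≤ euclNorm (f z) * R := by
    refine max_bd (f := fun ζ => star (f z) ⬝ᵥ f ζ) (dcc_dot diffContOnCl_const S.hf) (fun θ hθ => ?_) hz
    refine (dot_cs _ _).trans ?_
    rw [Data.eucl_star]
    have := D.eucl_le_R (θ := θ) (w := f (ex θ)) (by rw [S.lev θ hθ]; exact S.htR)
    have := eucl_nonneg (f z)
    gcongr
  rw [dotProduct_comm, dot_star_self, Complex.norm_real, Real.norm_of_nonneg (by positivity)] at h1
  rcases (eucl_nonneg (f z)).lt_or_eq with h | h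
  · nlinarith
  · rw [← h]; linarith [D.hR]

end Sol

lemma max_re {h : ℂ → ℂ} {z : ℂ} {r C : ℝ} (hr : 0 < r) (hh : DiffContOnCl ℂ h (ball z r))
    (hb : ∀ ζ ∈ sphere z r, (h ζ).re ≤ C) : (h z).re ≤ C := by
  have hw : DiffContOnCl ℂ (fun z => Complex.exp (h z)) (ball z r) :=
    ⟨hh.differentiableOn.cexp, Complex.continuous_exp.comp_continuousOn hh.continuousOn⟩
  have := Complex.norm_le_of_forall_mem_frontier_norm_le isBounded_ball hw (C := Real.exp C) (fun ζ hζ => by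
    rw [frontier_ball _ hr.ne'] at hζ
    rw [Complex.norm_exp, Real.exp_le_exp]; exact hb ζ hζ) (subset_closure (mem_ball_self hr))
  rwa [Complex.norm_exp, Real.exp_le_exp] at this

/-- quadratic comparison implies a derivative bound -/
lemma deriv_of_re {F h : ℂ → ℂ} {z : ℂ} {r' r k C : ℝ} (hr : 0 < r) (hrr : r < r') (hk : 0 < k)
    (hF : DifferentiableOn ℂ F (ball z r')) (hh : DifferentiableOn ℂ h (ball z r')) (h0 : h z = 0)
    (hb : ∀ ζ ∈ sphere z r, k * ‖F ζ - F z‖ ^ 2 + (h ζ).re ≤ C) : k * (r * ‖deriv F z‖) ^ 2 ≤ C := by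
  set a := deriv F z with ha
  obtain ⟨u, hu1, hu2⟩ : ∃ u : ℂ, ‖u‖ = 1 ∧ u * a ^ 2 = ((‖a‖ ^ 2 : ℝ) : ℂ) := by
    by_cases h : a = 0
    · exact ⟨1, by simp, by simp [h]⟩
    · refine ⟨(starRingEnd ℂ a) ^ 2 / ((‖a‖ ^ 2 : ℝ) : ℂ), ?_, ?_⟩
      · rw [norm_div, norm_pow, RCLike.norm_conj, Complex.norm_real, Real.norm_of_nonneg (by positivity)]
        have := norm_pos_iff.2 h
        field_simp
      · have h2 : (starRingEnd ℂ a) * a = ((‖a‖ ^ 2 : ℝ) : ℂ) := by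
          rw [mul_comm, Complex.mul_conj, Complex.normSq_eq_norm_sq]
        have h3 : ((‖a‖ ^ 2 : ℝ) : ℂ) ≠ 0 := by
          have := norm_pos_iff.2 h
          exact_mod_cast (by positivity : (‖a‖ ^ 2 : ℝ) ≠ 0)
        rw [div_mul_eq_mul_div, ← mul_pow, h2, div_eq_iff h3]; ring
  have hz : ball z r' ∈ nhds z := ball_mem_nhds z (hr.trans hrr)
  have hd : DifferentiableOn ℂ (dslope F z) (ball z r') := (Complex.differentiableOn_dslope hz).2 hF
  set H : ℂ → ℂ := fun ζ => (k : ℂ) * ((r : ℂ) ^ 2 * (u * (dslope F z ζ) ^ 2)) + h ζ with hH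
  have hHd : DifferentiableOn ℂ H (ball z r') := by
    rw [hH]
    exact ((((hd.pow 2).const_mul u).const_mul _).const_mul _).add hh
  have hHc : DiffContOnCl ℂ H (ball z r) := by
    refine DifferentiableOn.diffContOnCl (hHd.mono ?_)
    rw [closure_ball _ hr.ne']
    exact closedBall_subset_ball hrr
  have := max_re hr hHc (C := C) (fun ζ hζ => by
    have hne : ζ ≠ z := fun h => by rw [h, mem_sphere, dist_self] at hζ; linarith
    have hn : ‖ζ - z‖ = r := by rwa [mem_sphere, dist_eq_norm] at hζ
    refine le_trans ?_ (hb ζ hζ)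
    rw [hH]
    simp only [Complex.add_re]
    gcongr
    rw [dslope_of_ne _ hne]
    refine (Complex.re_le_norm _).trans ?_
    rw [norm_mul, norm_mul, norm_mul, hu1, Complex.norm_real, Real.norm_of_nonneg hk.le, norm_pow, Complex.norm_real,
      Real.norm_of_nonneg hr.le, norm_pow, slope_def_module, norm_smul, norm_inv, hn]
    apply le_of_eq
    field_simp)
  rw [hH] at this
  simp only [dslope_same, ← ha, h0, add_zero, hu2] at this
  rw [Complex.re_ofReal_mul, ← Complex.ofReal_pow, Complex.re_ofReal_mul, Complex.ofReal_re] at this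
  rw [mul_pow]; exact this

set_option maxHeartbeats 2000000 in
theorem deriv_bd (D : Data n Ψ R) {s0 : ℝ} (hs0 : 0 < s0) : ∃ q δ0 C : ℝ, 0 < q ∧ q < 1 ∧ 0 < δ0 ∧ 0 < C ∧
    ∀ (t : ℝ) (f g : ℂ → Fin n → ℂ), Sol Ψ R t f g → s0 ≤ t → ∀ θ0 ∈ TI, ∀ j : ℕ, R * q ^ j ≤ s0 / 2 → ∀ r, 0 < r → r ≤ 1 →
      2 * r ≤ δ0 / 2 ^ j → ∀ i, ‖deriv (fun z => f z i) ((1 - r) * ex θ0)‖ ≤ C * Real.sqrt (R * q ^ j) / r := by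
  obtain ⟨q, δ0, κ, hq, hq1, hδ0, hκ, hcl⟩ := claims D hs0
  have hR1 := D.hR
  have hR : 0 < R := by linarith
  obtain ⟨δ, hδ, k, hk, C, hC, hLT⟩ := D.LT (D.KS_compact (s0 / 2)) (D.KS_ne (half_pos hs0))
  obtain ⟨N, hN, hNb⟩ := compact_bound (D.KS_compact (s0 / 2)) (D.gr_cont.mono (D.KS_ne (half_pos hs0)))
  set C' := C * (1 + (n * N) ^ 2) with hC'
  have hC'0 : 0 < C' := by positivity
  set B := 2 * R + 1 with hB
  have hB0 : 0 < B := by positivity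
  set η := min (1 / 2) (min (δ / (2 * B)) (Real.sqrt (k / (2 * C)) / (C' * B))) with hη
  have hη0 : 0 < η := by positivity
  have hη1 : η ≤ 1 / 2 := min_le_left _ _
  have hη2 : B * η < δ := by
    have : η ≤ δ / (2 * B) := (min_le_right _ _).trans (min_le_left _ _)
    rw [le_div_iff₀ (by positivity)] at this; linarith
  have hη3 : C * (C' * (B * η)) ^ 2 ≤ k / 2 := by
    have : η ≤ Real.sqrt (k / (2 * C)) / (C' * B) := (min_le_right _ _).trans (min_le_right _ _)
    rw [le_div_iff₀ (by positivity)] at this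
    have h2 : (C' * (B * η)) ^ 2 ≤ k / (2 * C) := by
      rw [← Real.sq_sqrt (by positivity : 0 ≤ k / (2 * C))]
      have h3 : C' * (B * η) = η * (C' * B) := by ring
      rw [h3]
      gcongr
    calc C * (C' * (B * η)) ^ 2 ≤ C * (k / (2 * C)) := by gcongr
      _ = k / 2 := by field_simp
  set C3 := 2 + 4 * C * R with hC3
  have hC30 : 0 < C3 := by positivity
  refine ⟨q, δ0, Real.sqrt (2 * C3 / k) / η, by linarith, hq1, hδ0, by positivity, ?_⟩
  intro t f g S hst θ0 hθ0 j hj r hr hr1 hrδ i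
  set σ := R * q ^ j with hσ
  have hq0 : 0 < q := by linarith
  have hσ0 : 0 < σ := by positivity
  have hσR : σ ≤ R := by rw [hσ]; have := pow_le_one₀ hq0.le hq1.le (n := j); nlinarith
  set z : ℂ := (1 - r) * ex θ0 with hz
  have hexx : ex θ0 * (starRingEnd ℂ) (ex θ0) = 1 := by
    rw [Complex.mul_conj, Complex.normSq_eq_norm_sq, ex_norm]; norm_num
  have hzn : ‖z‖ = 1 - r := by
    rw [hz, norm_mul, ex_norm, mul_one, ← Complex.ofReal_one, ← Complex.ofReal_sub, Complex.norm_real,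
      Real.norm_of_nonneg (by linarith)]
  have hball : ∀ ζ ∈ ball z r, ‖ζ‖ < 1 ∧ ζ ∈ cap θ0 (δ0 / 2 ^ j) := by
    intro ζ hζ
    rw [mem_ball, dist_eq_norm] at hζ
    have h1 : ‖ζ‖ < 1 := by
      have := norm_add_le z (ζ - z); rw [add_sub_cancel] at this; linarith
    refine ⟨h1, h1, ?_⟩
    have h2 : ζ * (starRingEnd ℂ) (ex θ0) = ((1 - r : ℝ) : ℂ) + (ζ - z) * (starRingEnd ℂ) (ex θ0) := by
      rw [hz]; push_cast; linear_combination (1 - (r:ℂ)) * (-hexx) + 0 * hexx + 2 * (1 - (r:ℂ)) * hexx - (1 - (r:ℂ)) * hexx + (1 - (r:ℂ)) * hexx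
    rw [h2, Complex.add_re, Complex.ofReal_re]
    have h3 := (abs_le.1 (Complex.abs_re_le_norm ((ζ - z) * (starRingEnd ℂ) (ex θ0)))).1
    rw [norm_mul, RCLike.norm_conj, ex_norm, mul_one] at h3
    linarith
  have hlev : ∀ ζ ∈ ball z r, t - σ < Ψ θ0 (f ζ) ∧ Ψ θ0 (f ζ) < t + σ ∧ Ψ θ0 (f ζ) ≤ R := by
    intro ζ hζ
    obtain ⟨h1, h2⟩ := hball ζ hζ
    have h3 := hcl t f g S hst θ0 hθ0 j ζ h2
    have h4 : Ψ θ0 (f ζ) ≤ R := D.le_R (S.eucl_le D h1.le)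
    have h5 : 0 < κ * σ := by positivity
    refine ⟨?_, ?_, h4⟩
    · by_contra hcon
      have := h3.1 (f ζ) (not_lt.1 hcon)
      rw [S.dot_one D h1.le, sub_self, norm_zero] at this
      linarith
    · by_contra hcon
      have := h3.2 (f ζ) (not_lt.1 hcon) h4
      rw [nu_dot_self (D.cc_ne (by have := S.ht; linarith [not_lt.1 hcon]) h4), sub_self, norm_zero] at this
      linarith
  have hzb : z ∈ ball z r := mem_ball_self hr
  have hp : (θ0, f z) ∈ Data.KS Ψ R (s0 / 2) := ⟨TI_sub hθ0, by have := (hlev z hzb).1; simp only; linarith, (hlev z hzb).2.2⟩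
  have hfd : DifferentiableOn ℂ f (ball z r) := S.hf.differentiableOn.mono fun ζ hζ => by simpa using (hball ζ hζ).1
  have hfi : ∀ i, DifferentiableOn ℂ (fun ζ => f ζ i) (ball z r) := fun i => differentiableOn_pi.1 hfd i
  set G := gr Ψ θ0 (f z) with hG
  have hGN : ‖G‖ ≤ N := hNb (θ0, f z) hp
  set e : ℂ → ℂ := fun ζ => (f ζ - f z) ⬝ᵥ G with he
  have hed : DifferentiableOn ℂ e (ball z r) := by
    rw [he]; unfold dotProduct
    exact DifferentiableOn.fun_sum fun i _ => ((hfi i).sub_const _).mul_const _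
  have hez : e z = 0 := by rw [he]; simp
  have key := deriv_of_re (F := fun ζ => f ζ i) (h := fun ζ => 2 * e ζ + C * e ζ ^ 2) (z := z) (r' := r) (r := η * r) (k := k / 2)
    (C := C3 * σ) (by positivity) (by nlinarith) (by positivity) (hfi i) ((hed.const_mul 2).add ((hed.pow 2).const_mul _))
    (by simp [hez]) ?_
  · have h1 : (η * r * ‖deriv (fun z => f z i) z‖) ^ 2 ≤ 2 * C3 / k * σ := by
      rw [div_mul_eq_mul_div, le_div_iff₀ hk]; linarith
    have h2 := Real.le_sqrt_of_sq_le h1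
    rw [Real.sqrt_mul (by positivity)] at h2
    rw [le_div_iff₀ hr, div_mul_eq_mul_div, le_div_iff₀ hη0]
    linarith
  · intro ζ hζ
    rw [mem_sphere] at hζ
    have hζb : ζ ∈ ball z r := by rw [mem_ball, hζ]; nlinarith
    set d := f ζ - f z with hd
    have hdB : ‖d‖ ≤ B * η := by
      have h1 := Complex.dist_le_div_mul_dist_of_mapsTo_ball (R₂ := B) hfd (fun x hx => by
        rw [mem_closedBall, dist_eq_norm]
        have h2 := norm_sub_le (f x) (f z)
        have h3 := S.f_le D (hball x hx).1.le
        have h4 := S.f_le D (hball z hzb).1.le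
        rw [hB]; linarith) hζb
      rw [dist_eq_norm, hζ] at h1
      refine h1.trans (le_of_eq ?_)
      field_simp
    obtain ⟨l1, l2, -, -⟩ := hLT (θ0, f z) hp d (hdB.trans_lt hη2)
    simp only [hd, add_sub_cancel] at l1 l2
    rw [← hd, ← hG] at l1 l2
    have hee : e ζ = d ⬝ᵥ G := rfl
    rw [← hee] at l1 l2
    obtain ⟨a1, a2, -⟩ := hlev ζ hζb
    obtain ⟨b1, b2, -⟩ := hlev z hzb
    have hen : ‖e ζ‖ ^ 2 ≤ (n * N) ^ 2 * ‖d‖ ^ 2 := by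
      have h1 : ‖e ζ‖ ≤ n * N * ‖d‖ := by
        refine (dot_norm_le _ _).trans ?_
        rw [mul_right_comm]
        gcongr
      calc ‖e ζ‖ ^ 2 ≤ (n * N * ‖d‖) ^ 2 := by gcongr
        _ = _ := by ring
    have hsq : ‖e ζ‖ ^ 2 = 2 * (e ζ).re ^ 2 - (e ζ ^ 2).re := by
      rw [← Complex.normSq_eq_norm_sq, Complex.normSq_apply, pow_two (e ζ), Complex.mul_re]; ring
    have hre : |2 * (e ζ).re| ≤ 2 * σ + C' * ‖d‖ ^ 2 := by
      have h1 : C * ‖e ζ‖ ^ 2 ≤ C * ((n * N) ^ 2 * ‖d‖ ^ 2) := by gcongr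
      have h2 : C' * ‖d‖ ^ 2 = C * ‖d‖ ^ 2 + C * ((n * N) ^ 2 * ‖d‖ ^ 2) := by rw [hC']; ring
      have h3 : 0 ≤ C * ‖d‖ ^ 2 := by positivity
      have h4 : 0 ≤ C * ((n * N) ^ 2 * ‖d‖ ^ 2) := by positivity
      have h5 : 0 ≤ k * ‖d‖ ^ 2 := by positivity
      rw [abs_le]
      constructor <;> linarith
    have hre2 : 2 * (e ζ).re ^ 2 ≤ 4 * σ ^ 2 + (C' * ‖d‖ ^ 2) ^ 2 := by
      have h1 := sq_le_sq' (by linarith [(abs_le.1 hre).1]) ((abs_le.1 hre).2)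
      have h2 := sq_nonneg (2 * σ - C' * ‖d‖ ^ 2)
      have h3 : (2 * (e ζ).re) ^ 2 = 4 * (e ζ).re ^ 2 := by ring
      have h4 : (2 * σ + C' * ‖d‖ ^ 2) ^ 2 + (2 * σ - C' * ‖d‖ ^ 2) ^ 2 = 8 * σ ^ 2 + 2 * (C' * ‖d‖ ^ 2) ^ 2 := by ring
      linarith
    have h6 : C * (C' * ‖d‖ ^ 2) ^ 2 ≤ k / 2 * ‖d‖ ^ 2 := by
      calc C * (C' * ‖d‖ ^ 2) ^ 2 = C * (C' * ‖d‖) ^ 2 * ‖d‖ ^ 2 := by ring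
        _ ≤ C * (C' * (B * η)) ^ 2 * ‖d‖ ^ 2 := by gcongr
        _ ≤ _ := by gcongr
    have h7 : C * (4 * σ ^ 2) ≤ 4 * C * R * σ := by
      have h8 : (C * σ) * σ ≤ (C * σ) * R := mul_le_mul_of_nonneg_left (by linarith) (mul_pos hC hσ0).le
      linarith
    have hC2 : C * ‖e ζ‖ ^ 2 ≤ C * (4 * σ ^ 2 + (C' * ‖d‖ ^ 2) ^ 2) - C * (e ζ ^ 2).re := by
      rw [hsq]
      have : C * (2 * (e ζ).re ^ 2) ≤ C * (4 * σ ^ 2 + (C' * ‖d‖ ^ 2) ^ 2) := by gcongr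
      linarith
    have hdi : k / 2 * ‖f ζ i - f z i‖ ^ 2 ≤ k / 2 * ‖d‖ ^ 2 := by
      have := norm_le_pi_norm d i
      gcongr
      exact this
    have hhre : (2 * e ζ + C * e ζ ^ 2).re = 2 * (e ζ).re + C * (e ζ ^ 2).re := by
      rw [Complex.add_re, Complex.re_ofReal_mul, show (2 : ℂ) = ((2 : ℝ) : ℂ) by norm_num, Complex.re_ofReal_mul]
    rw [hhre, hC3]
    linarith

end S17

namespace S17
variable {n : ℕ} {Ψ : ℝ → (Fin n → ℂ) → ℝ} {R : ℝ}

lemma radial_norm {r : ℝ} (hr0 : 0 ≤ r) (hr : r ≤ 1) (θ : ℝ) : ‖(1 - (r:ℂ)) * ex θ‖ = 1 - r := by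
  rw [norm_mul, ex_norm, mul_one, ← Complex.ofReal_one, ← Complex.ofReal_sub, Complex.norm_real,
      Real.norm_of_nonneg (by linarith)]

lemma radial_mv {f : ℂ → ℂ} (hf : DifferentiableOn ℂ f (ball 0 1)) {a b M : ℝ} {θ : ℝ} (ha : 0 < a) (hb : b ≤ 1) (hab : a ≤ b)
    (hM : ∀ s ∈ Icc a b, ‖deriv f ((1 - (s:ℂ)) * ex θ)‖ ≤ M) :
    ‖f ((1 - (b:ℂ)) * ex θ) - f ((1 - (a:ℂ)) * ex θ)‖ ≤ M * (b - a) := by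
  have h1 : ∀ s ∈ Icc a b, HasDerivWithinAt (fun s : ℝ => f ((1 - (s:ℂ)) * ex θ)) (deriv f ((1 - (s:ℂ)) * ex θ) * (-ex θ)) (Icc a b) s := by
    intro s hs
    have h2 : (1 - (s:ℂ)) * ex θ ∈ ball (0:ℂ) 1 := by
      rw [mem_ball_zero_iff, radial_norm (by linarith [hs.1]) (by linarith [hs.2])]; linarith [hs.1]
    have h3 : HasDerivAt f (deriv f ((1 - (s:ℂ)) * ex θ)) ((1 - (s:ℂ)) * ex θ) :=
      (hf.differentiableAt (isOpen_ball.mem_nhds h2)).hasDerivAt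
    have h4 : HasDerivAt (fun s : ℂ => (1 - s) * ex θ) (-ex θ) (s:ℂ) := by
      have := ((hasDerivAt_id (s:ℂ)).const_sub 1).mul_const (ex θ)
      simpa using this
    have h5 := (HasDerivAt.comp (s:ℂ) h3 h4).comp_ofReal
    exact h5.hasDerivWithinAt
  have h2 := Convex.norm_image_sub_le_of_norm_hasDerivWithin_le (C := M) h1 (fun s hs => by
    rw [norm_mul, norm_neg, ex_norm, mul_one]; exact hM s hs) (convex_Icc a b) (left_mem_Icc.2 hab) (right_mem_Icc.2 hab)
  rw [Real.norm_of_nonneg (by linarith)] at h2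
  exact h2

set_option maxHeartbeats 1000000 in
theorem equicont (D : Data n Ψ R) {s0 : ℝ} (hs0 : 0 < s0) {ε : ℝ} (hε : 0 < ε) : ∃ δ > 0,
    ∀ (t : ℝ) (f g : ℂ → Fin n → ℂ), Sol Ψ R t f g → s0 ≤ t → ∀ x x' : ℂ, ‖x‖ = 1 → ‖x'‖ = 1 → ‖x - x'‖ < δ → ‖f x - f x'‖ ≤ ε := by
  obtain ⟨q, δ0, C, hq0, hq1, hδ0, hC, hd⟩ := deriv_bd D hs0
  have hR : 0 < R := by have := D.hR; linarith
  set a := Real.sqrt q with ha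
  have ha0 : 0 < a := Real.sqrt_pos.2 hq0
  have ha1 : a < 1 := by rw [ha, Real.sqrt_lt' one_pos]; linarith
  have e1 : Tendsto (fun J : ℕ => δ0 / 2 ^ J / 2) atTop (nhds 0) := by
    have := (tendsto_pow_atTop_nhds_zero_of_lt_one (r := (1/2:ℝ)) (by norm_num) (by norm_num)).const_mul (δ0 / 2)
    rw [mul_zero] at this
    refine this.congr fun J => ?_
    rw [one_div, inv_pow]; ring
  have e2 : Tendsto (fun J : ℕ => R * q ^ J) atTop (nhds 0) := by
    simpa using (tendsto_pow_atTop_nhds_zero_of_lt_one hq0.le hq1).const_mul R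
  have e3 : Tendsto (fun J : ℕ => C * Real.sqrt R * a ^ J / (1 - a)) atTop (nhds 0) := by
    simpa using ((tendsto_pow_atTop_nhds_zero_of_lt_one ha0.le ha1).const_mul (C * Real.sqrt R)).div_const (1 - a)
  obtain ⟨J, hJ1, hJ2, hJ3⟩ := ((e1.eventually_lt_const one_pos).and ((e2.eventually_lt_const (half_pos hs0)).and
    (e3.eventually_lt_const (by positivity : 0 < ε / 3)))).exists
  set r : ℕ → ℝ := fun m => δ0 / 2 ^ (J + m) / 2 with hr
  have hr0 : ∀ m, 0 < r m := fun m => by rw [hr]; positivity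
  have hrs : ∀ m, r m = 2 * r (m + 1) := fun m => by simp only [hr]; rw [← add_assoc, pow_succ 2 (J + m)]; field_simp
  have hr1 : ∀ m, r m ≤ 1 := by
    intro m
    induction m with
    | zero => exact hJ1.le
    | succ m ih => linarith [hrs m, hr0 m]
  have hr' : Tendsto r atTop (nhds 0) := by
    have := e1.comp (tendsto_add_atTop_nat J)
    refine this.congr fun m => ?_
    simp only [hr, Function.comp, add_comm J]
  have hqa : ∀ m, Real.sqrt (R * q ^ m) = Real.sqrt R * a ^ m := by
    intro m
    have h1 : Real.sqrt (q ^ m) = a ^ m := by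
      rw [Real.sqrt_eq_iff_mul_self_eq (by positivity) (by positivity), ← mul_pow, ha, Real.mul_self_sqrt hq0.le]
    rw [Real.sqrt_mul hR.le, h1]
  have main : ∀ (t : ℝ) (f g : ℂ → Fin n → ℂ), Sol Ψ R t f g → s0 ≤ t → ∀ θ ∈ TI,
      ‖f ((1 - (r 0 : ℂ)) * ex θ) - f (ex θ)‖ ≤ ε / 3 := by
    intro t f g S hst θ hθ
    rw [pi_norm_le_iff_of_nonneg (by positivity)]
    intro i
    have hfi : DifferentiableOn ℂ (fun z => f z i) (ball 0 1) := differentiableOn_pi.1 S.hf.differentiableOn i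
    have h1 : ∀ m, dist (f ((1 - (r m : ℂ)) * ex θ) i) (f ((1 - (r (m+1) : ℂ)) * ex θ) i) ≤ C * Real.sqrt R * a ^ J * a ^ m := by
      intro m
      rw [dist_eq_norm]
      have h2 := radial_mv (f := fun z => f z i) (θ := θ) (a := r (m+1)) (b := r m) (M := C * Real.sqrt (R * q ^ (J + m)) / r (m+1)) hfi
        (hr0 _) (hr1 m) (by linarith [hrs m, hr0 (m+1)]) (by
          intro s hs
          have h3 := hd t f g S hst θ hθ (J + m) (by
            have : q ^ (J + m) ≤ q ^ J := pow_le_pow_of_le_one hq0.le hq1.le (by omega)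
            have := mul_le_mul_of_nonneg_left this hR.le
            linarith) s (by linarith [hs.1, hr0 (m+1)]) (by linarith [hs.2, hr1 m]) (by
            have : δ0 / 2 ^ (J + m) = 2 * r m := by simp only [hr]; ring
            rw [this]; linarith [hs.2]) i
          refine h3.trans ?_
          have := hr0 (m+1)
          have := hs.1
          gcongr)
      refine h2.trans (le_of_eq ?_)
      have h3 : r m - r (m+1) = r (m+1) := by linarith [hrs m]
      rw [h3, div_mul_cancel₀ _ (hr0 _).ne', hqa, pow_add]; ring
    have h2 : Tendsto (fun m => f ((1 - (r m : ℂ)) * ex θ) i) atTop (nhds (f (ex θ) i)) := by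
      have h3 : ContinuousOn (fun z => f z i) (closedBall 0 1) := (continuous_apply i).comp_continuousOn (DiffContOnCl.cl S.hf)
      have h4 : ContinuousWithinAt (fun z => f z i) (closedBall 0 1) (ex θ) := h3 (ex θ) (by simp [ex_norm])
      refine h4.tendsto.comp (tendsto_nhdsWithin_iff.2 ⟨?_, ?_⟩)
      · have h5 : Tendsto (fun m => (1 - (r m : ℂ)) * ex θ) atTop (nhds ((1 - ((0:ℝ):ℂ)) * ex θ)) :=
          (((Complex.continuous_ofReal.tendsto 0).comp hr').const_sub 1).mul_const _
        simpa using h5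
      · filter_upwards with m
        rw [mem_closedBall_zero_iff, radial_norm (hr0 m).le (hr1 m)]; linarith [hr0 m]
    have h3 := dist_le_of_le_geometric_of_tendsto₀ a (C * Real.sqrt R * a ^ J) ha1 h1 h2
    rw [dist_eq_norm] at h3
    exact h3.trans hJ3.le
  refine ⟨r 0 * min 1 (ε / (3 * (2 * R + 1))), mul_pos (hr0 0) (by positivity), ?_⟩
  intro t f g S hst x x' hx hx' hxx
  obtain ⟨θ, hθ, rfl⟩ := exists_ex hx
  obtain ⟨θ', hθ', rfl⟩ := exists_ex hx'
  have m1 := main t f g S hst θ hθ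
  have m2 := main t f g S hst θ' hθ'
  set z := (1 - (r 0 : ℂ)) * ex θ with hz
  set z' := (1 - (r 0 : ℂ)) * ex θ' with hz'
  have hzz : ‖z' - z‖ ≤ ‖ex θ - ex θ'‖ := by
    rw [hz, hz', ← mul_sub, norm_mul, norm_sub_rev (ex θ')]
    have h1 : ‖1 - (r 0 : ℂ)‖ ≤ 1 := by
      rw [← Complex.ofReal_one, ← Complex.ofReal_sub, Complex.norm_real, Real.norm_of_nonneg (by linarith [hr1 0])]
      linarith [hr0 0]
    exact mul_le_of_le_one_left (norm_nonneg _) h1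
  have hb : ∀ ζ ∈ ball z (r 0), ‖ζ‖ < 1 := by
    intro ζ hζ
    rw [mem_ball, dist_eq_norm] at hζ
    have h1 := norm_add_le z (ζ - z)
    rw [add_sub_cancel, hz, radial_norm (hr0 0).le (hr1 0)] at h1
    rw [hz] at hζ
    linarith
  have hr00 := hr0 0
  have m3 : ‖f z' - f z‖ ≤ ε / 3 := by
    have h0 : z' ∈ ball z (r 0) := by
      rw [mem_ball, dist_eq_norm]
      refine (hzz.trans_lt hxx).trans_le ?_
      exact mul_le_of_le_one_right hr00.le (min_le_left _ _)
    have hfd : DifferentiableOn ℂ f (ball z (r 0)) := S.hf.differentiableOn.mono fun ζ hζ => by simpa using hb ζ hζ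
    have h1 := Complex.dist_le_div_mul_dist_of_mapsTo_ball (R₂ := 2 * R + 1) hfd (fun y hy => by
        rw [mem_closedBall, dist_eq_norm]
        have h2 := norm_sub_le (f y) (f z)
        have h3 := S.f_le D (hb y hy).le
        have h4 := S.f_le D (hb z (mem_ball_self hr00)).le
        linarith) h0
    rw [dist_eq_norm, dist_eq_norm] at h1
    refine h1.trans ?_
    have h2 : ‖z' - z‖ ≤ r 0 * (ε / (3 * (2 * R + 1))) :=
      (hzz.trans hxx.le).trans (mul_le_mul_of_nonneg_left (min_le_right _ _) hr00.le)
    calc (2 * R + 1) / r 0 * ‖z' - z‖ ≤ (2 * R + 1) / r 0 * (r 0 * (ε / (3 * (2 * R + 1)))) := by gcongr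
      _ = ε / 3 := by field_simp
  calc ‖f (ex θ) - f (ex θ')‖ = ‖-(f z - f (ex θ)) - (f z' - f z) + (f z' - f (ex θ'))‖ := by congr 1; abel
    _ ≤ ‖f z - f (ex θ)‖ + ‖f z' - f z‖ + ‖f z' - f (ex θ')‖ := by
        refine (norm_add_le _ _).trans ?_
        gcongr
        refine (norm_sub_le _ _).trans ?_
        rw [norm_neg]
    _ ≤ ε := by linarith

end S17

namespace S17

/-- the circle as an additive group -/
abbrev TT : Type := AddCircle (2 * Real.pi)
/-- normalized Haar measure -/
abbrev mT : Measure TT := AddCircle.haarAddCircle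
/-- square integrable functions on the circle -/
abbrev L2 : Type := Lp ℂ 2 mT

/-- Sobolev weight -/
def wt (j : ℤ) : ℝ := Real.sqrt (1 + (j:ℝ)^2)

lemma wt_sq (j : ℤ) : wt j ^ 2 = 1 + (j:ℝ)^2 := Real.sq_sqrt (by positivity)
lemma wt_pos (j : ℤ) : 0 < wt j := Real.sqrt_pos.2 (by positivity)
lemma one_le_wt (j : ℤ) : 1 ≤ wt j := Real.one_le_sqrt.2 (by nlinarith [sq_nonneg (j:ℝ)])
lemma abs_le_wt (j : ℤ) : |(j:ℝ)| ≤ wt j := Real.abs_le_sqrt (by linarith)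
lemma wt_neg (j : ℤ) : wt (-j) = wt j := by simp [wt]
lemma wtC_ne (j : ℤ) : (wt j : ℂ) ≠ 0 := by exact_mod_cast (wt_pos j).ne'

lemma seq2_sum (a : Seq2) : HasSum (fun j => ‖a j‖ ^ 2) (‖a‖ ^ 2) := by
  have := lp.hasSum_norm (p := 2) (by norm_num) a
  simpa using this

lemma diag_mem {m : ℤ → ℂ} (hm : ∀ j, ‖m j‖ ≤ 1) (a : Seq2) : Memℓp (fun j => m j * a j) 2 := by
  refine memℓp_gen ?_
  have h := (seq2_sum a).summable
  simp only [ENNReal.toReal_ofNat, Real.rpow_ofNat]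
  refine Summable.of_nonneg_of_le (fun j => by positivity) (fun j => ?_) h
  rw [norm_mul]
  have := hm j
  gcongr
  exact mul_le_of_le_one_left (norm_nonneg _) this

/-- diagonal Fourier multiplier -/
def diag (m : ℤ → ℂ) (hm : ∀ j, ‖m j‖ ≤ 1) : Seq2 →L[ℂ] Seq2 :=
  LinearMap.mkContinuous
    { toFun := fun a => ⟨fun j => m j * a j, diag_mem hm a⟩
      map_add' := fun a b => by ext j; exact mul_add _ _ _
      map_smul' := fun c a => by ext j; simp; ring } 1 (fun a => by
      rw [one_mul]
      have h1 := seq2_sum (⟨fun j => m j * a j, diag_mem hm a⟩ : Seq2)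
      have h2 := hasSum_le (fun j => by
        show ‖m j * a j‖ ^ 2 ≤ ‖a j‖ ^ 2
        rw [norm_mul]
        have := hm j
        gcongr
        exact mul_le_of_le_one_left (norm_nonneg _) this) h1 (seq2_sum a)
      exact le_of_sq_le_sq h2 (norm_nonneg _))

@[simp] lemma diag_apply (m : ℤ → ℂ) (hm : ∀ j, ‖m j‖ ≤ 1) (a : Seq2) (j : ℤ) : diag m hm a j = m j * a j := rfl

lemma diag_norm (m : ℤ → ℂ) (hm : ∀ j, ‖m j‖ ≤ 1) (a : Seq2) : ‖diag m hm a‖ ≤ ‖a‖ := by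
  have := (diag m hm).le_of_opNorm_le (LinearMap.mkContinuous_norm_le _ zero_le_one _) a
  simpa using this

lemma inv_wt_le (j : ℤ) : ‖((wt j : ℂ))⁻¹‖ ≤ 1 := by
  rw [norm_inv, Complex.norm_real, Real.norm_of_nonneg (wt_pos j).le]
  exact inv_le_one_of_one_le₀ (one_le_wt j)

lemma j_wt_le (j : ℤ) : ‖Complex.I * j / (wt j : ℂ)‖ ≤ 1 := by
  rw [norm_div, norm_mul, Complex.norm_I, one_mul, Complex.norm_real, Real.norm_of_nonneg (wt_pos j).le, Complex.norm_intCast]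
  rw [div_le_one (wt_pos j)]
  exact abs_le_wt j

/-- Fourier coefficients of the function -/
def dW : Seq2 →L[ℂ] Seq2 := diag (fun j => ((wt j : ℂ))⁻¹) inv_wt_le
/-- Fourier coefficients of the derivative -/
def dD : Seq2 →L[ℂ] Seq2 := diag (fun j => Complex.I * j / (wt j : ℂ)) j_wt_le

lemma dW_apply (a : Seq2) (j : ℤ) : dW a j = (wt j : ℂ)⁻¹ * a j := rfl
lemma dD_apply (a : Seq2) (j : ℤ) : dD a j = Complex.I * j / (wt j : ℂ) * a j := rfl

lemma summable_wt : Summable (fun j : ℤ => (wt j)⁻¹ ^ 2) := by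
  have h : Summable (fun j : ℤ => 1 / (j:ℝ) ^ 2) := Real.summable_one_div_int_pow.2 (by norm_num)
  refine Summable.of_norm_bounded_eventually h ?_
  have : ∀ᶠ j : ℤ in cofinite, j ≠ 0 := by
    rw [eventually_cofinite]; simp
  filter_upwards [this] with j hj
  rw [Real.norm_of_nonneg (by positivity), inv_pow, wt_sq, one_div]
  have : 0 < (j:ℝ)^2 := by positivity
  gcongr; linarith

/-- Sobolev constant -/
def KW : ℝ := Real.sqrt (∑' j : ℤ, (wt j)⁻¹ ^ 2)

lemma cs_sum (a : Seq2) (m : ℤ → ℝ) (hm0 : ∀ j, 0 ≤ m j) (hm : Summable (fun j => m j ^ 2)) :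
    Summable (fun j => m j * ‖a j‖) ∧ ∑' j, m j * ‖a j‖ ≤ Real.sqrt (∑' j, m j ^ 2) * ‖a‖ := by
  have h2 := seq2_sum a
  have hs : Summable (fun j => m j * ‖a j‖) := by
    refine Summable.of_nonneg_of_le (fun j => mul_nonneg (hm0 j) (norm_nonneg _)) (fun j => ?_) (hm.add h2.summable)
    nlinarith [sq_nonneg (m j - ‖a j‖), sq_nonneg (m j), sq_nonneg ‖a j‖]
  refine ⟨hs, hs.tsum_le_of_sum_le fun s => ?_⟩
  have h3 := Finset.sum_mul_sq_le_sq_mul_sq s m (fun j => ‖a j‖)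
  have h4 : ∑ j ∈ s, m j ^ 2 ≤ ∑' j, m j ^ 2 := hm.sum_le_tsum s fun j _ => sq_nonneg _
  have h5 : ∑ j ∈ s, ‖a j‖ ^ 2 ≤ ‖a‖ ^ 2 := by
    rw [← h2.tsum_eq]; exact h2.summable.sum_le_tsum s fun j _ => sq_nonneg _
  refine abs_le_of_sq_le_sq' ?_ (by positivity) |>.2
  rw [mul_pow, Real.sq_sqrt (tsum_nonneg fun j => sq_nonneg _)]
  refine h3.trans ?_
  gcongr

lemma dW_summable (a : Seq2) : Summable (fun j => ‖dW a j‖) ∧ ∑' j, ‖dW a j‖ ≤ KW * ‖a‖ := by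
  have h := cs_sum a (fun j => (wt j)⁻¹) (fun j => (inv_pos.2 (wt_pos j)).le) summable_wt
  have e : (fun j => ‖dW a j‖) = fun j => (wt j)⁻¹ * ‖a j‖ := by
    ext j
    rw [dW_apply, norm_mul, norm_inv, Complex.norm_real, Real.norm_of_nonneg (wt_pos j).le]
  rw [e]; exact h

lemma dW_term_summable (a : Seq2) : Summable (fun j => dW a j • (fourier j : C(TT, ℂ))) := by
  refine Summable.of_norm ?_
  simp only [norm_smul, fourier_norm, mul_one]
  exact (dW_summable a).1

/-- the continuous function represented by a sequence -/
def ev : Seq2 →L[ℂ] C(TT, ℂ) :=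
  LinearMap.mkContinuous
    { toFun := fun a => ∑' j, dW a j • (fourier j : C(TT, ℂ))
      map_add' := fun a b => by
        rw [← (dW_term_summable a).tsum_add (dW_term_summable b)]
        congr 1; ext j : 1
        rw [map_add, ← add_smul]; rfl
      map_smul' := fun c a => by
        rw [RingHom.id_apply, ← (dW_term_summable a).tsum_const_smul c]
        congr 1; ext j : 1
        rw [map_smul, smul_smul]; rfl } KW (fun a => by
      refine le_trans (norm_tsum_le_tsum_norm ?_) ?_
      · simp only [norm_smul, fourier_norm, mul_one]; exact (dW_summable a).1
      · simp only [norm_smul, fourier_norm, mul_one]; exact (dW_summable a).2)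

lemma ev_def (a : Seq2) : ev a = ∑' j, dW a j • (fourier j : C(TT, ℂ)) := rfl

lemma ev_norm_le (a : Seq2) : ‖ev a‖ ≤ ∑' j, ‖dW a j‖ := by
  rw [ev_def]
  refine le_trans (norm_tsum_le_tsum_norm ?_) ?_
  · simp only [norm_smul, fourier_norm, mul_one]; exact (dW_summable a).1
  · simp only [norm_smul, fourier_norm, mul_one]; exact le_rfl

lemma ev_hasSum (a : Seq2) (x : TT) : HasSum (fun j => dW a j * fourier j x) (ev a x) := by
  have h := (dW_term_summable a).hasSum
  rw [← ev_def] at h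
  exact h.mapL (ContinuousMap.evalCLM ℂ x)

/-- square-integrable class of a continuous function -/
def cL : C(TT, ℂ) →L[ℂ] L2 := ContinuousMap.toLp 2 mT ℂ

/-- Fourier coefficients as an isometry -/
def FC : L2 ≃ₗᵢ[ℂ] Seq2 := fourierBasis.repr

lemma FC_fourier (j : ℤ) : FC (cL (fourier j)) = lp.single 2 j (1:ℂ) := by
  have : cL (fourier j) = fourierBasis j := by rw [coe_fourierBasis]; rfl
  rw [this]
  exact fourierBasis.repr_self j

lemma FC_ev (a : Seq2) : FC (cL (ev a)) = dW a := by
  have h := (dW_term_summable a).hasSum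
  rw [← ev_def] at h
  have h2 := (h.mapL cL).mapL (FC.toContinuousLinearEquiv : L2 →L[ℂ] Seq2)
  have h4 := lp.hasSum_single (p := 2) (by norm_num) (dW a)
  refine h2.unique ?_
  convert h4 using 1
  ext j : 1
  show FC (cL (dW a j • (fourier j : C(TT, ℂ)))) = _
  rw [map_smul, map_smul, FC_fourier, ← lp.single_smul, smul_eq_mul, mul_one]

lemma FC_apply (h : L2) (j : ℤ) : FC h j = fourierCoeff h j := fourierBasis_repr h j

lemma FC_cL (f : C(TT, ℂ)) (j : ℤ) : FC (cL f) j = fourierCoeff f j := by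
  rw [FC_apply]; exact fourierCoeff_toLp f j

lemma cL_inj {f g : C(TT, ℂ)} (h : ∀ j, FC (cL f) j = FC (cL g) j) : f = g := by
  have h1 : FC (cL f) = FC (cL g) := by ext j; exact h j
  exact ContinuousMap.toLp_injective mT (FC.injective h1)

/-- derivative -/
def dv : Seq2 →L[ℂ] L2 := (FC.symm.toContinuousLinearEquiv : Seq2 →L[ℂ] L2).comp dD

lemma FC_dv (a : Seq2) : FC (dv a) = dD a := FC.apply_symm_apply _

/-- reconstruct from function and derivative -/
def rc : C(TT, ℂ) × L2 →L[ℂ] Seq2 :=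
  (dW.comp (FC.toContinuousLinearEquiv : L2 →L[ℂ] Seq2)).comp (cL.comp (ContinuousLinearMap.fst ℂ _ _)) -
    (dD.comp (FC.toContinuousLinearEquiv : L2 →L[ℂ] Seq2)).comp (ContinuousLinearMap.snd ℂ _ _)

lemma rc_apply (f : C(TT, ℂ)) (h : L2) : rc (f, h) = dW (FC (cL f)) - dD (FC h) := rfl

/-- `h` is the weak derivative of `f` -/
def WD (f : C(TT, ℂ)) (h : L2) : Prop := ∀ j : ℤ, FC h j = Complex.I * j * FC (cL f) j

lemma WD_ev (a : Seq2) : WD (ev a) (dv a) := by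
  intro j
  rw [FC_dv, FC_ev, dD_apply, dW_apply]; ring

lemma rc_coef {f : C(TT, ℂ)} {h : L2} (hw : WD f h) (j : ℤ) : rc (f, h) j = wt j * FC (cL f) j := by
  rw [rc_apply, lp.coeFn_sub, Pi.sub_apply, dW_apply, dD_apply, hw j]
  have h1 := wtC_ne j
  have h2 : (wt j : ℂ) ^ 2 = 1 + (j:ℂ)^2 := by exact_mod_cast congrArg (fun x : ℝ => (x:ℂ)) (wt_sq j)
  field_simp
  linear_combination (-FC (cL f) j) * h2 - (j:ℂ)^2 * FC (cL f) j * Complex.I_sq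

lemma ev_rc {f : C(TT, ℂ)} {h : L2} (hw : WD f h) : ev (rc (f, h)) = f := by
  refine cL_inj fun j => ?_
  rw [FC_ev, dW_apply, rc_coef hw, inv_mul_cancel_left₀ (wtC_ne j)]

lemma dv_rc {f : C(TT, ℂ)} {h : L2} (hw : WD f h) : dv (rc (f, h)) = h := by
  refine FC.injective ?_
  ext j
  rw [FC_dv, dD_apply, rc_coef hw, hw j]
  have h1 := wtC_ne j
  field_simp

lemma ev_inj {a b : Seq2} (h : ev a = ev b) : a = b := by
  have : dW a = dW b := by rw [← FC_ev, ← FC_ev, h]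
  ext j
  have h2 := congrArg (fun c : Seq2 => c j) this
  simp only [dW_apply] at h2
  exact mul_left_cancel₀ (inv_ne_zero (wtC_ne j)) h2

lemma rc_ev (a : Seq2) : rc (ev a, dv a) = a := ev_inj (ev_rc (WD_ev a))

lemma coef_eq (a : Seq2) (j : ℤ) : a j = wt j * FC (cL (ev a)) j := by
  rw [FC_ev, dW_apply, mul_inv_cancel_left₀ (wtC_ne j)]

end S17

namespace S17

lemma fourier_ex (j : ℤ) (θ : ℝ) : fourier j (θ : TT) = Complex.exp (j * θ * Complex.I) := by
  rw [fourier_coe_apply]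
  congr 1
  have : (Real.pi : ℂ) ≠ 0 := by exact_mod_cast Real.pi_ne_zero
  push_cast
  field_simp

lemma fourier_one_ex (θ : ℝ) : fourier 1 (θ : TT) = ex θ := by
  rw [fourier_ex]; simp [ex]

lemma fourier_nat_ex (j : ℕ) (θ : ℝ) : fourier (j:ℤ) (θ : TT) = ex θ ^ j := by
  rw [fourier_ex, ex, ← Complex.exp_nat_mul]; congr 1; push_cast; ring

lemma FC_star (p : L2) (j : ℤ) : FC (star p) j = (starRingEnd ℂ) (FC p (-j)) := by
  rw [FC_apply, FC_apply, fourierCoeff, fourierCoeff, ← integral_conj]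
  refine integral_congr_ae ?_
  filter_upwards [Lp.coeFn_star p] with x hx
  rw [hx]
  simp [fourier_neg]

lemma pairing_zero {p q : L2} (hp : ∀ j < 0, FC p j = 0) (hq : ∀ j ≤ 0, FC q j = 0) : ∫ x, p x * q x ∂mT = 0 := by
  have h1 : ∫ x, p x * q x ∂mT = inner ℂ (star p) q := by
    rw [L2.inner_def]
    refine integral_congr_ae ?_
    filter_upwards [Lp.coeFn_star p] with x hx
    rw [hx]
    simp [mul_comm]
  rw [h1, ← FC.inner_map_map, lp.inner_eq_tsum]
  have : ∀ j, inner ℂ (FC (star p) j) (FC q j) = 0 := by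
    intro j
    rcases le_or_gt j 0 with h | h
    · rw [hq j h, inner_zero_right]
    · rw [FC_star, hp (-j) (by linarith), map_zero, inner_zero_left]
  simp only [this, tsum_zero]

lemma mul_pos_spec {q : C(TT, ℂ)} (hq : ∀ j < 0, FC (cL q) j = 0) {v w : L2} (hv : ∀ j ≤ 0, FC v j = 0)
    (hw : w =ᵐ[mT] fun x => q x * v x) : ∀ j ≤ 0, FC w j = 0 := by
  intro j hj
  rw [FC_apply, fourierCoeff]
  have h0 : ∀ k < 0, FC (cL (fourier (-j) * q)) k = 0 := by
    intro k hk
    have h1 := hq (k + j) (by linarith)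
    rw [FC_cL, fourierCoeff] at h1 ⊢
    rw [← h1]
    refine integral_congr_ae (Eventually.of_forall fun x => ?_)
    simp only [ContinuousMap.mul_apply, smul_eq_mul]
    rw [neg_add, fourier_add]; ring
  rw [← pairing_zero h0 hv]
  refine integral_congr_ae ?_
  filter_upwards [hw, ContinuousMap.coeFn_toLp (p := 2) (𝕜 := ℂ) mT (fourier (-j) * q)] with x hx h2
  rw [hx]
  have h3 : (cL (fourier (-j) * q) : L2) x = (fourier (-j) * q : C(TT, ℂ)) x := h2
  rw [h3]
  rw [ContinuousMap.mul_apply, smul_eq_mul, mul_assoc]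

lemma FC_cL_int (F : C(TT, ℂ)) (j : ℤ) : FC (cL F) j =
    (1 / (2 * Real.pi) : ℂ) * ∫ θ in (0:ℝ)..(2 * Real.pi), F (θ : TT) * Complex.exp (-(j : ℂ) * ↑θ * Complex.I) := by
  rw [FC_cL, fourierCoeff_eq_intervalIntegral F j 0, zero_add, Complex.real_smul]
  congr 1
  · push_cast; rfl
  · refine intervalIntegral.integral_congr fun θ _ => ?_
    simp only [fourier_ex, smul_eq_mul]
    push_cast
    rw [mul_comm]

lemma dcc_neg {f : ℂ → ℂ} (hf : DiffContOnCl ℂ f (ball 0 1)) {F : C(TT, ℂ)} (hF : ∀ θ : ℝ, F (θ : TT) = f (ex θ)) :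
    ∀ j < 0, FC (cL F) j = 0 := by
  intro j hj
  obtain ⟨k, hk⟩ : ∃ k : ℕ, j = -((k:ℤ) + 1) := ⟨(-j - 1).toNat, by omega⟩
  have h1 : DiffContOnCl ℂ (fun z => z ^ k * f z) (ball 0 1) :=
    DiffContOnCl.smul (𝕜' := ℂ) (f := f) (c := fun z => z ^ k) ((differentiable_pow k).diffContOnCl) hf
  have h2 : (∮ z in C(0, 1), z ^ k * f z) = 0 := h1.circleIntegral_eq_zero zero_le_one
  have h3 : (∫ θ in (0:ℝ)..(2 * Real.pi), F (θ : TT) * Complex.exp (-(j : ℂ) * ↑θ * Complex.I)) =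
      -Complex.I * ∮ z in C(0, 1), z ^ k * f z := by
    rw [circleIntegral, ← intervalIntegral.integral_const_mul]
    refine intervalIntegral.integral_congr fun θ _ => ?_
    have e : circleMap 0 1 θ = ex θ := by simp [circleMap, ex]
    simp only [deriv_circleMap, e, smul_eq_mul, hF]
    have e2 : Complex.exp (-(j : ℂ) * ↑θ * Complex.I) = ex θ ^ (k + 1) := by
      rw [ex, ← Complex.exp_nat_mul]; congr 1; rw [hk]; push_cast; ring
    rw [e2, pow_succ]
    linear_combination (ex θ * ex θ ^ k * f (ex θ)) * Complex.I_sq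
  rw [FC_cL_int, h3, h2, mul_zero, mul_zero]

lemma rep_of {a : Seq2} {f : ℂ → ℂ} (h : ∀ θ : ℝ, f (ex θ) = ev a (θ : TT)) : RepOf a f := by
  intro j
  rw [coef_eq a j, FC_cL_int]
  unfold bCoeff wt
  congr 2
  refine intervalIntegral.integral_congr fun θ _ => ?_
  show _ = f (ex θ) * _
  rw [h]

/-- holomorphic extension of an analytic boundary function -/
def ext (a : Seq2) (z : ℂ) : ℂ := ∑' j : ℕ, dW a (j:ℤ) * z ^ j

lemma ext_summable (a : Seq2) : Summable (fun j : ℕ => ‖dW a (j:ℤ)‖) :=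
  (dW_summable a).1.comp_injective Nat.cast_injective

lemma ext_dcc (a : Seq2) : DiffContOnCl ℂ (ext a) (ball 0 1) := by
  have hb : ∀ (j : ℕ), ∀ z ∈ closedBall (0:ℂ) 1, ‖dW a (j:ℤ) * z ^ j‖ ≤ ‖dW a (j:ℤ)‖ := by
    intro j z hz
    rw [norm_mul, norm_pow]
    exact mul_le_of_le_one_right (norm_nonneg _) (pow_le_one₀ (norm_nonneg _) (by simpa using hz))
  refine ⟨?_, ?_⟩
  · exact differentiableOn_tsum_of_summable_norm (ext_summable a) (fun j => (differentiable_pow j).differentiableOn.const_mul _)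
      isOpen_ball fun j z hz => hb j z (ball_subset_closedBall hz)
  · rw [closure_ball _ one_ne_zero]
    exact continuousOn_tsum (fun j => (continuous_const.mul (continuous_pow j)).continuousOn) (ext_summable a) hb

lemma ext_ex {a : Seq2} (ha : ∀ j < 0, a j = 0) (θ : ℝ) : ext a (ex θ) = ev a (θ : TT) := by
  have h1 := ev_hasSum a (θ : TT)
  have h2 : HasSum (fun j : ℕ => dW a (j:ℤ) * fourier (j:ℤ) (θ : TT)) (ev a (θ : TT)) := by
    refine (Function.Injective.hasSum_iff (g := fun j : ℕ => (j:ℤ)) Nat.cast_injective ?_).2 h1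
    intro j hj
    have : j < 0 := by
      by_contra hc
      exact hj ⟨j.toNat, by simp; omega⟩
    rw [dW_apply, ha j this]; simp
  rw [← h2.tsum_eq, ext]
  simp only [fourier_nat_ex]

lemma ext_zero (a : Seq2) : ext a 0 = a 0 := by
  rw [ext, tsum_eq_single 0 (fun j hj => by simp [hj])]
  simp [dW_apply, wt]

end S17

namespace S17
variable {E F : Type*} [NormedAddCommGroup E] [NormedSpace ℝ E] [NormedAddCommGroup F] [NormedSpace ℝ F]

/-- representative of a point of the circle -/
def rp (x : TT) : ℝ := (AddCircle.equivIco (2 * Real.pi) 0 x : ℝ)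

lemma rp_coe (x : TT) : ((rp x : ℝ) : TT) = x := AddCircle.coe_equivIco
lemma rp_mem (x : TT) : rp x ∈ TI := by
  have h := (AddCircle.equivIco (2 * Real.pi) 0 x).2
  exact ⟨h.1, by have h2 := h.2; unfold rp; linarith⟩

lemma rp_per {α : Type*} {g : ℝ → α} (hg : Function.Periodic g (2 * Real.pi)) (θ : ℝ) : g (rp (θ : TT)) = g θ := by
  rw [← hg.lift_coe, ← hg.lift_coe θ, rp_coe]

/-- periodic domain -/
structure PDom (U : Set (ℝ × E)) : Prop where
  op : IsOpen U
  per : ∀ θ w, (θ + 2 * Real.pi, w) ∈ U ↔ (θ, w) ∈ U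

/-- periodicity in the first variable -/
def Per (ψ : ℝ × E → F) : Prop := ∀ θ w, ψ (θ + 2 * Real.pi, w) = ψ (θ, w)

/-- the functions whose graph lies in the domain -/
def gU (U : Set (ℝ × E)) : Set C(TT, E) := {f | ∀ θ : ℝ, (θ, f (θ : TT)) ∈ U}

lemma gU_of_TI {U : Set (ℝ × E)} (hU : PDom U) {f : C(TT, E)} (h : ∀ θ ∈ TI, (θ, f (θ : TT)) ∈ U) : f ∈ gU U := by
  intro θ
  have h1 : Function.Periodic (fun θ : ℝ => ((θ, f (θ : TT)) ∈ U)) (2 * Real.pi) := by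
    intro θ
    simp only [AddCircle.coe_add_period]
    exact propext (hU.per _ _)
  exact Eq.mp (rp_per h1 θ) (h _ (rp_mem _))

lemma coeTT_cont : Continuous (fun θ : ℝ => (θ : TT)) := AddCircle.continuous_mk' _

lemma unif {U : Set (ℝ × E)} (hU : PDom U) {ψ : ℝ × E → F} (hψ : ContinuousOn ψ U) {f : C(TT, E)} (hf : f ∈ gU U) {ε : ℝ} (hε : 0 < ε) :
    ∃ δ > 0, ∀ θ ∈ TI, ∀ u : E, ‖u‖ < δ → (θ, f (θ : TT) + u) ∈ U ∧ ‖ψ (θ, f (θ : TT) + u) - ψ (θ, f (θ : TT))‖ ≤ ε := by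
  have h := IsCompact.eventually_forall_of_forall_eventually (x₀ := (0 : E)) TI_compact
    (P := fun u θ => (θ, f (θ : TT) + u) ∈ U ∧ ‖ψ (θ, f (θ : TT) + u) - ψ (θ, f (θ : TT))‖ < ε) ?_
  · obtain ⟨δ, hδ, h2⟩ := Metric.eventually_nhds_iff.1 h
    refine ⟨δ, hδ, fun θ hθ u hu => ?_⟩
    have := h2 (y := u) (by simpa using hu) θ hθ
    exact ⟨this.1, this.2.le⟩
  · intro θ hθ
    have c1 : Continuous (fun z : E × ℝ => (z.2, f (z.2 : TT) + z.1)) := by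
      have := coeTT_cont
      fun_prop
    have c2 : Continuous (fun z : E × ℝ => (z.2, f (z.2 : TT))) := by
      have := coeTT_cont
      fun_prop
    have m1 : (θ, f (θ : TT) + 0) ∈ U := by rw [add_zero]; exact hf θ
    have a1 : ContinuousAt (fun z : E × ℝ => ψ (z.2, f (z.2 : TT) + z.1)) (0, θ) :=
      ContinuousAt.comp (g := ψ) (hψ.continuousAt (hU.op.mem_nhds m1)) c1.continuousAt
    have a2 : ContinuousAt (fun z : E × ℝ => ψ (z.2, f (z.2 : TT))) (0, θ) :=
      ContinuousAt.comp (g := ψ) (hψ.continuousAt (hU.op.mem_nhds (hf θ))) c2.continuousAt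
    have e1 : ∀ᶠ z : E × ℝ in nhds (0, θ), (z.2, f (z.2 : TT) + z.1) ∈ U := c1.continuousAt.eventually_mem (hU.op.mem_nhds m1)
    have e2 := (a1.sub a2).norm.eventually_lt_const (u := ε) (by simpa using hε)
    filter_upwards [e1, e2] with z h1 h2 using ⟨h1, h2⟩

lemma gU_open {U : Set (ℝ × E)} (hU : PDom U) : IsOpen (gU U) := by
  rw [Metric.isOpen_iff]
  intro f hf
  obtain ⟨δ, hδ, h⟩ := unif (ψ := fun _ => (0:ℝ)) hU continuousOn_const hf one_pos
  refine ⟨δ, hδ, fun g hg => gU_of_TI hU fun θ hθ => ?_⟩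
  have h1 := (h θ hθ (g (θ:TT) - f (θ:TT)) (by
    rw [← dist_eq_norm]; exact (ContinuousMap.dist_apply_le_dist _).trans_lt hg)).1
  rwa [add_sub_cancel] at h1

open Classical in
/-- superposition operator on continuous functions -/
def NemC (ψ : ℝ × E → F) (f : C(TT, E)) : C(TT, F) :=
  if h : Continuous (fun x : TT => ψ (rp x, f x)) then ⟨_, h⟩ else 0

lemma NemC_apply {U : Set (ℝ × E)} (hU : PDom U) {ψ : ℝ × E → F} (hψ : ContinuousOn ψ U) (hp : Per ψ) {f : C(TT, E)} (hf : f ∈ gU U)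
    (θ : ℝ) : NemC ψ f (θ : TT) = ψ (θ, f (θ : TT)) := by
  have hper : Function.Periodic (fun θ : ℝ => ψ (θ, f (θ : TT))) (2 * Real.pi) := by
    intro θ
    simp only [AddCircle.coe_add_period]
    exact hp _ _
  have hl : (fun x : TT => ψ (rp x, f x)) = hper.lift := by
    ext x
    conv_rhs => rw [← rp_coe x]
    rw [Function.Periodic.lift_coe]
    simp only [rp_coe]
  have hc : Continuous (fun x : TT => ψ (rp x, f x)) := by
    rw [hl]
    have h1 : Continuous (fun θ : ℝ => ψ (θ, f (θ : TT))) := by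
      have c2 : Continuous (fun z : ℝ => (z, f (z : TT))) := by
        have := coeTT_cont
        fun_prop
      exact hψ.comp_continuous c2 hf
    exact continuous_coinduced_dom.2 h1
  rw [NemC, dif_pos hc]
  show ψ (rp (θ:TT), f (θ:TT)) = _
  exact congrFun hl (θ : TT) |>.trans (Function.Periodic.lift_coe _ _)

lemma norm_le_TI {G : C(TT, F)} {C : ℝ} (hC : 0 ≤ C) (h : ∀ θ ∈ TI, ‖G (θ : TT)‖ ≤ C) : ‖G‖ ≤ C := by
  rw [ContinuousMap.norm_le _ hC]
  intro x
  rw [← rp_coe x]; exact h _ (rp_mem x)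

lemma NemC_contOn {U : Set (ℝ × E)} (hU : PDom U) {ψ : ℝ × E → F} (hψ : ContinuousOn ψ U) (hp : Per ψ) : ContinuousOn (NemC ψ) (gU U) := by
  intro f hf
  refine ContinuousAt.continuousWithinAt ?_
  rw [Metric.continuousAt_iff]
  intro ε hε
  obtain ⟨δ, hδ, h⟩ := unif hU hψ hf (half_pos hε)
  obtain ⟨δ', hδ', h'⟩ := Metric.isOpen_iff.1 (gU_open hU) f hf
  refine ⟨min δ δ', lt_min hδ hδ', fun {g} hg => ?_⟩
  have hg' : g ∈ gU U := h' (hg.trans_le (min_le_right _ _))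
  rw [dist_eq_norm]
  refine lt_of_le_of_lt (norm_le_TI (half_pos hε).le fun θ hθ => ?_) (half_lt_self hε)
  rw [ContinuousMap.sub_apply, NemC_apply hU hψ hp hg', NemC_apply hU hψ hp hf]
  have h1 := (h θ hθ (g (θ:TT) - f (θ:TT)) (by
    rw [← dist_eq_norm]; exact (ContinuousMap.dist_apply_le_dist _).trans_lt (hg.trans_le (min_le_left _ _)))).2
  rwa [add_sub_cancel] at h1

/-- pointwise application -/
def apC : C(TT, E →L[ℝ] F) →L[ℝ] C(TT, E) →L[ℝ] C(TT, F) :=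
  LinearMap.mkContinuous₂
    (LinearMap.mk₂ ℝ (fun (K : C(TT, E →L[ℝ] F)) (u : C(TT, E)) => (⟨fun x => K x (u x), by fun_prop⟩ : C(TT, F)))
      (fun K K' u => by ext x; simp) (fun c K u => by ext x; simp) (fun K u u' => by ext x; simp) (fun c K u => by ext x; simp)) 1
    (fun K u => by
      rw [one_mul, ContinuousMap.norm_le _ (by positivity)]
      intro x
      exact ((K x).le_opNorm _).trans (mul_le_mul (K.norm_coe_le_norm x) (u.norm_coe_le_norm x) (norm_nonneg _) ((norm_nonneg (K x)).trans (K.norm_coe_le_norm x))))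

@[simp] lemma apC_apply (K : C(TT, E →L[ℝ] F)) (u : C(TT, E)) (x : TT) : apC K u x = K x (u x) := rfl

/-- partial derivative in the second variable -/
def pw (ψ : ℝ × E → F) (p : ℝ × E) : E →L[ℝ] F := (fderiv ℝ ψ p).comp (ContinuousLinearMap.inr ℝ ℝ E)
/-- partial derivative in the first variable -/
def pθ (ψ : ℝ × E → F) (p : ℝ × E) : F := fderiv ℝ ψ p (1, 0)

lemma fderiv_per {ψ : ℝ × E → F} (hp : Per ψ) : Per (fderiv ℝ ψ) := by
  intro θ w
  have : ψ = fun p => ψ (p + ((2 * Real.pi, 0) : ℝ × E)) := by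
    ext ⟨θ, w⟩; simp [hp θ w]
  conv_rhs => rw [this]
  rw [fderiv_comp_add_right]; simp

lemma pw_per {ψ : ℝ × E → F} (hp : Per ψ) : Per (pw ψ) := fun θ w => by rw [pw, fderiv_per hp, pw]
lemma pθ_per {ψ : ℝ × E → F} (hp : Per ψ) : Per (pθ ψ) := fun θ w => by rw [pθ, fderiv_per hp, pθ]

lemma fderiv_c {U : Set (ℝ × E)} (hU : PDom U) {ψ : ℝ × E → F} {m k : WithTop ℕ∞} (hψ : ContDiffOn ℝ m ψ U) (h : k + 1 ≤ m) :
    ContDiffOn ℝ k (fderiv ℝ ψ) U := hψ.fderiv_of_isOpen hU.op h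

lemma pw_c {U : Set (ℝ × E)} (hU : PDom U) {ψ : ℝ × E → F} {m k : WithTop ℕ∞} (hψ : ContDiffOn ℝ m ψ U) (h : k + 1 ≤ m) :
    ContDiffOn ℝ k (pw ψ) U := (fderiv_c hU hψ h).clm_comp contDiffOn_const
lemma pθ_c {U : Set (ℝ × E)} (hU : PDom U) {ψ : ℝ × E → F} {m k : WithTop ℕ∞} (hψ : ContDiffOn ℝ m ψ U) (h : k + 1 ≤ m) :
    ContDiffOn ℝ k (pθ ψ) U := (fderiv_c hU hψ h).clm_apply contDiffOn_const

lemma pw_has {U : Set (ℝ × E)} (hU : PDom U) {ψ : ℝ × E → F} (hψ : ContDiffOn ℝ 1 ψ U) {θ : ℝ} {w : E} (h : (θ, w) ∈ U) :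
    HasFDerivAt (fun w => ψ (θ, w)) (pw ψ (θ, w)) w := by
  have h1 : HasFDerivAt ψ (fderiv ℝ ψ (θ, w)) (θ, w) :=
    ((hψ.differentiableOn one_ne_zero).differentiableAt (hU.op.mem_nhds h)).hasFDerivAt
  exact h1.comp w (hasFDerivAt_prodMk_right θ w)

set_option maxHeartbeats 1000000 in
lemma NemC_has {U : Set (ℝ × E)} (hU : PDom U) {ψ : ℝ × E → F} (hψ : ContDiffOn ℝ 1 ψ U) (hp : Per ψ) {f : C(TT, E)} (hf : f ∈ gU U) :
    HasFDerivAt (NemC ψ) (apC (NemC (pw ψ) f)) f := by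
  have hpw : ContinuousOn (pw ψ) U := (pw_c hU hψ (k := 0) (by norm_num)).continuousOn
  rw [hasFDerivAt_iff_isLittleO_nhds_zero, Asymptotics.isLittleO_iff]
  intro ε hε
  obtain ⟨δ, hδ, h⟩ := unif hU hpw hf hε
  obtain ⟨δ', hδ', h'⟩ := Metric.isOpen_iff.1 (gU_open hU) f hf
  filter_upwards [Metric.ball_mem_nhds (0 : C(TT, E)) (lt_min hδ hδ')] with u hu
  rw [mem_ball_zero_iff] at hu
  have hg' : f + u ∈ gU U := h' (by rw [mem_ball, dist_eq_norm, add_sub_cancel_left]; exact hu.trans_le (min_le_right _ _))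
  refine norm_le_TI (by positivity) fun θ hθ => ?_
  rw [ContinuousMap.sub_apply, ContinuousMap.sub_apply, apC_apply, NemC_apply hU hψ.continuousOn hp hg', NemC_apply hU hψ.continuousOn hp hf,
    NemC_apply hU hpw (pw_per hp) hf]
  have hux : ‖u (θ:TT)‖ < δ := (u.norm_coe_le_norm _).trans_lt (hu.trans_le (min_le_left _ _))
  have hmv := Convex.norm_image_sub_le_of_norm_hasFDerivWithin_le' (𝕜 := ℝ) (f := fun w => ψ (θ, w)) (f' := fun w => pw ψ (θ, w))
    (φ := pw ψ (θ, f (θ:TT))) (s := ball (f (θ:TT)) δ) (C := ε) (x := f (θ:TT)) (y := f (θ:TT) + u (θ:TT)) (fun w hw => by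
      have h1 := (h θ hθ (w - f (θ:TT)) (by rwa [← dist_eq_norm])).1
      rw [add_sub_cancel] at h1
      exact (pw_has hU hψ h1).hasFDerivWithinAt) (fun w hw => by
      have h1 := (h θ hθ (w - f (θ:TT)) (by rwa [← dist_eq_norm])).2
      rwa [add_sub_cancel] at h1) (convex_ball _ _) (mem_ball_self hδ) (by rw [mem_ball, dist_eq_norm, add_sub_cancel_left]; exact hux)
  rw [add_sub_cancel_left] at hmv
  exact hmv.trans (mul_le_mul_of_nonneg_left (u.norm_coe_le_norm _) hε.le)

lemma NemC_c1 {U : Set (ℝ × E)} (hU : PDom U) {ψ : ℝ × E → F} (hψ : ContDiffOn ℝ 1 ψ U) (hp : Per ψ) {f : C(TT, E)} (hf : f ∈ gU U) :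
    ContDiffAt ℝ 1 (NemC ψ) f := by
  have hpw : ContinuousOn (pw ψ) U := (pw_c hU hψ (k := 0) (by norm_num)).continuousOn
  rw [contDiffAt_one_iff]
  exact ⟨fun f => apC (NemC (pw ψ) f), gU U, (gU_open hU).mem_nhds hf,
    apC.continuous.comp_continuousOn (NemC_contOn hU hpw (pw_per hp)), fun f hf => NemC_has hU hψ hp hf⟩

end S17

namespace S17
section
variable {E F : Type*} [NormedAddCommGroup E] [NormedSpace ℝ E] [NormedAddCommGroup F] [NormedSpace ℝ F]

lemma acL_mem (K : C(TT, E →L[ℝ] F)) (h : Lp E 2 mT) : MemLp (fun x => K x (h x)) 2 mT := by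
  refine MemLp.of_le_mul (c := ‖K‖) (Lp.memLp h) ?_ (Eventually.of_forall fun x => ?_)
  · exact ContinuousLinearMap.aestronglyMeasurable_comp₂ (ContinuousLinearMap.id ℝ (E →L[ℝ] F))
      K.continuous.aestronglyMeasurable (Lp.aestronglyMeasurable h)
  · exact ((K x).le_opNorm _).trans (mul_le_mul_of_nonneg_right (K.norm_coe_le_norm x) (norm_nonneg _))

/-- pointwise application on square integrable functions -/
def acL : C(TT, E →L[ℝ] F) →L[ℝ] Lp E 2 mT →L[ℝ] Lp F 2 mT :=
  LinearMap.mkContinuous₂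
    (LinearMap.mk₂ ℝ (fun (K : C(TT, E →L[ℝ] F)) (h : Lp E 2 mT) => (acL_mem K h).toLp)
      (fun K K' u => by rw [← MemLp.toLp_add]; rfl)
      (fun c K u => by rw [← MemLp.toLp_const_smul]; rfl)
      (fun K u u' => by
        rw [← MemLp.toLp_add]
        refine MemLp.toLp_congr _ _ ?_
        filter_upwards [Lp.coeFn_add u u'] with x hx
        rw [hx]; simp)
      (fun c K u => by
        rw [← MemLp.toLp_const_smul]
        refine MemLp.toLp_congr _ _ ?_
        filter_upwards [Lp.coeFn_smul c u] with x hx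
        rw [hx]; simp)) 1
    (fun K u => by
      rw [one_mul]
      refine Lp.norm_le_mul_norm_of_ae_le_mul ?_
      filter_upwards [MemLp.coeFn_toLp (acL_mem K u)] with x hx
      rw [LinearMap.mk₂_apply, hx]
      exact ((K x).le_opNorm _).trans (mul_le_mul_of_nonneg_right (K.norm_coe_le_norm x) (norm_nonneg _)))

lemma acL_ae (K : C(TT, E →L[ℝ] F)) (h : Lp E 2 mT) : acL K h =ᵐ[mT] fun x => K x (h x) :=
  MemLp.coeFn_toLp (acL_mem K h)

lemma acL_le (K : C(TT, E →L[ℝ] F)) (h : Lp E 2 mT) : ‖acL K h‖ ≤ ‖K‖ * ‖h‖ := by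
  refine Lp.norm_le_mul_norm_of_ae_le_mul ?_
  filter_upwards [acL_ae K h] with x hx
  rw [hx]
  exact ((K x).le_opNorm _).trans (mul_le_mul_of_nonneg_right (K.norm_coe_le_norm x) (norm_nonneg _))

lemma apC_le (K : C(TT, E →L[ℝ] F)) (u : C(TT, E)) : ‖apC K u‖ ≤ ‖K‖ * ‖u‖ := by
  rw [ContinuousMap.norm_le _ (mul_nonneg ((norm_nonneg (K 0)).trans (K.norm_coe_le_norm 0)) ((norm_nonneg (u 0)).trans (u.norm_coe_le_norm 0)))]
  intro x
  exact ((K x).le_opNorm _).trans (mul_le_mul (K.norm_coe_le_norm x) (u.norm_coe_le_norm x) (norm_nonneg _) ((norm_nonneg (K x)).trans (K.norm_coe_le_norm x)))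

end

lemma cL_ae (f : C(TT, ℂ)) : cL f =ᵐ[mT] f := ContinuousMap.coeFn_toLp mT f

/-- weak derivative of a continuously differentiable function -/
lemma WD_c1 {F D : C(TT, ℂ)} (h : ∀ θ : ℝ, HasDerivAt (fun θ : ℝ => F (θ : TT)) (D (θ : TT)) θ) : WD F (cL D) := by
  intro j
  rw [FC_cL_int, FC_cL_int]
  have hD : Continuous fun θ : ℝ => D (θ : TT) := D.continuous.comp coeTT_cont
  have hF : Continuous fun θ : ℝ => F (θ : TT) := F.continuous.comp coeTT_cont
  have he : ∀ θ : ℝ, HasDerivAt (fun θ : ℝ => Complex.exp (-(j : ℂ) * ↑θ * Complex.I)) (Complex.exp (-(j : ℂ) * ↑θ * Complex.I) * (-(j:ℂ) * 1 * Complex.I)) θ := by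
    intro θ
    exact (((Complex.ofRealCLM.hasDerivAt (x := θ)).const_mul (-(j:ℂ))).mul_const Complex.I).cexp
  have hce : Continuous fun θ : ℝ => Complex.exp (-(j : ℂ) * ↑θ * Complex.I) := by fun_prop
  have h1 := intervalIntegral.integral_eq_sub_of_hasDerivAt (a := 0) (b := 2 * Real.pi)
    (fun θ _ => (h θ).mul (he θ)) (by
      refine Continuous.intervalIntegrable ?_ _ _
      fun_prop)
  have hz : (fun θ : ℝ => F (θ : TT)) (2 * Real.pi) = (fun θ : ℝ => F (θ : TT)) 0 := by
    have := AddCircle.coe_period (2 * Real.pi)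
    simp only [this]; simp
  have hz2 : Complex.exp (-(j : ℂ) * ((2 * Real.pi : ℝ):ℂ) * Complex.I) = 1 := by
    rw [Complex.exp_eq_one_iff]
    exact ⟨-j, by push_cast; ring⟩
  simp only [Pi.mul_apply] at h1
  rw [hz2] at h1
  simp only [] at hz
  rw [hz] at h1
  simp only [Complex.ofReal_zero, mul_zero, zero_mul, Complex.exp_zero, sub_self] at h1
  rw [intervalIntegral.integral_add (by refine Continuous.intervalIntegrable ?_ _ _; fun_prop) (by refine Continuous.intervalIntegrable ?_ _ _; fun_prop)] at h1
  have h2 : ∫ θ in (0:ℝ)..(2 * Real.pi), F (θ : TT) * (Complex.exp (-(j : ℂ) * ↑θ * Complex.I) * (-(j:ℂ) * 1 * Complex.I)) =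
      (-(j:ℂ) * Complex.I) * ∫ θ in (0:ℝ)..(2 * Real.pi), F (θ : TT) * Complex.exp (-(j : ℂ) * ↑θ * Complex.I) := by
    rw [← intervalIntegral.integral_const_mul]
    congr 1; ext θ; ring
  rw [h2] at h1
  linear_combination (1 / (2 * Real.pi) : ℂ) * h1

lemma WD_closed {α : Type*} {l : Filter α} [l.NeBot] {F : α → C(TT, ℂ)} {H : α → L2} {F0 : C(TT, ℂ)} {H0 : L2}
    (h : ∀ᶠ s in l, WD (F s) (H s)) (hF : Tendsto F l (nhds F0)) (hH : Tendsto H l (nhds H0)) : WD F0 H0 := by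
  intro j
  have c1 : Continuous fun a : Seq2 => a j := by
    have : Continuous fun a : Seq2 => (a : ∀ _ : ℤ, ℂ) := lp.uniformContinuous_coe.continuous
    exact (continuous_apply j).comp this
  have a1 : Tendsto (fun s => FC (H s) j) l (nhds (FC H0 j)) := ((c1.comp FC.continuous).tendsto H0).comp hH
  have a2 : Tendsto (fun s => Complex.I * j * FC (cL (F s)) j) l (nhds (Complex.I * j * FC (cL F0) j)) :=
    (((c1.comp FC.continuous).comp cL.continuous).tendsto F0).comp hF |>.const_mul _
  exact tendsto_nhds_unique (a1.congr' (h.mono fun s hs => hs j)) a2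

/-- sequences with finite support represent smooth functions -/
def Sm (a : Seq2) : Prop := ∃ d : C(TT, ℂ), dv a = cL d ∧ ∀ θ : ℝ, HasDerivAt (fun θ : ℝ => ev a (θ : TT)) (d (θ : TT)) θ

lemma Sm.add {a b : Seq2} (ha : Sm a) (hb : Sm b) : Sm (a + b) := by
  obtain ⟨d, h1, h2⟩ := ha
  obtain ⟨e, h3, h4⟩ := hb
  refine ⟨d + e, by rw [map_add, map_add, h1, h3], fun θ => ?_⟩
  have := (h2 θ).add (h4 θ)
  rw [map_add]
  exact this

lemma Sm.zero : Sm 0 := ⟨0, by rw [map_zero, map_zero], fun θ => by rw [map_zero]; exact hasDerivAt_const _ _⟩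

lemma ev_single (j : ℤ) (c : ℂ) : ev (lp.single 2 j c) = ((wt j : ℂ)⁻¹ * c) • (fourier j : C(TT, ℂ)) := by
  have h : (lp.single 2 j c : Seq2) = c • (lp.single 2 j (1:ℂ)) := by
    rw [← lp.single_smul]; simp
  refine cL_inj fun k => ?_
  rw [FC_ev, map_smul, map_smul, FC_fourier, h]
  rw [dW_apply]
  simp only [lp.coeFn_smul, Pi.smul_apply, smul_eq_mul, lp.coeFn_single]
  by_cases hk : k = j
  · subst hk; simp
  · simp [Pi.single_eq_of_ne hk]

lemma Sm.single (j : ℤ) (c : ℂ) : Sm (lp.single 2 j c) := by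
  have h2 : ∀ θ : ℝ, HasDerivAt (fun θ : ℝ => ev (lp.single 2 j c) (θ : TT)) (((((wt j : ℂ)⁻¹ * c) * (j * Complex.I)) • (fourier j : C(TT, ℂ))) (θ : TT)) θ := by
    intro θ
    simp only [ev_single, ContinuousMap.smul_apply, fourier_ex, smul_eq_mul]
    have := (((Complex.ofRealCLM.hasDerivAt (x := θ)).const_mul (j:ℂ)).mul_const Complex.I).cexp.const_mul ((wt j : ℂ)⁻¹ * c)
    refine this.congr_deriv ?_
    simp only [Complex.ofRealCLM_apply, Complex.ofReal_one]
    ring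
  refine ⟨_, ?_, h2⟩
  refine FC.injective ?_
  ext k
  rw [WD_ev _ k, WD_c1 h2 k]

lemma Sm.approx (a : Seq2) (s : Finset ℤ) : Sm (∑ j ∈ s, lp.single 2 j (a j)) := by
  classical
  induction s using Finset.induction_on with
  | empty => simpa using Sm.zero
  | insert j s hj ih => rw [Finset.sum_insert hj]; exact (Sm.single _ _).add ih

lemma approx_tendsto (a : Seq2) : Tendsto (fun s : Finset ℤ => ∑ j ∈ s, (lp.single 2 j (a j) : Seq2)) atTop (nhds a) :=
  lp.hasSum_single (by norm_num) a

section
variable {ι : Type*} [Fintype ι]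

/-- vector of functions -/
def evV : (ι → Seq2) →L[ℝ] C(TT, ι → ℂ) :=
  LinearMap.mkContinuous
    { toFun := fun a => (⟨fun x i => ev (a i) x, by fun_prop⟩ : C(TT, ι → ℂ))
      map_add' := fun a b => by ext x i; simp
      map_smul' := fun c a => by
        ext x i
        have h : ev (c • a i) = (c:ℂ) • ev (a i) := by rw [← map_smul]; rfl
        simp [h] } ‖(ev : Seq2 →L[ℂ] C(TT, ℂ))‖
    (fun a => by
      rw [ContinuousMap.norm_le _ (by positivity)]
      intro x
      rw [pi_norm_le_iff_of_nonneg (by positivity)]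
      intro i
      refine ((ev (a i)).norm_coe_le_norm x).trans ((ev.le_opNorm _).trans ?_)
      exact mul_le_mul_of_nonneg_left (norm_le_pi_norm a i) (norm_nonneg _))

@[simp] lemma evV_apply (a : ι → Seq2) (x : TT) (i : ι) : evV a x i = ev (a i) x := rfl

variable [DecidableEq ι]

/-- assemble a vector valued function -/
def asm : (ι → L2) →L[ℝ] Lp (ι → ℂ) 2 mT :=
  ∑ i, ((ContinuousLinearMap.single ℝ (fun _ : ι => ℂ) i).compLpL 2 mT).comp (ContinuousLinearMap.proj i)

lemma asm_ae (h : ι → L2) : asm h =ᵐ[mT] fun x i => h i x := by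
  have e : asm h = ∑ i, (ContinuousLinearMap.single ℝ (fun _ : ι => ℂ) i).compLpL 2 mT (h i) := by
    simp only [asm, ContinuousLinearMap.sum_apply]; rfl
  rw [e]
  have h1 := Lp.coeFn_finsetSum (μ := mT) (p := 2) Finset.univ (fun i => (ContinuousLinearMap.single ℝ (fun _ : ι => ℂ) i).compLpL 2 mT (h i))
  have h2 : ∀ i, ∀ᵐ x ∂mT, (ContinuousLinearMap.single ℝ (fun _ : ι => ℂ) i).compLpL 2 mT (h i) x = Pi.single i (h i x) := fun i =>
    ContinuousLinearMap.coeFn_compLpL _ _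
  filter_upwards [h1, ae_all_iff.2 h2] with x hx hx2
  rw [hx]
  simp only [Finset.sum_apply, hx2]
  ext i
  simp [Finset.sum_apply, Pi.single_apply]

/-- vector of derivatives -/
def dvV : (ι → Seq2) →L[ℝ] Lp (ι → ℂ) 2 mT :=
  asm.comp (ContinuousLinearMap.pi fun i => (dv.restrictScalars ℝ).comp (ContinuousLinearMap.proj i))

lemma dvV_ae (a : ι → Seq2) : dvV a =ᵐ[mT] fun x i => dv (a i) x := asm_ae _

lemma dvV_eq (a : ι → Seq2) : dvV a = asm (fun i => dv (a i)) := rfl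

end
end S17

namespace S17
variable {ι : Type*} [Fintype ι] [DecidableEq ι]

/-- superposition operator: derivative part -/
def NemD (φ : ℝ × (ι → ℂ) → ℂ) (a : ι → Seq2) : L2 := cL (NemC (pθ φ) (evV a)) + acL (NemC (pw φ) (evV a)) (dvV a)

/-- superposition operator -/
def Nem (φ : ℝ × (ι → ℂ) → ℂ) (a : ι → Seq2) : Seq2 := rc (NemC φ (evV a), NemD φ a)

/-- standing assumptions on a superposition function -/
structure NOK (U : Set (ℝ × (ι → ℂ))) (φ : ℝ × (ι → ℂ) → ℂ) : Prop where
  dom : PDom U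
  c2 : ContDiffOn ℝ 2 φ U
  per : Per φ

variable {U : Set (ℝ × (ι → ℂ))} {φ : ℝ × (ι → ℂ) → ℂ}

lemma NOK.c1 (H : NOK U φ) : ContDiffOn ℝ 1 φ U := H.c2.of_le (by norm_num)
lemma NOK.pwc (H : NOK U φ) : ContDiffOn ℝ 1 (pw φ) U := pw_c H.dom H.c2 (by norm_num)
lemma NOK.pθc (H : NOK U φ) : ContDiffOn ℝ 1 (pθ φ) U := pθ_c H.dom H.c2 (by norm_num)

/-- derivative of the derivative part -/
def NemDD (φ : ℝ × (ι → ℂ) → ℂ) (a u : ι → Seq2) : L2 :=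
  cL (apC (NemC (pw (pθ φ)) (evV a)) (evV u)) + (acL (NemC (pw φ) (evV a)) (dvV u) + acL (apC (NemC (pw (pw φ)) (evV a)) (evV u)) (dvV a))

/-- the derivative of the derivative part as a continuous linear map -/
def NemDL (φ : ℝ × (ι → ℂ) → ℂ) (a : ι → Seq2) : (ι → Seq2) →L[ℝ] L2 :=
  (cL.restrictScalars ℝ).comp ((apC (NemC (pw (pθ φ)) (evV a))).comp evV) + ((acL (NemC (pw φ) (evV a))).comp dvV +
    (acL.flip (dvV a)).comp ((apC (NemC (pw (pw φ)) (evV a))).comp evV))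

lemma NemDL_apply (a u : ι → Seq2) : NemDL φ a u = NemDD φ a u := rfl

lemma NemD_has (H : NOK U φ) {a : ι → Seq2} (ha : evV a ∈ gU U) : HasFDerivAt (NemD φ) (NemDL φ a) a := by
  have h1 : HasFDerivAt (fun a : ι → Seq2 => NemC (pθ φ) (evV a)) ((apC (NemC (pw (pθ φ)) (evV a))).comp evV) a :=
    (NemC_has H.dom H.pθc (pθ_per H.per) ha).comp a evV.hasFDerivAt
  have h2 : HasFDerivAt (fun a : ι → Seq2 => NemC (pw φ) (evV a)) ((apC (NemC (pw (pw φ)) (evV a))).comp evV) a :=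
    (NemC_has H.dom H.pwc (pw_per H.per) ha).comp a evV.hasFDerivAt
  have h3 := ((cL.restrictScalars ℝ).hasFDerivAt (x := NemC (pθ φ) (evV a))).comp a h1
  have h4 := acL.hasFDerivAt_of_bilinear h2 (dvV.hasFDerivAt (x := a))
  have h5 := h3.add h4
  refine h5.congr_fderiv ?_
  ext1 u
  rfl

lemma Nem_has (H : NOK U φ) {a : ι → Seq2} (ha : evV a ∈ gU U) :
    HasFDerivAt (Nem φ) ((rc.restrictScalars ℝ).comp (((apC (NemC (pw φ) (evV a))).comp evV).prod (NemDL φ a))) a := by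
  have h1 : HasFDerivAt (fun a : ι → Seq2 => NemC φ (evV a)) ((apC (NemC (pw φ) (evV a))).comp evV) a :=
    (NemC_has H.dom H.c1 H.per ha).comp a evV.hasFDerivAt
  exact ((rc.restrictScalars ℝ).hasFDerivAt).comp a (h1.prodMk (NemD_has H ha))

lemma gUV_open (H : NOK U φ) : IsOpen {a : ι → Seq2 | evV a ∈ gU U} := (gU_open H.dom).preimage evV.continuous

lemma Nem_c1 (H : NOK U φ) {a : ι → Seq2} (ha : evV a ∈ gU U) : ContDiffAt ℝ 1 (Nem φ) a := by
  have he : ContDiffAt ℝ 1 (fun a : ι → Seq2 => evV a) a := by fun_prop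
  have h1 : ContDiffAt ℝ 1 (fun a : ι → Seq2 => NemC φ (evV a)) a :=
    ContDiffAt.comp a (NemC_c1 H.dom H.c1 H.per ha) he
  have h2 : ContDiffAt ℝ 1 (fun a : ι → Seq2 => NemC (pθ φ) (evV a)) a :=
    ContDiffAt.comp a (NemC_c1 H.dom H.pθc (pθ_per H.per) ha) he
  have h3 : ContDiffAt ℝ 1 (fun a : ι → Seq2 => NemC (pw φ) (evV a)) a :=
    ContDiffAt.comp a (NemC_c1 H.dom H.pwc (pw_per H.per) ha) he
  have h4 : ContDiffAt ℝ 1 (fun a : ι → Seq2 => acL (NemC (pw φ) (evV a)) (dvV a)) a :=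
    (ContDiffAt.comp a acL.contDiff.contDiffAt h3).clm_apply dvV.contDiff.contDiffAt
  have h5 : ContDiffAt ℝ 1 (fun a : ι → Seq2 => cL (NemC (pθ φ) (evV a))) a :=
    ContDiffAt.comp a (cL.restrictScalars ℝ).contDiff.contDiffAt h2
  exact ContDiffAt.comp a (rc.restrictScalars ℝ).contDiff.contDiffAt (h1.prodMk (h5.add h4))

lemma Nem_WD_sm (H : NOK U φ) {a : ι → Seq2} (ha : evV a ∈ gU U) (hs : ∀ i, Sm (a i)) : WD (NemC φ (evV a)) (NemD φ a) := by
  choose d hd1 hd2 using hs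
  set dd : C(TT, ι → ℂ) := ⟨fun x i => d i x, by fun_prop⟩ with hdd
  set D : C(TT, ℂ) := NemC (pθ φ) (evV a) + apC (NemC (pw φ) (evV a)) dd with hD
  have e1 : NemD φ a = cL D := by
    have : acL (NemC (pw φ) (evV a)) (dvV a) = cL (apC (NemC (pw φ) (evV a)) dd) := by
      refine Lp.ext ?_
      filter_upwards [acL_ae (NemC (pw φ) (evV a)) (dvV a), dvV_ae a, cL_ae (apC (NemC (pw φ) (evV a)) dd),
        ae_all_iff.2 fun i => cL_ae (d i)] with x h1 h2 h3 h4
      rw [h1, h2, h3, apC_apply]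
      congr 1
      ext i
      rw [hd1, h4]; rfl
    rw [NemD, this, hD, map_add]
  rw [e1]
  refine WD_c1 fun θ => ?_
  have hdiff : HasFDerivAt φ (fderiv ℝ φ (θ, evV a (θ:TT))) (θ, evV a (θ:TT)) :=
    ((H.c1.differentiableOn one_ne_zero).differentiableAt (H.dom.op.mem_nhds (ha θ))).hasFDerivAt
  have hf : HasDerivAt (fun θ : ℝ => evV a (θ : TT)) (dd (θ:TT)) θ := hasDerivAt_pi.2 fun i => hd2 i θ
  have h2 := hdiff.comp_hasDerivAt θ ((hasDerivAt_id θ).prodMk hf)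
  have h3 : (fun θ : ℝ => NemC φ (evV a) (θ : TT)) = φ ∘ fun θ => (id θ, evV a (θ : TT)) := by
    ext θ
    exact NemC_apply H.dom H.c1.continuousOn H.per ha θ
  rw [h3]
  refine h2.congr_deriv ?_
  rw [hD, ContinuousMap.add_apply, apC_apply, NemC_apply H.dom H.pθc.continuousOn (pθ_per H.per) ha,
    NemC_apply H.dom H.pwc.continuousOn (pw_per H.per) ha, pθ, pw, ContinuousLinearMap.comp_apply, ContinuousLinearMap.inr_apply, ← map_add]
  simp

lemma Nem_WD (H : NOK U φ) {a : ι → Seq2} (ha : evV a ∈ gU U) : WD (NemC φ (evV a)) (NemD φ a) := by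
  have ht : Tendsto (fun (s : Finset ℤ) (i : ι) => ∑ j ∈ s, (lp.single 2 j (a i j) : Seq2)) atTop (nhds a) :=
    tendsto_pi_nhds.2 fun i => approx_tendsto (a i)
  have hc : ContinuousAt (fun a : ι → Seq2 => NemC φ (evV a)) a :=
    ((NemC_contOn H.dom H.c1.continuousOn H.per).continuousAt ((gU_open H.dom).mem_nhds ha)).comp evV.continuous.continuousAt
  refine WD_closed ?_ (hc.tendsto.comp ht) ((NemD_has H ha).continuousAt.tendsto.comp ht)
  filter_upwards [ht.eventually_mem ((gUV_open H).mem_nhds ha)] with s hs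
  exact Nem_WD_sm H hs fun i => Sm.approx (a i) s

lemma ev_Nem (H : NOK U φ) {a : ι → Seq2} (ha : evV a ∈ gU U) : ev (Nem φ a) = NemC φ (evV a) := ev_rc (Nem_WD H ha)
lemma dv_Nem (H : NOK U φ) {a : ι → Seq2} (ha : evV a ∈ gU U) : dv (Nem φ a) = NemD φ a := dv_rc (Nem_WD H ha)

lemma ev_Nem_apply (H : NOK U φ) {a : ι → Seq2} (ha : evV a ∈ gU U) (θ : ℝ) : ev (Nem φ a) (θ : TT) = φ (θ, evV a (θ : TT)) := by
  rw [ev_Nem H ha, NemC_apply H.dom H.c1.continuousOn H.per ha]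

/-- derivative of the superposition operator -/
def NemL (φ : ℝ × (ι → ℂ) → ℂ) (a : ι → Seq2) : (ι → Seq2) →L[ℝ] Seq2 := fderiv ℝ (Nem φ) a

lemma ev_NemL (H : NOK U φ) {a : ι → Seq2} (ha : evV a ∈ gU U) (u : ι → Seq2) : ev (NemL φ a u) = apC (NemC (pw φ) (evV a)) (evV u) := by
  have h1 : HasFDerivAt (fun a : ι → Seq2 => ev (Nem φ a)) ((ev.restrictScalars ℝ).comp (NemL φ a)) a :=
    ((ev.restrictScalars ℝ).hasFDerivAt).comp a (Nem_has H ha).differentiableAt.hasFDerivAt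
  have h2 : HasFDerivAt (fun a : ι → Seq2 => NemC φ (evV a)) ((apC (NemC (pw φ) (evV a))).comp evV) a :=
    (NemC_has H.dom H.c1 H.per ha).comp a evV.hasFDerivAt
  have h3 : (fun a : ι → Seq2 => ev (Nem φ a)) =ᶠ[nhds a] fun a : ι → Seq2 => NemC φ (evV a) := by
    filter_upwards [(gUV_open H).mem_nhds ha] with b hb using ev_Nem H hb
  have := (h1.unique (h2.congr_of_eventuallyEq h3))
  exact congrArg (fun L => L u) this

lemma dv_NemL (H : NOK U φ) {a : ι → Seq2} (ha : evV a ∈ gU U) (u : ι → Seq2) : dv (NemL φ a u) = NemDD φ a u := by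
  have h1 : HasFDerivAt (fun a : ι → Seq2 => dv (Nem φ a)) ((dv.restrictScalars ℝ).comp (NemL φ a)) a :=
    ((dv.restrictScalars ℝ).hasFDerivAt).comp a (Nem_has H ha).differentiableAt.hasFDerivAt
  have h3 : (fun a : ι → Seq2 => dv (Nem φ a)) =ᶠ[nhds a] NemD φ := by
    filter_upwards [(gUV_open H).mem_nhds ha] with b hb using dv_Nem H hb
  have := (h1.unique ((NemD_has H ha).congr_of_eventuallyEq h3))
  exact congrArg (fun L => L u) this

/-- the derivative splits into multiplication and a lower order part -/
lemma dv_NemL_split (H : NOK U φ) {a : ι → Seq2} (ha : evV a ∈ gU U) : ∃ C, 0 ≤ C ∧ ∀ u : ι → Seq2,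
    ‖dv (NemL φ a u) - acL (NemC (pw φ) (evV a)) (dvV u)‖ ≤ C * ‖evV u‖ := by
  refine ⟨‖(cL : C(TT, ℂ) →L[ℂ] L2)‖ * ‖NemC (pw (pθ φ)) (evV a)‖ + ‖NemC (pw (pw φ)) (evV a)‖ * ‖dvV a‖, ?_, fun u => ?_⟩
  · have h1 : 0 ≤ ‖NemC (pw (pθ φ)) (evV a)‖ := (norm_nonneg (NemC (pw (pθ φ)) (evV a) 0)).trans (ContinuousMap.norm_coe_le_norm _ 0)
    have h2 : 0 ≤ ‖NemC (pw (pw φ)) (evV a)‖ := (norm_nonneg (NemC (pw (pw φ)) (evV a) 0)).trans (ContinuousMap.norm_coe_le_norm _ 0)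
    positivity
  rw [dv_NemL H ha, NemDD]
  have : ∀ x y z : L2, x + (y + z) - y = x + z := fun x y z => by abel
  rw [this]
  refine (norm_add_le _ _).trans ?_
  rw [add_mul]
  refine add_le_add ?_ ?_
  · refine (cL.le_opNorm _).trans ?_
    rw [mul_assoc]
    exact mul_le_mul_of_nonneg_left (apC_le _ _) (norm_nonneg _)
  · refine (acL_le _ _).trans ?_
    calc _ ≤ (‖NemC (pw (pw φ)) (evV a)‖ * ‖evV u‖) * ‖dvV a‖ := mul_le_mul_of_nonneg_right (apC_le _ _) (norm_nonneg _)
      _ = _ := by ring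

end S17

namespace S17

lemma ite_norm_le (p : ℤ → Prop) [DecidablePred p] (j : ℤ) : ‖(if p j then (1:ℂ) else 0)‖ ≤ 1 := by
  split_ifs <;> simp

/-- projection to negative frequencies -/
def Pm : Seq2 →L[ℂ] Seq2 := diag (fun j => if j < 0 then 1 else 0) (ite_norm_le _)
/-- projection to frequency zero -/
def P0 : Seq2 →L[ℂ] Seq2 := diag (fun j => if j = 0 then 1 else 0) (ite_norm_le _)
/-- projection to positive frequencies -/
def Pp : Seq2 →L[ℂ] Seq2 := diag (fun j => if 0 < j then 1 else 0) (ite_norm_le _)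
/-- projection to nonnegative frequencies -/
def Ph : Seq2 →L[ℂ] Seq2 := diag (fun j => if 0 ≤ j then 1 else 0) (ite_norm_le _)

lemma Pm_apply (a : Seq2) (j : ℤ) : Pm a j = if j < 0 then a j else 0 := by
  rw [Pm, diag_apply]; split_ifs <;> simp
lemma P0_apply (a : Seq2) (j : ℤ) : P0 a j = if j = 0 then a j else 0 := by
  rw [P0, diag_apply]; split_ifs <;> simp
lemma Pp_apply (a : Seq2) (j : ℤ) : Pp a j = if 0 < j then a j else 0 := by
  rw [Pp, diag_apply]; split_ifs <;> simp
lemma Ph_apply (a : Seq2) (j : ℤ) : Ph a j = if 0 ≤ j then a j else 0 := by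
  rw [Ph, diag_apply]; split_ifs <;> simp

lemma Ph_eq (a : Seq2) : Ph a = P0 a + Pp a := by
  ext j
  rw [lp.coeFn_add, Pi.add_apply, Ph_apply, P0_apply, Pp_apply]
  rcases lt_trichotomy j 0 with h | h | h
  · simp [h.not_ge, h.ne, h.not_gt]
  · simp [h]
  · simp [h, h.le, h.ne']

lemma split3 (a : Seq2) : a = Pm a + P0 a + Pp a := by
  ext j
  rw [lp.coeFn_add, Pi.add_apply, lp.coeFn_add, Pi.add_apply, Pm_apply, P0_apply, Pp_apply]
  rcases lt_trichotomy j 0 with h | h | h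
  · simp [h, h.ne, h.not_gt]
  · simp [h]
  · simp [h, h.not_gt, h.ne']

lemma Pm_le (a : Seq2) : ‖Pm a‖ ≤ ‖a‖ := diag_norm _ _ a
lemma P0_le (a : Seq2) : ‖P0 a‖ ≤ ‖a‖ := diag_norm _ _ a
lemma Pp_le (a : Seq2) : ‖Pp a‖ ≤ ‖a‖ := diag_norm _ _ a
lemma Ph_le (a : Seq2) : ‖Ph a‖ ≤ ‖a‖ := diag_norm _ _ a

lemma CJ_mem (a : Seq2) : Memℓp (fun j => (starRingEnd ℂ) (a (-j))) 2 := by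
  refine memℓp_gen ?_
  have h := (seq2_sum a).summable
  simp only [ENNReal.toReal_ofNat, Real.rpow_ofNat, RCLike.norm_conj]
  exact h.comp_injective (neg_injective (G := ℤ))

lemma CJ_norm_aux (a : Seq2) : ‖(⟨fun j => (starRingEnd ℂ) (a (-j)), CJ_mem a⟩ : Seq2)‖ = ‖a‖ := by
  have h1 := seq2_sum (⟨fun j => (starRingEnd ℂ) (a (-j)), CJ_mem a⟩ : Seq2)
  have h2 : HasSum (fun j => ‖(⟨fun j => (starRingEnd ℂ) (a (-j)), CJ_mem a⟩ : Seq2) j‖ ^ 2) (‖a‖ ^ 2) := by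
    have := (Equiv.neg ℤ).hasSum_iff.2 (seq2_sum a)
    refine this.congr_fun ?_
    intro j
    show ‖(starRingEnd ℂ) (a (-j))‖ ^ 2 = _
    rw [RCLike.norm_conj]; rfl
  have h3 := h1.unique h2
  exact (pow_left_inj₀ (norm_nonneg _) (norm_nonneg _) two_ne_zero).1 h3

/-- conjugation -/
def CJ : Seq2 →L[ℝ] Seq2 :=
  LinearMap.mkContinuous
    { toFun := fun a => ⟨fun j => (starRingEnd ℂ) (a (-j)), CJ_mem a⟩
      map_add' := fun a b => by ext j; exact map_add (starRingEnd ℂ) _ _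
      map_smul' := fun c a => by
        ext j
        show (starRingEnd ℂ) ((c • a) (-j)) = c • (starRingEnd ℂ) (a (-j))
        rw [lp.coeFn_smul, Pi.smul_apply, Complex.real_smul, Complex.real_smul, map_mul, Complex.conj_ofReal] } 1
    (fun a => by rw [one_mul]; exact (CJ_norm_aux a).le)

lemma CJ_apply (a : Seq2) (j : ℤ) : CJ a j = (starRingEnd ℂ) (a (-j)) := rfl
lemma CJ_norm (a : Seq2) : ‖CJ a‖ = ‖a‖ := CJ_norm_aux a

lemma CJ_CJ (a : Seq2) : CJ (CJ a) = a := by ext j; simp [CJ_apply]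

lemma ev_CJ (a : Seq2) (x : TT) : ev (CJ a) x = (starRingEnd ℂ) (ev a x) := by
  have h1 := ev_hasSum (CJ a) x
  have h2 : HasSum (fun j => dW (CJ a) j * fourier j x) ((starRingEnd ℂ) (ev a x)) := by
    have h3 := (Equiv.neg ℤ).hasSum_iff.2 ((ev_hasSum a x).mapL (Complex.conjCLE : ℂ →L[ℝ] ℂ))
    refine h3.congr_fun ?_
    intro j
    simp only [Function.comp_apply, Equiv.neg_apply]
    show _ = (starRingEnd ℂ) (dW a (-j) * fourier (-j) x)
    rw [map_mul, fourier_neg, Complex.conj_conj, dW_apply, dW_apply, CJ_apply, map_mul, map_inv₀, Complex.conj_ofReal, wt_neg]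
  exact h1.unique h2

lemma dv_CJ (a : Seq2) : dv (CJ a) = star (dv a) := by
  refine FC.injective ?_
  ext j
  rw [FC_star, FC_dv, FC_dv, dD_apply, dD_apply, CJ_apply, map_mul, map_div₀, map_mul, Complex.conj_ofReal, wt_neg, Complex.conj_I]
  push_cast
  rw [map_neg, map_intCast]; ring

lemma norm_split (a : Seq2) : ‖a‖ ≤ ‖dW a‖ + ‖dD a‖ := by
  have h : HasSum (fun j => ‖a j‖ ^ 2) (‖dW a‖ ^ 2 + ‖dD a‖ ^ 2) := by
    refine ((seq2_sum (dW a)).add (seq2_sum (dD a))).congr_fun fun j => ?_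
    rw [dW_apply, dD_apply, norm_mul, norm_mul, norm_div, norm_mul, norm_inv, Complex.norm_I, Complex.norm_real, Real.norm_of_nonneg (wt_pos j).le,
      Complex.norm_intCast]
    have h1 := (wt_pos j).ne'
    have h2 := wt_sq j
    field_simp
    rw [sq_abs, h2]
  have h2 := (seq2_sum a).unique h
  refine abs_le_of_sq_le_sq' (a := ‖a‖) ?_ (by positivity) |>.2
  rw [h2]; nlinarith [norm_nonneg (dW a), norm_nonneg (dD a)]

lemma dW_norm (a : Seq2) : ‖dW a‖ = ‖cL (ev a)‖ := by rw [← FC_ev]; exact FC.norm_map _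
lemma dD_norm (a : Seq2) : ‖dD a‖ = ‖dv a‖ := by rw [← FC_dv]; exact FC.norm_map _
lemma dW_le (a : Seq2) : ‖dW a‖ ≤ ‖a‖ := diag_norm _ _ a
lemma dD_le (a : Seq2) : ‖dD a‖ ≤ ‖a‖ := diag_norm _ _ a

lemma interp {ε : ℝ} (hε : 0 < ε) : ∃ C, 0 ≤ C ∧ ∀ a : Seq2, ‖ev a‖ ≤ ε * ‖a‖ + C * ‖dW a‖ := by
  classical
  have h := tendsto_tsum_compl_atTop_zero (fun j : ℤ => (wt j)⁻¹ ^ 2)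
  obtain ⟨s, hs⟩ := (h.eventually_lt_const (u := ε ^ 2) (by positivity)).exists
  refine ⟨s.card, by positivity, fun a => ?_⟩
  refine (ev_norm_le a).trans ?_
  set m : ℤ → ℝ := (↑s : Set ℤ)ᶜ.indicator fun j => (wt j)⁻¹ with hm
  have hm2 : (fun j => m j ^ 2) = (↑s : Set ℤ)ᶜ.indicator fun j => (wt j)⁻¹ ^ 2 := by
    ext j
    by_cases hj : j ∈ (↑s : Set ℤ)ᶜ
    · simp [hm, indicator_of_mem hj]
    · simp [hm, indicator_of_notMem hj]
  have hc := cs_sum a m (fun j => indicator_nonneg (fun j _ => (inv_pos.2 (wt_pos j)).le) j) (by rw [hm2]; exact summable_wt.indicator _)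
  have h3 : Real.sqrt (∑' j, m j ^ 2) ≤ ε := by
    rw [hm2, Real.sqrt_le_left hε.le, ← tsum_subtype]
    exact hs.le
  have h4 : ∀ j, ‖dW a j‖ = m j * ‖a j‖ + (↑s : Set ℤ).indicator (fun j => ‖dW a j‖) j := by
    intro j
    by_cases hj : j ∈ (↑s : Set ℤ)
    · have : j ∉ (↑s : Set ℤ)ᶜ := fun h => h hj
      simp [hm, indicator_of_notMem this, indicator_of_mem hj]
    · have h5 : j ∈ (↑s : Set ℤ)ᶜ := hj
      rw [hm, indicator_of_mem h5, indicator_of_notMem hj, dW_apply, norm_mul, norm_inv, Complex.norm_real, Real.norm_of_nonneg (wt_pos j).le, add_zero]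
  have h6 : ∑' j, ‖dW a j‖ = ∑' j, m j * ‖a j‖ + ∑ j ∈ s, ‖dW a j‖ := by
    rw [tsum_congr h4, (hc.1).tsum_add ((dW_summable a).1.indicator _)]
    congr 1
    rw [sum_eq_tsum_indicator]
  rw [h6]
  refine add_le_add (hc.2.trans (mul_le_mul_of_nonneg_right h3 (norm_nonneg _))) ?_
  refine (Finset.sum_le_card_nsmul s _ ‖dW a‖ fun j _ => lp.norm_apply_le_norm (by norm_num) _ _).trans ?_
  rw [nsmul_eq_mul]

end S17

namespace S17
variable {ι : Type*} [Fintype ι] [DecidableEq ι]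

/-- bilinear pairing on square integrable functions -/
def pr (p q : L2) : ℂ := inner ℂ (star p) q

lemma pr_int (p q : L2) : pr p q = ∫ x, p x * q x ∂mT := by
  rw [pr, L2.inner_def]
  refine integral_congr_ae ?_
  filter_upwards [Lp.coeFn_star p] with x hx
  rw [hx]
  simp [mul_comm]

lemma star_norm' (p : L2) : ‖star p‖ = ‖p‖ := by
  have h : ∀ᵐ x ∂mT, ‖(star p : L2) x‖ = ‖p x‖ := by
    filter_upwards [Lp.coeFn_star p] with x hx
    rw [hx]; simp
  exact le_antisymm (Lp.norm_le_norm_of_ae_le (h.mono fun x hx => hx.le)) (Lp.norm_le_norm_of_ae_le (h.mono fun x hx => hx.ge))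

lemma pr_le (p q : L2) : ‖pr p q‖ ≤ ‖p‖ * ‖q‖ := by
  have := norm_inner_le_norm (𝕜 := ℂ) (star p) q
  have h : ‖star p‖ = ‖p‖ := star_norm' p
  rw [h] at this
  exact this

lemma pr_sub (p p' q : L2) : pr (p - p') q = pr p q - pr p' q := by
  have h : star (p - p') = star p - star p' := by
    refine Lp.ext ?_
    filter_upwards [Lp.coeFn_star (p - p'), Lp.coeFn_sub p p', Lp.coeFn_star p, Lp.coeFn_star p', Lp.coeFn_sub (star p) (star p')] with x h1 h2 h3 h4 h5
    rw [h1, h5]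
    simp only [Pi.star_apply, Pi.sub_apply, h2, h3, h4, star_sub]
  rw [pr, h, inner_sub_left]; rfl
lemma pr_add (p p' q : L2) : pr (p + p') q = pr p q + pr p' q := by
  have h : star (p + p') = star p + star p' := by
    refine Lp.ext ?_
    filter_upwards [Lp.coeFn_star (p + p'), Lp.coeFn_add p p', Lp.coeFn_star p, Lp.coeFn_star p', Lp.coeFn_add (star p) (star p')] with x h1 h2 h3 h4 h5
    rw [h1, h5]
    simp only [Pi.star_apply, Pi.add_apply, h2, h3, h4, star_add]
  rw [pr, h, inner_add_left]; rfl
lemma pr_smul (c : ℝ) (p q : L2) : pr (c • p) q = c * pr p q := by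
  have : star (c • p) = (c : ℂ) • star p := by
    refine Lp.ext ?_
    filter_upwards [Lp.coeFn_star (c • p), Lp.coeFn_smul c p, Lp.coeFn_star p, Lp.coeFn_smul (c:ℂ) (star p)] with x h1 h2 h3 h4
    rw [h1, h4]
    simp [h2, h3]
  rw [pr, this, inner_smul_left, Complex.conj_ofReal]; rfl

lemma pr_star (p : L2) : pr (star p) p = (‖p‖ : ℂ) ^ 2 := by
  rw [pr, star_star, inner_self_eq_norm_sq_to_K]; rfl

lemma pr_zero {p q : L2} (hp : ∀ j < 0, FC p j = 0) (hq : ∀ j ≤ 0, FC q j = 0) : pr p q = 0 := by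
  rw [pr_int]; exact pairing_zero hp hq

/-- coercivity on positive frequencies -/
def Coer (K : ι → C(TT, (ι → ℂ) →L[ℝ] ℂ)) (k : ℝ) : Prop :=
  ∀ v : ι → L2, (∀ i, ∀ j ≤ 0, FC (v i) j = 0) → k * ‖v‖ ^ 2 ≤ (∑ i, pr (acL (K i) (asm v)) (v i)).re

lemma Coer.bd {K : ι → C(TT, (ι → ℂ) →L[ℝ] ℂ)} {k : ℝ} (hK : Coer K k) (hk : 0 < k) {v r : ι → L2} (hv : ∀ i, ∀ j ≤ 0, FC (v i) j = 0)
    (hr : ∀ i, ∀ j < 0, FC (r i) j = FC (acL (K i) (asm v)) j) : ‖v‖ ≤ (Fintype.card ι / k) * ‖r‖ := by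
  have h1 := hK v hv
  have h2 : ∀ i, pr (acL (K i) (asm v)) (v i) = pr (r i) (v i) := by
    intro i
    have h3 : pr (acL (K i) (asm v) - r i) (v i) = 0 := by
      refine pr_zero (fun j hj => ?_) (hv i)
      rw [map_sub, lp.coeFn_sub, Pi.sub_apply, hr i j hj, sub_self]
    rw [pr_sub] at h3
    exact sub_eq_zero.1 h3
  rw [Finset.sum_congr rfl fun i _ => h2 i] at h1
  have h4 : (∑ i, pr (r i) (v i)).re ≤ Fintype.card ι * (‖r‖ * ‖v‖) := by
    refine (Complex.re_le_norm _).trans ((norm_sum_le _ _).trans ?_)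
    refine (Finset.sum_le_card_nsmul _ _ (‖r‖ * ‖v‖) fun i _ => (pr_le _ _).trans ?_).trans ?_
    · exact mul_le_mul (norm_le_pi_norm r i) (norm_le_pi_norm v i) (norm_nonneg _) (norm_nonneg _)
    · rw [nsmul_eq_mul]; rfl
  rcases (norm_nonneg v).eq_or_lt with h0 | h0
  · rw [← h0]; positivity
  · have h5 : k * ‖v‖ ≤ Fintype.card ι * ‖r‖ := by
      refine le_of_mul_le_mul_right ?_ h0
      nlinarith
    rw [div_mul_eq_mul_div, le_div_iff₀ hk]; linarith

/-- the pieces of a linear operator of multiplication type -/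
structure MulOp (K : ι → C(TT, (ι → ℂ) →L[ℝ] ℂ)) (L : ι → (ι → Seq2) →L[ℝ] Seq2) (C k B : ℝ) : Prop where
  hC : 0 ≤ C
  hk : 0 < k
  hB : 0 ≤ B
  evL : ∀ i u, ev (L i u) = apC (K i) (evV u)
  dvL : ∀ i u, ‖dv (L i u) - acL (K i) (dvV u)‖ ≤ C * ‖evV u‖
  bd : ∀ i u, ‖L i u‖ ≤ B * ‖u‖
  co : Coer K k

/-- componentwise application -/
def cw (A : Seq2 →L[ℝ] Seq2) : (ι → Seq2) →L[ℝ] (ι → Seq2) := ContinuousLinearMap.pi fun i => A.comp (ContinuousLinearMap.proj i)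
lemma cw_apply (A : Seq2 →L[ℝ] Seq2) (u : ι → Seq2) (i : ι) : cw A u i = A (u i) := rfl

/-- the linear operator to be inverted -/
def TL (L : ι → (ι → Seq2) →L[ℝ] Seq2) : (ι → Seq2) →L[ℝ] (ι → Seq2) :=
  ContinuousLinearMap.pi fun i => ((Pm.restrictScalars ℝ).comp (L i)).comp (cw (Ph.restrictScalars ℝ)) +
    ((P0.restrictScalars ℝ) + CJ.comp (Pm.restrictScalars ℝ)).comp (ContinuousLinearMap.proj i)

lemma TL_apply (L : ι → (ι → Seq2) →L[ℝ] Seq2) (u : ι → Seq2) (i : ι) :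
    TL L u i = Pm (L i (fun i => Ph (u i))) + (P0 (u i) + CJ (Pm (u i))) := rfl

lemma proj_pieces (x y z : Seq2) : Pm (Pm x + (P0 y + CJ (Pm z))) = Pm x ∧ P0 (Pm x + (P0 y + CJ (Pm z))) = P0 y ∧
    Pp (Pm x + (P0 y + CJ (Pm z))) = CJ (Pm z) := by
  refine ⟨?_, ?_, ?_⟩ <;> ext j <;>
    simp only [Pm_apply, P0_apply, Pp_apply, lp.coeFn_add, Pi.add_apply, CJ_apply] <;>
    split_ifs <;> first | omega | simp

set_option maxHeartbeats 1000000 in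
lemma MulOp.lower (ι : Type*) [Fintype ι] [DecidableEq ι] {C k B : ℝ} (hC0 : 0 ≤ C) (hk0 : 0 < k) (hB0 : 0 ≤ B) : ∃ κ > 0,
    ∀ (K : ι → C(TT, (ι → ℂ) →L[ℝ] ℂ)) (L : ι → (ι → Seq2) →L[ℝ] Seq2), MulOp K L C k B → ∀ u, ‖u‖ ≤ κ * ‖TL L u‖ := by
  set N : ℝ := Fintype.card ι / k with hN
  have hN0 : 0 ≤ N := by positivity
  obtain ⟨Ce, hCe, hitg⟩ := interp (ε := 1 / (2 * (N * C + 1))) (by positivity)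
  set q0 : ℝ := N * (1 + B) with hq0
  set v0 : ℝ := 2 * (q0 + N * ((1 + B) + C * (Ce * q0))) with hv0
  refine ⟨v0 + 2 + 1, by positivity, fun K L H u => ?_⟩
  set b : ℝ := ‖TL L u‖ with hb
  have hb0 : 0 ≤ b := norm_nonneg _
  have hTi : ∀ i, ‖TL L u i‖ ≤ b := fun i => norm_le_pi_norm (TL L u) i
  have hP := fun i => proj_pieces (L i (fun i => Ph (u i))) (u i) (u i)
  have hu0 : ∀ i, ‖P0 (u i)‖ ≤ b := fun i => by
    rw [← (hP i).2.1, ← TL_apply]; exact (P0_le _).trans (hTi i)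
  have hum : ∀ i, ‖Pm (u i)‖ ≤ b := fun i => by
    rw [← CJ_norm, ← (hP i).2.2, ← TL_apply]; exact (Pp_le _).trans (hTi i)
  set v : ι → Seq2 := fun i => Pp (u i) with hv
  set u0 : ι → Seq2 := fun i => P0 (u i) with hu0d
  have hu0n : ‖u0‖ ≤ b := (pi_norm_le_iff_of_nonneg hb0).2 hu0
  have hsum : (fun i => Ph (u i)) = u0 + v := by ext1 i; exact Ph_eq (u i)
  set r : ι → Seq2 := fun i => Pm (TL L u i) - Pm (L i u0) with hr
  have hrL : ∀ i, r i = Pm (L i v) := by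
    intro i
    have : Pm (TL L u i) = Pm (L i (fun i => Ph (u i))) := by rw [TL_apply]; exact (hP i).1
    simp only [hr]
    rw [this, hsum, map_add, map_add, add_sub_cancel_left]
  have hrn : ∀ i, ‖r i‖ ≤ (1 + B) * b := by
    intro i
    refine (norm_sub_le _ _).trans ?_
    have h1 := (Pm_le (TL L u i)).trans (hTi i)
    have h2 := (Pm_le (L i u0)).trans ((H.bd i u0).trans (mul_le_mul_of_nonneg_left hu0n H.hB))
    linarith
  have hvneg : ∀ i, ∀ j ≤ 0, v i j = 0 := by
    intro i j hj
    simp only [hv]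
    rw [Pp_apply, if_neg hj.not_gt]
  -- L2 bound
  set q : ι → L2 := fun i => cL (ev (v i)) with hq
  have hasm : ∀ i, acL (K i) (asm q) = cL (ev (L i v)) := by
    intro i
    rw [H.evL]
    refine Lp.ext ?_
    filter_upwards [acL_ae (K i) (asm q), asm_ae q, cL_ae (apC (K i) (evV v)), ae_all_iff.2 fun i => cL_ae (ev (v i))] with x h1 h2 h3 h4
    rw [h1, h2, h3, apC_apply]
    congr 1
    ext i
    exact h4 i
  have hqb : ‖q‖ ≤ q0 * b := by
    have h1 := H.co.bd H.hk (v := q) (r := fun i => cL (ev (r i))) (fun i j hj => by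
      simp only [hq]; rw [FC_ev, dW_apply, hvneg i j hj, mul_zero]) (fun i j hj => by
      rw [hasm, FC_ev, FC_ev, dW_apply, dW_apply, hrL, Pm_apply, if_pos hj])
    refine h1.trans ?_
    rw [hq0, mul_assoc]
    refine mul_le_mul_of_nonneg_left ?_ hN0
    refine (pi_norm_le_iff_of_nonneg (mul_nonneg (by linarith) hb0)).2 fun i => ?_
    rw [← dW_norm]
    exact (dW_le _).trans (hrn i)
  -- derivative bound
  set d : ι → L2 := fun i => dv (v i) with hd
  have hdb : ‖d‖ ≤ N * ((1 + B) * b + C * ‖evV v‖) := by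
    have h1 := H.co.bd H.hk (v := d) (r := fun i => dv (r i) - (dv (L i v) - acL (K i) (dvV v))) (fun i j hj => by
      simp only [hd]; rw [FC_dv, dD_apply, hvneg i j hj, mul_zero]) (fun i j hj => by
      have e : FC (dv (r i)) j = FC (dv (L i v)) j := by
        rw [FC_dv, FC_dv, dD_apply, dD_apply, hrL, Pm_apply, if_pos hj]
      have e2 : ∀ x y z : L2, FC x j = FC y j → FC (x - (y - z)) j = FC z j := fun x y z h => by
        rw [map_sub, map_sub]
        show FC x j - (FC y j - FC z j) = _
        rw [h, sub_sub_cancel]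
      exact e2 _ _ _ e)
    refine h1.trans ?_
    refine mul_le_mul_of_nonneg_left ?_ hN0
    have hev0 : 0 ≤ ‖evV v‖ := norm_nonneg _
    refine (pi_norm_le_iff_of_nonneg (add_nonneg (mul_nonneg (by linarith) hb0) (mul_nonneg H.hC hev0))).2 fun i => ?_
    refine (norm_sub_le _ _).trans (add_le_add ?_ (H.dvL i v))
    rw [← dD_norm]
    exact (dD_le _).trans (hrn i)
  have hevb : ‖evV v‖ ≤ 1 / (2 * (N * C + 1)) * ‖v‖ + Ce * ‖q‖ := by
    rw [ContinuousMap.norm_le _ (by positivity)]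
    intro x
    rw [pi_norm_le_iff_of_nonneg (by positivity)]
    intro i
    rw [evV_apply]
    refine ((ev (v i)).norm_coe_le_norm x).trans ((hitg (v i)).trans ?_)
    refine add_le_add (mul_le_mul_of_nonneg_left (norm_le_pi_norm v i) (by positivity)) (mul_le_mul_of_nonneg_left ?_ hCe)
    rw [dW_norm]; exact norm_le_pi_norm q i
  have hvb : ‖v‖ ≤ ‖q‖ + ‖d‖ := by
    rw [pi_norm_le_iff_of_nonneg (by positivity)]
    intro i
    refine (norm_split (v i)).trans (add_le_add ?_ ?_)
    · rw [dW_norm]; exact norm_le_pi_norm q i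
    · rw [dD_norm]; exact norm_le_pi_norm d i
  have hvfin : ‖v‖ ≤ v0 * b := by
    have h1 : N * C * (1 / (2 * (N * C + 1)) * ‖v‖) ≤ ‖v‖ / 2 := by
      have hNC : 0 ≤ N * C := mul_nonneg hN0 hC0
      have : N * C * (1 / (2 * (N * C + 1)) * ‖v‖) = (N * C / (N * C + 1)) * (‖v‖ / 2) := by field_simp
      rw [this]
      refine mul_le_of_le_one_left (by positivity) ?_
      rw [div_le_one (by positivity)]; linarith
    have h2 : N * (C * ‖evV v‖) ≤ ‖v‖ / 2 + N * (C * (Ce * (q0 * b))) := by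
      have h3 : N * (C * ‖evV v‖) ≤ N * (C * (1 / (2 * (N * C + 1)) * ‖v‖ + Ce * (q0 * b))) := by
        gcongr
        refine hevb.trans ?_
        gcongr
      refine h3.trans ?_
      have : N * (C * (1 / (2 * (N * C + 1)) * ‖v‖ + Ce * (q0 * b))) = N * C * (1 / (2 * (N * C + 1)) * ‖v‖) + N * (C * (Ce * (q0 * b))) := by ring
      rw [this]
      linarith
    have h4 : ‖v‖ ≤ q0 * b + (N * ((1 + B) * b) + (‖v‖ / 2 + N * (C * (Ce * (q0 * b))))) := by
      refine hvb.trans (add_le_add hqb (hdb.trans ?_))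
      rw [mul_add]
      linarith
    have h5 : v0 * b = 2 * (q0 * b + (N * ((1 + B) * b) + N * (C * (Ce * (q0 * b))))) := by rw [hv0]; ring
    rw [h5]; linarith
  rw [pi_norm_le_iff_of_nonneg (by positivity)]
  intro i
  have h6 : ‖u i‖ ≤ ‖Pm (u i)‖ + ‖P0 (u i)‖ + ‖Pp (u i)‖ := by
    conv_lhs => rw [split3 (u i)]
    exact norm_add₃_le
  have h7 : ‖Pp (u i)‖ ≤ v0 * b := (norm_le_pi_norm v i).trans hvfin
  have h8 := hu0 i
  have h9 := hum i
  nlinarith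

end S17

namespace S17

lemma moc {E : Type*} [NormedAddCommGroup E] [NormedSpace ℝ E] [CompleteSpace E] {A B : E →L[ℝ] E} {κ : ℝ} (hκ : 0 < κ)
    (hA : IsUnit A) (h : ∀ s : ℝ, 0 ≤ s → s ≤ 1 → ∀ u, ‖u‖ ≤ κ * ‖(A + s • (B - A)) u‖) : IsUnit B := by
  obtain ⟨N, hN⟩ := exists_nat_gt (κ * ‖B - A‖)
  have hN0 : (0:ℝ) < N := lt_of_le_of_lt (by positivity) hN
  have key : ∀ m : ℕ, m ≤ N → IsUnit (A + ((m:ℝ) / N) • (B - A)) := by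
    intro m
    induction m with
    | zero => intro _; simpa using hA
    | succ m ih =>
      intro hm
      obtain ⟨U, hU⟩ := ih (by omega)
      have hs0 : (0:ℝ) ≤ (m:ℝ) / N := by positivity
      have hs1 : (m:ℝ) / N ≤ 1 := by
        rw [div_le_one hN0]; exact_mod_cast (by omega : m ≤ N)
      have hUi : ∀ u, ‖((U⁻¹ : (E →L[ℝ] E)ˣ) : E →L[ℝ] E) u‖ ≤ κ * ‖u‖ := by
        intro u
        have h1 := h _ hs0 hs1 (((U⁻¹ : (E →L[ℝ] E)ˣ) : E →L[ℝ] E) u)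
        rw [← hU, ← ContinuousLinearMap.mul_apply, Units.mul_inv] at h1
        simpa using h1
      set t : E →L[ℝ] E := -(((U⁻¹ : (E →L[ℝ] E)ˣ) : E →L[ℝ] E) * ((1 / (N:ℝ)) • (B - A))) with ht
      have htn : ‖t‖ < 1 := by
        rw [ht, norm_neg]
        have h2 : ‖((U⁻¹ : (E →L[ℝ] E)ˣ) : E →L[ℝ] E)‖ ≤ κ := ContinuousLinearMap.opNorm_le_bound _ hκ.le hUi
        have h3 : ‖(1 / (N:ℝ)) • (B - A)‖ = ‖B - A‖ / N := by
          rw [norm_smul, Real.norm_of_nonneg (by positivity)]; ring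
        refine (norm_mul_le _ _).trans_lt ?_
        rw [h3]
        calc _ ≤ κ * (‖B - A‖ / N) := mul_le_mul_of_nonneg_right h2 (by positivity)
          _ < 1 := by rw [← mul_div_assoc, div_lt_one hN0]; exact hN
      have e : A + (((m + 1 : ℕ):ℝ) / N) • (B - A) = (U : E →L[ℝ] E) * (1 - t) := by
        rw [ht, sub_neg_eq_add, mul_add, mul_one, ← mul_assoc, Units.mul_inv, one_mul, hU, add_assoc, ← add_smul]
        congr 2
        push_cast; ring
      rw [e]
      exact U.isUnit.mul (Units.oneSub t htn).isUnit
  have := key N le_rfl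
  rw [div_self hN0.ne', one_smul, add_sub_cancel] at this
  exact this

variable {ι : Type*} [Fintype ι] [DecidableEq ι]

/-- base operator: conjugation -/
def L00 (i : ι) : (ι → Seq2) →L[ℝ] Seq2 := CJ.comp (ContinuousLinearMap.proj i)
/-- base multiplier: conjugation -/
def K00 (i : ι) : C(TT, (ι → ℂ) →L[ℝ] ℂ) := ContinuousMap.const _ ((Complex.conjCLE : ℂ →L[ℝ] ℂ).comp (ContinuousLinearMap.proj i))

lemma acL_K00 (i : ι) (v : ι → L2) : acL (K00 i) (asm v) = star (v i) := by
  refine Lp.ext ?_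
  filter_upwards [acL_ae (K00 i) (asm v), asm_ae v, Lp.coeFn_star (v i)] with x h1 h2 h3
  rw [h1, h2, h3]
  rfl

lemma base_evL (i : ι) (u : ι → Seq2) : ev (L00 i u) = apC (K00 i) (evV u) := by
  ext x
  show ev (CJ (u i)) x = _
  rw [ev_CJ]; rfl

lemma base_dvL (i : ι) (u : ι → Seq2) : dv (L00 i u) = acL (K00 i) (dvV u) := by
  rw [dvV_eq, acL_K00]
  exact dv_CJ (u i)

lemma norm_sq_le_sum (v : ι → L2) : ‖v‖ ^ 2 ≤ ∑ i, ‖v i‖ ^ 2 := by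
  have h : ‖v‖ ≤ Real.sqrt (∑ i, ‖v i‖ ^ 2) := by
    rw [pi_norm_le_iff_of_nonneg (by positivity)]
    intro i
    refine Real.le_sqrt_of_sq_le ?_
    exact Finset.single_le_sum (f := fun i => ‖v i‖ ^ 2) (fun i _ => by positivity) (Finset.mem_univ i)
  have h2 := pow_le_pow_left₀ (norm_nonneg _) h 2
  rwa [Real.sq_sqrt (by positivity)] at h2

lemma base_co : Coer (K00 (ι := ι)) 1 := by
  intro v _
  rw [one_mul]
  have : (∑ i, pr (acL (K00 i) (asm v)) (v i)).re = ∑ i, ‖v i‖ ^ 2 := by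
    rw [Complex.re_sum]
    refine Finset.sum_congr rfl fun i _ => ?_
    rw [acL_K00, pr_star]
    rw [← Complex.ofReal_pow, Complex.ofReal_re]
  rw [this]
  exact norm_sq_le_sum v

lemma base_unit : IsUnit (TL (L00 (ι := ι))) := by
  have h : TL (L00 (ι := ι)) * TL L00 = 1 := by
    ext1 u
    show TL L00 (TL L00 u) = u
    ext1 i
    have e : ∀ u : ι → Seq2, TL L00 u i = Pm (CJ (Ph (u i))) + (P0 (u i) + CJ (Pm (u i))) := fun u => rfl
    rw [e, e]
    ext j
    simp only [Pm_apply, P0_apply, Ph_apply, lp.coeFn_add, Pi.add_apply, CJ_apply]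
    rcases lt_trichotomy j 0 with h | h | h
    · simp [h, h.ne, h.not_gt, h.le]
    · subst h; simp
    · simp [h, h.ne', h.not_gt, h.le]
  exact ⟨⟨_, _, h, h⟩, rfl⟩

set_option maxHeartbeats 1000000 in
theorem MulOp.unit {K : ι → C(TT, (ι → ℂ) →L[ℝ] ℂ)} {L : ι → (ι → Seq2) →L[ℝ] Seq2} {C k B : ℝ} (H : MulOp K L C k B) : IsUnit (TL L) := by
  obtain ⟨κ, hκ, hl⟩ := MulOp.lower ι H.hC (lt_min H.hk one_pos) (add_nonneg H.hB zero_le_one) (C := C) (k := min k 1) (B := B + 1)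
  refine moc hκ base_unit fun s hs0 hs1 u => ?_
  set Ls : ι → (ι → Seq2) →L[ℝ] Seq2 := fun i => (1 - s) • L00 i + s • L i with hLs
  set Ks : ι → C(TT, (ι → ℂ) →L[ℝ] ℂ) := fun i => (1 - s) • K00 i + s • K i with hKs
  have e : TL (L00 (ι := ι)) + s • (TL L - TL L00) = TL Ls := by
    ext1 u
    ext1 i
    have e1 : (TL (L00 (ι := ι)) + s • (TL L - TL L00) : (ι → Seq2) →L[ℝ] (ι → Seq2)) u i = TL L00 u i + s • (TL L u i - TL L00 u i) := rfl
    have e2 : Ls i (fun i => Ph (u i)) = (1 - s) • L00 i (fun i => Ph (u i)) + s • L i (fun i => Ph (u i)) := rfl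
    have e3 : ∀ (c : ℝ) (a : Seq2), Pm (c • a) = c • Pm a := fun c a => (Pm.restrictScalars ℝ).map_smul c a
    rw [e1, TL_apply, TL_apply, TL_apply, e2, map_add, e3, e3]
    module
  rw [e]
  have hac : ∀ i h, acL (Ks i) h = (1 - s) • acL (K00 i) h + s • acL (K i) h := by
    intro i h
    simp only [hKs, map_add, map_smul]
    rfl
  refine hl Ks Ls ⟨H.hC, lt_min H.hk one_pos, add_nonneg H.hB zero_le_one, ?_, ?_, ?_, ?_⟩ u
  · intro i u
    have e2 : Ls i u = (1 - s) • L00 i u + s • L i u := rfl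
    have e3 : ∀ (c : ℝ) (a : Seq2), ev (c • a) = c • ev a := fun c a => (ev.restrictScalars ℝ).map_smul c a
    rw [e2, map_add, e3, e3, base_evL, H.evL]
    simp only [hKs, map_add, map_smul]
    rfl
  · intro i u
    have e2 : Ls i u = (1 - s) • L00 i u + s • L i u := rfl
    have e3 : ∀ (c : ℝ) (a : Seq2), dv (c • a) = c • dv a := fun c a => (dv.restrictScalars ℝ).map_smul c a
    rw [e2, map_add, e3, e3, base_dvL, hac]
    have e4 : (1 - s) • acL (K00 i) (dvV u) + s • dv (L i u) - ((1 - s) • acL (K00 i) (dvV u) + s • acL (K i) (dvV u)) =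
      s • (dv (L i u) - acL (K i) (dvV u)) := by module
    rw [e4, norm_smul, Real.norm_of_nonneg hs0]
    exact (mul_le_of_le_one_left (norm_nonneg _) hs1).trans (H.dvL i u)
  · intro i u
    have e2 : Ls i u = (1 - s) • L00 i u + s • L i u := rfl
    rw [e2]
    refine (norm_add_le _ _).trans ?_
    rw [norm_smul, norm_smul, Real.norm_of_nonneg hs0, Real.norm_of_nonneg (by linarith : (0:ℝ) ≤ 1 - s)]
    have h1 : ‖L00 i u‖ ≤ ‖u‖ := by
      show ‖CJ (u i)‖ ≤ _
      rw [CJ_norm]; exact norm_le_pi_norm u i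
    have h2 := H.bd i u
    have h3 : 0 ≤ B * ‖u‖ := mul_nonneg H.hB (norm_nonneg _)
    nlinarith [norm_nonneg u, norm_nonneg (L00 i u), norm_nonneg (L i u)]
  · intro v hv
    have h1 := base_co v hv
    have h2 := H.co v hv
    have h3 : (∑ i, pr (acL (Ks i) (asm v)) (v i)).re = (1 - s) * (∑ i, pr (acL (K00 i) (asm v)) (v i)).re + s * (∑ i, pr (acL (K i) (asm v)) (v i)).re := by
      rw [← Complex.re_ofReal_mul, ← Complex.re_ofReal_mul, ← Complex.add_re]
      congr 1
      rw [Finset.mul_sum, Finset.mul_sum, ← Finset.sum_add_distrib]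
      refine Finset.sum_congr rfl fun i _ => ?_
      rw [hac, pr_add, pr_smul, pr_smul]
    rw [h3]
    have h4 : min k 1 * ‖v‖ ^ 2 ≤ 1 * ‖v‖ ^ 2 := mul_le_mul_of_nonneg_right (min_le_right _ _) (by positivity)
    have h5 : min k 1 * ‖v‖ ^ 2 ≤ k * ‖v‖ ^ 2 := mul_le_mul_of_nonneg_right (min_le_left _ _) (by positivity)
    have h6 := mul_le_mul_of_nonneg_left (h4.trans h1) (by linarith : (0:ℝ) ≤ 1 - s)
    have h7 := mul_le_mul_of_nonneg_left (h5.trans h2) hs0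
    linarith

end S17

namespace S17
variable {n : ℕ} {Ψ : ℝ → (Fin n → ℂ) → ℝ} {R : ℝ}

/-- uncurried versions -/
def nuP (Ψ : ℝ → (Fin n → ℂ) → ℝ) (p : ℝ × (Fin n → ℂ)) : Fin n → ℂ := nu Ψ p.1 p.2
def ccP (Ψ : ℝ → (Fin n → ℂ) → ℝ) (p : ℝ × (Fin n → ℂ)) : ℂ := cc Ψ p.1 p.2
def grP (Ψ : ℝ → (Fin n → ℂ) → ℝ) (p : ℝ × (Fin n → ℂ)) : Fin n → ℂ := gr Ψ p.1 p.2

namespace Data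
lemma gr_per (D : Data n Ψ R) (θ : ℝ) : gr Ψ (θ + 2 * Real.pi) = gr Ψ θ := by
  have : Ψ (θ + 2 * Real.pi) = Ψ θ := funext fun w => D.per θ w
  funext w
  unfold gr; rw [this]
lemma cc_per (D : Data n Ψ R) (θ : ℝ) : cc Ψ (θ + 2 * Real.pi) = cc Ψ θ := by
  funext w; unfold cc; rw [D.gr_per]
lemma nu_per (D : Data n Ψ R) (θ : ℝ) : nu Ψ (θ + 2 * Real.pi) = nu Ψ θ := by
  funext w; unfold nu; rw [D.gr_per, D.cc_per]
lemma OK_dom (D : Data n Ψ R) : PDom (OK Ψ) := ⟨D.OK_open, fun θ w => by unfold OK; simp only [mem_ofPred_eq, D.cc_per]⟩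
lemma nuP_per (D : Data n Ψ R) : Per (nuP Ψ) := fun θ w => by unfold nuP; simp only [D.nu_per]
lemma ccP_per (D : Data n Ψ R) : Per (ccP Ψ) := fun θ w => by unfold ccP; simp only [D.cc_per]
lemma nuP_c (D : Data n Ψ R) : ContDiffOn ℝ 5 (nuP Ψ) (OK Ψ) := D.nu_contDiff
lemma ccP_c (D : Data n Ψ R) : ContDiffOn ℝ 5 (ccP Ψ) (OK Ψ) := D.cc_contDiff.mono fun _ h => h.1
lemma grP_c (D : Data n Ψ R) : ContDiffOn ℝ 5 (grP Ψ) (OK Ψ) := D.grC.mono fun _ h => h.1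

lemma dnu (D : Data n Ψ R) {p : ℝ × (Fin n → ℂ)} (hp : p ∈ OK Ψ) (v : Fin n → ℂ) :
    ccP Ψ p • pw (nuP Ψ) p v = pw (grP Ψ) p v - pw (ccP Ψ) p v • nuP Ψ p := by
  obtain ⟨θ, w⟩ := p
  have h1 := pw_has D.OK_dom (D.nuP_c.of_le (by norm_num)) hp
  have h2 := pw_has D.OK_dom (D.ccP_c.of_le (by norm_num)) hp
  have h3 := pw_has D.OK_dom (D.grP_c.of_le (by norm_num)) hp
  have h4 := h2.smul h1
  have h5 : (fun w => ccP Ψ (θ, w) • nuP Ψ (θ, w)) =ᶠ[nhds w] fun w => grP Ψ (θ, w) := by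
    have : ∀ᶠ w' in nhds w, (θ, w') ∈ OK Ψ := (Continuous.prodMk_right θ).continuousAt.eventually (D.OK_open.mem_nhds hp)
    filter_upwards [this] with w' hw'
    unfold ccP nuP nu grP
    rw [smul_smul, mul_inv_cancel₀ hw'.2, one_smul]
  have h6 := (h4.congr_of_eventuallyEq h5.symm).unique h3
  have h7 := congrArg (fun L => L v) h6
  simp only [ContinuousLinearMap.add_apply, ContinuousLinearMap.smul_apply, ContinuousLinearMap.smulRight_apply] at h7
  rw [← h7, eq_sub_iff_add_eq]

lemma pw_gr (D : Data n Ψ R) {p : ℝ × (Fin n → ℂ)} (hp : p ∈ OK Ψ) : fderiv ℝ (gr Ψ p.1) p.2 = pw (grP Ψ) p :=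
  (pw_has (θ := p.1) (w := p.2) D.OK_dom (D.grP_c.of_le (by norm_num)) hp).fderiv

set_option maxHeartbeats 1000000 in
lemma coer_pt (D : Data n Ψ R) {s : ℝ} (hs : 0 < s) : ∃ ε > (0:ℝ), ∃ k > (0:ℝ), ∃ C > (0:ℝ), ∀ p ∈ KS Ψ R s, ∀ m > (0:ℝ), ∀ Y : ℂ,
    ‖(ccP Ψ p)⁻¹ * Y - m‖ ≤ ε * m → ∀ v : Fin n → ℂ,
    m * k * ‖v‖ ^ 2 ≤ (Y * (v ⬝ᵥ pw (nuP Ψ) p v)).re + C * m * ‖nuP Ψ p ⬝ᵥ v‖ ^ 2 := by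
  obtain ⟨k, hk, C, hC, hco⟩ := D.hess_coercive (D.KS_compact s) (D.KS_ne hs)
  obtain ⟨B1, hB1, hB1b⟩ := compact_bound (D.KS_compact s) ((pw_c D.OK_dom D.grP_c (k := 0) (by norm_num)).continuousOn.mono (D.KS_OK hs))
  obtain ⟨B2, hB2, hB2b⟩ := compact_bound (D.KS_compact s) ((pw_c D.OK_dom D.ccP_c (k := 0) (by norm_num)).continuousOn.mono (D.KS_OK hs))
  obtain ⟨B3, hB3, hB3b⟩ := compact_bound (D.KS_compact s) (D.ccP_c.continuousOn.mono (D.KS_OK hs))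
  set ε : ℝ := min 1 (k / (8 * (n * B1 + 1))) with hε
  have hε0 : 0 < ε := lt_min one_pos (by positivity)
  have hε1 : ε ≤ 1 := min_le_left _ _
  have hε2 : ε * (n * B1) ≤ k / 8 := by
    have h1 : ε ≤ k / (8 * (n * B1 + 1)) := min_le_right _ _
    have h2 : ε * (8 * (n * B1 + 1)) ≤ k := (le_div_iff₀ (by positivity)).1 h1
    nlinarith
  refine ⟨ε, hε0, k / 8, by positivity, C * B3 ^ 2 / 2 + 4 * B2 ^ 2 / k, by positivity, fun p hp m hm Y hY v => ?_⟩
  have hOK := D.KS_OK hs hp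
  have hcc : ccP Ψ p ≠ 0 := hOK.2
  have h1 := D.dnu hOK v
  have h2 := hco p hp v
  rw [D.pw_gr hOK] at h2
  set S : ℂ := v ⬝ᵥ pw (grP Ψ) p v with hS
  set lam : ℂ := nuP Ψ p ⬝ᵥ v with hlam
  set Dc : ℂ := pw (ccP Ψ) p v with hDc
  have h3 : ccP Ψ p * (v ⬝ᵥ pw (nuP Ψ) p v) = S - Dc * lam := by
    have := congrArg (fun x => v ⬝ᵥ x) h1
    simp only [dotProduct_smul, dotProduct_sub, smul_eq_mul] at this
    rw [this, dotProduct_comm v (nuP Ψ p)]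
  have h4 : v ⬝ᵥ gr Ψ p.1 p.2 = ccP Ψ p * lam := by
    have : gr Ψ p.1 p.2 = ccP Ψ p • nuP Ψ p := by
      unfold nuP nu ccP; rw [smul_smul, mul_inv_cancel₀ hOK.2, one_smul]
    rw [this, dotProduct_smul, dotProduct_comm]; rfl
  rw [h4, norm_mul, mul_pow] at h2
  have h5 : ‖S‖ ≤ n * B1 * ‖v‖ ^ 2 := by
    refine (dot_norm_le _ _).trans ?_
    have : ‖pw (grP Ψ) p v‖ ≤ B1 * ‖v‖ := (ContinuousLinearMap.le_opNorm _ _).trans (mul_le_mul_of_nonneg_right (hB1b p hp) (norm_nonneg _))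
    calc n * ‖v‖ * ‖pw (grP Ψ) p v‖ ≤ n * ‖v‖ * (B1 * ‖v‖) := by gcongr
      _ = _ := by ring
  have h6 : ‖Dc‖ ≤ B2 * ‖v‖ := (ContinuousLinearMap.le_opNorm _ _).trans (mul_le_mul_of_nonneg_right (hB2b p hp) (norm_nonneg _))
  have h7 : ‖ccP Ψ p‖ ^ 2 ≤ B3 ^ 2 := pow_le_pow_left₀ (norm_nonneg _) (hB3b p hp) 2
  set e : ℂ := (ccP Ψ p)⁻¹ * Y - m with he
  have h8 : Y * (v ⬝ᵥ pw (nuP Ψ) p v) = m * S - (m * (Dc * lam) - e * (S - Dc * lam)) := by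
    have : Y = ccP Ψ p * (m + e) := by rw [he]; field_simp; ring
    rw [this, mul_right_comm, h3]; ring
  have h9 : (m * (Dc * lam) - e * (S - Dc * lam)).re ≤ m * (B2 * ‖v‖ * ‖lam‖) + ε * m * (n * B1 * ‖v‖ ^ 2 + B2 * ‖v‖ * ‖lam‖) := by
    refine (Complex.re_le_norm _).trans ((norm_sub_le _ _).trans ?_)
    have h10 : ‖Dc * lam‖ ≤ B2 * ‖v‖ * ‖lam‖ := by rw [norm_mul]; gcongr
    rw [norm_mul (m : ℂ), norm_mul e]
    refine add_le_add ?_ (mul_le_mul hY ((norm_sub_le _ _).trans (add_le_add h5 h10)) (norm_nonneg _) (by positivity))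
    rw [Complex.norm_real, Real.norm_of_nonneg hm.le]
    gcongr
  rw [h8, Complex.sub_re, Complex.re_ofReal_mul]
  have hx : 0 ≤ B2 * ‖v‖ * ‖lam‖ := by positivity
  have h11 : ε * m * (n * B1 * ‖v‖ ^ 2 + B2 * ‖v‖ * ‖lam‖) ≤ m * (k / 8 * ‖v‖ ^ 2 + B2 * ‖v‖ * ‖lam‖) := by
    have a1 : ε * (n * B1) * ‖v‖ ^ 2 ≤ k / 8 * ‖v‖ ^ 2 := by gcongr
    have a2 : ε * (B2 * ‖v‖ * ‖lam‖) ≤ 1 * (B2 * ‖v‖ * ‖lam‖) := by gcongr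
    have : ε * (n * B1 * ‖v‖ ^ 2 + B2 * ‖v‖ * ‖lam‖) ≤ k / 8 * ‖v‖ ^ 2 + B2 * ‖v‖ * ‖lam‖ := by linarith
    calc _ = m * (ε * (n * B1 * ‖v‖ ^ 2 + B2 * ‖v‖ * ‖lam‖)) := by ring
      _ ≤ _ := by gcongr
  have h12 : 2 * (B2 * ‖v‖ * ‖lam‖) ≤ k / 4 * ‖v‖ ^ 2 + 4 * B2 ^ 2 / k * ‖lam‖ ^ 2 := by
    have a1 : 0 ≤ (k / 2 * ‖v‖ - 2 * B2 * ‖lam‖) ^ 2 := sq_nonneg _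
    have a2 : 0 ≤ (k / 2 * ‖v‖ - 2 * B2 * ‖lam‖) ^ 2 / k := by positivity
    have a3 : (k / 2 * ‖v‖ - 2 * B2 * ‖lam‖) ^ 2 / k = k / 4 * ‖v‖ ^ 2 + 4 * B2 ^ 2 / k * ‖lam‖ ^ 2 - 2 * (B2 * ‖v‖ * ‖lam‖) := by
      field_simp; ring
    linarith
  have h13 : C * (‖ccP Ψ p‖ ^ 2 * ‖lam‖ ^ 2) ≤ C * (B3 ^ 2 * ‖lam‖ ^ 2) := by gcongr
  have h14 : k / 2 * ‖v‖ ^ 2 - C * B3 ^ 2 / 2 * ‖lam‖ ^ 2 ≤ S.re := by linarith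
  have h15 : m * (k / 8 * ‖v‖ ^ 2 + 2 * (B2 * ‖v‖ * ‖lam‖) + k / 8 * ‖v‖ ^ 2) ≤ m * (S.re + (C * B3 ^ 2 / 2 + 4 * B2 ^ 2 / k) * ‖lam‖ ^ 2) := by
    refine mul_le_mul_of_nonneg_left ?_ hm.le
    nlinarith [sq_nonneg ‖v‖]
  nlinarith
end Data
end S17

namespace S17
variable {n : ℕ} {Ψ : ℝ → (Fin n → ℂ) → ℝ} {R : ℝ} {t : ℝ} {a : Fin n → Seq2}

/-- solutions in the Sobolev class, in coefficient form -/
structure WS (Ψ : ℝ → (Fin n → ℂ) → ℝ) (R t : ℝ) (a : Fin n → Seq2) : Prop where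
  ht : 0 < t
  htR : t ≤ R
  an : ∀ i, ∀ j < 0, a i j = 0
  lev : ∀ θ : ℝ, Ψ θ (evV a (θ : TT)) = t
  nug : ∃ b : Fin n → Seq2, (∀ i, ∀ j < 0, b i j = 0) ∧ ∀ θ : ℝ, evV b (θ : TT) = nu Ψ θ (evV a (θ : TT))

/-- vector extension -/
def extV (a : Fin n → Seq2) (z : ℂ) : Fin n → ℂ := fun i => ext (a i) z

lemma extV_dcc (a : Fin n → Seq2) : DiffContOnCl ℂ (extV a) (ball 0 1) :=
  ⟨differentiableOn_pi.2 fun i => (ext_dcc (a i)).differentiableOn, continuousOn_pi.2 fun i => (ext_dcc (a i)).continuousOn⟩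

lemma extV_ex {a : Fin n → Seq2} (ha : ∀ i, ∀ j < 0, a i j = 0) (θ : ℝ) : extV a (ex θ) = evV a (θ : TT) := by
  ext i; exact ext_ex (ha i) θ

lemma neg_of_dcc {a : Seq2} {f : ℂ → ℂ} (hf : DiffContOnCl ℂ f (ball 0 1)) (h : ∀ θ : ℝ, ev a (θ : TT) = f (ex θ)) : ∀ j < 0, a j = 0 := by
  intro j hj
  have h1 := dcc_neg hf h j hj
  rw [FC_ev, dW_apply] at h1
  exact (mul_eq_zero.1 h1).resolve_left (inv_ne_zero (wtC_ne j))

lemma WS.sol_of (W : WS Ψ R t a) {b : Fin n → Seq2} (hb : ∀ i, ∀ j < 0, b i j = 0)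
    (hab : ∀ θ : ℝ, evV b (θ : TT) = nu Ψ θ (evV a (θ : TT))) : Sol Ψ R t (extV a) (extV b) where
  ht := W.ht
  htR := W.htR
  hf := extV_dcc a
  hg := extV_dcc b
  lev := fun θ _ => by rw [extV_ex W.an]; exact W.lev θ
  nug := fun θ _ => by rw [extV_ex W.an, extV_ex hb]; exact hab θ

lemma WS.pOK (W : WS Ψ R t a) (D : Data n Ψ R) (θ : ℝ) : (θ, evV a (θ : TT)) ∈ OK Ψ := by
  have h := W.lev θ
  exact D.mem_OK (by rw [h]; exact W.ht) (by rw [h]; exact W.htR)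

lemma WS.gOK (W : WS Ψ R t a) (D : Data n Ψ R) : evV a ∈ gU (OK Ψ) := W.pOK D

lemma ex_contDiff {N : WithTop ℕ∞} : ContDiff ℝ N ex := by
  unfold ex
  exact (Complex.ofRealCLM.contDiff.mul contDiff_const).cexp

lemma polyex_contDiff (A : Polynomial ℂ) {N : WithTop ℕ∞} : ContDiff ℝ N (fun θ => A.eval (ex θ)) := by
  have h : ContDiff ℂ N (fun z : ℂ => A.eval z) := A.differentiable.contDiff
  exact (h.restrict_scalars ℝ).comp ex_contDiff

lemma dcc_exp {f : ℂ → ℂ} (hf : DiffContOnCl ℂ f (ball 0 1)) : DiffContOnCl ℂ (fun z => Complex.exp (f z)) (ball 0 1) :=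
  ⟨hf.differentiableOn.cexp, hf.continuousOn.cexp⟩

set_option maxHeartbeats 1000000 in
lemma WS.exY (W : WS Ψ R t a) (D : Data n Ψ R) : ∃ (yy : Seq2) (Yd : ℂ → ℂ) (m : ℝ → ℝ), DiffContOnCl ℂ Yd (ball 0 1) ∧ (∀ z, Yd z ≠ 0) ∧
    (∀ θ : ℝ, ev yy (θ : TT) = Yd (ex θ)) ∧ ∀ θ : ℝ, 0 < m θ ∧ ev yy (θ : TT) = m θ * ccP Ψ (θ, evV a (θ : TT)) := by
  obtain ⟨b, hb, hab⟩ := W.nug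
  have S := W.sol_of hb hab
  obtain ⟨A, m0, hm0, -, hA⟩ := exists_Y (S.cc_log D).inv (ε := 1 / 2) (by norm_num)
  set κ : ℝ × (Fin n → ℂ) → ℂ := fun p => ccP Ψ p * Complex.exp (-(A.eval (ex p.1))) with hκ
  have hκc : ContDiffOn ℝ 2 κ (OK Ψ) := by
    refine (D.ccP_c.of_le (by norm_num)).mul (ContDiff.contDiffOn ?_)
    exact (((polyex_contDiff A).comp contDiff_fst).neg).cexp
  have hκp : Per κ := fun θ w => by
    simp only [hκ]; rw [D.ccP_per, ex_add_twopi]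
  set U : Set (ℝ × (Fin n → ℂ)) := OK Ψ ∩ κ ⁻¹' Complex.slitPlane with hU
  have hUd : PDom U := by
    refine ⟨hκc.continuousOn.isOpen_inter_preimage D.OK_open Complex.isOpen_slitPlane, fun θ w => ?_⟩
    simp only [hU, mem_inter_iff, mem_preimage, D.OK_dom.per, hκp θ w]
  have H : NOK U (fun p => Complex.log (κ p)) := by
    refine ⟨hUd, ?_, fun θ w => by simp only [hκp θ w]⟩
    intro p hp
    have h1 : ContDiffAt ℝ 2 Complex.log (κ p) := (Complex.contDiffAt_log hp.2).restrict_scalars ℝ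
    exact h1.comp_contDiffWithinAt p ((hκc.mono inter_subset_left) p hp)
  have hin : evV a ∈ gU U := by
    refine gU_of_TI hUd fun θ hθ => ⟨W.pOK D θ, ?_⟩
    have h1 := hA θ hθ
    rw [extV_ex W.an] at h1
    have h2 : 0 < ((cc Ψ θ (evV a (θ : TT)))⁻¹ * Complex.exp (A.eval (ex θ))).re := by
      have h3 := (Complex.abs_re_le_norm _).trans h1
      rw [Complex.sub_re, Complex.ofReal_re, abs_le] at h3
      linarith [hm0 θ, h3.1]
    have h4 : κ (θ, evV a (θ : TT)) = ((cc Ψ θ (evV a (θ : TT)))⁻¹ * Complex.exp (A.eval (ex θ)))⁻¹ := by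
      simp only [hκ, ccP]
      rw [mul_inv, inv_inv, Complex.exp_neg]
    refine Or.inl ?_
    rw [h4, Complex.inv_re]
    refine div_pos h2 (Complex.normSq_pos.2 fun h0 => ?_)
    rw [h0] at h2; simp at h2
  set l : Seq2 := Nem (fun p => Complex.log (κ p)) a with hl
  have hlev : ∀ θ : ℝ, Complex.exp (ev l (θ : TT)) = κ (θ, evV a (θ : TT)) := fun θ => by
    rw [hl, ev_Nem_apply H hin θ]
    exact Complex.exp_log (Complex.slitPlane_ne_zero (hin θ).2)
  set y1 : Seq2 := l - (Pm l + CJ (Pm l)) with hy1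
  have hy1n : ∀ j < 0, y1 j = 0 := by
    intro j hj
    rw [hy1, lp.coeFn_sub, Pi.sub_apply, lp.coeFn_add, Pi.add_apply, CJ_apply, Pm_apply, Pm_apply, if_pos hj, if_neg (by omega)]
    simp
  have hy1e : ∀ θ : ℝ, ev y1 (θ : TT) = ev l (θ : TT) - ((2 * (ev (Pm l) (θ : TT)).re : ℝ) : ℂ) := by
    intro θ
    rw [hy1, map_sub, map_add, ContinuousMap.sub_apply, ContinuousMap.add_apply, ev_CJ, Complex.add_conj]
  set E : ℝ × (Unit → ℂ) → ℂ := fun p => Complex.exp (A.eval (ex p.1) + p.2 ()) with hE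
  have HE : NOK univ E := by
    refine ⟨⟨isOpen_univ, fun _ _ => by simp⟩, ContDiff.contDiffOn ?_, fun θ w => by simp only [hE]; rw [ex_add_twopi]⟩
    exact (((polyex_contDiff A).comp contDiff_fst).add (by fun_prop)).cexp
  have hyy : ∀ θ : ℝ, ev (Nem E (fun _ => y1)) (θ : TT) = Complex.exp (A.eval (ex θ) + ev y1 (θ : TT)) := fun θ => by
    rw [ev_Nem_apply HE (fun _ => mem_univ _) θ]; rfl
  refine ⟨Nem E (fun _ => y1), fun z => Complex.exp (A.eval z + ext y1 z), fun θ => Real.exp (-(2 * (ev (Pm l) (θ : TT)).re)), ?_, fun z => Complex.exp_ne_zero _,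
    fun θ => ?_, fun θ => ⟨Real.exp_pos _, ?_⟩⟩
  · exact dcc_exp (A.differentiable.diffContOnCl.add (ext_dcc y1))
  · beta_reduce; rw [hyy, ext_ex hy1n]
  · rw [hyy, hy1e, add_sub, sub_eq_add_neg, Complex.exp_add, Complex.exp_add, hlev]
    simp only [hκ]
    rw [Complex.exp_neg, Complex.ofReal_exp, mul_comm (Complex.exp _), mul_assoc (ccP Ψ _), inv_mul_cancel₀ (Complex.exp_ne_zero _)]
    push_cast; ring
end S17

namespace S17
variable {n : ℕ} {Ψ : ℝ → (Fin n → ℂ) → ℝ} {R : ℝ} {t : ℝ} {a : Fin n → Seq2}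

lemma dot_gr {p : ℝ × (Fin n → ℂ)} (h : p ∈ OK Ψ) (v : Fin n → ℂ) : v ⬝ᵥ gr Ψ p.1 p.2 = ccP Ψ p * (nuP Ψ p ⬝ᵥ v) := by
  have : gr Ψ p.1 p.2 = ccP Ψ p • nuP Ψ p := by
    unfold nuP nu ccP; rw [smul_smul, mul_inv_cancel₀ h.2, one_smul]
  rw [this, dotProduct_smul, dotProduct_comm]; rfl

set_option maxHeartbeats 1000000 in
lemma WS.pt (W : WS Ψ R t a) (D : Data n Ψ R) {yy : Seq2} {m : ℝ → ℝ}
    (hm : ∀ θ : ℝ, 0 < m θ ∧ ev yy (θ : TT) = m θ * ccP Ψ (θ, evV a (θ : TT))) :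
    ∃ k > (0:ℝ), ∃ C > (0:ℝ), ∃ μ > (0:ℝ), ∀ θ ∈ TI, ∀ v : Fin n → ℂ,
      k * ‖v‖ ^ 2 + C * ((ev yy (θ : TT) * (nuP Ψ (θ, evV a (θ : TT)) ⬝ᵥ v)) * (ev yy (θ : TT) * (nuP Ψ (θ, evV a (θ : TT)) ⬝ᵥ v))).re ≤
      (ev yy (θ : TT) * (v ⬝ᵥ pw (nuP Ψ) (θ, evV a (θ : TT)) v) + ((μ * (2 * (v ⬝ᵥ gr Ψ θ (evV a (θ : TT))).re) : ℝ) : ℂ) *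
        (ev yy (θ : TT) * (nuP Ψ (θ, evV a (θ : TT)) ⬝ᵥ v))).re := by
  obtain ⟨ε, hε, k, hk, C, hC, hco⟩ := D.coer_pt W.ht
  have hKS : ∀ θ ∈ TI, (θ, evV a (θ : TT)) ∈ Data.KS Ψ R t := fun θ hθ => ⟨TI_sub hθ, (W.lev θ).ge, (W.lev θ).le.trans W.htR⟩
  have hccc := D.ccP_c.continuousOn.mono (D.KS_OK W.ht)
  obtain ⟨c2, hc2, hc2b⟩ := compact_bound (D.KS_compact t) hccc
  obtain ⟨c1, hc1, hc1b⟩ := compact_lower (D.KS_compact t) hccc.norm (fun p hp => norm_pos_iff.2 (D.KS_OK W.ht hp).2)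
  have hyc : ContinuousOn (fun θ : ℝ => ev yy (θ : TT)) TI := ((ev yy).continuous.comp coeTT_cont).continuousOn
  obtain ⟨y2, hy2, hy2b⟩ := compact_bound TI_compact hyc
  obtain ⟨y1, hy1, hy1b⟩ := compact_lower TI_compact hyc.norm (fun θ hθ => norm_pos_iff.2 (by
    rw [(hm θ).2]; exact mul_ne_zero (by exact_mod_cast (hm θ).1.ne') (W.pOK D θ).2))
  set C3 : ℝ := C / (y1 / c2 * c1 ^ 2) with hC3
  have hC30 : 0 < C3 := by positivity
  refine ⟨y1 / c2 * k, by positivity, C3, hC30, C3 * (y2 / c1), by positivity, fun θ hθ v => ?_⟩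
  set p : ℝ × (Fin n → ℂ) := (θ, evV a (θ : TT)) with hp
  have hpOK : p ∈ OK Ψ := W.pOK D θ
  set lam := nuP Ψ p ⬝ᵥ v with hlam
  set Y := ev yy (θ : TT) with hY
  have hm0 := (hm θ).1
  have hmY : Y = m θ * ccP Ψ p := (hm θ).2
  have hn : ‖Y‖ = m θ * ‖ccP Ψ p‖ := by rw [hmY, norm_mul, Complex.norm_real, Real.norm_of_nonneg hm0.le]
  have hcp : 0 < ‖ccP Ψ p‖ := norm_pos_iff.2 hpOK.2
  have hm1 : y1 / c2 ≤ m θ := by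
    rw [div_le_iff₀ hc2]
    have := hy1b θ hθ
    rw [← hY, hn] at this
    exact this.trans (mul_le_mul_of_nonneg_left (hc2b p (hKS θ hθ)) hm0.le)
  have hm2 : m θ ≤ y2 / c1 := by
    rw [le_div_iff₀ hc1]
    have := hy2b θ hθ
    rw [← hY, hn] at this
    exact (mul_le_mul_of_nonneg_left (hc1b p (hKS θ hθ)) hm0.le).trans this
  have h1 := hco p (hKS θ hθ) (m θ) hm0 Y (by
    rw [hmY, mul_comm (m θ : ℂ), inv_mul_cancel_left₀ (show ccP Ψ p ≠ 0 from hpOK.2), sub_self, norm_zero]; positivity) v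
  have h2 : v ⬝ᵥ gr Ψ θ (evV a (θ : TT)) = ccP Ψ p * lam := dot_gr hpOK v
  set P := Y * lam with hP
  have h3 : (ccP Ψ p * lam).re = P.re / m θ := by
    have : P = m θ * (ccP Ψ p * lam) := by rw [hP, hmY, mul_assoc]
    rw [this, Complex.re_ofReal_mul, mul_div_cancel_left₀ _ hm0.ne']
  rw [h2, h3, Complex.add_re, Complex.re_ofReal_mul]
  have h4 : C * m θ * ‖lam‖ ^ 2 ≤ C3 * ‖P‖ ^ 2 := by
    rw [hP, norm_mul, hn, hC3]
    have h5 : y1 / c2 * c1 ^ 2 ≤ m θ * ‖ccP Ψ p‖ ^ 2 := by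
      have := hc1b p (hKS θ hθ)
      gcongr
    rw [div_mul_eq_mul_div, le_div_iff₀ (by positivity)]
    calc C * m θ * ‖lam‖ ^ 2 * (y1 / c2 * c1 ^ 2) ≤ C * m θ * ‖lam‖ ^ 2 * (m θ * ‖ccP Ψ p‖ ^ 2) := by gcongr
      _ = _ := by ring
  have h6 : C3 * (2 * P.re ^ 2) ≤ C3 * (y2 / c1) * (2 * (P.re / m θ)) * P.re := by
    have : 1 ≤ y2 / c1 / m θ := by rw [le_div_iff₀ hm0, one_mul]; exact hm2
    calc C3 * (2 * P.re ^ 2) = C3 * (2 * P.re ^ 2) * 1 := by ring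
      _ ≤ C3 * (2 * P.re ^ 2) * (y2 / c1 / m θ) := by gcongr
      _ = _ := by ring
  have h7 : (P * P).re = 2 * P.re ^ 2 - ‖P‖ ^ 2 := by
    rw [Complex.mul_re, ← Complex.normSq_eq_norm_sq, Complex.normSq_apply]; ring
  rw [h7]
  have h8 : y1 / c2 * k * ‖v‖ ^ 2 ≤ m θ * k * ‖v‖ ^ 2 := by gcongr
  linarith

set_option maxHeartbeats 1000000 in
lemma WS.coer (W : WS Ψ R t a) (D : Data n Ψ R) {yy : Seq2} {Yd : ℂ → ℂ} {m : ℝ → ℝ} (hYd : DiffContOnCl ℂ Yd (ball 0 1))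
    (hY : ∀ θ : ℝ, ev yy (θ : TT) = Yd (ex θ))
    (hm : ∀ θ : ℝ, 0 < m θ ∧ ev yy (θ : TT) = m θ * ccP Ψ (θ, evV a (θ : TT)))
    {b : Fin n → Seq2} (hb : ∀ i, ∀ j < 0, b i j = 0) (hab : ∀ θ : ℝ, evV b (θ : TT) = nu Ψ θ (evV a (θ : TT))) :
    ∃ k > (0:ℝ), ∃ μ > (0:ℝ), ∀ K : Fin n → C(TT, (Fin n → ℂ) →L[ℝ] ℂ),
      (∀ i, ∀ θ : ℝ, ∀ v, K i (θ : TT) v = ev yy (θ : TT) * (pw (nuP Ψ) (θ, evV a (θ : TT)) v i +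
        ((μ * (2 * (v ⬝ᵥ gr Ψ θ (evV a (θ : TT))).re) : ℝ) : ℂ) * ev (b i) (θ : TT))) → Coer K k := by
  obtain ⟨k, hk, C, hC, μ, hμ, hpt⟩ := W.pt D hm
  refine ⟨k, hk, μ, hμ, fun K hK v hv => ?_⟩
  -- the function p
  set q : Fin n → C(TT, ℂ) := fun i => ev yy * ev (b i) with hq
  have hqn : ∀ i, ∀ j < 0, FC (cL (q i)) j = 0 := fun i => by
    refine dcc_neg (f := fun z => Yd z * ext (b i) z) (hYd.smul (ext_dcc (b i))) fun θ => ?_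
    beta_reduce
    rw [ext_ex (hb i), ← hY]; rfl
  have hmul : ∀ i, ∃ w : L2, w =ᵐ[mT] fun x => q i x * v i x := fun i =>
    ⟨acL (F := ℂ) ⟨fun x => ContinuousLinearMap.mul ℝ ℂ (q i x), by fun_prop⟩ (v i), by
      filter_upwards [acL_ae (F := ℂ) ⟨fun x => ContinuousLinearMap.mul ℝ ℂ (q i x), by fun_prop⟩ (v i)] with x hx
      rw [hx]; rfl⟩
  choose w hw using hmul
  set P : L2 := ∑ i, w i with hP
  have hPn : ∀ j ≤ 0, FC P j = 0 := by
    intro j hj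
    have h1 : ∀ i, FC (w i) j = 0 := fun i => mul_pos_spec (hqn i) (hv i) (hw i) j hj
    rw [hP, map_sum, lp.coeFn_sum, Finset.sum_apply]
    exact Finset.sum_eq_zero fun i _ => h1 i
  have hPae : P =ᵐ[mT] fun x => ∑ i, q i x * v i x := by
    have h1 := Lp.coeFn_finsetSum Finset.univ w
    have h2 : ∀ᵐ x ∂mT, ∀ i, w i x = q i x * v i x := ae_all_iff.2 hw
    filter_upwards [h1, h2] with x hx1 hx2
    rw [hP, hx1, Finset.sum_apply]
    exact Finset.sum_congr rfl fun i _ => hx2 i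
  have hPP : pr P P = 0 := pr_zero (fun j hj => hPn j hj.le) hPn
  -- pointwise inequality
  have hx : ∀ x : TT, ∀ u : Fin n → ℂ, k * ‖u‖ ^ 2 + C * ((∑ i, q i x * u i) * (∑ i, q i x * u i)).re ≤ (∑ i, K i x u * u i).re := by
    intro x u
    have h1 := hpt (rp x) (rp_mem x) u
    rw [rp_coe] at h1
    have h2 : ∀ i, K i x u = ev yy x * (pw (nuP Ψ) (rp x, evV a x) u i +
        ((μ * (2 * (u ⬝ᵥ gr Ψ (rp x) (evV a x)).re) : ℝ) : ℂ) * ev (b i) x) := fun i => by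
      have := hK i (rp x) u
      rwa [rp_coe] at this
    have h3 : nuP Ψ (rp x, evV a x) = evV b x := by
      have := hab (rp x)
      rw [rp_coe] at this
      rw [this]; rfl
    rw [h3] at h1
    have h4 : (∑ i, q i x * u i) = ev yy x * (evV b x ⬝ᵥ u) := by
      unfold dotProduct; rw [Finset.mul_sum]
      refine Finset.sum_congr rfl fun i _ => ?_
      rw [evV_apply]; simp only [hq, ContinuousMap.mul_apply]; ring
    rw [h4]
    convert h1 using 2
    unfold dotProduct
    simp only [Finset.mul_sum, ← Finset.sum_add_distrib]
    refine Finset.sum_congr rfl fun i _ => ?_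
    rw [h2, evV_apply]; unfold dotProduct; ring
  -- integrate
  have hitg : ∀ p q : L2, Integrable (fun x => p x * q x) mT := fun p q => (Lp.memLp p).integrable_mul (Lp.memLp q)
  have hsum : ∑ i, pr (acL (K i) (asm v)) (v i) = ∫ x, ∑ i, K i x (fun i => v i x) * v i x ∂mT := by
    rw [integral_finset_sum]
    · refine Finset.sum_congr rfl fun i _ => ?_
      rw [pr_int]
      refine integral_congr_ae ?_
      filter_upwards [acL_ae (K i) (asm v), asm_ae v] with x h1 h2
      rw [h1, h2]
    · intro i _
      refine (hitg (acL (K i) (asm v)) (v i)).congr ?_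
      filter_upwards [acL_ae (K i) (asm v), asm_ae v] with x h1 h2
      rw [h1, h2]
  have hsint : Integrable (fun x => ∑ i, K i x (fun i => v i x) * v i x) mT := by
    refine integrable_finset_sum _ fun i _ => ?_
    refine (hitg (acL (K i) (asm v)) (v i)).congr ?_
    filter_upwards [acL_ae (K i) (asm v), asm_ae v] with x h1 h2
    rw [h1, h2]
  have hone : ∀ i, k * ‖v i‖ ^ 2 ≤ (∑ i, pr (acL (K i) (asm v)) (v i)).re := by
    intro i
    have e1 : ((‖v i‖ : ℂ)) ^ 2 = ∫ x, star (v i) x * v i x ∂mT := by rw [← pr_star, pr_int]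
    have e2 : ‖v i‖ ^ 2 = ∫ x, (star (v i) x * v i x).re ∂mT := by
      have h := integral_re (𝕜 := ℂ) (hitg (star (v i)) (v i))
      rw [← e1] at h
      simp only [RCLike.re_to_complex] at h
      rw [h]; norm_cast
    have e3 : ∫ x, (P x * P x).re ∂mT = 0 := by
      have h := integral_re (𝕜 := ℂ) (hitg P P)
      rw [← pr_int, hPP] at h
      simpa using h
    have e4 := integral_re (𝕜 := ℂ) hsint
    simp only [RCLike.re_to_complex] at e4
    rw [hsum, ← e4]
    have hre : ∀ p q : L2, Integrable (fun x => (p x * q x).re) mT := fun p q => (hitg p q).re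
    have e5 : k * ‖v i‖ ^ 2 = ∫ x, (k * (star (v i) x * v i x).re + C * (P x * P x).re) ∂mT := by
      rw [integral_add ((hre _ _).const_mul k) ((hre _ _).const_mul C), integral_const_mul, integral_const_mul, e3, ← e2]; ring
    rw [e5]
    refine integral_mono_ae (((hre _ _).const_mul k).add ((hre _ _).const_mul C)) hsint.re ?_
    filter_upwards [hPae, Lp.coeFn_star (v i)] with x h1 h2
    beta_reduce
    rw [h1, h2]
    refine le_trans ?_ (hx x fun i => v i x)
    have h3 : (star (v i x) * v i x).re = ‖v i x‖ ^ 2 := by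
      rw [mul_comm, ← Complex.normSq_eq_norm_sq, Complex.star_def, Complex.mul_conj, Complex.ofReal_re]
    rw [Pi.star_apply, h3]
    have h4 : ‖v i x‖ ≤ ‖fun i => v i x‖ := norm_le_pi_norm (fun i => v i x) i
    gcongr
  rcases isEmpty_or_nonempty (Fin n) with he | he
  · have : v = 0 := Subsingleton.elim _ _
    rw [this]; simp
  · obtain ⟨i, hi⟩ := Finite.exists_max (fun i => ‖v i‖)
    have : ‖v‖ ≤ ‖v i‖ := (pi_norm_le_iff_of_nonneg (norm_nonneg _)).2 hi
    have h2 : ‖v‖ ^ 2 ≤ ‖v i‖ ^ 2 := pow_le_pow_left₀ (norm_nonneg _) this 2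
    exact (mul_le_mul_of_nonneg_left h2 hk.le).trans (hone i)
end S17

namespace S17
variable {n : ℕ} {Ψ : ℝ → (Fin n → ℂ) → ℝ} {R : ℝ} {t : ℝ} {a : Fin n → Seq2}

/-- index set: unknown components and coefficient components -/
abbrev IX (n : ℕ) := Fin n ⊕ Option (Fin n)

/-- the unknown components -/
def lft : (IX n → ℂ) →L[ℝ] (Fin n → ℂ) := ContinuousLinearMap.pi fun i => ContinuousLinearMap.proj (Sum.inl i)
lemma lft_apply (x : IX n → ℂ) : lft x = fun i => x (Sum.inl i) := rfl

/-- inclusion of the unknown components -/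
def inlL (X : Type*) [NormedAddCommGroup X] [NormedSpace ℝ X] : (Fin n → X) →L[ℝ] (IX n → X) :=
  ContinuousLinearMap.pi (Sum.elim (fun i => ContinuousLinearMap.proj i) fun _ => 0)

/-- the nonlinear expression -/
def phi (Ψ : ℝ → (Fin n → ℂ) → ℝ) (μ : ℝ) (i : Fin n) (p : ℝ × (IX n → ℂ)) : ℂ :=
  p.2 (Sum.inr none) * (nuP Ψ (p.1, lft p.2) i + ((μ * Ψ p.1 (lft p.2) : ℝ) : ℂ) * p.2 (Sum.inr (some i)))

/-- its domain -/
def UX (Ψ : ℝ → (Fin n → ℂ) → ℝ) : Set (ℝ × (IX n → ℂ)) := {p | (p.1, lft p.2) ∈ OK Ψ}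

lemma lftP_c {N : WithTop ℕ∞} : ContDiff ℝ N (fun p : ℝ × (IX n → ℂ) => (p.1, lft p.2)) := by fun_prop

lemma Data.Psi_c (D : Data n Ψ R) : ContDiffOn ℝ 2 (fun p : ℝ × (Fin n → ℂ) => ((Ψ p.1 p.2 : ℝ) : ℂ)) (OK Ψ) :=
  Complex.ofRealCLM.contDiff.comp_contDiffOn ((D.smooth.of_le (by norm_num)).mono fun _ h => h.1)

lemma Data.UX_dom (D : Data n Ψ R) : PDom (UX Ψ) :=
  ⟨D.OK_open.preimage (lftP_c (N := 0)).continuous, fun θ w => D.OK_dom.per θ (lft w)⟩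

lemma Data.phi_NOK (D : Data n Ψ R) (μ : ℝ) (i : Fin n) : NOK (UX Ψ) (phi Ψ μ i) := by
  refine ⟨D.UX_dom, ?_, fun θ w => ?_⟩
  · have h1 : ContDiffOn ℝ 2 (fun p : ℝ × (IX n → ℂ) => nuP Ψ (p.1, lft p.2) i) (UX Ψ) :=
      (contDiffOn_pi.1 ((D.nuP_c.of_le (by norm_num)).comp lftP_c.contDiffOn fun p hp => hp)) i
    have h2 : ContDiffOn ℝ 2 (fun p : ℝ × (IX n → ℂ) => ((μ * Ψ p.1 (lft p.2) : ℝ) : ℂ)) (UX Ψ) := by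
      simp only [Complex.ofReal_mul]
      exact contDiffOn_const.mul (D.Psi_c.comp lftP_c.contDiffOn fun p hp => hp)
    have h3 : ∀ k : IX n, ContDiffOn ℝ 2 (fun p : ℝ × (IX n → ℂ) => p.2 k) (UX Ψ) := fun k => by fun_prop
    exact (h3 _).mul (h1.add (h2.mul (h3 _)))
  · have := D.nuP_per θ (lft w)
    simp only [phi, this, D.per]

lemma Data.phi_pw (D : Data n Ψ R) (μ : ℝ) (i : Fin n) {p : ℝ × (IX n → ℂ)} (hp : p ∈ UX Ψ) (v : Fin n → ℂ) :
    pw (phi Ψ μ i) p (inlL ℂ v) = p.2 (Sum.inr none) * (pw (nuP Ψ) (p.1, lft p.2) v i +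
        ((μ * (2 * (v ⬝ᵥ gr Ψ p.1 (lft p.2)).re) : ℝ) : ℂ) * p.2 (Sum.inr (some i))) := by
  obtain ⟨θ, x⟩ := p
  have hl : HasDerivAt (fun s : ℝ => x + s • inlL ℂ v) (inlL ℂ v) 0 := by
    simpa using ((hasDerivAt_id (0:ℝ)).smul_const (inlL ℂ v)).const_add x
  have hl' : HasDerivAt (fun s : ℝ => lft x + s • v) v 0 := by
    simpa using ((hasDerivAt_id (0:ℝ)).smul_const v).const_add (lft x)
  have h1 : HasDerivAt (fun s : ℝ => phi Ψ μ i (θ, x + s • inlL ℂ v)) (pw (phi Ψ μ i) (θ, x) (inlL ℂ v)) 0 := by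
    have h := pw_has D.UX_dom (D.phi_NOK μ i).c1 hp
    have h' : HasFDerivAt (fun w => phi Ψ μ i (θ, w)) (pw (phi Ψ μ i) (θ, x)) (x + (0:ℝ) • inlL ℂ v) := by rwa [zero_smul, add_zero]
    exact h'.comp_hasDerivAt 0 hl
  have h2 : HasDerivAt (fun s : ℝ => nuP Ψ (θ, lft x + s • v)) (pw (nuP Ψ) (θ, lft x) v) 0 := by
    have h := pw_has D.OK_dom (D.nuP_c.of_le (by norm_num)) (show (θ, lft x) ∈ OK Ψ from hp)
    have h' : HasFDerivAt (fun w => nuP Ψ (θ, w)) (pw (nuP Ψ) (θ, lft x)) (lft x + (0:ℝ) • v) := by rwa [zero_smul, add_zero]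
    exact h'.comp_hasDerivAt 0 hl'
  have h3 := ((D.hasDerivAt_line (θ := θ) (x := lft x) hp.1 v).const_mul μ).ofReal_comp
  have h4 := (((hasDerivAt_pi.1 h2 i).add (h3.mul_const (x (Sum.inr (some i))))).const_mul (x (Sum.inr none)))
  refine h1.unique (h4.congr_of_eventuallyEq (Eventually.of_forall fun s => ?_))
  have e1 : lft (x + s • inlL ℂ v) = lft x + s • v := by
    rw [map_add, map_smul]; rfl
  have e2 : ∀ k, (x + s • inlL ℂ v) (Sum.inr k) = x (Sum.inr k) := fun k => by
    simp [inlL]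
  simp only [phi, e1, e2, Pi.add_apply]

/-- the full argument -/
def Jm (yy : Seq2) (b : Fin n → Seq2) (a : Fin n → Seq2) : IX n → Seq2 := Sum.elim a (fun o => o.elim yy b)

lemma Jm_eq (yy : Seq2) (b a : Fin n → Seq2) : Jm yy b a = inlL Seq2 a + Jm yy b 0 := by
  funext k; rcases k with k | k <;> simp [Jm, inlL]

lemma lft_Jm (yy : Seq2) (b a : Fin n → Seq2) (x : TT) : lft (evV (Jm yy b a) x) = evV a x := rfl
lemma ev_Jm_none (yy : Seq2) (b a : Fin n → Seq2) (x : TT) : evV (Jm yy b a) x (Sum.inr none) = ev yy x := rfl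
lemma ev_Jm_some (yy : Seq2) (b a : Fin n → Seq2) (x : TT) (i : Fin n) : evV (Jm yy b a) x (Sum.inr (some i)) = ev (b i) x := rfl
lemma Jm_mem {yy : Seq2} {b a : Fin n → Seq2} : evV (Jm yy b a) ∈ gU (UX Ψ) ↔ evV a ∈ gU (OK Ψ) := Iff.rfl

/-- the nonlinear operator -/
def EE (Ψ : ℝ → (Fin n → ℂ) → ℝ) (μ : ℝ) (yy : Seq2) (b : Fin n → Seq2) (i : Fin n) (a : Fin n → Seq2) : Seq2 := Nem (phi Ψ μ i) (Jm yy b a)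

lemma Data.EE_ev (D : Data n Ψ R) (μ : ℝ) (yy : Seq2) (b : Fin n → Seq2) (i : Fin n) (ha : evV a ∈ gU (OK Ψ)) (θ : ℝ) :
    ev (EE Ψ μ yy b i a) (θ : TT) = ev yy (θ : TT) * (nu Ψ θ (evV a (θ : TT)) i + ((μ * Ψ θ (evV a (θ : TT)) : ℝ) : ℂ) * ev (b i) (θ : TT)) := by
  rw [EE, ev_Nem_apply (D.phi_NOK μ i) (Jm_mem.2 ha) θ]; rfl

lemma Data.EE_c1 (D : Data n Ψ R) (μ : ℝ) (yy : Seq2) (b : Fin n → Seq2) (i : Fin n) (ha : evV a ∈ gU (OK Ψ)) :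
    ContDiffAt ℝ 1 (EE Ψ μ yy b i) a ∧ HasFDerivAt (EE Ψ μ yy b i) ((NemL (phi Ψ μ i) (Jm yy b a)).comp (inlL Seq2)) a := by
  have h1 := Nem_c1 (D.phi_NOK μ i) (Jm_mem (yy := yy) (b := b).2 ha)
  have e : EE Ψ μ yy b i = Nem (phi Ψ μ i) ∘ fun a => inlL Seq2 a + Jm yy b 0 := by
    funext a; rw [Function.comp, ← Jm_eq]; rfl
  have hL : HasFDerivAt (fun a => inlL Seq2 a + Jm yy b 0) (inlL Seq2 : (Fin n → Seq2) →L[ℝ] (IX n → Seq2)) a :=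
    ((inlL Seq2).hasFDerivAt).add_const _
  have hLc : ContDiffAt ℝ 1 (fun a => inlL Seq2 a + Jm yy b 0) a :=
    ((inlL Seq2 : (Fin n → Seq2) →L[ℝ] (IX n → Seq2)).contDiff.add contDiff_const).contDiffAt
  constructor
  · rw [e]
    exact ContDiffAt.comp a (by rw [← Jm_eq]; exact h1) hLc
  · rw [e]
    have h2 : HasFDerivAt (Nem (phi Ψ μ i)) (NemL (phi Ψ μ i) (Jm yy b a)) (inlL Seq2 a + Jm yy b 0) := by
      rw [← Jm_eq]; exact (h1.differentiableAt one_ne_zero).hasFDerivAt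
    exact h2.comp a hL

set_option maxHeartbeats 1000000 in
lemma WS.mulop (W : WS Ψ R t a) (D : Data n Ψ R) {yy : Seq2} {Yd : ℂ → ℂ} {m : ℝ → ℝ} (hYd : DiffContOnCl ℂ Yd (ball 0 1))
    (hY : ∀ θ : ℝ, ev yy (θ : TT) = Yd (ex θ))
    (hm : ∀ θ : ℝ, 0 < m θ ∧ ev yy (θ : TT) = m θ * ccP Ψ (θ, evV a (θ : TT)))
    {b : Fin n → Seq2} (hb : ∀ i, ∀ j < 0, b i j = 0) (hab : ∀ θ : ℝ, evV b (θ : TT) = nu Ψ θ (evV a (θ : TT))) :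
    ∃ μ > (0:ℝ), IsUnit (TL fun i => (NemL (phi Ψ μ i) (Jm yy b a)).comp (inlL Seq2)) := by
  obtain ⟨k, hk, μ, hμ, hco⟩ := W.coer D hYd hY hm hb hab
  refine ⟨μ, hμ, ?_⟩
  have ha := W.gOK D
  have hJ : evV (Jm yy b a) ∈ gU (UX Ψ) := Jm_mem.2 ha
  set K : Fin n → C(TT, (Fin n → ℂ) →L[ℝ] ℂ) := fun i => ⟨fun x => (NemC (pw (phi Ψ μ i)) (evV (Jm yy b a)) x).comp (inlL ℂ), by fun_prop⟩ with hK
  choose C hC hCb using fun i => dv_NemL_split (D.phi_NOK μ i) hJ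
  set L : Fin n → (Fin n → Seq2) →L[ℝ] Seq2 := fun i => (NemL (phi Ψ μ i) (Jm yy b a)).comp (inlL Seq2) with hL
  have hev : ∀ (u : Fin n → Seq2) (x : TT), evV (inlL Seq2 u) x = inlL ℂ (evV u x) := fun u x => by
    funext k; rcases k with k | k
    · rfl
    · show ev (0 : Seq2) x = 0
      simp
  refine MulOp.unit (K := K) (C := ∑ i, C i) (k := k) (B := ∑ i, ‖L i‖) ⟨Finset.sum_nonneg fun i _ => hC i, hk,
    Finset.sum_nonneg fun i _ => norm_nonneg _, fun i u => ?_, fun i u => ?_, fun i u => ?_, hco K fun i θ v => ?_⟩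
  · show ev (NemL (phi Ψ μ i) (Jm yy b a) (inlL Seq2 u)) = _
    rw [ev_NemL (D.phi_NOK μ i) hJ]
    ext x
    rw [apC_apply, apC_apply, hev]; rfl
  · have h1 := hCb i (inlL Seq2 u)
    have h2 : acL (NemC (pw (phi Ψ μ i)) (evV (Jm yy b a))) (dvV (inlL Seq2 u)) = acL (K i) (dvV u) := by
      refine Lp.ext ?_
      have h5 : ∀ᵐ x ∂mT, (dv (0 : Seq2) : L2) x = 0 := by
        rw [map_zero]; filter_upwards [Lp.coeFn_zero ℂ 2 mT] with x hx; rw [hx]; rfl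
      filter_upwards [acL_ae (NemC (pw (phi Ψ μ i)) (evV (Jm yy b a))) (dvV (inlL Seq2 u)), acL_ae (K i) (dvV u), dvV_ae u, dvV_ae (inlL Seq2 u), h5] with x h1 h2 h3 h4 h5
      rw [h1, h2, h3, h4]
      show _ = NemC (pw (phi Ψ μ i)) (evV (Jm yy b a)) x (inlL ℂ _)
      congr 1
      funext k; rcases k with k | k
      · rfl
      · exact h5
    rw [h2] at h1
    refine h1.trans (mul_le_mul (Finset.single_le_sum (fun i _ => hC i) (Finset.mem_univ i)) ?_ (norm_nonneg _) (Finset.sum_nonneg fun i _ => hC i))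
    rw [ContinuousMap.norm_le _ (norm_nonneg _)]
    intro x
    rw [hev, pi_norm_le_iff_of_nonneg (norm_nonneg _)]
    intro k; rcases k with k | k
    · exact (norm_le_pi_norm (evV u x) k).trans ((evV u).norm_coe_le_norm x)
    · show ‖(0:ℂ)‖ ≤ _
      rw [norm_zero]; exact norm_nonneg _
  · exact ((L i).le_opNorm u).trans (mul_le_mul_of_nonneg_right (Finset.single_le_sum (f := fun i => ‖L i‖) (fun i _ => norm_nonneg _) (Finset.mem_univ i)) (norm_nonneg _))
  · show NemC (pw (phi Ψ μ i)) (evV (Jm yy b a)) (θ : TT) (inlL ℂ v) = _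
    rw [NemC_apply D.UX_dom (D.phi_NOK μ i).pwc.continuousOn (pw_per (D.phi_NOK μ i).per) hJ, D.phi_pw μ i (hJ θ)]
    rfl

/-- constants as sequences -/
def constV : (Fin n → ℂ) →L[ℝ] (Fin n → Seq2) :=
  ContinuousLinearMap.pi fun i => ((lp.singleContinuousLinearMap ℝ (fun _ : ℤ => ℂ) 2 0).comp (ContinuousLinearMap.proj i))

lemma constV_apply (w : Fin n → ℂ) (i : Fin n) (j : ℤ) : constV w i j = if j = 0 then w i else 0 := by
  show (lp.single 2 0 (w i) : Seq2) j = _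
  rw [lp.coeFn_single, Pi.single_apply]

set_option maxHeartbeats 1000000 in
lemma WS.inv (W : WS Ψ R t a) (D : Data n Ψ R) {yy : Seq2} {b : Fin n → Seq2} {μ : ℝ}
    (hneg : ∀ i, ∀ j < 0, EE Ψ μ yy b i a j = 0)
    (hU : IsUnit (TL fun i => (NemL (phi Ψ μ i) (Jm yy b a)).comp (inlL Seq2))) :
    ∃ A : (Fin n → ℂ) → (Fin n → Seq2), ContDiffAt ℝ 1 A (fun i => a i 0) ∧ A (fun i => a i 0) = a ∧
      ∀ᶠ w in nhds (fun i => a i 0), ∀ i, A w i 0 = w i ∧ ∀ j < 0, A w i j = 0 ∧ EE Ψ μ yy b i (A w) j = 0 := by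
  set w0 : Fin n → ℂ := fun i => a i 0 with hw0
  have hPa : cw (Ph.restrictScalars ℝ) a = a := by
    funext i; ext j
    rw [cw_apply]
    show Ph (a i) j = _
    rw [Ph_apply]; split_ifs with h
    · rfl
    · exact (W.an i j (not_le.1 h)).symm
  set Φ : (Fin n → Seq2) → (Fin n → Seq2) := fun x i => (Pm.restrictScalars ℝ) (EE Ψ μ yy b i (cw (Ph.restrictScalars ℝ) x)) +
    ((P0.restrictScalars ℝ) + CJ.comp (Pm.restrictScalars ℝ)) (x i) with hΦ
  have hE := fun i => D.EE_c1 μ yy b i (W.gOK D)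
  have hP : HasFDerivAt (fun x => cw (Ph.restrictScalars ℝ) x) (cw (Ph.restrictScalars ℝ) : (Fin n → Seq2) →L[ℝ] _) a := (cw _).hasFDerivAt
  have hΦd : HasFDerivAt Φ (TL fun i => (NemL (phi Ψ μ i) (Jm yy b a)).comp (inlL Seq2)) a := by
    refine hasFDerivAt_pi.2 fun i => HasFDerivAt.add ?_ ?_
    · have h1 : HasFDerivAt (EE Ψ μ yy b i) ((NemL (phi Ψ μ i) (Jm yy b a)).comp (inlL Seq2)) (cw (Ph.restrictScalars ℝ) a) := by
        rw [hPa]; exact (hE i).2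
      exact ((Pm.restrictScalars ℝ).hasFDerivAt.comp a (h1.comp a hP))
    · exact (((P0.restrictScalars ℝ) + CJ.comp (Pm.restrictScalars ℝ)).hasFDerivAt.comp a (hasFDerivAt_apply i a))
  have hΦc : ContDiffAt ℝ 1 Φ a := by
    refine contDiffAt_pi.2 fun i => ContDiffAt.add ?_ ?_
    · have h1 : ContDiffAt ℝ 1 (EE Ψ μ yy b i) (cw (Ph.restrictScalars ℝ) a) := by rw [hPa]; exact (hE i).1
      have h2 : ContDiff ℝ 1 (cw (Ph.restrictScalars ℝ) : (Fin n → Seq2) →L[ℝ] (Fin n → Seq2)) := by fun_prop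
      exact ((Pm.restrictScalars ℝ).contDiff.contDiffAt.comp a (h1.comp a h2.contDiffAt))
    · exact (((P0.restrictScalars ℝ) + CJ.comp (Pm.restrictScalars ℝ)).contDiff.contDiffAt.comp a (contDiff_apply ℝ Seq2 i).contDiffAt)
  obtain ⟨T, hT⟩ := hU
  set T' : (Fin n → Seq2) ≃L[ℝ] (Fin n → Seq2) := ContinuousLinearEquiv.unitsEquiv ℝ _ T with hT'
  have hT2 : (T' : (Fin n → Seq2) →L[ℝ] (Fin n → Seq2)) = TL fun i => (NemL (phi Ψ μ i) (Jm yy b a)).comp (inlL Seq2) := by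
    rw [← hT]; rfl
  have hd : HasFDerivAt Φ (T' : (Fin n → Seq2) →L[ℝ] (Fin n → Seq2)) a := by rw [hT2]; exact hΦd
  have hΦa : Φ a = constV w0 := by
    funext i
    simp only [hΦ, hPa]
    ext j
    show (Pm (EE Ψ μ yy b i a) + (P0 (a i) + CJ (Pm (a i)))) j = _
    rw [lp.coeFn_add, Pi.add_apply, lp.coeFn_add, Pi.add_apply, Pm_apply, P0_apply, CJ_apply, Pm_apply, constV_apply]
    rcases lt_trichotomy j 0 with h | h | h
    · rw [if_pos h, if_neg h.ne, if_neg (by omega), if_neg h.ne, hneg i j h]; simp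
    · subst h; simp [hw0]
    · rw [if_neg (by omega), if_neg h.ne', if_pos (by omega), if_neg h.ne', W.an i _ (by omega)]; simp
  have hs := hΦc.hasStrictFDerivAt' hd one_ne_zero
  refine ⟨fun w => hΦc.localInverse hd one_ne_zero (constV w), ?_, ?_, ?_⟩
  · have h1 := hΦc.to_localInverse hd one_ne_zero
    rw [hΦa] at h1
    exact h1.comp w0 constV.contDiff.contDiffAt
  · show hΦc.localInverse hd one_ne_zero (constV w0) = a
    rw [← hΦa]; exact hΦc.localInverse_apply_image hd one_ne_zero
  · have h1 := hs.eventually_right_inverse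
    rw [hΦa] at h1
    have h2 : ∀ᶠ w in nhds w0, Φ (hΦc.localInverse hd one_ne_zero (constV w)) = constV w :=
      (constV.continuous.tendsto w0).eventually h1
    filter_upwards [h2] with w hw
    set x := hΦc.localInverse hd one_ne_zero (constV w) with hx
    have h3 : ∀ i, Pm (EE Ψ μ yy b i (cw (Ph.restrictScalars ℝ) x)) + (P0 (x i) + CJ (Pm (x i))) = constV w i := fun i => congrFun hw i
    have h4 : ∀ i j, (if j < 0 then EE Ψ μ yy b i (cw (Ph.restrictScalars ℝ) x) j else 0) + ((if j = 0 then x i j else 0) + (starRingEnd ℂ) (if -j < 0 then x i (-j) else 0)) =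
        if j = 0 then w i else 0 := fun i j => by
      have := congrArg (fun s : Seq2 => s j) (h3 i)
      beta_reduce at this
      rwa [lp.coeFn_add, Pi.add_apply, lp.coeFn_add, Pi.add_apply, Pm_apply, P0_apply, CJ_apply, Pm_apply, constV_apply] at this
    have hxn : ∀ i, ∀ j < 0, x i j = 0 := fun i j hj => by
      have := h4 i (-j)
      rw [if_neg (by omega), if_neg (by omega), if_pos (by omega), if_neg (by omega)] at this
      simpa using this
    have hPx : cw (Ph.restrictScalars ℝ) x = x := by
      funext i; ext j
      show Ph (x i) j = _
      rw [Ph_apply]; split_ifs with h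
      · rfl
      · exact (hxn i j (not_le.1 h)).symm
    rw [hPx] at h4
    refine fun i => ⟨by simpa using h4 i 0, fun j hj => ⟨hxn i j hj, ?_⟩⟩
    have := h4 i j
    rw [if_pos hj, if_neg (by omega), if_neg (by omega), if_neg (by omega)] at this
    simpa using this
end S17

namespace S17
variable {n : ℕ} {Ψ : ℝ → (Fin n → ℂ) → ℝ} {R : ℝ} {t : ℝ} {a : Fin n → Seq2}

lemma Data.Psi_NOK (D : Data n Ψ R) : NOK (OK Ψ) (fun p : ℝ × (Fin n → ℂ) => ((Ψ p.1 p.2 : ℝ) : ℂ)) :=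
  ⟨D.OK_dom, D.Psi_c, fun θ w => by simp only [D.per]⟩
lemma Data.nu_NOK (D : Data n Ψ R) (i : Fin n) : NOK (OK Ψ) (fun p : ℝ × (Fin n → ℂ) => nuP Ψ p i) :=
  ⟨D.OK_dom, contDiffOn_pi.1 (D.nuP_c.of_le (by norm_num)) i, fun θ w => by simp only [D.nuP_per θ w]⟩

lemma coef_of_real {r : Seq2} (hr : ∀ j < 0, r j = 0) (h : ∀ x, (starRingEnd ℂ) (ev r x) = ev r x) : ∀ j, j ≠ 0 → r j = 0 := by
  have h1 : CJ r = r := ev_inj (by ext x; rw [ev_CJ, h])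
  intro j hj
  rcases hj.lt_or_gt with h3 | h3
  · exact hr j h3
  · rw [← h1, CJ_apply, hr _ (by omega), map_zero]

lemma const_of_real {r : Seq2} (hr : ∀ j < 0, r j = 0) (h : ∀ x, (starRingEnd ℂ) (ev r x) = ev r x) (x y : TT) : ev r x = ev r y := by
  have h2 := coef_of_real hr h
  have h4 : ∀ x, ev r x = dW r 0 := fun x => by
    have := hasSum_single (f := fun j => dW r j * fourier j x) 0 (fun j hj => by rw [dW_apply, h2 j hj]; simp)
    rw [(ev_hasSum r x).unique this, fourier_zero, mul_one]
  rw [h4, h4]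

lemma dcc_mul {f g : ℂ → ℂ} (hf : DiffContOnCl ℂ f (ball 0 1)) (hg : DiffContOnCl ℂ g (ball 0 1)) : DiffContOnCl ℂ (fun z => f z * g z) (ball 0 1) :=
  ⟨hf.differentiableOn.mul hg.differentiableOn, hf.continuousOn.mul hg.continuousOn⟩

lemma dcc_inv {f : ℂ → ℂ} (hf : DiffContOnCl ℂ f (ball 0 1)) (h : ∀ z, ‖z‖ ≤ 1 → f z ≠ 0) : DiffContOnCl ℂ (fun z => (f z)⁻¹) (ball 0 1) :=
  hf.inv fun z hz => h z (by rw [closure_ball _ one_ne_zero] at hz; simpa using hz)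

set_option maxHeartbeats 1000000 in
lemma Data.recover (D : Data n Ψ R) {yy : Seq2} {Yd : ℂ → ℂ} (hYd : DiffContOnCl ℂ Yd (ball 0 1)) (hY0 : ∀ z, Yd z ≠ 0)
    (hY : ∀ θ : ℝ, ev yy (θ : TT) = Yd (ex θ)) {b : Fin n → Seq2} (hb : ∀ i, ∀ j < 0, b i j = 0) {μ : ℝ} (hμ : 0 < μ)
    (hO : evV a ∈ gU (OK Ψ)) (ha : ∀ i, ∀ j < 0, a i j = 0) (hE : ∀ i, ∀ j < 0, EE Ψ μ yy b i a j = 0)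
    (hba : ∀ θ : ℝ, ‖evV b (θ : TT) ⬝ᵥ evV a (θ : TT) - 1‖ ≤ 1 / 2) :
    ∃ t, (∀ θ : ℝ, Ψ θ (evV a (θ : TT)) = t) ∧ ∃ b' : Fin n → Seq2, (∀ i, ∀ j < 0, b' i j = 0) ∧ ∀ θ : ℝ, evV b' (θ : TT) = nu Ψ θ (evV a (θ : TT)) := by
  set E : Fin n → Seq2 := fun i => EE Ψ μ yy b i a with hEd
  have hEv : ∀ θ : ℝ, ∀ i, ext (E i) (ex θ) = Yd (ex θ) * (nu Ψ θ (evV a (θ : TT)) i + ((μ * Ψ θ (evV a (θ : TT)) : ℝ) : ℂ) * ev (b i) (θ : TT)) := fun θ i => by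
    rw [ext_ex (hE i), ← hY]; exact D.EE_ev μ yy b i hO θ
  have hbf : ∀ z, ‖z‖ ≤ 1 → extV b z ⬝ᵥ extV a z ≠ 0 := fun z hz h0 => by
    have := max_bd ((dcc_dot (extV_dcc b) (extV_dcc a)).sub (diffContOnCl_const (c := (1:ℂ)))) (C := 1 / 2) (fun θ _ => by
      simp only [Pi.sub_apply]
      rw [extV_ex hb, extV_ex ha]; exact hba θ) hz
    simp only [Pi.sub_apply] at this
    rw [h0] at this; norm_num at this
  have hμC : (μ : ℂ) ≠ 0 := by exact_mod_cast hμ.ne'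
  set q : ℂ → ℂ := fun z => ((extV E z ⬝ᵥ extV a z) * (Yd z)⁻¹ - 1) * ((μ : ℂ) * (extV b z ⬝ᵥ extV a z))⁻¹ with hq
  have hqd : DiffContOnCl ℂ q (ball 0 1) := by
    refine dcc_mul ((dcc_mul (dcc_dot (extV_dcc E) (extV_dcc a)) (dcc_inv hYd fun z _ => hY0 z)).sub diffContOnCl_const) (dcc_inv (dcc_mul diffContOnCl_const (dcc_dot (extV_dcc b) (extV_dcc a))) fun z hz => mul_ne_zero hμC (hbf z hz))
  have hqe : ∀ θ : ℝ, q (ex θ) = ((Ψ θ (evV a (θ : TT)) : ℝ) : ℂ) := fun θ => by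
    have h1 : extV E (ex θ) = Yd (ex θ) • (nu Ψ θ (evV a (θ : TT)) + ((μ * Ψ θ (evV a (θ : TT)) : ℝ) : ℂ) • extV b (ex θ)) := by
      funext i
      rw [extV_ex hb]
      exact hEv θ i
    have h2 := hbf (ex θ) (ex_norm θ).le
    have h3 := nu_dot_self (hO θ).2
    simp only [hq]
    rw [h1, smul_dotProduct, add_dotProduct, smul_dotProduct]
    rw [extV_ex ha] at h2 ⊢
    rw [h3]
    simp only [smul_eq_mul]
    have h4 := hY0 (ex θ)
    push_cast
    field_simp
    ring
  set r : Seq2 := Nem (fun p : ℝ × (Fin n → ℂ) => ((Ψ p.1 p.2 : ℝ) : ℂ)) a with hr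
  have hre : ∀ θ : ℝ, ev r (θ : TT) = ((Ψ θ (evV a (θ : TT)) : ℝ) : ℂ) := fun θ => ev_Nem_apply D.Psi_NOK hO θ
  have hrn : ∀ j < 0, r j = 0 := neg_of_dcc hqd fun θ => by rw [hre, hqe]
  have hrc := const_of_real hrn fun x => by rw [← rp_coe x, hre, Complex.conj_ofReal]
  have hlev : ∀ θ : ℝ, Ψ θ (evV a (θ : TT)) = Ψ 0 (evV a ((0:ℝ) : TT)) := fun θ => by
    have := hrc (θ : TT) ((0:ℝ) : TT)
    rw [hre, hre] at this
    exact_mod_cast this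
  refine ⟨_, hlev, fun i => Nem (fun p : ℝ × (Fin n → ℂ) => nuP Ψ p i) a, fun i => ?_, fun θ => ?_⟩
  · set t := Ψ 0 (evV a ((0:ℝ) : TT)) with ht
    refine neg_of_dcc (f := fun z => ext (E i) z * (Yd z)⁻¹ - ((μ * t : ℝ) : ℂ) * ext (b i) z) ?_ fun θ => ?_
    · exact (dcc_mul (ext_dcc (E i)) (dcc_inv hYd fun z _ => hY0 z)).sub (dcc_mul diffContOnCl_const (ext_dcc _))
    · rw [ev_Nem_apply (D.nu_NOK i) hO θ, hEv, hlev, ext_ex (hb i), mul_comm (Yd _), mul_assoc, mul_inv_cancel₀ (hY0 _), mul_one, add_sub_cancel_right]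
      rfl
  · funext i
    exact ev_Nem_apply (D.nu_NOK i) hO θ

set_option maxHeartbeats 1000000 in
lemma Data.top_le (D : Data n Ψ R) {w0 : Fin n → ℂ} (hw0 : euclNorm w0 = R) : ∃ δ > (0:ℝ), ∀ (t' : ℝ) (a' b' : Fin n → Seq2) (w : Fin n → ℂ),
    (∀ i, ∀ j < 0, a' i j = 0) → (∀ i, ∀ j < 0, b' i j = 0) → evV a' ∈ gU (OK Ψ) → (∀ θ : ℝ, Ψ θ (evV a' (θ : TT)) = t') →
    (∀ θ : ℝ, evV b' (θ : TT) = nu Ψ θ (evV a' (θ : TT))) → (∀ θ : ℝ, ‖evV a' (θ : TT) - w0‖ < δ) → ‖w - w0‖ < δ → (∀ i, a' i 0 = w i) →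
    euclNorm w ≤ R → t' ≤ R := by
  have hRpos : 0 < R := by linarith [D.hR]
  have hl0 : ∀ θ, Ψ θ w0 = R := fun θ => (D.levelR θ w0).2 hw0
  have hw00 : w0 ≠ 0 := D.ne_of_pos (θ := 0) (by rw [hl0]; exact hRpos)
  have hw0n : 0 < ‖w0‖ := norm_pos_iff.2 hw00
  set Z : Set (ℝ × (Fin n → ℂ)) := Icc (-10) 10 ×ˢ closedBall w0 (‖w0‖ / 2) with hZd
  have hZ : IsCompact Z := isCompact_Icc.prod (isCompact_closedBall _ _)
  have hZ0 : Z ⊆ {p | p.2 ≠ 0} := fun p hp h0 => by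
    have := hp.2
    rw [h0, mem_closedBall, dist_comm, dist_zero_right] at this
    linarith
  obtain ⟨δ1, hδ1, k, hk, C, hC, hLT⟩ := D.LT hZ hZ0
  obtain ⟨M, hM, hMb⟩ := compact_bound hZ (q := fun p : ℝ × (Fin n → ℂ) => gr Ψ p.1 p.2) (D.grC.continuousOn.mono hZ0)
  have hO0 : ContinuousMap.const TT w0 ∈ gU (OK Ψ) := fun θ => D.mem_OK (by simp only [ContinuousMap.const_apply, hl0]; exact hRpos) (by simp only [ContinuousMap.const_apply, hl0]; exact le_rfl)
  obtain ⟨c, hc, hcb⟩ := compact_lower TI_compact (q := fun θ : ℝ => ‖cc Ψ θ w0‖)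
    ((ContinuousOn.comp (f := fun θ : ℝ => (θ, w0)) D.ccP_c.continuousOn (by fun_prop) fun θ _ => hO0 θ).norm) (fun θ _ => norm_pos_iff.2 (hO0 θ).2)
  obtain ⟨δ2, hδ2, hu⟩ := unif D.OK_dom D.ccP_c.continuousOn hO0 (ε := c / 2) (by linarith)
  set κ : ℝ := 1 / (C * (n * M) + 1) with hκ
  have hκ0 : 0 < κ := by positivity
  set δ : ℝ := min (min (δ1 / 2) δ2) (min (‖w0‖ / 2) (κ / 2)) with hδ
  have d1 : δ ≤ δ1 / 2 := (min_le_left _ _).trans (min_le_left _ _)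
  have d2 : δ ≤ δ2 := (min_le_left _ _).trans (min_le_right _ _)
  have d3 : δ ≤ ‖w0‖ / 2 := (min_le_right _ _).trans (min_le_left _ _)
  have d4 : δ ≤ κ / 2 := (min_le_right _ _).trans (min_le_right _ _)
  refine ⟨δ, lt_min (lt_min (by linarith) hδ2) (lt_min (by linarith) (by linarith)), fun t' a' b' w ha hb hO hlev hnu hnear hw h0 hwR => ?_⟩
  clear_value δ
  by_contra hcon
  push Not at hcon
  have hal : Loop (fun θ : ℝ => evV a' (θ : TT)) := by
    have := ex_loop (DiffContOnCl.cl (extV_dcc a'))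
    simpa only [extV_ex ha] using this
  have hgrl : Loop (fun θ : ℝ => gr Ψ θ (evV a' (θ : TT))) :=
    ⟨ContinuousOn.comp (g := grP Ψ) (f := fun θ : ℝ => (θ, evV a' (θ : TT))) D.grP_c.continuousOn (continuousOn_id.prodMk hal.cont) fun θ _ => hO θ, by
      have := D.gr_per 0; rw [zero_add] at this
      have h2 : evV a' ((0:ℝ) : TT) = evV a' ((2 * Real.pi : ℝ) : TT) := hal.ends
      rw [this, ← h2]⟩
  have hcl : Loop (fun θ : ℝ => cc Ψ θ (evV a' (θ : TT))) := hal.dot hgrl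
  have hel : Loop (fun θ : ℝ => -((w - evV a' (θ : TT)) ⬝ᵥ gr Ψ θ (evV a' (θ : TT)))) := by
    have h1 : Loop (fun θ : ℝ => w - evV a' (θ : TT)) := ⟨continuousOn_const.sub hal.cont, by rw [show evV a' ((0:ℝ) : TT) = evV a' ((2 * Real.pi : ℝ) : TT) from hal.ends]⟩
    exact ⟨(h1.dot hgrl).cont.neg, congrArg Neg.neg (h1.dot hgrl).ends⟩
  have hcw0 : Loop (fun _ : ℝ => w0) := ⟨continuousOn_const, rfl⟩
  have hlog0 := D.cc_log hRpos le_rfl hcw0 (fun θ _ => hl0 θ)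
  have hcc0l : Loop (fun θ : ℝ => cc Ψ θ w0) := ⟨ContinuousOn.comp (g := ccP Ψ) (f := fun θ : ℝ => (θ, w0)) D.ccP_c.continuousOn (by fun_prop) fun θ _ => hO0 θ, by
    have := D.cc_per 0; rw [zero_add] at this; rw [this]⟩
  have hlogc : HasLog (fun θ : ℝ => cc Ψ θ (evV a' (θ : TT))) := by
    refine HasLog.of_near hcl hcc0l (fun θ _ => (hO0 θ).2) hlog0 fun θ hθ => ?_
    have h1 := (hu θ hθ (evV a' (θ : TT) - w0) ((hnear θ).trans_le d2)).2
    simp only [ContinuousMap.const_apply, add_sub_cancel] at h1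
    have h2 := hcb θ hθ
    exact lt_of_le_of_lt h1 (by linarith)
  have hloge := HasLog.of_slit hel fun θ hθ => by
    set e := (w - evV a' (θ : TT)) ⬝ᵥ gr Ψ θ (evV a' (θ : TT)) with he
    have hpZ : (θ, evV a' (θ : TT)) ∈ Z := ⟨TI_sub hθ, by rw [mem_closedBall, dist_eq_norm]; exact (hnear θ).le.trans d3⟩
    have hd : ‖w - evV a' (θ : TT)‖ < 2 * δ := by
      have := norm_sub_le (w - w0) (evV a' (θ : TT) - w0)
      rw [sub_sub_sub_cancel_right] at this
      linarith [hnear θ]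
    have h1 := (hLT _ hpZ (w - evV a' (θ : TT)) (by linarith)).1
    simp only [add_sub_cancel] at h1
    rw [← he, hlev θ] at h1
    have h2 := D.le_R (θ := θ) hwR
    have h3 : ‖e‖ ≤ n * M * κ := by
      refine (dot_norm_le _ _).trans ?_
      have h4 := hMb _ hpZ
      calc _ ≤ n * κ * M := mul_le_mul (mul_le_mul_of_nonneg_left (by linarith) (Nat.cast_nonneg n)) h4 (norm_nonneg _) (by positivity)
        _ = _ := by ring
    have h5 : C * ‖e‖ ≤ 1 := by
      calc _ ≤ C * (n * M * κ) := mul_le_mul_of_nonneg_left h3 hC.le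
        _ = (C * (n * M)) / (C * (n * M) + 1) := by rw [hκ]; ring
        _ ≤ 1 := by rw [div_le_one (by positivity)]; linarith
    have h6 : 0 ≤ k * ‖w - evV a' (θ : TT)‖ ^ 2 := by positivity
    have h7 : 2 * e.re < C * ‖e‖ ^ 2 := by linarith
    by_contra hns
    rw [Complex.mem_slitPlane_iff] at hns
    push Not at hns
    rw [Complex.neg_re, Complex.neg_im] at hns
    have h8 : e.im = 0 := by linarith [hns.2]
    have h9 : ‖e‖ = e.re := by
      rw [← Complex.re_add_im e, h8]; simp; linarith [hns.1]
    rw [h9] at h7 h5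
    nlinarith [hns.1]
  have hu1 : HasLog (fun θ : ℝ => 1 - extV b' (ex θ) ⬝ᵥ w) := by
    refine (hlogc.inv.mul hloge).congr fun θ hθ => ?_
    rw [extV_ex hb, hnu, one_sub_nu (hO θ).2]
    ring
  refine NV (u := fun z => 1 - extV b' z ⬝ᵥ w) (diffContOnCl_const.sub (dcc_dot (extV_dcc b') diffContOnCl_const)) hu1 (z := 0) (by simp) ?_
  have h1 : extV b' 0 ⬝ᵥ extV a' 0 = 1 := eq_of_bdry (dcc_dot (extV_dcc b') (extV_dcc a')) diffContOnCl_const (fun θ _ => by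
    rw [extV_ex hb, extV_ex ha, hnu, nu_dot_self (hO θ).2]) (z := 0) (by simp)
  have h2 : extV a' 0 = w := by funext i; rw [← h0 i]; exact ext_zero _
  rw [h2] at h1
  simp only [h1, sub_self]
end S17

namespace S17
variable {n : ℕ} {Ψ : ℝ → (Fin n → ℂ) → ℝ} {R : ℝ} {t : ℝ} {a : Fin n → Seq2}

/-- constant solutions on the outer sphere -/
lemma Data.topWS (D : Data n Ψ R) {w0 : Fin n → ℂ} (hw0 : euclNorm w0 = R) : WS Ψ R R (constV w0) ∧ ∀ x : TT, evV (constV w0) x = w0 := by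
  have hc : ∀ (w : Fin n → ℂ) (x : TT), evV (constV w) x = w := fun w x => by
    funext i
    show ev (constV w i) x = w i
    have := hasSum_single (f := fun j => dW (constV w i) j * fourier j x) 0 (fun j hj => by rw [dW_apply, constV_apply, if_neg hj]; simp)
    rw [(ev_hasSum _ x).unique this, fourier_zero, mul_one, dW_apply, constV_apply, if_pos rfl]
    simp [wt]
  have hn : ∀ (w : Fin n → ℂ), ∀ i, ∀ j < 0, constV w i j = 0 := fun w i j hj => by rw [constV_apply, if_neg hj.ne]
  have hl0 : ∀ θ, Ψ θ w0 = R := fun θ => (D.levelR θ w0).2 hw0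
  refine ⟨⟨by linarith [D.hR], le_rfl, hn w0, fun θ => by rw [hc]; exact hl0 θ, constV (((R : ℂ) ^ 2)⁻¹ • star w0), hn _, fun θ => ?_⟩, hc w0⟩
  rw [hc, hc, D.nu_top (hl0 θ)]

lemma WS.top (W : WS Ψ R R a) (D : Data n Ψ R) : euclNorm (fun i => a i 0) = R ∧ ∀ θ : ℝ, evV a (θ : TT) = fun i => a i 0 := by
  obtain ⟨b, hb, hab⟩ := W.nug
  have S := W.sol_of hb hab
  have h0 : extV a 0 = fun i => a i 0 := by funext i; exact ext_zero _
  obtain ⟨θ, -, h1⟩ := S.le_max D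
  have h2 := S.eucl_le D (z := 0) (by simp)
  rw [h0] at h1 h2
  have h3 : euclNorm (fun i => a i 0) = R := (D.levelR θ _).1 (le_antisymm (D.le_R h2) h1)
  refine ⟨h3, fun θ => ?_⟩
  obtain ⟨W', hc⟩ := D.topWS h3
  obtain ⟨b', hb', hab'⟩ := W'.nug
  have S' := W'.sol_of hb' hab'
  have h0' : extV (constV fun i => a i 0) 0 = fun i => a i 0 := by
    funext i; rw [extV, ext_zero, constV_apply, if_pos rfl]
  have := (S.unique S' D (by rw [h0, h0'])).2.1 (ex θ) (ex_norm θ).le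
  rw [extV_ex W.an, extV_ex W'.an, hc] at this
  exact this

set_option maxHeartbeats 1000000 in
theorem WS.loc (W : WS Ψ R t a) (D : Data n Ψ R) : ∃ A : (Fin n → ℂ) → (Fin n → Seq2), ContDiffAt ℝ 1 A (fun i => a i 0) ∧ A (fun i => a i 0) = a ∧
    ∀ᶠ w in nhds (fun i => a i 0), euclNorm w ≤ R → ∃ t', WS Ψ R t' (A w) ∧ ∀ i, A w i 0 = w i := by
  obtain ⟨b, hb, hab⟩ := W.nug
  obtain ⟨yy, Yd, m, hYd, hY0, hY, hm⟩ := W.exY D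
  obtain ⟨μ, hμ, hU⟩ := W.mulop D hYd hY hm hb hab
  have hneg : ∀ i, ∀ j < 0, EE Ψ μ yy b i a j = 0 := fun i => by
    refine neg_of_dcc (f := fun z => Yd z * ((1 + ((μ * t : ℝ) : ℂ)) * ext (b i) z)) (dcc_mul hYd (dcc_mul diffContOnCl_const (ext_dcc _))) fun θ => ?_
    rw [D.EE_ev μ yy b i (W.gOK D), W.lev, ← hab, hY, ext_ex (hb i)]
    show _ * (ev (b i) _ + _) = _
    ring
  obtain ⟨A, hA, hA0, hAe⟩ := W.inv D hneg hU
  refine ⟨A, hA, hA0, ?_⟩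
  set w0 : Fin n → ℂ := fun i => a i 0 with hw0
  have hcont : Tendsto (fun w => evV (A w)) (nhds w0) (nhds (evV a)) := by
    have := evV.continuous.continuousAt.comp hA.continuousAt
    rw [ContinuousAt, Function.comp, hA0] at this
    exact this
  have e1 : ∀ᶠ w in nhds w0, evV (A w) ∈ gU (OK Ψ) := hcont.eventually ((gU_open D.OK_dom).mem_nhds (W.gOK D))
  have e2 : ∀ δ > (0:ℝ), ∀ᶠ w in nhds w0, ∀ θ : ℝ, ‖evV (A w) (θ : TT) - evV a (θ : TT)‖ < δ := fun δ hδ => by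
    filter_upwards [hcont.eventually (Metric.ball_mem_nhds _ hδ)] with w hw θ
    rw [← dist_eq_norm]
    exact (ContinuousMap.dist_apply_le_dist _).trans_lt hw
  have e3 : ∀ᶠ w in nhds w0, ∀ θ : ℝ, ‖evV b (θ : TT) ⬝ᵥ evV (A w) (θ : TT) - 1‖ ≤ 1 / 2 := by
    filter_upwards [e2 (1 / (2 * (n * ‖evV b‖ + 1))) (by positivity)] with w hw θ
    have h1 : (1:ℂ) = evV b (θ : TT) ⬝ᵥ evV a (θ : TT) := by rw [hab, nu_dot_self (W.pOK D θ).2]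
    rw [h1, ← dotProduct_sub]
    refine (dot_norm_le _ _).trans ?_
    have h2 := (evV b).norm_coe_le_norm (θ : TT)
    calc _ ≤ (n * ‖evV b‖ + 1) * (1 / (2 * (n * ‖evV b‖ + 1))) := mul_le_mul ((mul_le_mul_of_nonneg_left h2 (Nat.cast_nonneg n)).trans (by linarith)) (hw θ).le (norm_nonneg _) (by positivity)
      _ = 1 / 2 := by field_simp
  have e4 : ∀ᶠ w in nhds w0, euclNorm w ≤ R → ∀ t', (∀ θ : ℝ, Ψ θ (evV (A w) (θ : TT)) = t') →
      ∀ b' : Fin n → Seq2, (∀ i, ∀ j < 0, b' i j = 0) → (∀ θ : ℝ, evV b' (θ : TT) = nu Ψ θ (evV (A w) (θ : TT))) → t' ≤ R := by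
    rcases W.htR.lt_or_eq with h | h
    · have h1 : Tendsto (fun w => Ψ 0 (evV (A w) ((0:ℝ) : TT))) (nhds w0) (nhds (Ψ 0 (evV a ((0:ℝ) : TT)))) := by
        have h3 : Tendsto (fun w => evV (A w) ((0:ℝ) : TT)) (nhds w0) (nhds (evV a ((0:ℝ) : TT))) :=
          ((continuous_eval_const ((0:ℝ) : TT)).tendsto (evV a)).comp hcont
        exact ((D.contw 0).tendsto _).comp h3
      rw [W.lev 0] at h1
      filter_upwards [h1.eventually (gt_mem_nhds h)] with w hw _ t' ht' _ _ _
      rw [← ht' 0]; exact hw.le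
    · subst h
      obtain ⟨h1, h2⟩ := W.top D
      obtain ⟨δ, hδ, htop⟩ := D.top_le h1
      filter_upwards [e1, e2 δ hδ, Metric.ball_mem_nhds w0 hδ, hAe] with w h3 h4 h5 h6 hwR t' ht' b' hb' hab'
      refine htop t' (A w) b' w (fun i j hj => ((h6 i).2 j hj).1) hb' h3 ht' hab' (fun θ => ?_) (by rw [← dist_eq_norm]; exact h5) (fun i => (h6 i).1) hwR
      have := h4 θ
      rwa [h2 θ] at this
  filter_upwards [e1, e3, e4, hAe] with w h1 h3 h4 h6 hwR
  obtain ⟨t', ht', b', hb', hab'⟩ := D.recover hYd hY0 hY hb hμ h1 (fun i j hj => ((h6 i).2 j hj).1) (fun i j hj => ((h6 i).2 j hj).2) h3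
  refine ⟨t', ⟨?_, h4 hwR t' ht' b' hb' hab', fun i j hj => ((h6 i).2 j hj).1, ht', b', hb', hab'⟩, fun i => (h6 i).1⟩
  rw [← ht' 0]
  exact D.pos_of_ne (h1 0).1
end S17

namespace S17
variable {n : ℕ} {Ψ : ℝ → (Fin n → ℂ) → ℝ} {R : ℝ} {t : ℝ} {a : Fin n → Seq2}

lemma pt_alg {m B M1 : ℝ} (hm : 0 < m) (hmM : m ≤ M1) {X q : ℂ} (hq : ‖q - m‖ ≤ 1 / 4 * m) (hB : |X.re| ≤ B) :
    m * ‖X‖ ≤ 4 / 3 * ‖q * X‖ ∧ 5 / 9 * ‖q * X‖ ^ 2 ≤ 4 * (M1 * B) ^ 2 - ((q * X) * (q * X)).re := by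
  have hX := norm_nonneg X
  have e1 : q * X = m * X + (q - m) * X := by ring
  have h1 : ‖(q - m) * X‖ ≤ 1 / 4 * m * ‖X‖ := by rw [norm_mul]; exact mul_le_mul_of_nonneg_right hq hX
  have h2 : ‖(m : ℂ) * X‖ = m * ‖X‖ := by rw [norm_mul, Complex.norm_real, Real.norm_of_nonneg hm.le]
  have h3 : m * ‖X‖ ≤ 4 / 3 * ‖q * X‖ := by
    have := norm_sub_le (q * X) ((q - m) * X)
    rw [show q * X - (q - m) * X = m * X by ring, h2] at this
    linarith
  refine ⟨h3, ?_⟩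
  set P := q * X with hP
  have h4 : |P.re| ≤ M1 * B + 1 / 3 * ‖P‖ := by
    have h5 : P.re = m * X.re + ((q - m) * X).re := by rw [e1, Complex.add_re, Complex.re_ofReal_mul]
    rw [h5]
    refine (abs_add_le _ _).trans (add_le_add ?_ ?_)
    · rw [abs_mul, abs_of_pos hm]
      exact mul_le_mul hmM hB (abs_nonneg _) (hm.le.trans hmM)
    · refine (Complex.abs_re_le_norm _).trans (h1.trans ?_)
      linarith
  have h6 : ‖P‖ ^ 2 = P.re * P.re + P.im * P.im := by rw [← Complex.normSq_eq_norm_sq, Complex.normSq_apply]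
  have h7 : (P * P).re = P.re * P.re - P.im * P.im := Complex.mul_re _ _
  have h8 : P.re ^ 2 ≤ (M1 * B + 1 / 3 * ‖P‖) ^ 2 := by
    rw [← sq_abs]; exact pow_le_pow_left₀ (abs_nonneg _) h4 2
  nlinarith [sq_nonneg (M1 * B - 1 / 3 * ‖P‖)]

set_option maxHeartbeats 1000000 in
lemma Data.en_pt (D : Data n Ψ R) {s : ℝ} (hs : 0 < s) : ∃ ε > (0:ℝ), ∀ m0 > (0:ℝ), ∀ M1 > (0:ℝ), ∃ κ > (0:ℝ), ∃ C4 C5 : ℝ, ∀ p ∈ KS Ψ R s, ∀ m, m0 ≤ m → m ≤ M1 →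
    ∀ Y : ℂ, ‖(ccP Ψ p)⁻¹ * Y - m‖ ≤ ε * m → ∀ v : Fin n → ℂ, pθ (fun p : ℝ × (Fin n → ℂ) => ((Ψ p.1 p.2 : ℝ) : ℂ)) p + ((2 * (v ⬝ᵥ gr Ψ p.1 p.2).re : ℝ) : ℂ) = 0 →
    κ * ‖v‖ ^ 2 ≤ (Y * (v ⬝ᵥ (pθ (nuP Ψ) p + pw (nuP Ψ) p v))).re - C4 * ((Y * (nuP Ψ p ⬝ᵥ v)) * (Y * (nuP Ψ p ⬝ᵥ v))).re + C5 := by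
  obtain ⟨ε, hε, k, hk, C, hC, hco⟩ := D.coer_pt hs
  have hOK := D.KS_OK hs
  obtain ⟨B, hB, hBb⟩ := compact_bound (D.KS_compact s) ((pθ_c D.OK_dom D.Psi_c (k := 0) (by norm_num)).continuousOn.mono hOK)
  obtain ⟨B', hB', hBb'⟩ := compact_bound (D.KS_compact s) ((pθ_c D.OK_dom D.nuP_c (k := 0) (by norm_num)).continuousOn.mono hOK)
  have hccc := D.ccP_c.continuousOn.mono hOK
  obtain ⟨c2, hc2, hc2b⟩ := compact_bound (D.KS_compact s) hccc
  obtain ⟨c1, hc1, hc1b⟩ := compact_lower (D.KS_compact s) hccc.norm (fun p hp => norm_pos_iff.2 (hOK hp).2)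
  refine ⟨min ε (1 / 4), lt_min hε (by norm_num), fun m0 hm0 M1 hM1 => ?_⟩
  set C6 : ℝ := C * M1 * (16 / 9) / (m0 * c1) ^ 2 with hC6
  set N : ℝ := c2 * (2 * M1) * (n * B') with hN
  have hC60 : 0 < C6 := by positivity
  have hN0 : 0 ≤ N := by positivity
  refine ⟨m0 * k / 2, by positivity, C6 * (9 / 5), N ^ 2 / (2 * (m0 * k)) + C6 * (9 / 5) * (4 * (M1 * B) ^ 2), fun p hp m hmm hmM Y hY v hv => ?_⟩
  have hm : 0 < m := by linarith
  have hcp : ccP Ψ p ≠ 0 := (hOK hp).2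
  have hq : ‖(ccP Ψ p)⁻¹ * Y - m‖ ≤ 1 / 4 * m := hY.trans (mul_le_mul_of_nonneg_right (min_le_right _ _) hm.le)
  have h1 := hco p hp m hm Y (hY.trans (mul_le_mul_of_nonneg_right (min_le_left _ _) hm.le)) v
  set l := nuP Ψ p ⬝ᵥ v with hl
  have hX : v ⬝ᵥ gr Ψ p.1 p.2 = ccP Ψ p * l := dot_gr (hOK hp) v
  have hXB : |(ccP Ψ p * l).re| ≤ B := by
    rw [hX] at hv
    have h2 := hBb p hp
    rw [eq_neg_of_add_eq_zero_left hv, norm_neg, Complex.norm_real, Real.norm_eq_abs, abs_mul, abs_two] at h2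
    linarith [abs_nonneg (ccP Ψ p * l).re]
  obtain ⟨h2, h3⟩ := pt_alg hm hmM hq hXB
  have e1 : (ccP Ψ p)⁻¹ * Y * (ccP Ψ p * l) = Y * l := by field_simp
  rw [e1] at h2 h3
  set P := Y * l with hP
  have h4 : C * m * ‖l‖ ^ 2 ≤ C6 * ‖P‖ ^ 2 := by
    have h5 : m0 * c1 * ‖l‖ ≤ 4 / 3 * ‖P‖ := by
      refine le_trans ?_ h2
      rw [norm_mul, ← mul_assoc]
      exact mul_le_mul_of_nonneg_right (mul_le_mul hmm (hc1b p hp) hc1.le hm.le) (norm_nonneg _)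
    have h6 : (m0 * c1) ^ 2 * ‖l‖ ^ 2 ≤ 16 / 9 * ‖P‖ ^ 2 := by
      have := pow_le_pow_left₀ (by positivity) h5 2
      rw [mul_pow, mul_pow (4 / 3 : ℝ)] at this
      linarith
    have h7 : ‖l‖ ^ 2 ≤ 16 / 9 * ‖P‖ ^ 2 / (m0 * c1) ^ 2 := by rw [le_div_iff₀ (by positivity)]; linarith
    calc C * m * ‖l‖ ^ 2 ≤ C * M1 * (16 / 9 * ‖P‖ ^ 2 / (m0 * c1) ^ 2) := mul_le_mul (mul_le_mul_of_nonneg_left hmM hC.le) h7 (by positivity) (by positivity)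
      _ = _ := by rw [hC6]; ring
  have hYn : ‖Y‖ ≤ c2 * (2 * M1) := by
    have h5 : ‖(ccP Ψ p)⁻¹ * Y‖ ≤ 2 * M1 := by
      have := norm_sub_norm_le ((ccP Ψ p)⁻¹ * Y) (m : ℂ)
      rw [Complex.norm_real, Real.norm_of_nonneg hm.le] at this
      linarith
    have h6 : Y = ccP Ψ p * ((ccP Ψ p)⁻¹ * Y) := by field_simp
    rw [h6, norm_mul]
    exact mul_le_mul (hc2b p hp) h5 (norm_nonneg _) hc2.le
  have h8 : ‖Y * (v ⬝ᵥ pθ (nuP Ψ) p)‖ ≤ N * ‖v‖ := by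
    rw [norm_mul]
    calc _ ≤ c2 * (2 * M1) * (n * ‖v‖ * B') := mul_le_mul hYn ((dot_norm_le _ _).trans (mul_le_mul_of_nonneg_left (hBb' p hp) (by positivity))) (norm_nonneg _) (by positivity)
      _ = _ := by rw [hN]; ring
  have h9 := (abs_le.1 ((Complex.abs_re_le_norm _).trans h8)).1
  rw [dotProduct_add, mul_add, Complex.add_re]
  have h10 : m0 * k * ‖v‖ ^ 2 ≤ m * k * ‖v‖ ^ 2 := by gcongr
  have h11 : N * ‖v‖ ≤ m0 * k / 2 * ‖v‖ ^ 2 + N ^ 2 / (2 * (m0 * k)) := by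
    have hmk : 0 < m0 * k := by positivity
    have : m0 * k / 2 * ‖v‖ ^ 2 + N ^ 2 / (2 * (m0 * k)) - N * ‖v‖ = (m0 * k * ‖v‖ - N) ^ 2 / (2 * (m0 * k)) := by field_simp; ring
    have h12 : 0 ≤ (m0 * k * ‖v‖ - N) ^ 2 / (2 * (m0 * k)) := by positivity
    linarith
  have h13 : C6 * (5 / 9 * ‖P‖ ^ 2) ≤ C6 * (4 * (M1 * B) ^ 2 - (P * P).re) := mul_le_mul_of_nonneg_left h3 hC60.le
  linarith
end S17

namespace S17
variable {n : ℕ} {Ψ : ℝ → (Fin n → ℂ) → ℝ} {R : ℝ} {t : ℝ} {a : Fin n → Seq2}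

lemma dv_Nem_ae {ι : Type*} [Fintype ι] [DecidableEq ι] {U : Set (ℝ × (ι → ℂ))} {φ : ℝ × (ι → ℂ) → ℂ} (H : NOK U φ) {a : ι → Seq2} (ha : evV a ∈ gU U) :
    dv (Nem φ a) =ᵐ[mT] fun x => pθ φ (rp x, evV a x) + pw φ (rp x, evV a x) (fun i => dv (a i) x) := by
  rw [dv_Nem H ha, NemD]
  filter_upwards [Lp.coeFn_add (cL (NemC (pθ φ) (evV a))) (acL (NemC (pw φ) (evV a)) (dvV a)), cL_ae (NemC (pθ φ) (evV a)),
    acL_ae (NemC (pw φ) (evV a)) (dvV a), dvV_ae a] with x h1 h2 h3 h4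
  rw [h1, Pi.add_apply, h2, h3, h4]
  have e1 := NemC_apply H.dom H.pθc.continuousOn (pθ_per H.per) ha (rp x)
  have e2 := NemC_apply H.dom H.pwc.continuousOn (pw_per H.per) ha (rp x)
  rw [rp_coe] at e1 e2
  rw [e1, e2]

lemma dv_pos {r : Seq2} (hr : ∀ j < 0, r j = 0) : ∀ j ≤ 0, FC (dv r) j = 0 := by
  intro j hj
  rw [FC_dv, dD_apply]
  rcases hj.lt_or_eq with h | h
  · rw [hr j h]; simp
  · rw [h]; simp

lemma Data.nu_comp (D : Data n Ψ R) {p : ℝ × (Fin n → ℂ)} (hp : p ∈ OK Ψ) (i : Fin n) (v : Fin n → ℂ) :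
    pθ (fun p => nuP Ψ p i) p + pw (fun p => nuP Ψ p i) p v = (pθ (nuP Ψ) p + pw (nuP Ψ) p v) i := by
  have h := ((D.nuP_c.differentiableOn (by norm_num)).differentiableAt (D.OK_dom.op.mem_nhds hp)).hasFDerivAt
  have h2 := (hasFDerivAt_pi'.1 h i).fderiv
  simp only [pθ, pw, h2, Pi.add_apply]; rfl

lemma Data.Psi_pw (D : Data n Ψ R) {p : ℝ × (Fin n → ℂ)} (hp : p ∈ OK Ψ) (v : Fin n → ℂ) :
    pw (fun p : ℝ × (Fin n → ℂ) => ((Ψ p.1 p.2 : ℝ) : ℂ)) p v = ((2 * (v ⬝ᵥ gr Ψ p.1 p.2).re : ℝ) : ℂ) := by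
  obtain ⟨θ, w⟩ := p
  have h1 := pw_has D.OK_dom D.Psi_NOK.c1 hp
  have h2 : HasFDerivAt (fun w => ((Ψ θ w : ℝ) : ℂ)) (Complex.ofRealCLM.comp (fderiv ℝ (Ψ θ) w)) w :=
    Complex.ofRealCLM.hasFDerivAt.comp w (D.diffAt_w hp.1).hasFDerivAt
  have h3 := h1.unique h2
  rw [h3, ← fderiv_eq]; rfl

lemma lp_mul (q : C(TT, ℂ)) (v : L2) : ∃ w : L2, w =ᵐ[mT] fun x => q x * v x :=
  ⟨acL (F := ℂ) ⟨fun x => ContinuousLinearMap.mul ℝ ℂ (q x), by fun_prop⟩ v, by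
      filter_upwards [acL_ae (F := ℂ) ⟨fun x => ContinuousLinearMap.mul ℝ ℂ (q x), by fun_prop⟩ v] with x hx
      rw [hx]; rfl⟩

set_option maxHeartbeats 1000000 in
lemma WS.energy (W : WS Ψ R t a) (D : Data n Ψ R) {Yc : C(TT, ℂ)} {Yd : ℂ → ℂ} (hYd : DiffContOnCl ℂ Yd (ball 0 1))
    (hY : ∀ θ : ℝ, Yc (θ : TT) = Yd (ex θ)) {κ C4 C5 : ℝ} (hκ : 0 < κ)
    (hpt : ∀ x : TT, ∀ v : Fin n → ℂ, pθ (fun p : ℝ × (Fin n → ℂ) => ((Ψ p.1 p.2 : ℝ) : ℂ)) (rp x, evV a x) +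
        ((2 * (v ⬝ᵥ gr Ψ (rp x) (evV a x)).re : ℝ) : ℂ) = 0 →
      κ * ‖v‖ ^ 2 ≤ (Yc x * (v ⬝ᵥ (pθ (nuP Ψ) (rp x, evV a x) + pw (nuP Ψ) (rp x, evV a x) v))).re -
        C4 * ((Yc x * (nuP Ψ (rp x, evV a x) ⬝ᵥ v)) * (Yc x * (nuP Ψ (rp x, evV a x) ⬝ᵥ v))).re + C5) (i : Fin n) :
    κ * ‖dv (a i)‖ ^ 2 ≤ C5 := by
  have hO := W.gOK D
  have hOx : ∀ x : TT, (rp x, evV a x) ∈ OK Ψ := fun x => by have := hO (rp x); rwa [rp_coe] at this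
  obtain ⟨b, hb, hab⟩ := W.nug
  have hbN : ∀ i, b i = Nem (fun p => nuP Ψ p i) a := fun i => ev_inj (by
    ext x
    have h1 := congrFun (hab (rp x)) i
    have h2 := ev_Nem_apply (D.nu_NOK i) hO (rp x)
    rw [rp_coe] at h1 h2
    rw [h2]; exact h1)
  have hbx : ∀ x : TT, ∀ i, ev (b i) x = nuP Ψ (rp x, evV a x) i := fun x i => by
    have h2 := ev_Nem_apply (D.nu_NOK i) hO (rp x)
    rw [rp_coe, ← hbN] at h2; exact h2
  have hbd : ∀ i, dv (b i) =ᵐ[mT] fun x => (pθ (nuP Ψ) (rp x, evV a x) + pw (nuP Ψ) (rp x, evV a x) (fun i => dv (a i) x)) i := fun i => by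
    rw [hbN i]
    filter_upwards [dv_Nem_ae (D.nu_NOK i) hO] with x hx
    rw [hx, D.nu_comp (hOx x)]
  -- the level equation
  have hlev : ∀ᵐ x ∂mT, pθ (fun p : ℝ × (Fin n → ℂ) => ((Ψ p.1 p.2 : ℝ) : ℂ)) (rp x, evV a x) +
        ((2 * ((fun i => dv (a i) x) ⬝ᵥ gr Ψ (rp x) (evV a x)).re : ℝ) : ℂ) = 0 := by
    have hev : ∀ θ : ℝ, ev (Nem (fun p : ℝ × (Fin n → ℂ) => ((Ψ p.1 p.2 : ℝ) : ℂ)) a) (θ : TT) = (t : ℂ) := fun θ => by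
      rw [ev_Nem_apply D.Psi_NOK hO]
      show ((Ψ θ (evV a (θ : TT)) : ℝ) : ℂ) = t
      rw [W.lev θ]
    have hn := neg_of_dcc (f := fun _ => (t : ℂ)) diffContOnCl_const hev
    have hz := coef_of_real hn (fun x => by
      have := hev (rp x); rw [rp_coe] at this
      rw [this, Complex.conj_ofReal])
    have hd : dv (Nem (fun p : ℝ × (Fin n → ℂ) => ((Ψ p.1 p.2 : ℝ) : ℂ)) a) = 0 := by
      refine FC.injective ?_
      rw [FC_dv, map_zero]
      ext j
      rw [dD_apply]
      rcases eq_or_ne j 0 with h | h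
      · rw [h]; simp
      · rw [hz j h]; simp
    have h := dv_Nem_ae D.Psi_NOK hO
    rw [hd] at h
    filter_upwards [h, Lp.coeFn_zero ℂ 2 mT] with x h1 h2
    rw [h2, D.Psi_pw (hOx x)] at h1
    exact h1.symm
  have hYn : ∀ j < 0, FC (cL Yc) j = 0 := dcc_neg hYd hY
  -- P
  set q : Fin n → C(TT, ℂ) := fun i => Yc * ev (b i) with hq
  have hqn : ∀ i, ∀ j < 0, FC (cL (q i)) j = 0 := fun i => by
    refine dcc_neg (f := fun z => Yd z * ext (b i) z) (dcc_mul hYd (ext_dcc (b i))) fun θ => ?_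
    beta_reduce
    rw [ext_ex (hb i), ← hY]; rfl
  choose w hw using fun i => lp_mul (q i) (dv (a i))
  choose u hu using fun i => lp_mul Yc (dv (a i))
  set P : L2 := ∑ i, w i with hP
  have hPn : ∀ j ≤ 0, FC P j = 0 := by
    intro j hj
    have h1 : ∀ i, FC (w i) j = 0 := fun i => mul_pos_spec (hqn i) (dv_pos (W.an i)) (hw i) j hj
    rw [hP, map_sum, lp.coeFn_sum, Finset.sum_apply]
    exact Finset.sum_eq_zero fun i _ => h1 i
  have hPae : P =ᵐ[mT] fun x => Yc x * (nuP Ψ (rp x, evV a x) ⬝ᵥ fun i => dv (a i) x) := by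
    filter_upwards [Lp.coeFn_finsetSum Finset.univ w, ae_all_iff.2 hw] with x hx1 hx2
    rw [hP, hx1, Finset.sum_apply]
    unfold dotProduct
    rw [Finset.mul_sum]
    refine Finset.sum_congr rfl fun i _ => ?_
    rw [hx2 i, ← hbx]; simp only [hq, ContinuousMap.mul_apply]; ring
  have hitg : ∀ p q : L2, Integrable (fun x => p x * q x) mT := fun p q => (Lp.memLp p).integrable_mul (Lp.memLp q)
  have hre : ∀ p q : L2, Integrable (fun x => (p x * q x).re) mT := fun p q => (hitg p q).re
  have hri : ∀ p q : L2, ∫ x, (p x * q x).re ∂mT = (pr p q).re := fun p q => by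
    have h := integral_re (𝕜 := ℂ) (hitg p q)
    rw [← pr_int] at h
    simpa using h
  have e2 : ‖dv (a i)‖ ^ 2 = ∫ x, (star (dv (a i)) x * dv (a i) x).re ∂mT := by
    rw [hri, pr_star]; norm_cast
  have e3 : ∫ x, (P x * P x).re ∂mT = 0 := by rw [hri, pr_zero (fun j hj => hPn j hj.le) hPn]; simp
  have e4 : ∫ x, ∑ i, (u i x * dv (b i) x).re ∂mT = 0 := by
    rw [integral_finset_sum _ fun i _ => hre _ _]
    refine Finset.sum_eq_zero fun i _ => ?_
    rw [hri, pr_zero (fun j hj => mul_pos_spec hYn (dv_pos (W.an i)) (hu i) j hj.le) (dv_pos (hb i))]; simp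
  have hsi : Integrable (fun x => ∑ i, (u i x * dv (b i) x).re) mT := integrable_finset_sum _ fun i _ => hre _ _
  have hdi : Integrable (fun x => ∑ i, (u i x * dv (b i) x).re - C4 * (P x * P x).re) mT := hsi.sub ((hre P P).const_mul C4)
  have hgi : Integrable (fun x => (∑ i, (u i x * dv (b i) x).re - C4 * (P x * P x).re) + C5) mT :=
    hdi.add (integrable_const C5)
  have e5 : C5 = ∫ x, ((∑ i, (u i x * dv (b i) x).re - C4 * (P x * P x).re) + C5) ∂mT := by
    rw [integral_add hdi (integrable_const C5), integral_sub hsi ((hre P P).const_mul C4), integral_const_mul, e3, e4]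
    simp
  rw [e5, e2, ← integral_const_mul]
  refine integral_mono_ae ((hre _ _).const_mul κ) hgi ?_
  filter_upwards [hPae, Lp.coeFn_star (dv (a i)), hlev, ae_all_iff.2 hu, ae_all_iff.2 hbd] with x h1 h2 h3 h4 h5
  have h6 := hpt x _ h3
  rw [h1, h2]
  have h7 : (star (dv (a i) x) * dv (a i) x).re = ‖dv (a i) x‖ ^ 2 := by
    rw [mul_comm, ← Complex.normSq_eq_norm_sq, Complex.star_def, Complex.mul_conj, Complex.ofReal_re]
  rw [Pi.star_apply, h7]
  have h8 : ‖dv (a i) x‖ ≤ ‖fun i => dv (a i) x‖ := norm_le_pi_norm (fun i => dv (a i) x) i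
  have h9 : κ * ‖dv (a i) x‖ ^ 2 ≤ κ * ‖fun i => dv (a i) x‖ ^ 2 := by gcongr
  refine h9.trans (h6.trans (le_of_eq ?_))
  have h10 : (Yc x * ((fun i => dv (a i) x) ⬝ᵥ (pθ (nuP Ψ) (rp x, evV a x) + pw (nuP Ψ) (rp x, evV a x) fun i => dv (a i) x))).re =
      ∑ i, (u i x * dv (b i) x).re := by
    unfold dotProduct
    rw [Finset.mul_sum, Complex.re_sum]
    refine Finset.sum_congr rfl fun i _ => ?_
    rw [h4 i, h5 i, mul_assoc]
  rw [h10]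
end S17

namespace S17
variable {n : ℕ} {Ψ : ℝ → (Fin n → ℂ) → ℝ} {R : ℝ} {t : ℝ} {a : Fin n → Seq2}

lemma WS.nR (W : WS Ψ R t a) (D : Data n Ψ R) (x : TT) : ‖evV a x‖ ≤ R := by
  rw [← rp_coe x]
  exact D.norm_le_R (θ := rp x) (by rw [W.lev]; exact W.htR)

lemma WS.cpt (D : Data n Ψ R) {s0 : ℝ} (hs0 : 0 < s0) {tk : ℕ → ℝ} {ak : ℕ → Fin n → Seq2} (W : ∀ k, WS Ψ R (tk k) (ak k)) (hk : ∀ k, s0 ≤ tk k) :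
    ∃ (F : C(TT, Fin n → ℂ)) (φ : ℕ → ℕ), StrictMono φ ∧ Tendsto (fun k => evV (ak (φ k))) atTop (nhds F) := by
  set B : ℕ → BoundedContinuousFunction TT (Fin n → ℂ) := fun k => BoundedContinuousFunction.mkOfCompact (evV (ak k)) with hB
  have hc : IsCompact (closure (range B)) := by
    refine BoundedContinuousFunction.arzela_ascoli (closedBall 0 R) (isCompact_closedBall _ _) (range B) ?_ ?_
    · rintro f x ⟨k, rfl⟩
      rw [mem_closedBall_zero_iff]; exact (W k).nR D x
    · intro x0
      rw [Metric.equicontinuousAt_iff_right]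
      intro ε hε
      obtain ⟨δ, hδ, h⟩ := equicont D hs0 (half_pos hε)
      have hcont : ContinuousAt (fun x : TT => (fourier 1 x : ℂ)) x0 := (fourier (T := 2 * Real.pi) 1).continuous.continuousAt
      filter_upwards [Metric.continuousAt_iff'.1 hcont δ hδ] with x hx
      rintro ⟨_, k, rfl⟩
      obtain ⟨b, hb, hab⟩ := (W k).nug
      have S := (W k).sol_of hb hab
      have e : ∀ x : TT, evV (ak k) x = extV (ak k) (ex (rp x)) := fun x => by rw [extV_ex (W k).an, rp_coe]
      rw [dist_comm, dist_eq_norm] at hx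
      rw [← rp_coe x0, ← rp_coe x, fourier_one_ex, fourier_one_ex] at hx
      show dist (evV (ak k) x0) (evV (ak k) x) < ε
      rw [dist_eq_norm, e, e]
      exact (h _ _ _ S (hk k) _ _ (ex_norm _) (ex_norm _) hx).trans_lt (half_lt_self hε)
  obtain ⟨f, -, φ, hφ, hlim⟩ := hc.tendsto_subseq (fun k => subset_closure (mem_range_self k))
  refine ⟨f.toContinuousMap, φ, hφ, ?_⟩
  rw [ContinuousMap.tendsto_iff_tendstoUniformly]
  exact BoundedContinuousFunction.tendsto_iff_tendstoUniformly.1 hlim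

lemma loop_of (F : C(TT, Fin n → ℂ)) : Loop (fun θ : ℝ => F (θ : TT)) where
  cont := (F.continuous.comp coeTT_cont).continuousOn
  ends := by
    have h := AddCircle.coe_add_period (2 * Real.pi) 0
    rw [zero_add] at h
    show F ((0 : ℝ) : TT) = F ((2 * Real.pi : ℝ) : TT)
    rw [h]

set_option maxHeartbeats 1000000 in
lemma WS.bdd (D : Data n Ψ R) {s0 : ℝ} (hs0 : 0 < s0) {tk : ℕ → ℝ} {ak : ℕ → Fin n → Seq2} (W : ∀ k, WS Ψ R (tk k) (ak k)) (hk : ∀ k, s0 ≤ tk k)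
    {F : C(TT, Fin n → ℂ)} (hF : Tendsto (fun k => evV (ak k)) atTop (nhds F)) (ht : s0 ≤ t) (htR : t ≤ R) (hlev : ∀ θ : ℝ, Ψ θ (F (θ : TT)) = t) :
    ∃ C, ∀ᶠ k in atTop, ∀ i, ‖ak k i‖ ≤ C := by
  have ht0 : 0 < t := hs0.trans_le ht
  obtain ⟨ε, hε, hen⟩ := D.en_pt hs0
  obtain ⟨A, m, hm, hmc, hA⟩ := exists_Y (D.cc_log ht0 htR (loop_of F) fun θ _ => hlev θ).inv (half_pos hε)
  obtain ⟨m0, hm0, hm0b⟩ := compact_lower TI_compact hmc.continuousOn (fun θ _ => hm θ)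
  obtain ⟨M1, hM1, hM1b⟩ := compact_bound TI_compact hmc.continuousOn
  obtain ⟨κ, hκ, C4, C5, hpt⟩ := hen m0 hm0 M1 hM1
  set Yc : C(TT, ℂ) := ⟨fun x => Complex.exp (A.eval (fourier 1 x)), by
    exact Complex.continuous_exp.comp (A.continuous.comp (fourier (T := 2 * Real.pi) 1).continuous)⟩ with hYc
  have hYv : ∀ θ : ℝ, Yc (θ : TT) = Complex.exp (A.eval (ex θ)) := fun θ => by rw [← fourier_one_ex]; rfl
  set N := ‖Yc‖ + 1 with hN
  have hN0 : 0 < N := by positivity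
  have hOF : F ∈ gU (OK Ψ) := fun θ => D.mem_OK (by rw [hlev]; exact ht0) (by rw [hlev]; exact htR)
  have hci : ContinuousOn (fun p => (ccP Ψ p)⁻¹) (OK Ψ) := D.ccP_c.continuousOn.inv₀ fun p hp => show ccP Ψ p ≠ 0 from hp.2
  obtain ⟨δ, hδ, hun⟩ := unif D.OK_dom hci hOF (ε := ε / 2 * m0 / N) (by positivity)
  refine ⟨‖cL‖ * R + Real.sqrt (C5 / κ), ?_⟩
  filter_upwards [Metric.tendsto_nhds.1 hF δ hδ] with k hkd i
  rw [dist_eq_norm] at hkd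
  have hE := (W k).energy D (poly_dcc A) hYv hκ (C4 := C4) (C5 := C5) (fun x v hv => by
    have hx := rp_mem x
    have hq : ‖(ccP Ψ (rp x, evV (ak k) x))⁻¹ * Yc x - m (rp x)‖ ≤ ε * m (rp x) := by
      have h1 := hA (rp x) hx
      rw [← hYv, rp_coe] at h1
      have h2 := (hun (rp x) hx (evV (ak k) x - F x) (lt_of_le_of_lt ((evV (ak k) - F).norm_coe_le_norm x) hkd)).2
      rw [rp_coe, add_sub_cancel] at h2
      have h3 : ‖Yc x‖ ≤ N := (Yc.norm_coe_le_norm x).trans (by rw [hN]; linarith)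
      have h4 : ‖((ccP Ψ (rp x, evV (ak k) x))⁻¹ - (ccP Ψ (rp x, F x))⁻¹) * Yc x‖ ≤ ε / 2 * m0 / N * N := by
        rw [norm_mul]; exact mul_le_mul h2 h3 (norm_nonneg _) (by positivity)
      rw [div_mul_cancel₀ _ hN0.ne'] at h4
      have h5 : ε / 2 * m0 ≤ ε / 2 * m (rp x) := mul_le_mul_of_nonneg_left (hm0b _ hx) (by positivity)
      have h1' : ‖(ccP Ψ (rp x, F x))⁻¹ * Yc x - m (rp x)‖ ≤ ε / 2 * m (rp x) := h1
      calc _ = ‖((ccP Ψ (rp x, evV (ak k) x))⁻¹ - (ccP Ψ (rp x, F x))⁻¹) * Yc x + ((ccP Ψ (rp x, F x))⁻¹ * Yc x - m (rp x))‖ := by congr 1; ring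
        _ ≤ _ := (norm_add_le _ _).trans (by linarith)
    have hKS : (rp x, evV (ak k) x) ∈ Data.KS Ψ R s0 := by
      have := (W k).lev (rp x)
      rw [rp_coe] at this
      exact ⟨TI_sub hx, by rw [this]; exact hk k, by rw [this]; exact (W k).htR⟩
    exact hpt _ hKS (m (rp x)) (hm0b _ hx) ((le_abs_self _).trans (hM1b _ hx)) (Yc x) hq v hv) i
  have h1 : ‖dv (ak k i)‖ ≤ Real.sqrt (C5 / κ) := by
    refine Real.le_sqrt_of_sq_le ?_
    rw [le_div_iff₀ hκ]; linarith
  have h2 : ‖ev (ak k i)‖ ≤ R := by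
    rw [ContinuousMap.norm_le _ (by linarith [D.hR])]
    exact fun x => (norm_le_pi_norm (evV (ak k) x) i).trans ((W k).nR D x)
  refine (norm_split _).trans ?_
  rw [dW_norm, dD_norm]
  exact add_le_add ((cL.le_opNorm _).trans (mul_le_mul_of_nonneg_left h2 (norm_nonneg _))) h1

lemma FCcL_tendsto {X : Type*} {l : Filter X} {q : X → C(TT, ℂ)} {q0 : C(TT, ℂ)} (h : Tendsto q l (nhds q0)) (j : ℤ) :
    Tendsto (fun k => FC (cL (q k)) j) l (nhds (FC (cL q0) j)) := by
  have h1 : Tendsto (fun k => FC (cL (q k))) l (nhds (FC (cL q0))) := ((FC.continuous.comp cL.continuous).tendsto q0).comp h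
  have h2 := (lp.uniformContinuous_coe (E := fun _ : ℤ => ℂ) (p := 2)).continuous
  exact ((continuous_apply j).comp h2).continuousAt.tendsto.comp h1

set_option maxHeartbeats 1000000 in
theorem WS.limit (D : Data n Ψ R) {s0 : ℝ} (hs0 : 0 < s0) {tk : ℕ → ℝ} {ak : ℕ → Fin n → Seq2} (W : ∀ k, WS Ψ R (tk k) (ak k)) (hk : ∀ k, s0 ≤ tk k)
    {F : C(TT, Fin n → ℂ)} (hF : Tendsto (fun k => evV (ak k)) atTop (nhds F)) :
    ∃ t a, WS Ψ R t a ∧ ∀ i, Tendsto (fun k => ak k i 0) atTop (nhds (a i 0)) := by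
  have hlim : ∀ θ : ℝ, Tendsto tk atTop (nhds (Ψ θ (F (θ : TT)))) := fun θ => by
    have h1 : Tendsto (fun k => evV (ak k) (θ : TT)) atTop (nhds (F (θ : TT))) := ((continuous_eval_const (θ : TT)).tendsto F).comp hF
    have h2 := ((D.contw θ).tendsto _).comp h1
    refine h2.congr fun k => (W k).lev θ
  set t := Ψ 0 (F ((0:ℝ) : TT)) with ht
  have hlev : ∀ θ : ℝ, Ψ θ (F (θ : TT)) = t := fun θ => tendsto_nhds_unique (hlim θ) (hlim 0)
  have hst : s0 ≤ t := ge_of_tendsto' (hlim 0) hk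
  have htR : t ≤ R := le_of_tendsto' (hlim 0) fun k => (W k).htR
  obtain ⟨C, hC⟩ := WS.bdd D hs0 W hk hF hst htR hlev
  obtain ⟨K, hK⟩ := eventually_atTop.1 hC
  have hOF : F ∈ gU (OK Ψ) := fun θ => D.mem_OK (by rw [hlev]; exact hs0.trans_le hst) (by rw [hlev]; exact htR)
  set Fi : Fin n → C(TT, ℂ) := fun i => (⟨fun v : Fin n → ℂ => v i, by fun_prop⟩ : C(Fin n → ℂ, ℂ)).comp F with hFi
  have hFl : ∀ i, Tendsto (fun k => ev (ak k i)) atTop (nhds (Fi i)) := fun i =>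
    ((ContinuousMap.continuous_postcomp (⟨fun v : Fin n → ℂ => v i, by fun_prop⟩ : C(Fin n → ℂ, ℂ))).tendsto F).comp hF
  have hcoef : ∀ i j, Tendsto (fun k => ak k i j) atTop (nhds (wt j * FC (cL (Fi i)) j)) := fun i j => by
    refine ((FCcL_tendsto (hFl i) j).const_mul (wt j : ℂ)).congr fun k => ?_
    rw [← coef_eq]
  have hmem : ∀ i, Memℓp (fun j : ℤ => (wt j : ℂ) * FC (cL (Fi i)) j) 2 := fun i => by
    refine lp.memℓp_of_tendsto (E := fun _ : ℤ => ℂ) (F := fun k => ak (k + K) i) (l := atTop) ?_ ?_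
    · rw [isBounded_iff_forall_norm_le]
      exact ⟨C, by rintro _ ⟨k, rfl⟩; exact hK _ (by omega) i⟩
    · exact tendsto_pi_nhds.2 fun j => (hcoef i j).comp (tendsto_add_atTop_nat K)
  set as : Fin n → Seq2 := fun i => ⟨_, hmem i⟩ with has
  have hasj : ∀ i j, as i j = wt j * FC (cL (Fi i)) j := fun i j => rfl
  have hev : ∀ i, ev (as i) = Fi i := fun i => cL_inj fun j => by
    rw [FC_ev, dW_apply, hasj, inv_mul_cancel_left₀ (wtC_ne j)]
  have hevV : evV as = F := by
    ext x i
    show ev (as i) x = F x i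
    rw [hev]; rfl
  refine ⟨t, as, ⟨hs0.trans_le hst, htR, fun i j hj => ?_, fun θ => by rw [hevV, hlev], fun i => Nem (fun p => nuP Ψ p i) as, fun i j hj => ?_, fun θ => ?_⟩, fun i => ?_⟩
  · refine tendsto_nhds_unique (hcoef i j) (tendsto_const_nhds.congr fun k => ((W k).an i j hj).symm)
  · rw [coef_eq, ev_Nem (D.nu_NOK i) (by rw [hevV]; exact hOF), hevV]
    have H := D.nu_NOK i
    have hc := (NemC_contOn H.dom H.c1.continuousOn H.per).continuousAt ((gU_open H.dom).mem_nhds hOF)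
    have h1 := FCcL_tendsto (hc.tendsto.comp hF) j
    have h2 : FC (cL (NemC (fun p => nuP Ψ p i) F)) j = 0 := by
      refine tendsto_nhds_unique h1 (tendsto_const_nhds.congr fun k => ?_)
      obtain ⟨b, hb, hab⟩ := (W k).nug
      have hO := (W k).gOK D
      have e : NemC (fun p => nuP Ψ p i) (evV (ak k)) = ev (b i) := by
        ext x
        have e1 := congrFun (hab (rp x)) i
        have e2 := NemC_apply H.dom H.c1.continuousOn H.per hO (rp x)
        rw [rp_coe] at e1 e2
        rw [e2]; exact e1.symm
      simp only [Function.comp_apply]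
      rw [e, FC_ev, dW_apply, hb i j hj, mul_zero]
    rw [h2, mul_zero]
  · ext i
    exact ev_Nem_apply (D.nu_NOK i) (by rw [hevV]; exact hOF) θ
  · exact hcoef i 0
end S17

namespace S17
variable {n : ℕ} {Ψ : ℝ → (Fin n → ℂ) → ℝ} {R : ℝ} {t : ℝ} {a : Fin n → Seq2}

lemma extV_zero (a : Fin n → Seq2) : extV a 0 = fun i => a i 0 := funext fun i => ext_zero (a i)

lemma WS.small (W : WS Ψ R t a) {r s : ℝ} (hs : ∀ θ ∈ Icc (-10:ℝ) 10, ∀ w : Fin n → ℂ, Ψ θ w ≤ s → ‖w‖ ≤ r) (hts : t ≤ s) {z : ℂ} (hz : ‖z‖ ≤ 1) :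
    ‖extV a z‖ ≤ r :=
  max_bd (extV_dcc a) (fun θ hθ => hs θ (TI_sub hθ) _ (by rw [extV_ex W.an, W.lev]; exact hts)) hz

lemma WS.lower (D : Data n Ψ R) {r : ℝ} (hr : 0 < r) : ∃ s0 > (0:ℝ), ∀ t a, WS Ψ R t a → r ≤ ‖fun i => a i 0‖ → s0 ≤ t := by
  obtain ⟨s, hs, h⟩ := D.small_level (half_pos hr)
  refine ⟨s, hs, fun t a W hra => ?_⟩
  by_contra! hlt
  have h1 := W.small h hlt.le (z := 0) (by simp)
  rw [extV_zero] at h1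
  linarith

/-- existence set -/
def ES (Ψ : ℝ → (Fin n → ℂ) → ℝ) (R : ℝ) : Set (Fin n → ℂ) := {w | ∃ t a, WS Ψ R t a ∧ ∀ i, a i 0 = w i}

lemma ES_closed (D : Data n Ψ R) {w : Fin n → ℂ} (hw : w ≠ 0) (h : w ∈ closure (ES Ψ R)) : w ∈ ES Ψ R := by
  obtain ⟨wk, hwk, hlim⟩ := mem_closure_iff_seq_limit.1 h
  have hr : 0 < ‖w‖ / 2 := half_pos (norm_pos_iff.2 hw)
  obtain ⟨s0, hs0, hlow⟩ := WS.lower D hr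
  obtain ⟨K, hK⟩ := eventually_atTop.1 (hlim.norm.eventually_const_le (u := ‖w‖ / 2) (by linarith))
  choose tk ak W ha using fun k => hwk (k + K)
  obtain ⟨F, φ, hφ, hF⟩ := WS.cpt D hs0 W fun k => hlow _ _ (W k) (by rw [funext (ha k)]; exact hK _ (by omega))
  obtain ⟨t, a, W', h'⟩ := WS.limit D hs0 (fun k => W (φ k)) (fun k => hlow _ _ (W (φ k)) (by rw [funext (ha (φ k))]; exact hK _ (by omega))) hF
  refine ⟨t, a, W', fun i => tendsto_nhds_unique (h' i) ?_⟩
  have h2 : Tendsto (fun k => wk (φ k + K) i) atTop (nhds (w i)) :=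
    (((continuous_apply i).tendsto w).comp hlim).comp ((tendsto_add_atTop_nat K).comp hφ.tendsto_atTop)
  exact h2.congr fun k => (ha (φ k) i).symm

lemma eucl_smul {c : ℝ} (hc : 0 ≤ c) (w : Fin n → ℂ) : euclNorm (c • w) = c * euclNorm w := by
  unfold euclNorm
  have : ∑ j, Complex.normSq ((c • w) j) = c ^ 2 * ∑ j, Complex.normSq (w j) := by
    rw [Finset.mul_sum]
    refine Finset.sum_congr rfl fun i _ => ?_
    rw [Pi.smul_apply, Complex.real_smul, map_mul, Complex.normSq_ofReal]; ring
  rw [this, Real.sqrt_mul (sq_nonneg c), Real.sqrt_sq hc]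

lemma ES_all (D : Data n Ψ R) {w : Fin n → ℂ} (h0 : 0 < euclNorm w) (hR : euclNorm w ≤ R) : w ∈ ES Ψ R := by
  have hw : w ≠ 0 := fun h => by rw [h] at h0; simp [euclNorm] at h0
  set S := R / euclNorm w with hS
  have hS1 : 1 ≤ S := by rw [hS, le_div_iff₀ h0]; linarith
  have hSe : S * euclNorm w = R := div_mul_cancel₀ _ h0.ne'
  have hγ : Continuous fun s : ℝ => (S - s) • w := by fun_prop
  have hne : ∀ s ≤ S - 1, (S - s) • w ≠ 0 := fun s hs => smul_ne_zero (by linarith : (0:ℝ) < S - s).ne' hw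
  have key : Icc 0 (S - 1) ⊆ (fun s : ℝ => (S - s) • w) ⁻¹' ES Ψ R := by
    refine IsClosed.Icc_subset_of_forall_exists_gt ?_ ?_ ?_
    · refine isClosed_of_closure_subset fun s hs => ?_
      have h1 : s ∈ Icc 0 (S - 1) := closure_minimal inter_subset_right isClosed_Icc hs
      refine ⟨ES_closed D (hne s h1.2) ?_, h1⟩
      exact hγ.closure_preimage_subset _ (closure_mono inter_subset_left hs)
    · obtain ⟨W, -⟩ := D.topWS (w0 := (S - 0) • w) (by rw [eucl_smul (by linarith), sub_zero, hSe])
      exact ⟨R, _, W, fun i => by rw [constV_apply, if_pos rfl]⟩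
    · rintro x ⟨⟨t, a, W, ha⟩, hx⟩ y hy
      obtain ⟨A, -, -, hA⟩ := W.loc D
      rw [funext ha] at hA
      have h1 := (hγ.tendsto x).eventually hA
      have h2 : ∀ᶠ s in nhdsWithin x (Ioi x), s ∈ Ioo x (min y S) := Ioo_mem_nhdsGT (lt_min hy (by linarith [hx.2]))
      obtain ⟨s, hs1, hs2⟩ := ((h1.filter_mono nhdsWithin_le_nhds).and h2).exists
      have h3 := hs2.2.trans_le (min_le_right _ _)
      obtain ⟨t', W', h'⟩ := hs1 (by
        rw [eucl_smul (by linarith), ← hSe]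
        exact mul_le_mul_of_nonneg_right (by linarith [hs2.1, hx.1]) h0.le)
      exact ⟨s, ⟨t', _, W', h'⟩, hs2.1, (hs2.2.trans_le (min_le_left _ _)).le⟩
  have := key (right_mem_Icc.2 (by linarith) : S - 1 ∈ _)
  simpa using this

lemma WS.uniq (D : Data n Ψ R) {t' : ℝ} {a' : Fin n → Seq2} (W : WS Ψ R t a) (W' : WS Ψ R t' a') (h : ∀ i, a i 0 = a' i 0) : a = a' := by
  obtain ⟨b, hb, hab⟩ := W.nug
  obtain ⟨b', hb', hab'⟩ := W'.nug
  have h1 := ((W.sol_of hb hab).unique (W'.sol_of hb' hab') D (by rw [extV_zero, extV_zero]; exact funext h)).2.1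
  funext i
  refine ev_inj ?_
  ext x
  have h2 := congrFun (h1 (ex (rp x)) (ex_norm _).le) i
  rw [extV_ex W.an, extV_ex W'.an, rp_coe] at h2
  exact h2

open Classical in
/-- the coefficient map -/
def Fm (Ψ : ℝ → (Fin n → ℂ) → ℝ) (R : ℝ) (w : Fin n → ℂ) : Fin n → Seq2 :=
  if h : w ∈ ES Ψ R then h.choose_spec.choose else 0

lemma Fm_spec {w : Fin n → ℂ} (h : w ∈ ES Ψ R) : (∃ t, WS Ψ R t (Fm Ψ R w)) ∧ ∀ i, Fm Ψ R w i 0 = w i := by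
  rw [Fm, dif_pos h]
  exact ⟨⟨_, h.choose_spec.choose_spec.1⟩, h.choose_spec.choose_spec.2⟩

lemma Fm_c1 (D : Data n Ψ R) : ContDiffOn ℝ 1 (Fm Ψ R) {w : Fin n → ℂ | 0 < euclNorm w ∧ euclNorm w ≤ R} := by
  intro w hw
  obtain ⟨⟨t, W⟩, h0⟩ := Fm_spec (ES_all D hw.1 hw.2)
  obtain ⟨A, hA1, hA2, hA⟩ := W.loc D
  rw [funext h0] at hA1 hA2 hA
  refine hA1.contDiffWithinAt.congr_of_eventuallyEq ?_ hA2.symm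
  filter_upwards [self_mem_nhdsWithin, mem_nhdsWithin_of_mem_nhds hA] with v hv hvA
  obtain ⟨t', W', h'⟩ := hvA hv.2
  obtain ⟨⟨t2, W2⟩, h2⟩ := Fm_spec (ES_all D hv.1 hv.2)
  exact W2.uniq D W' fun i => by rw [h2, h']

def Gm (Ψ : ℝ → (Fin n → ℂ) → ℝ) (R : ℝ) (w : Fin n → ℂ) : Fin n → Seq2 := fun i => Nem (fun p => nuP Ψ p i) (Fm Ψ R w)

lemma Gm_c1 (D : Data n Ψ R) : ContDiffOn ℝ 1 (Gm Ψ R) {w : Fin n → ℂ | 0 < euclNorm w ∧ euclNorm w ≤ R} := by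
  refine contDiffOn_pi.2 fun i w hw => ?_
  obtain ⟨⟨t, W⟩, h0⟩ := Fm_spec (ES_all D hw.1 hw.2)
  exact (Nem_c1 (D.nu_NOK i) (W.gOK D)).comp_contDiffWithinAt w (Fm_c1 D w hw)

lemma Gm_spec (D : Data n Ψ R) {w : Fin n → ℂ} (h : w ∈ ES Ψ R) : (∀ i, ∀ j < 0, Gm Ψ R w i j = 0) ∧
    ∀ θ : ℝ, evV (Gm Ψ R w) (θ : TT) = nu Ψ θ (evV (Fm Ψ R w) (θ : TT)) := by
  obtain ⟨⟨t, W⟩, -⟩ := Fm_spec h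
  have h1 : ∀ θ : ℝ, evV (Gm Ψ R w) (θ : TT) = nu Ψ θ (evV (Fm Ψ R w) (θ : TT)) := fun θ => by
    ext i; exact ev_Nem_apply (D.nu_NOK i) (W.gOK D) θ
  obtain ⟨b, hb, hab⟩ := W.nug
  have h2 : ∀ i, Gm Ψ R w i = b i := fun i => ev_inj (by
    ext x
    have e1 := congrFun (hab (rp x)) i
    have e2 := congrFun (h1 (rp x)) i
    rw [rp_coe] at e1 e2
    exact e2.trans e1.symm)
  exact ⟨fun i j hj => by rw [h2]; exact hb i j hj, h1⟩

/-- levels tend to zero at the origin -/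
lemma WS.lev_zero (D : Data n Ψ R) {s : ℝ} (hs : 0 < s) : ∃ δ > (0:ℝ), ∀ t a, WS Ψ R t a → ‖fun i => a i 0‖ < δ → t ≤ s := by
  have h := IsCompact.eventually_forall_of_forall_eventually (x₀ := (0 : Fin n → ℂ)) TI_compact (P := fun w θ => Ψ θ w < s) (by
    intro θ _
    have hc : ContinuousAt (fun p : (Fin n → ℂ) × ℝ => Ψ p.2 p.1) (0, θ) := (D.cont.comp continuous_swap).continuousAt
    exact hc.eventually_lt_const (by show Ψ θ 0 < s; rw [(D.zero θ 0).2 rfl]; exact hs))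
  obtain ⟨δ, hδ, h⟩ := Metric.eventually_nhds_iff.1 h
  refine ⟨δ, hδ, fun t a W ha => ?_⟩
  obtain ⟨b, hb, hab⟩ := W.nug
  obtain ⟨θ, hθ, hle⟩ := (W.sol_of hb hab).le_max D
  rw [extV_zero] at hle
  exact hle.trans (h (by rwa [dist_zero_right]) θ hθ).le
end S17

namespace S17
variable {n : ℕ} {Ψ : ℝ → (Fin n → ℂ) → ℝ} {R : ℝ} {t : ℝ} {a : Fin n → Seq2}

lemma memH12_ext {a : Fin n → Seq2} (ha : ∀ i, ∀ j < 0, a i j = 0) : MemH12V (extV a) := fun j => by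
  refine ⟨?_, (ext_dcc (a j)).differentiableOn, a j, rep_of fun θ => ext_ex (ha j) θ⟩
  have := (ext_dcc (a j)).continuousOn
  rwa [closure_ball _ one_ne_zero] at this

/-- the level function -/
def Plev (Ψ : ℝ → (Fin n → ℂ) → ℝ) (R : ℝ) (w : Fin n → ℂ) : ℝ := Ψ 0 (evV (Fm Ψ R w) ((0:ℝ) : TT))

lemma Plev_eq {w : Fin n → ℂ} (W : WS Ψ R t (Fm Ψ R w)) : Plev Ψ R w = t := W.lev 0

lemma Plev_zero (D : Data n Ψ R) : Plev Ψ R 0 = 0 := by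
  have h0 : (0 : Fin n → ℂ) ∉ ES Ψ R := by
    rintro ⟨t, a, W, ha⟩
    obtain ⟨δ, hδ, h⟩ := WS.lev_zero D (half_pos W.ht)
    have := h t a W (by rw [funext ha]; simpa using hδ)
    linarith [W.ht]
  rw [Plev, Fm, dif_neg h0, map_zero]
  exact (D.zero 0 0).2 rfl

lemma Plev_cont (D : Data n Ψ R) : ContinuousOn (Plev Ψ R) {w : Fin n → ℂ | euclNorm w ≤ R} := by
  intro w hw
  by_cases h : w = 0
  · subst h
    rw [Metric.continuousWithinAt_iff]
    intro ε hε
    obtain ⟨δ, hδ, h⟩ := WS.lev_zero D (half_pos hε)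
    refine ⟨δ, hδ, fun v hv hvd => ?_⟩
    rw [Plev_zero D, dist_zero_right, Real.norm_eq_abs, abs_of_nonneg (show 0 ≤ Plev Ψ R v from D.nonneg _ _)]
    by_cases hv0 : v = 0
    · rw [hv0, Plev_zero D]; exact hε
    have hvp : 0 < euclNorm v := (norm_pos_iff.2 hv0).trans_le (norm_le_eucl v)
    obtain ⟨⟨t, W⟩, h0⟩ := Fm_spec (ES_all D hvp hv)
    have := h t _ W (by rw [funext h0]; simpa using hvd)
    rw [Plev_eq W]; linarith
  · have hwp : 0 < euclNorm w := (norm_pos_iff.2 h).trans_le (norm_le_eucl w)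
    have h1 : ContinuousWithinAt (Fm Ψ R) {w : Fin n → ℂ | 0 < euclNorm w ∧ euclNorm w ≤ R} w := (Fm_c1 D).continuousOn w ⟨hwp, hw⟩
    have h2 : Continuous fun a : Fin n → Seq2 => Ψ 0 (evV a ((0:ℝ) : TT)) :=
      D.cont.comp (continuous_const.prodMk ((continuous_eval_const _).comp evV.continuous))
    refine (h2.continuousAt.comp_continuousWithinAt h1).mono_of_mem_nhdsWithin ?_
    filter_upwards [self_mem_nhdsWithin, mem_nhdsWithin_of_mem_nhds (_root_.isOpen_ne.mem_nhds h)] with v hv hv0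
    exact ⟨(norm_pos_iff.2 hv0).trans_le (norm_le_eucl v), hv⟩

lemma small_F (D : Data n Ψ R) {ε : ℝ} (hε : 0 < ε) : ∃ δ : ℝ, 0 < δ ∧ ∀ w : Fin n → ℂ, 0 < euclNorm w → euclNorm w ≤ δ →
    ∀ z ∈ Disk, euclNorm (extV (Fm Ψ R w) z) ≤ ε := by
  obtain ⟨s, hs, h⟩ := D.small_level (r := ε / (n + 1)) (by positivity)
  obtain ⟨δ, hδ, h'⟩ := WS.lev_zero D hs
  have hR := D.hR
  refine ⟨min (δ / 2) R, lt_min (by linarith) (by linarith), fun w h0 hw z hz => ?_⟩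
  obtain ⟨⟨t, W⟩, h1⟩ := Fm_spec (ES_all D h0 (hw.trans (min_le_right _ _)))
  have h2 := h' t _ W (by rw [funext h1]; linarith [norm_le_eucl w, hw.trans (min_le_left _ _)])
  have h3 := W.small h h2 (mem_closedBall_zero_iff.1 hz)
  calc _ ≤ n * ‖extV (Fm Ψ R w) z‖ := eucl_le _
    _ ≤ (n + 1) * (ε / (n + 1)) := by gcongr; linarith
    _ = ε := by field_simp

lemma top_F (D : Data n Ψ R) {w : Fin n → ℂ} (hw : euclNorm w = R) {z : ℂ} (hz : z ∈ Disk) :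
    extV (Fm Ψ R w) z = w ∧ extV (Gm Ψ R w) z = fun j => starRingEnd ℂ (w j) / ((R : ℂ) ^ 2) := by
  have hR := D.hR
  have hE := ES_all D (w := w) (by rw [hw]; linarith) hw.le
  obtain ⟨⟨t, W⟩, h1⟩ := Fm_spec hE
  obtain ⟨W', hc⟩ := D.topWS hw
  have e : Fm Ψ R w = constV w := W.uniq D W' fun i => by rw [h1, constV_apply, if_pos rfl]
  obtain ⟨hG, hG'⟩ := Gm_spec D hE
  have hz1 := mem_closedBall_zero_iff.1 hz
  constructor <;> funext i
  · refine eq_of_bdry (f := ext (Fm Ψ R w i)) (g := fun _ => w i) (ext_dcc _) diffContOnCl_const (fun θ _ => ?_) hz1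
    rw [ext_ex (W.an i), e]
    exact congrFun (hc θ) i
  · refine eq_of_bdry (f := ext (Gm Ψ R w i)) (g := fun _ => starRingEnd ℂ (w i) / ((R : ℂ) ^ 2)) (ext_dcc _) diffContOnCl_const (fun θ _ => ?_) hz1
    rw [ext_ex (hG i)]
    have := congrFun (hG' θ) i
    rw [e, hc, D.nu_top ((D.levelR θ w).2 hw)] at this
    refine this.trans ?_
    simp [div_eq_inv_mul]

lemma plane_eq {g : (Fin n → ℂ) → ℝ} {p : Fin n → ℂ} {θ : ℝ} (hg : Ψ θ = g) (h : cc Ψ θ p ≠ 0) :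
    {v : Fin n → ℂ | ∑ j, nu Ψ θ p j * v j = 1} = TangentPlane g p := by
  subst hg
  ext v
  have e1 : ∑ j, nu Ψ θ p j * v j = (cc Ψ θ p)⁻¹ * ∑ j, v j * wderiv (Ψ θ) p j := by
    rw [Finset.mul_sum]
    refine Finset.sum_congr rfl fun j _ => ?_
    show (cc Ψ θ p)⁻¹ * wderiv (Ψ θ) p j * v j = _
    ring
  have e2 : ∑ j, (v j - p j) * wderiv (Ψ θ) p j = ∑ j, v j * wderiv (Ψ θ) p j - cc Ψ θ p := by
    simp only [sub_mul, Finset.sum_sub_distrib]; rfl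
  show _ = 1 ↔ _ = 0
  rw [e1, e2, sub_eq_zero, inv_mul_eq_one₀ h, eq_comm]
end S17
open S17

/-- global extension of `F`, `G` to the annulus `0 < |w| ≤ R` and of `P`
to the closed ball, with `P(0) = 0` and uniform vanishing of `F(w)` as `w → 0`. -/
theorem statement17 {n : ℕ} (ρ : ℂ → (Fin n → ℂ) → ℝ) (R : ℝ)
    (hρ : Cond3 n ρ R (fun _ => 0)) :
    ∃ (F G : (Fin n → ℂ) → ℂ → (Fin n → ℂ)) (P : (Fin n → ℂ) → ℝ),
      (∀ w : Fin n → ℂ, 0 < euclNorm w → euclNorm w ≤ R →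
        (MemH12V (F w) ∧ MemH12V (G w)) ∧
        F w 0 = w ∧
        (∀ z ∈ Circ, ρ z (F w z) = P w) ∧
        (∀ z ∈ Circ, ∑ j, F w z j * G w z j = 1) ∧
        (∀ z ∈ Circ, {v : Fin n → ℂ | ∑ j, G w z j * v j = 1} = TangentPlane (ρ z) (F w z))) ∧
      (∃ Fc Gc : (Fin n → ℂ) → Fin n → Seq2,
        ContDiffOn ℝ 1 Fc {w : Fin n → ℂ | 0 < euclNorm w ∧ euclNorm w ≤ R} ∧
        ContDiffOn ℝ 1 Gc {w : Fin n → ℂ | 0 < euclNorm w ∧ euclNorm w ≤ R} ∧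
        ∀ w : Fin n → ℂ, 0 < euclNorm w → euclNorm w ≤ R → ∀ j,
          RepOf (Fc w j) (fun z => F w z j) ∧ RepOf (Gc w j) (fun z => G w z j)) ∧
      (∀ w : Fin n → ℂ, euclNorm w = R → ∀ z ∈ Disk,
        F w z = w ∧ G w z = fun j => starRingEnd ℂ (w j) / ((R : ℂ)^2)) ∧
      ContinuousOn P {w : Fin n → ℂ | euclNorm w ≤ R} ∧ P 0 = 0 ∧
      (∀ ε : ℝ, 0 < ε → ∃ δ : ℝ, 0 < δ ∧
        ∀ w : Fin n → ℂ, 0 < euclNorm w → euclNorm w ≤ δ →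
          ∀ z ∈ Disk, euclNorm (F w z) ≤ ε) := by
  have D := Data.ofCond hρ
  set Ψ : ℝ → (Fin n → ℂ) → ℝ := fun θ w => ρ (Complex.exp (θ * Complex.I)) w with hΨ
  refine ⟨fun w => extV (Fm Ψ R w), fun w => extV (Gm Ψ R w), Plev Ψ R, fun w h0 hw => ?_,
    ⟨Fm Ψ R, Gm Ψ R, Fm_c1 D, Gm_c1 D, fun w h0 hw j => ?_⟩, fun w hw z hz => top_F D hw hz, Plev_cont D, Plev_zero D,
    fun ε hε => small_F D hε⟩
  · obtain ⟨⟨t, W⟩, h1⟩ := Fm_spec (ES_all D h0 hw)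
    obtain ⟨hG, hG'⟩ := Gm_spec D (ES_all D h0 hw)
    have hc : ∀ θ, cc Ψ θ (evV (Fm Ψ R w) (θ : TT)) ≠ 0 := fun θ => (W.pOK D θ).2
    refine ⟨⟨memH12_ext W.an, memH12_ext hG⟩, (extV_zero _).trans (funext h1), fun z hz => ?_, fun z hz => ?_, fun z hz => ?_⟩ <;>
      obtain ⟨θ, -, rfl⟩ := exists_ex (mem_sphere_zero_iff_norm.1 hz)
    · simp only [extV_ex W.an, Plev_eq W]
      exact W.lev θ
    · simp only [extV_ex W.an, extV_ex hG, hG']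
      exact (dotProduct_comm _ _).trans (nu_dot_self (hc θ))
    · simp only [extV_ex W.an, extV_ex hG, hG']
      exact plane_eq rfl (hc θ)
  · obtain ⟨⟨t, W⟩, h1⟩ := Fm_spec (ES_all D h0 hw)
    exact ⟨rep_of fun θ => ext_ex (W.an j) θ, rep_of fun θ => ext_ex ((Gm_spec D (ES_all D h0 hw)).1 j) θ⟩
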